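/- For every real number δ < 8/9 and every function g : [0,1] → ℝ of bounded variation, there exists a constant C > 0 such that for all real numbers 2 ≤ n < N, |Σ_{n < p < N, p prime} Σ_{0 ≤ ν < p, ν² ≡ −1 (mod p)} g(ν/p) − 2·π₁([n,N])·∫₀¹ g(t) dt| ≤ C·N/(log N)^{1+δ}. -/

import Mathlib

namespace QuadRoots

open Finset

section Kloosterman

variable {l : ℕ} [Fact l.Prime]

/-- The additive character `x ↦ e(x / l)` on `ZMod l`. -/
noncomputable abbrev psi (l : ℕ) [NeZero l] : AddChar (ZMod l) ℂ := ZMod.stdAddChar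

lemma norm_psi (x : ZMod l) : ‖psi l x‖ = 1 := AddChar.norm_apply _ _

lemma sum_psi_mul (a : ZMod l) : ∑ x, psi l (x * a) = if a = 0 then (l : ℂ) else 0 := by
  have h := AddChar.sum_mulShift (R := ZMod l) a (ZMod.isPrimitive_stdAddChar l)
  simpa [ZMod.card] using h

lemma conj_psi (x : ZMod l) : (starRingEnd ℂ) (psi l x) = psi l (-x) := by
  rw [AddChar.map_neg_eq_conj]

/-- Orthogonality for a bilinear family of exponential sums. -/
lemma sum_sum_norm_sq {ι : Type*} [Fintype ι] (f g : ι → ZMod l) :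
    ∑ A : ZMod l, ∑ B : ZMod l, ‖∑ i, psi l (A * f i + B * g i)‖ ^ 2
      = (l : ℝ) ^ 2
        * ((univ.filter fun ij : ι × ι => f ij.1 = f ij.2 ∧ g ij.1 = g ij.2).card : ℝ) := by
  have key : ∀ A B : ZMod l, ((‖∑ i, psi l (A * f i + B * g i)‖ ^ 2 : ℝ) : ℂ)
      = ∑ i, ∑ j, psi l (A * (f i - f j)) * psi l (B * (g i - g j)) := by
    intro A B
    push_cast
    rw [← Complex.mul_conj', map_sum, Finset.sum_mul_sum]
    refine Finset.sum_congr rfl fun i _ => Finset.sum_congr rfl fun j _ => ?_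
    rw [conj_psi, ← AddChar.map_add_eq_mul, ← AddChar.map_add_eq_mul]
    congr 1; ring
  have : ((∑ A : ZMod l, ∑ B : ZMod l, ‖∑ i, psi l (A * f i + B * g i)‖ ^ 2 : ℝ) : ℂ)
      = (l : ℂ) ^ 2 *
        ((univ.filter fun ij : ι × ι => f ij.1 = f ij.2 ∧ g ij.1 = g ij.2).card : ℂ) := by
    rw [Complex.ofReal_sum]
    simp_rw [Complex.ofReal_sum, key]
    have e1 : ∑ A : ZMod l, ∑ B : ZMod l, ∑ i, ∑ j,
          psi l (A * (f i - f j)) * psi l (B * (g i - g j))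
        = ∑ i, ∑ j, (∑ A : ZMod l, psi l (A * (f i - f j)))
          * (∑ B : ZMod l, psi l (B * (g i - g j))) := by
      simp_rw [Finset.sum_mul_sum]
      calc _ = ∑ A : ZMod l, ∑ i, ∑ B : ZMod l, ∑ j,
              psi l (A * (f i - f j)) * psi l (B * (g i - g j)) :=
            Finset.sum_congr rfl fun A _ => Finset.sum_comm
        _ = ∑ i, ∑ A : ZMod l, ∑ B : ZMod l, ∑ j,
              psi l (A * (f i - f j)) * psi l (B * (g i - g j)) := Finset.sum_comm
        _ = ∑ i, ∑ A : ZMod l, ∑ j, ∑ B : ZMod l,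
              psi l (A * (f i - f j)) * psi l (B * (g i - g j)) :=
            Finset.sum_congr rfl fun i _ => Finset.sum_congr rfl fun A _ => Finset.sum_comm
        _ = _ := Finset.sum_congr rfl fun i _ => Finset.sum_comm
    rw [e1]
    simp_rw [sum_psi_mul, sub_eq_zero]
    rw [← Finset.sum_product' univ univ (fun i j => (if f i = f j then (l : ℂ) else 0) *
      if g i = g j then (l : ℂ) else 0)]
    rw [Finset.univ_product_univ, Finset.card_filter, Nat.cast_sum, Finset.mul_sum]
    refine Finset.sum_congr rfl fun ij _ => ?_
    by_cases h1 : f ij.1 = f ij.2 <;> by_cases h2 : g ij.1 = g ij.2 <;> simp [h1, h2, sq]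
  exact_mod_cast this

/-- The Kloosterman sum modulo a prime. -/
noncomputable def kl (A B : ZMod l) : ℂ := ∑ z : (ZMod l)ˣ, psi l (A * z + B * (z⁻¹ : (ZMod l)ˣ))

lemma kl_mul_unit (A B : ZMod l) (t : (ZMod l)ˣ) :
    kl (A * (t : ZMod l)) (B * ((t⁻¹ : (ZMod l)ˣ) : ZMod l)) = kl A B := by
  unfold kl
  refine Fintype.sum_equiv (Equiv.mulLeft t) _ _ fun z => ?_
  simp only [Equiv.coe_mulLeft, Units.val_mul, mul_inv]
  congr 1; ring

lemma card_kloosterman_solutions :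
    (univ.filter fun ij : ((ZMod l)ˣ × (ZMod l)ˣ) × ((ZMod l)ˣ × (ZMod l)ˣ) =>
      (ij.1.1 : ZMod l) + ij.1.2 = ij.2.1 + ij.2.2 ∧
      ((ij.1.1⁻¹ : (ZMod l)ˣ) : ZMod l) + (ij.1.2⁻¹ : (ZMod l)ˣ)
        = (ij.2.1⁻¹ : (ZMod l)ˣ) + (ij.2.2⁻¹ : (ZMod l)ˣ)).card ≤ 3 * (l - 1) ^ 2 := by
  classical
  have hc : Fintype.card ((ZMod l)ˣ × (ZMod l)ˣ) = (l - 1) ^ 2 := by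
    rw [Fintype.card_prod, ZMod.card_units, sq]
  let U := (ZMod l)ˣ
  let f1 : U × U → (U × U) × (U × U) := fun p => (p, p)
  let f2 : U × U → (U × U) × (U × U) := fun p => (p, p.swap)
  let f3 : U × U → (U × U) × (U × U) := fun p => ((p.1, -p.1), (p.2, -p.2))
  have hsub : (univ.filter fun ij : ((ZMod l)ˣ × (ZMod l)ˣ) × ((ZMod l)ˣ × (ZMod l)ˣ) =>
      (ij.1.1 : ZMod l) + ij.1.2 = ij.2.1 + ij.2.2 ∧
      ((ij.1.1⁻¹ : (ZMod l)ˣ) : ZMod l) + (ij.1.2⁻¹ : (ZMod l)ˣ)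
        = (ij.2.1⁻¹ : (ZMod l)ˣ) + (ij.2.2⁻¹ : (ZMod l)ˣ)) ⊆
      (univ.image f1 ∪ univ.image f2) ∪ univ.image f3 := by
    rintro ⟨⟨z1, z2⟩, ⟨z3, z4⟩⟩ h
    simp only [mem_filter, mem_univ, true_and, Units.val_inv_eq_inv_val] at h
    obtain ⟨h1, h2⟩ := h
    have n1 := z1.ne_zero
    have n2 := z2.ne_zero
    have n3 := z3.ne_zero
    have n4 := z4.ne_zero
    simp only [mem_union, mem_image, mem_univ, true_and]
    by_cases hs : (z1 : ZMod l) + z2 = 0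
    · right
      refine ⟨(z1, z3), ?_⟩
      simp only [f3, Prod.mk.injEq, true_and]
      constructor
      · ext; rw [Units.val_neg]; linear_combination -hs
      · ext; rw [Units.val_neg]; linear_combination -hs + h1
    · left
      have h3 : ((z1 : ZMod l) + z2) * (z3 * z4 - z1 * z2) = 0 := by
        field_simp at h2
        linear_combination h2 - (z1 : ZMod l) * z2 * h1
      have h4 : (z3 : ZMod l) * z4 = z1 * z2 :=
        sub_eq_zero.1 ((mul_eq_zero.1 h3).resolve_left hs)
      have h5 : ((z3 : ZMod l) - z1) * (z3 - z2) = 0 := by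
        linear_combination -(z3 : ZMod l) * h1 - h4
      rcases mul_eq_zero.1 h5 with h | h
      · left
        refine ⟨(z1, z2), ?_⟩
        simp only [f1, Prod.mk.injEq, true_and]
        constructor
        · ext; linear_combination -h
        · ext; linear_combination h + h1
      · right
        refine ⟨(z1, z2), ?_⟩
        simp only [f2, Prod.mk.injEq, Prod.swap_prod_mk, true_and]
        constructor
        · ext; linear_combination -h
        · ext; linear_combination h + h1
  refine (Finset.card_le_card hsub).trans ?_
  refine (Finset.card_union_le _ _).trans ?_
  have c1 := Finset.card_union_le (univ.image f1) (univ.image f2)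
  have c2 : (univ.image f1).card ≤ (l - 1) ^ 2 := hc ▸ Finset.card_image_le
  have c3 : (univ.image f2).card ≤ (l - 1) ^ 2 := hc ▸ Finset.card_image_le
  have c4 : (univ.image f3).card ≤ (l - 1) ^ 2 := hc ▸ Finset.card_image_le
  omega

/-- Kloosterman's fourth moment bound. -/
lemma norm_kl_pow_four_le (A B : ZMod l) (hA : A ≠ 0) : ‖kl A B‖ ^ 4 ≤ 3 * (l : ℝ) ^ 3 := by
  classical
  have hl : 2 ≤ l := (Fact.out : l.Prime).two_le
  have h1 : ∑ A : ZMod l, ∑ B : ZMod l, ‖kl A B‖ ^ 4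
      ≤ (l : ℝ) ^ 2 * (3 * ((l : ℝ) - 1) ^ 2) := by
    have e := sum_sum_norm_sq (l := l) (ι := (ZMod l)ˣ × (ZMod l)ˣ)
      (fun z => (z.1 : ZMod l) + z.2)
      (fun z => ((z.1⁻¹ : (ZMod l)ˣ) : ZMod l) + (z.2⁻¹ : (ZMod l)ˣ))
    have e2 : ∀ A B : ZMod l, ‖kl A B‖ ^ 4 = ‖∑ z : (ZMod l)ˣ × (ZMod l)ˣ,
        psi l (A * ((z.1 : ZMod l) + z.2)
          + B * (((z.1⁻¹ : (ZMod l)ˣ) : ZMod l) + (z.2⁻¹ : (ZMod l)ˣ)))‖ ^ 2 := by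
      intro A B
      rw [show (4 : ℕ) = 2 * 2 from rfl, pow_mul, ← norm_pow]
      congr 2
      rw [sq, kl, Finset.sum_mul_sum, ← Finset.univ_product_univ, Finset.sum_product]
      refine Finset.sum_congr rfl fun i _ => Finset.sum_congr rfl fun j _ => ?_
      rw [← AddChar.map_add_eq_mul]
      congr 1; ring
    simp_rw [e2, e]
    gcongr
    have := card_kloosterman_solutions (l := l)
    have h' : (3 * ((l : ℝ) - 1) ^ 2) = ((3 * (l - 1) ^ 2 : ℕ) : ℝ) := by
      push_cast [Nat.cast_sub (by omega : 1 ≤ l)]; ring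
    rw [h']
    exact_mod_cast this
  have h2 : ((l : ℝ) - 1) * ‖kl A B‖ ^ 4 ≤ ∑ A : ZMod l, ∑ B : ZMod l, ‖kl A B‖ ^ 4 := by
    rw [← Finset.sum_product' univ univ (fun A B : ZMod l => ‖kl A B‖ ^ 4)]
    have hinj : Function.Injective
        (fun t : (ZMod l)ˣ => ((A * t, B * (t⁻¹ : (ZMod l)ˣ)) : ZMod l × ZMod l)) := by
      intro s t h
      simp only [Prod.mk.injEq] at h
      exact Units.ext (mul_left_cancel₀ hA h.1)
    calc ((l : ℝ) - 1) * ‖kl A B‖ ^ 4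
        = ∑ t : (ZMod l)ˣ, ‖kl (A * (t : ZMod l)) (B * ((t⁻¹ : (ZMod l)ˣ) : ZMod l))‖ ^ 4 := by
          simp_rw [kl_mul_unit]
          rw [Finset.sum_const, Finset.card_univ, ZMod.card_units, nsmul_eq_mul,
            Nat.cast_sub (by omega)]
          simp
      _ = ∑ p ∈ univ.image
            (fun t : (ZMod l)ˣ => ((A * t, B * (t⁻¹ : (ZMod l)ˣ)) : ZMod l × ZMod l)),
            ‖kl p.1 p.2‖ ^ 4 := by
          rw [Finset.sum_image (fun _ _ _ _ h => hinj h)]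
      _ ≤ _ := Finset.sum_le_sum_of_subset_of_nonneg (Finset.subset_univ _)
          (fun _ _ _ => by positivity)
  have hl' : (2 : ℝ) ≤ l := by exact_mod_cast hl
  have h3 : ((l : ℝ) - 1) * ‖kl A B‖ ^ 4 ≤ ((l : ℝ) - 1) * (3 * (l : ℝ) ^ 2 * ((l : ℝ) - 1)) := by
    nlinarith
  have h4 := le_of_mul_le_mul_left h3 (by linarith)
  nlinarith [sq_nonneg (l : ℝ)]

lemma norm_kl_le {k : ℕ} (hk : 0 < k) (hkl : k ^ 4 ≤ l) (A B : ZMod l) (hA : A ≠ 0) :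
    ‖kl A B‖ ≤ 2 * ((l : ℝ) / k) := by
  have h := norm_kl_pow_four_le A B hA
  have hk' : (0 : ℝ) < k := by exact_mod_cast hk
  have hkl' : (k : ℝ) ^ 4 ≤ l := by exact_mod_cast hkl
  have hl : (0 : ℝ) < l := lt_of_lt_of_le (by positivity) hkl'
  refine le_of_pow_le_pow_left₀ (n := 4) (by norm_num) (by positivity) (h.trans ?_)
  rw [mul_pow, div_pow, ← mul_div_assoc, le_div_iff₀ (by positivity)]
  calc 3 * (l : ℝ) ^ 3 * (k : ℝ) ^ 4 ≤ 3 * (l : ℝ) ^ 3 * l := by gcongr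
    _ ≤ 2 ^ 4 * (l : ℝ) ^ 4 := by nlinarith [pow_pos hl 4]

/-- Correlation of two Möbius phases. -/
lemma norm_moebius_correlation_le {k : ℕ} (hk : 0 < k) (hkl : k ^ 4 ≤ l) {h : ZMod l} (hh : h ≠ 0)
    {a b c d a' b' c' d' : ZMod l} (h1 : a * d - b * c = 1) (h2 : a' * d' - b' * c' = 1)
    (hD : c * d' ≠ c' * d) :
    ‖∑ τ : ZMod l, psi l (h * ((a * τ + b) * (c * τ + d)⁻¹))
      * (starRingEnd ℂ) (psi l (h * ((a' * τ + b') * (c' * τ + d')⁻¹)))‖ ≤ 5 * ((l : ℝ) / k) := by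
  classical
  set D : ZMod l := c' * d - d' * c with hDdef
  have hD0 : D ≠ 0 := by
    intro h0; apply hD; rw [hDdef] at h0; linear_combination -h0
  have hl : 2 ≤ l := (Fact.out : l.Prime).two_le
  set F : ZMod l → ℂ := fun τ => psi l (h * ((a * τ + b) * (c * τ + d)⁻¹))
      * (starRingEnd ℂ) (psi l (h * ((a' * τ + b') * (c' * τ + d')⁻¹))) with hF
  have hFn : ∀ τ, ‖F τ‖ = 1 := by
    intro τ; simp only [hF, norm_mul, RCLike.norm_conj, norm_psi, mul_one]
  set good : Finset (ZMod l) := univ.filter fun τ => c * τ + d ≠ 0 ∧ c' * τ + d' ≠ 0 with hgood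
  set K0 : ZMod l := -(h * (a' * d - b' * c)) * D⁻¹ - h * (a * d' - b * c') * D⁻¹ with hK0
  set G : ZMod l → ℂ := fun z => psi l (h * D⁻¹ * z + h * D⁻¹ * z⁻¹) with hG
  have hGn : ∀ z, ‖G z‖ = 1 := fun z => norm_psi _
  set Z : ZMod l → ZMod l := fun τ => (c' * τ + d') * (c * τ + d)⁻¹ with hZ
  have hFG : ∀ τ ∈ good, F τ = psi l K0 * G (Z τ) := by
    intro τ hτ
    simp only [hgood, mem_filter, mem_univ, true_and] at hτ
    obtain ⟨g1, g2⟩ := hτ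
    simp only [hF, hG, hZ]
    rw [conj_psi, ← AddChar.map_add_eq_mul, ← AddChar.map_add_eq_mul]
    congr 1
    rw [hK0]
    have e1 : (a * τ + b) * (c * τ + d)⁻¹
        = D⁻¹ * ((c' * τ + d') * (c * τ + d)⁻¹ - (a * d' - b * c')) := by
      rw [eq_comm, inv_mul_eq_iff_eq_mul₀ hD0, ← mul_left_inj' g1, hDdef]
      linear_combination ((c' * τ + d') - (c' * d - d' * c) * (a * τ + b)) *
        (inv_mul_cancel₀ g1) - (c' * τ + d') * h1
    have e2 : (a' * τ + b') * (c' * τ + d')⁻¹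
        = D⁻¹ * ((a' * d - b' * c) - (c * τ + d) * (c' * τ + d')⁻¹) := by
      rw [eq_comm, inv_mul_eq_iff_eq_mul₀ hD0, ← mul_left_inj' g2, hDdef]
      linear_combination (-(c * τ + d) - (c' * d - d' * c) * (a' * τ + b')) *
        (inv_mul_cancel₀ g2) + (c * τ + d) * h2
    rw [e1, e2, mul_inv, inv_inv]
    ring
  have hinj : Set.InjOn Z good := by
    intro x hx y hy hxy
    simp only [hgood, coe_filter, mem_univ, true_and, Set.mem_ofPred_eq] at hx hy
    simp only [hZ] at hxy
    rw [← div_eq_mul_inv, ← div_eq_mul_inv, div_eq_div_iff hx.1 hy.1] at hxy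
    have : D * (x - y) = 0 := by rw [hDdef]; linear_combination hxy
    exact sub_eq_zero.1 ((mul_eq_zero.1 this).resolve_left hD0)
  have hcompl : (univ \ good).card ≤ 2 := by
    have : univ \ good ⊆ {-d * c⁻¹, -d' * c'⁻¹} := by
      intro τ hτ
      simp only [hgood, mem_sdiff, mem_univ, mem_filter, true_and, not_and_or, not_not] at hτ
      simp only [mem_insert, mem_singleton]
      rcases hτ with h0 | h0
      · left
        have hc : c ≠ 0 := by
          rintro rfl
          simp only [zero_mul, zero_add] at h0
          subst h0; simp at h1
        field_simp; linear_combination h0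
      · right
        have hc : c' ≠ 0 := by
          rintro rfl
          simp only [zero_mul, zero_add] at h0
          subst h0; simp at h2
        field_simp; linear_combination h0
    exact (Finset.card_le_card this).trans Finset.card_le_two
  have hcard : l ≤ good.card + 2 := by
    have := Finset.card_sdiff_add_card_eq_card (Finset.subset_univ good)
    rw [Finset.card_univ, ZMod.card] at this
    omega
  set nz : Finset (ZMod l) := univ.erase 0 with hnz
  have himg : good.image Z ⊆ nz := by
    intro z hz
    obtain ⟨τ, hτ, rfl⟩ := Finset.mem_image.1 hz
    simp only [hgood, mem_filter, mem_univ, true_and] at hτ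
    simp only [hnz, mem_erase, mem_univ, and_true, hZ]
    exact mul_ne_zero hτ.2 (inv_ne_zero hτ.1)
  have hmiss : (nz \ good.image Z).card ≤ 1 := by
    have e1 := Finset.card_sdiff_add_card_eq_card himg
    have e2 : (good.image Z).card = good.card := Finset.card_image_of_injOn hinj
    have e3 : nz.card = l - 1 := by
      rw [hnz, Finset.card_erase_of_mem (mem_univ _), Finset.card_univ, ZMod.card]
    omega
  have hkl0 : ∑ z ∈ nz, G z = kl (h * D⁻¹) (h * D⁻¹) := by
    rw [kl]
    symm
    refine Finset.sum_bij (fun (z : (ZMod l)ˣ) _ => (z : ZMod l)) ?_ ?_ ?_ ?_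
    · intro z _; simp [hnz]
    · intro z _ w _ h; exact Units.ext h
    · intro z hz
      simp only [hnz, mem_erase, mem_univ, and_true] at hz
      exact ⟨Units.mk0 z hz, mem_univ _, rfl⟩
    · intro z _; rw [hG, Units.val_inv_eq_inv_val]
  have hs1 : ∑ τ, F τ = psi l K0 * (kl (h * D⁻¹) (h * D⁻¹) - ∑ z ∈ nz \ good.image Z, G z)
      + ∑ τ ∈ univ \ good, F τ := by
    rw [← hkl0, ← Finset.sum_sdiff himg, add_sub_cancel_left, Finset.sum_image hinj,
      Finset.mul_sum, ← Finset.sum_congr rfl hFG, add_comm,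
      Finset.sum_sdiff (Finset.subset_univ good)]
  have hb1 : ‖∑ z ∈ nz \ good.image Z, G z‖ ≤ 1 := by
    refine (norm_sum_le _ _).trans ?_
    simp only [hGn, sum_const, nsmul_eq_mul, mul_one]
    exact_mod_cast hmiss
  have hb2 : ‖∑ τ ∈ univ \ good, F τ‖ ≤ 2 := by
    refine (norm_sum_le _ _).trans ?_
    simp only [hFn, sum_const, nsmul_eq_mul, mul_one]
    exact_mod_cast hcompl
  have hb3 := norm_kl_le hk hkl (h * D⁻¹) (h * D⁻¹) (mul_ne_zero hh (inv_ne_zero hD0))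
  have hkl1 : (1 : ℝ) ≤ (l : ℝ) / k := by
    rw [le_div_iff₀ (by exact_mod_cast hk), one_mul]
    exact_mod_cast (Nat.le_self_pow (by norm_num) k).trans hkl
  rw [hs1]
  calc _ ≤ ‖psi l K0 * (kl (h * D⁻¹) (h * D⁻¹) - ∑ z ∈ nz \ good.image Z, G z)‖
        + ‖∑ τ ∈ univ \ good, F τ‖ := norm_add_le _ _
    _ ≤ (2 * ((l : ℝ) / k) + 1) + 2 := by
        rw [norm_mul, norm_psi, one_mul]
        exact add_le_add ((norm_sub_le _ _).trans (add_le_add hb3 hb1)) hb2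
    _ ≤ _ := by linarith

/-- Mean square of a sum of Möbius phases over one prime modulus. -/
lemma sum_norm_sq_moebius_le {ι σ : Type*} [DecidableEq ι] {k : ℕ} (hk : 0 < k) (hkl : k ^ 4 ≤ l)
    {h : ZMod l} (hh : h ≠ 0) (S : Finset σ) (𝒜 : Finset ι) (a b c d : ι → ZMod l)
    (hdet : ∀ i ∈ 𝒜, a i * d i - b i * c i = 1) (χ : ι → σ → ℂ) (hχ : ∀ i s, ‖χ i s‖ ≤ 1) :
    ∑ s ∈ S, ∑ τ : ZMod l,
        ‖∑ i ∈ 𝒜, psi l (h * ((a i * τ + b i) * (c i * τ + d i)⁻¹)) * χ i s‖ ^ 2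
      ≤ (S.card : ℝ) * ((l : ℝ) *
          (((𝒜 ×ˢ 𝒜).filter fun ij : ι × ι => c ij.1 * d ij.2 = c ij.2 * d ij.1).card : ℝ)
        + 5 * ((l : ℝ) / k) * (𝒜.card : ℝ) ^ 2) := by
  classical
  rw [← nsmul_eq_mul]
  refine Finset.sum_le_card_nsmul _ _ _ fun s _ => ?_
  set f : ι → ZMod l → ℂ := fun i τ => psi l (h * ((a i * τ + b i) * (c i * τ + d i)⁻¹)) with hf
  have hfn : ∀ i τ, ‖f i τ‖ = 1 := fun i τ => norm_psi _
  have hl0 : (0 : ℝ) ≤ (l : ℝ) / k := by positivity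
  have hcor : ∀ i ∈ 𝒜, ∀ j ∈ 𝒜, ‖∑ τ, f i τ * (starRingEnd ℂ) (f j τ)‖
      ≤ (l : ℝ) * (if c i * d j = c j * d i then 1 else 0) + 5 * ((l : ℝ) / k) := by
    intro i hi j hj
    split_ifs with hij
    · refine (norm_sum_le _ _).trans ?_
      simp only [norm_mul, RCLike.norm_conj, hfn, mul_one, sum_const, card_univ, ZMod.card,
        nsmul_eq_mul]
      linarith
    · have := norm_moebius_correlation_le hk hkl hh (hdet i hi) (hdet j hj) hij
      simpa [hf] using this
  have key : ((∑ τ : ZMod l, ‖∑ i ∈ 𝒜, f i τ * χ i s‖ ^ 2 : ℝ) : ℂ)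
      = ∑ i ∈ 𝒜, ∑ j ∈ 𝒜, (χ i s * (starRingEnd ℂ) (χ j s))
          * ∑ τ, f i τ * (starRingEnd ℂ) (f j τ) := by
    rw [Complex.ofReal_sum]
    calc _ = ∑ τ : ZMod l, ∑ i ∈ 𝒜, ∑ j ∈ 𝒜, (χ i s * (starRingEnd ℂ) (χ j s))
          * (f i τ * (starRingEnd ℂ) (f j τ)) := by
          refine Finset.sum_congr rfl fun τ _ => ?_
          push_cast
          rw [← Complex.mul_conj', map_sum, Finset.sum_mul_sum]
          refine Finset.sum_congr rfl fun i _ => Finset.sum_congr rfl fun j _ => ?_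
          rw [map_mul]; ring
      _ = ∑ i ∈ 𝒜, ∑ τ : ZMod l, ∑ j ∈ 𝒜, (χ i s * (starRingEnd ℂ) (χ j s))
          * (f i τ * (starRingEnd ℂ) (f j τ)) := Finset.sum_comm
      _ = _ := by
          refine Finset.sum_congr rfl fun i _ => ?_
          rw [Finset.sum_comm]
          exact Finset.sum_congr rfl fun j _ => (Finset.mul_sum _ _ _).symm
  have h1 : ∑ τ : ZMod l, ‖∑ i ∈ 𝒜, f i τ * χ i s‖ ^ 2
      = ‖((∑ τ : ZMod l, ‖∑ i ∈ 𝒜, f i τ * χ i s‖ ^ 2 : ℝ) : ℂ)‖ := by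
    rw [Complex.norm_real, Real.norm_of_nonneg (Finset.sum_nonneg fun _ _ => by positivity)]
  rw [h1, key]
  calc _ ≤ ∑ i ∈ 𝒜, ∑ j ∈ 𝒜,
        ((l : ℝ) * (if c i * d j = c j * d i then 1 else 0) + 5 * ((l : ℝ) / k)) := by
        refine (norm_sum_le _ _).trans (Finset.sum_le_sum fun i hi => ?_)
        refine (norm_sum_le _ _).trans (Finset.sum_le_sum fun j hj => ?_)
        rw [norm_mul, norm_mul, RCLike.norm_conj]
        calc _ ≤ 1 * 1 * ‖∑ τ, f i τ * (starRingEnd ℂ) (f j τ)‖ := by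
              gcongr <;> exact hχ _ _
          _ ≤ _ := by rw [one_mul, one_mul]; exact hcor i hi j hj
    _ = _ := by
        rw [← Finset.sum_product' 𝒜 𝒜 (fun i j =>
          (l : ℝ) * (if c i * d j = c j * d i then 1 else 0) + 5 * ((l : ℝ) / k)),
          Finset.sum_add_distrib, ← Finset.mul_sum, Finset.sum_const, Finset.card_product,
          nsmul_eq_mul, Finset.sum_boole]
        push_cast
        ring

end Kloosterman

section Parametrization

/-- The second entry of the top row attached to a coprime bottom row `(r, s)`. -/
def vv (r s : ℕ) : ℕ := (-(r : ZMod s)⁻¹).val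

/-- The first entry of the top row attached to a coprime bottom row `(r, s)`. -/
def uu (r s : ℕ) : ℕ := (1 + vv r s * r) / s

/-- The root `ν` modulo `r ^ 2 + s ^ 2` attached to `(r, s)`. -/
def nu (γ : ℕ × ℕ) : ℕ := uu γ.1 γ.2 * γ.1 + vv γ.1 γ.2 * γ.2

/-- The modulus attached to `(r, s)`. -/
def nm (γ : ℕ × ℕ) : ℕ := γ.1 ^ 2 + γ.2 ^ 2

lemma vv_lt {r s : ℕ} (hs : 0 < s) : vv r s < s := by
  have : NeZero s := ⟨hs.ne'⟩
  exact ZMod.val_lt _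

lemma uu_mul {r s : ℕ} (hs : 0 < s) (h : r.Coprime s) : uu r s * s = vv r s * r + 1 := by
  have : NeZero s := ⟨hs.ne'⟩
  have hd : s ∣ 1 + vv r s * r := by
    rw [← ZMod.natCast_eq_zero_iff]
    push_cast
    rw [vv, ZMod.natCast_zmod_val, neg_mul, mul_comm, ZMod.coe_mul_inv_eq_one r h]
    ring
  rw [uu, Nat.div_mul_cancel hd, add_comm]

lemma top_row_unique {r s u v : ℕ} (hs : 0 < s) (hv : v < s) (h : u * s = v * r + 1) :
    r.Coprime s ∧ u = uu r s ∧ v = vv r s := by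
  have : NeZero s := ⟨hs.ne'⟩
  have hc : r.Coprime s := by
    have h1 : (r.gcd s) ∣ 1 := by
      have a1 : r.gcd s ∣ u * s := (Nat.gcd_dvd_right r s).mul_left u
      have a2 : r.gcd s ∣ v * r := (Nat.gcd_dvd_left r s).mul_left v
      rw [h] at a1
      exact (Nat.dvd_add_right a2).1 a1
    exact Nat.dvd_one.1 h1
  have hvv : v = vv r s := by
    have e : (v : ZMod s) * r + 1 = 0 := by
      have := congrArg (Nat.cast : ℕ → ZMod s) h
      push_cast at this
      rw [ZMod.natCast_self, mul_zero] at this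
      exact this.symm
    have e1 := ZMod.coe_mul_inv_eq_one r hc
    have e2 : (v : ZMod s) = -(r : ZMod s)⁻¹ := by
      linear_combination (r : ZMod s)⁻¹ * e - (v : ZMod s) * e1
    rw [vv, ← e2, ZMod.val_natCast, Nat.mod_eq_of_lt hv]
  refine ⟨hc, ?_, hvv⟩
  have := uu_mul hs hc
  rw [← hvv, ← h] at this
  exact (Nat.eq_of_mul_eq_mul_right hs this).symm

lemma uu_le {r s : ℕ} (hr : 0 < r) (hs : 0 < s) (h : r.Coprime s) : uu r s ≤ r := by
  have h1 := uu_mul hs h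
  have h2 := vv_lt (r := r) hs
  by_contra! h3
  nlinarith

lemma nu_lt {γ : ℕ × ℕ} (hr : 0 < γ.1) (hs : 0 < γ.2) (h : γ.1.Coprime γ.2) : nu γ < nm γ := by
  have h1 := uu_le hr hs h
  have h2 := vv_lt (r := γ.1) hs
  unfold nu nm
  nlinarith

lemma nu_sq_add_one {γ : ℕ × ℕ} (hs : 0 < γ.2) (h : γ.1.Coprime γ.2) :
    nu γ ^ 2 + 1 = nm γ * (uu γ.1 γ.2 ^ 2 + vv γ.1 γ.2 ^ 2) := by
  have h1 := uu_mul hs h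
  unfold nu nm
  zify at h1 ⊢
  linear_combination (-(uu γ.1 γ.2 : ℤ) * γ.2 + vv γ.1 γ.2 * γ.1 - 1) * h1

lemma uu_mul_nm {γ : ℕ × ℕ} (hs : 0 < γ.2) (h : γ.1.Coprime γ.2) :
    uu γ.1 γ.2 * nm γ = nu γ * γ.1 + γ.2 := by
  have h1 := uu_mul hs h
  unfold nu nm
  zify at h1 ⊢
  linear_combination (γ.2 : ℤ) * h1

lemma vv_mul_nm {γ : ℕ × ℕ} (hs : 0 < γ.2) (h : γ.1.Coprime γ.2) :
    vv γ.1 γ.2 * nm γ + γ.1 = nu γ * γ.2 := by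
  have h1 := uu_mul hs h
  unfold nu nm
  zify at h1 ⊢
  linear_combination -(γ.1 : ℤ) * h1

/-- The roots of `ν ^ 2 = -1` modulo `n`. -/
def roots (n : ℕ) : Finset ℕ := (range n).filter fun ν => n ∣ ν ^ 2 + 1

lemma exists_gram (n : ℕ) : ∀ m k ν : ℕ, m + k + ν ≤ n → m * k = ν ^ 2 + 1 →
    ∃ u v r s : ℕ, u * s = v * r + 1 ∧ m = r ^ 2 + s ^ 2 ∧ k = u ^ 2 + v ^ 2 ∧
      ν = u * r + v * s := by
  induction n with
  | zero =>
    intro m k ν h1 h2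
    have : m = 0 := by omega
    subst this; simp at h2
  | succ n ih =>
    intro m k ν hn h
    have hm : 0 < m := Nat.pos_of_ne_zero (by rintro rfl; simp at h)
    have hk : 0 < k := Nat.pos_of_ne_zero (by rintro rfl; simp at h)
    rcases Nat.eq_zero_or_pos ν with h0 | h0
    · subst h0
      have h' : m * k = 1 := by simpa using h
      obtain ⟨rfl, rfl⟩ := (⟨Nat.eq_one_of_mul_eq_one_right h',
        Nat.eq_one_of_mul_eq_one_left h'⟩ : m = 1 ∧ k = 1)
      exact ⟨1, 0, 0, 1, by simp⟩
    by_cases hkν : k ≤ ν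
    · obtain ⟨d, rfl⟩ := Nat.exists_eq_add_of_le hkν
      have h2 : 2 * (k + d) < m + k := by
        by_contra! h3
        nlinarith [sq_nonneg d]
      obtain ⟨m', hm'⟩ := Nat.exists_eq_add_of_le h2.le
      obtain ⟨u, v, r, s, e1, e2, e3, e4⟩ := ih m' k d (by omega) (by
        have : m = k + 2 * d + m' := by omega
        subst this
        nlinarith)
      refine ⟨u, v, r + u, s + v, ?_, ?_, e3, ?_⟩
      · nlinarith
      · have : m = k + 2 * d + m' := by omega
        rw [this, e3, e2, e4]; ring
      · rw [e3, e4]; ring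
    · by_cases hmν : m ≤ ν
      · obtain ⟨d, rfl⟩ := Nat.exists_eq_add_of_le hmν
        have h2 : 2 * (m + d) < m + k := by
          by_contra! h3
          nlinarith [sq_nonneg d]
        obtain ⟨k', hk'⟩ := Nat.exists_eq_add_of_le h2.le
        obtain ⟨u, v, r, s, e1, e2, e3, e4⟩ := ih m k' d (by omega) (by
          have : k = m + 2 * d + k' := by omega
          subst this
          nlinarith)
        refine ⟨u + r, v + s, r, s, ?_, e2, ?_, ?_⟩
        · nlinarith
        · have : k = m + 2 * d + k' := by omega
          rw [this, e3, e2, e4]; ring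
        · rw [e2, e4]; ring
      · exfalso
        push Not at hkν hmν
        nlinarith

/-- Pairs `(r, s)` of positive coprime integers with `r ^ 2 + s ^ 2 ≤ Y`. -/
def G (Y : ℕ) : Finset (ℕ × ℕ) :=
  ((Icc 1 Y) ×ˢ (Icc 1 Y)).filter fun γ => γ.1.Coprime γ.2 ∧ nm γ ≤ Y

lemma mem_G {Y : ℕ} {γ : ℕ × ℕ} :
    γ ∈ G Y ↔ 0 < γ.1 ∧ 0 < γ.2 ∧ γ.1.Coprime γ.2 ∧ nm γ ≤ Y := by
  rw [G, mem_filter, mem_product, mem_Icc, mem_Icc, nm]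
  constructor
  · rintro ⟨⟨⟨h1, -⟩, h2, -⟩, h3, h4⟩
    exact ⟨h1, h2, h3, h4⟩
  · rintro ⟨h1, h2, h3, h4⟩
    exact ⟨⟨⟨h1, by nlinarith⟩, h2, by nlinarith⟩, h3, h4⟩

lemma two_le_nm {γ : ℕ × ℕ} (h1 : 0 < γ.1) (h2 : 0 < γ.2) : 2 ≤ nm γ := by
  unfold nm; nlinarith

lemma nu_injOn {γ γ' : ℕ × ℕ} (h1 : 0 < γ.1) (h2 : 0 < γ.2) (h3 : γ.1.Coprime γ.2)
    (h1' : 0 < γ'.1) (h2' : 0 < γ'.2) (h3' : γ'.1.Coprime γ'.2) (hm : nm γ = nm γ')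
    (hν : nu γ = nu γ') : γ = γ' := by
  have e := uu_mul_nm h2 h3
  have e' := uu_mul_nm h2' h3'
  rw [← hm, ← hν] at e'
  have hd : (nm γ : ℤ) ∣ (γ'.1 : ℤ) * γ.2 - γ.1 * γ'.2 := by
    refine ⟨γ'.1 * uu γ.1 γ.2 - γ.1 * uu γ'.1 γ'.2, ?_⟩
    zify at e e'
    linear_combination -(γ'.1 : ℤ) * e + (γ.1 : ℤ) * e'
  have hz : (γ'.1 : ℤ) * γ.2 - γ.1 * γ'.2 = 0 := by
    refine Int.eq_zero_of_abs_lt_dvd hd ?_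
    have n1 : (nm γ : ℤ) = (γ.1 : ℤ) ^ 2 + γ.2 ^ 2 := by unfold nm; push_cast; ring
    have n2 : (nm γ : ℤ) = (γ'.1 : ℤ) ^ 2 + γ'.2 ^ 2 := by rw [hm]; unfold nm; push_cast; ring
    zify at h1 h2 h1' h2'
    rw [abs_lt]
    have b1 := sq_nonneg ((γ'.1 : ℤ) - γ.2)
    have b2 := sq_nonneg ((γ.1 : ℤ) - γ'.2)
    constructor <;> nlinarith [mul_pos h1' h2, mul_pos h1 h2']
  have hz' : γ'.1 * γ.2 = γ.1 * γ'.2 := by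
    have : (γ'.1 : ℤ) * γ.2 = γ.1 * γ'.2 := by linarith
    exact_mod_cast this
  have d1 : γ.1 ∣ γ'.1 := h3.dvd_of_dvd_mul_right ⟨γ'.2, hz'⟩
  have d2 : γ'.1 ∣ γ.1 := h3'.dvd_of_dvd_mul_right ⟨γ.2, hz'.symm⟩
  have f1 : γ.1 = γ'.1 := Nat.dvd_antisymm d1 d2
  rw [f1] at hz'
  exact Prod.ext f1 (Nat.eq_of_mul_eq_mul_left h1' hz')

/-- Sums over roots are sums over coprime representations as sums of two squares. -/
lemma sum_roots_eq {M : Type*} [AddCommMonoid M] {m : ℕ} (hm : 2 ≤ m) (Y : ℕ) (hY : m ≤ Y)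
    (F : ℕ → M) :
    ∑ ν ∈ roots m, F ν = ∑ γ ∈ (G Y).filter (fun γ => nm γ = m), F (nu γ) := by
  symm
  refine Finset.sum_bij (fun γ _ => nu γ) ?_ ?_ ?_ ?_
  · intro γ hγ
    obtain ⟨h, h5⟩ := mem_filter.1 hγ
    obtain ⟨h1, h2, h3, h4⟩ := mem_G.1 h
    rw [roots, mem_filter, mem_range, ← h5]
    exact ⟨nu_lt h1 h2 h3, ⟨_, nu_sq_add_one h2 h3⟩⟩
  · intro γ hγ γ' hγ' hν
    obtain ⟨h, h5⟩ := mem_filter.1 hγ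
    obtain ⟨h1, h2, h3, h4⟩ := mem_G.1 h
    obtain ⟨h', h5'⟩ := mem_filter.1 hγ'
    obtain ⟨h1', h2', h3', h4'⟩ := mem_G.1 h'
    exact nu_injOn h1 h2 h3 h1' h2' h3' (h5.trans h5'.symm) hν
  · intro ν hν
    rw [roots, mem_filter, mem_range] at hν
    obtain ⟨hν, k, hk⟩ := hν
    obtain ⟨u, v, r, s, e1, e2, e3, e4⟩ := exists_gram (m + k + ν) m k ν le_rfl hk.symm
    have hs : 0 < s := Nat.pos_of_ne_zero (by rintro rfl; simp at e1)
    have hr : 0 < r := by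
      refine Nat.pos_of_ne_zero ?_
      rintro rfl
      simp only [mul_zero, zero_add] at e1
      obtain rfl := Nat.eq_one_of_mul_eq_one_left e1
      omega
    have hv : v < s := by
      by_contra! h
      have : r < u := by
        by_contra! h'
        have := Nat.mul_le_mul_right s h'
        have := Nat.mul_le_mul_right r h
        nlinarith
      nlinarith
    obtain ⟨hc, rfl, rfl⟩ := top_row_unique hs hv e1
    refine ⟨(r, s), ?_, ?_⟩
    · rw [mem_filter, mem_G]
      exact ⟨⟨hr, hs, hc, by rw [nm, ← e2]; exact hY⟩, e2.symm⟩
    · exact e4.symm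
  · intro γ _; rfl

lemma sum_Icc_roots_eq {M : Type*} [AddCommMonoid M] (Y : ℕ) (F : ℕ → ℕ → M) :
    ∑ m ∈ Icc 2 Y, ∑ ν ∈ roots m, F m ν = ∑ γ ∈ G Y, F (nm γ) (nu γ) := by
  have h1 : ∀ γ ∈ G Y, nm γ ∈ Icc 2 Y := fun γ hγ => by
    obtain ⟨h1, h2, h3, h4⟩ := mem_G.1 hγ
    exact mem_Icc.2 ⟨two_le_nm h1 h2, h4⟩
  rw [← Finset.sum_fiberwise_of_maps_to h1]
  refine Finset.sum_congr rfl fun m hm => ?_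
  obtain ⟨hm1, hm2⟩ := mem_Icc.1 hm
  rw [sum_roots_eq hm1 Y hm2]
  exact Finset.sum_congr rfl fun γ hγ => by rw [(mem_filter.1 hγ).2]

lemma fst_le_sqrt {Y : ℕ} {γ : ℕ × ℕ} (h : nm γ ≤ Y) : γ.1 ≤ Nat.sqrt Y :=
  Nat.le_sqrt'.2 (le_trans (by unfold nm; omega) h)

lemma snd_le_sqrt {Y : ℕ} {γ : ℕ × ℕ} (h : nm γ ≤ Y) : γ.2 ≤ Nat.sqrt Y :=
  Nat.le_sqrt'.2 (le_trans (by unfold nm; omega) h)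

lemma card_G_le (Y : ℕ) : (G Y).card ≤ Y := by
  have : G Y ⊆ Icc 1 (Nat.sqrt Y) ×ˢ Icc 1 (Nat.sqrt Y) := by
    intro γ hγ
    obtain ⟨h1, h2, h3, h4⟩ := mem_G.1 hγ
    exact mem_product.2 ⟨mem_Icc.2 ⟨h1, fst_le_sqrt h4⟩, mem_Icc.2 ⟨h2, snd_le_sqrt h4⟩⟩
  refine (card_le_card this).trans ?_
  simpa using Nat.sqrt_le Y

lemma card_filter_mod_le (R D a : ℕ) :
    ((range (R + 1)).filter fun r => r % D = a).card ≤ R / D + 1 := by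
  have h : Set.InjOn (fun r => r / D) ((range (R + 1)).filter fun r => r % D = a) := by
    intro x hx y hy h
    simp only [coe_filter, Set.mem_ofPred_eq] at hx hy
    rw [← Nat.div_add_mod x D, ← Nat.div_add_mod y D, hx.2, hy.2]
    simp only at h
    rw [h]
  rw [← Finset.card_image_of_injOn h]
  calc _ ≤ (range (R / D + 1)).card := by
        refine card_le_card fun q hq => ?_
        obtain ⟨x, hx, rfl⟩ := mem_image.1 hq
        have := mem_range.1 (mem_filter.1 hx).1
        exact mem_range.2 (Nat.lt_succ_of_le (Nat.div_le_div_right (by omega)))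
    _ = _ := card_range _

/-- The number of roots modulo `n`. -/
def rho (n : ℕ) : ℕ := (roots n).card

lemma card_G_dvd_le (X D : ℕ) (hD : 0 < D) :
    ((G X).filter fun γ => D ∣ nm γ).card ≤ rho D * (Nat.sqrt X * (Nat.sqrt X / D + 1)) := by
  classical
  have : NeZero D := ⟨hD.ne'⟩
  set R := Nat.sqrt X
  have hsub : ((G X).filter fun γ => D ∣ nm γ) ⊆ (roots D).biUnion fun x =>
      (Icc 1 R).biUnion fun s =>
        ((range (R + 1)).filter fun r => r % D = (x * s) % D).map ⟨fun r => (r, s), fun a b h =>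
          (Prod.ext_iff.1 h).1⟩ := by
    intro γ hγ
    obtain ⟨h, hd⟩ := mem_filter.1 hγ
    obtain ⟨h1, h2, h3, h4⟩ := mem_G.1 h
    have hcop : γ.2.Coprime D := by
      have : (γ.2.gcd D) ∣ γ.1 ^ 2 := by
        have a1 : γ.2.gcd D ∣ nm γ := (Nat.gcd_dvd_right _ _).trans hd
        have a2 : γ.2.gcd D ∣ γ.2 ^ 2 := (Nat.gcd_dvd_left _ _).trans (Dvd.intro_left _ (sq _).symm)
        exact (Nat.dvd_add_left a2).1 a1
      have a3 : γ.2.gcd D ∣ Nat.gcd (γ.1 ^ 2) γ.2 := Nat.dvd_gcd this (Nat.gcd_dvd_left _ _)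
      rw [Nat.Coprime.gcd_eq_one (h3.pow_left 2)] at a3
      exact Nat.dvd_one.1 a3
    have hs := ZMod.coe_mul_inv_eq_one γ.2 hcop
    set x : ZMod D := γ.1 * (γ.2 : ZMod D)⁻¹ with hx
    have hx2 : x ^ 2 + 1 = 0 := by
      have e : (γ.1 : ZMod D) ^ 2 + (γ.2 : ZMod D) ^ 2 = 0 := by
        have := (ZMod.natCast_eq_zero_iff (nm γ) D).2 hd
        unfold nm at this
        exact_mod_cast this
      rw [hx]
      linear_combination ((γ.2 : ZMod D)⁻¹) ^ 2 * e -
        ((γ.2 : ZMod D) * (γ.2 : ZMod D)⁻¹ + 1) * hs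
    simp only [mem_biUnion, mem_map, mem_filter, mem_range]
    refine ⟨x.val, ?_, γ.2, mem_Icc.2 ⟨h2, snd_le_sqrt h4⟩, γ.1,
      ⟨Nat.lt_succ_of_le (fst_le_sqrt h4), ?_⟩, rfl⟩
    · rw [roots, mem_filter, mem_range]
      refine ⟨ZMod.val_lt _, ?_⟩
      rw [← ZMod.natCast_eq_zero_iff]
      push_cast
      rw [ZMod.natCast_zmod_val, hx2]
    · change γ.1 ≡ _ [MOD D]
      rw [← ZMod.natCast_eq_natCast_iff]
      push_cast
      rw [ZMod.natCast_zmod_val, hx]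
      linear_combination -(γ.1 : ZMod D) * hs
  refine (card_le_card hsub).trans ?_
  refine Finset.card_biUnion_le_card_mul _ _ _ fun x _ => ?_
  refine (Finset.card_biUnion_le_card_mul _ _ (R / D + 1) fun s _ => ?_).trans ?_
  · rw [card_map]; exact card_filter_mod_le _ _ _
  · simp

lemma rho_mul_prime_le (m l : ℕ) (hl : l.Prime) : rho (l * m) ≤ 2 * rho m := by
  classical
  have : Fact l.Prime := ⟨hl⟩
  rcases Nat.eq_zero_or_pos m with rfl | hm
  · simp [rho, roots]
  unfold rho
  refine Finset.card_le_mul_card_image_of_maps_to (f := fun N => N % m) ?_ 2 ?_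
  · intro N hN
    rw [roots, mem_filter, mem_range] at hN ⊢
    refine ⟨Nat.mod_lt _ hm, ?_⟩
    have h1 : m ∣ N ^ 2 + 1 := (Dvd.intro_left l rfl).trans hN.2
    have h2 : (N % m) ^ 2 + 1 ≡ N ^ 2 + 1 [MOD m] := ((Nat.mod_modEq N m).pow 2).add_right 1
    exact (h2.dvd_iff dvd_rfl).2 h1
  · intro ν hν
    set S := (roots (l * m)).filter fun N => N % m = ν with hS
    have hmem : ∀ N ∈ S, N / m < l ∧ N = ν + m * (N / m) ∧ l * m ∣ N ^ 2 + 1 := by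
      intro N hN
      rw [hS, mem_filter, roots, mem_filter, mem_range] at hN
      refine ⟨Nat.div_lt_of_lt_mul (by rw [mul_comm]; exact hN.1.1), ?_, hN.1.2⟩
      rw [← hN.2, Nat.mod_add_div]
    have hinj : Set.InjOn (fun N => ((N / m : ℕ) : ZMod l)) S := by
      intro N hN N' hN' h
      obtain ⟨a1, a2, a3⟩ := hmem N hN
      obtain ⟨b1, b2, b3⟩ := hmem N' hN'
      simp only at h
      rw [ZMod.natCast_eq_natCast_iff', Nat.mod_eq_of_lt a1, Nat.mod_eq_of_lt b1] at h
      rw [a2, b2, h]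
    rw [← Finset.card_image_of_injOn hinj]
    by_cases hl2 : l = 2
    · subst hl2
      exact (Finset.card_le_univ _).trans (by simp [ZMod.card])
    have h2 : (2 : ZMod l) ≠ 0 := by
      intro h
      have : ((2 : ℕ) : ZMod l) = 0 := by exact_mod_cast h
      rw [ZMod.natCast_eq_zero_iff] at this
      exact hl2 ((Nat.prime_dvd_prime_iff_eq hl Nat.prime_two).1 this)
    have hquad : ∀ t ∈ S.image (fun N => ((N / m : ℕ) : ZMod l)),
        ∀ t' ∈ S.image (fun N => ((N / m : ℕ) : ZMod l)), t' ≠ t →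
          (m : ZMod l) * (t + t') + 2 * ν = 0 := by
      intro t ht t' ht' hne
      obtain ⟨N, hN, rfl⟩ := mem_image.1 ht
      obtain ⟨N', hN', rfl⟩ := mem_image.1 ht'
      obtain ⟨a1, a2, a3⟩ := hmem N hN
      obtain ⟨b1, b2, b3⟩ := hmem N' hN'
      set q := N / m
      set q' := N' / m
      have hd : ((l * m : ℕ) : ℤ) ∣ (N ^ 2 + 1 : ℤ) - (N' ^ 2 + 1) := by
        refine dvd_sub ?_ ?_ <;> exact_mod_cast ‹_›
      rw [a2, b2] at hd
      have hd2 : (m : ℤ) * l ∣ m * (((q : ℤ) - q') * (m * (q + q') + 2 * ν)) := by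
        convert hd using 1 <;> push_cast <;> ring
      have hd3 : (l : ℤ) ∣ ((q : ℤ) - q') * (m * (q + q') + 2 * ν) :=
        Int.dvd_of_mul_dvd_mul_left (by exact_mod_cast hm.ne') hd2
      have h3 := (ZMod.intCast_zmod_eq_zero_iff_dvd _ l).2 hd3
      push_cast at h3
      refine (mul_eq_zero.1 h3).resolve_left fun h => hne (sub_eq_zero.1 h).symm
    have hνl : ∀ N ∈ S, (m : ZMod l) = 0 → (ν : ZMod l) ≠ 0 := by
      intro N hN hm0 h0
      obtain ⟨a1, a2, a3⟩ := hmem N hN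
      have : l ∣ N ^ 2 + 1 := (Dvd.intro m rfl).trans a3
      have h3 := (ZMod.natCast_eq_zero_iff _ l).2 this
      rw [a2] at h3
      push_cast at h3
      rw [h0, hm0] at h3
      simp at h3
    by_contra! hcard
    obtain ⟨t1, h1, t2, ht2, t3, h3, h12, h13, h23⟩ := Finset.two_lt_card.1 hcard
    have q12 := hquad t1 h1 t2 ht2 h12.symm
    have q13 := hquad t1 h1 t3 h3 h13.symm
    have hm0 : (m : ZMod l) = 0 := by
      have : (m : ZMod l) * (t2 - t3) = 0 := by linear_combination q12 - q13
      exact (mul_eq_zero.1 this).resolve_right (sub_ne_zero.2 h23)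
    obtain ⟨N, hN, -⟩ := mem_image.1 h1
    rw [hm0, zero_mul, zero_add] at q12
    exact hνl N hN hm0 ((mul_eq_zero.1 q12).resolve_left h2)

lemma rho_one : rho 1 = 1 := by decide

end Parametrization

section Phases

/-- `e(x) = exp(2πix)`. -/
noncomputable def ee (x : ℝ) : ℂ := Complex.exp (2 * Real.pi * x * Complex.I)

lemma norm_ee (x : ℝ) : ‖ee x‖ = 1 := by
  rw [ee, show (2 * Real.pi * x * Complex.I : ℂ) = ((2 * Real.pi * x : ℝ) : ℂ) * Complex.I by
    push_cast; ring, Complex.norm_exp_ofReal_mul_I]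

lemma ee_add (x y : ℝ) : ee (x + y) = ee x * ee y := by
  rw [ee, ee, ee, ← Complex.exp_add]; congr 1; push_cast; ring

lemma ee_int (n : ℤ) : ee n = 1 := by
  rw [ee, Complex.exp_eq_one_iff]
  exact ⟨n, by push_cast; ring⟩

lemma ee_zero : ee 0 = 1 := by simp [ee]

lemma norm_ee_sub_one_le (x : ℝ) : ‖ee x - 1‖ ≤ 7 * |x| := by
  have h := Real.norm_exp_I_mul_ofReal_sub_one_le (x := 2 * Real.pi * x)
  rw [ee, show (2 * Real.pi * x * Complex.I : ℂ) = Complex.I * ((2 * Real.pi * x : ℝ) : ℂ) by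
    push_cast; ring]
  refine h.trans ?_
  rw [Real.norm_eq_abs, abs_mul, abs_of_pos (by positivity : (0 : ℝ) < 2 * Real.pi)]
  have := Real.pi_lt_d2
  nlinarith [abs_nonneg x]

lemma norm_ee_sub_le (x y : ℝ) : ‖ee x - ee y‖ ≤ 7 * |x - y| := by
  have : ee x - ee y = ee y * (ee (x - y) - 1) := by
    rw [mul_sub, ← ee_add]; simp
  rw [this, norm_mul, norm_ee, one_mul]
  exact norm_ee_sub_one_le _

/-- The additive character of `ZMod l`, as a total function of `l`. -/
noncomputable def eZ (l : ℕ) (t : ZMod l) : ℂ := ee (t.val / l)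

lemma norm_eZ (l : ℕ) (t : ZMod l) : ‖eZ l t‖ = 1 := norm_ee _

lemma eZ_eq_psi (l : ℕ) [NeZero l] (t : ZMod l) : eZ l t = psi l t := by
  rw [eZ, ee, psi, ZMod.stdAddChar_apply, ZMod.toCircle_apply]
  congr 1; push_cast; ring

lemma eZ_natCast (l : ℕ) (hl : 0 < l) (n : ℕ) : eZ l n = ee ((n : ℝ) / l) := by
  have : NeZero l := ⟨hl.ne'⟩
  rw [eZ, ZMod.val_natCast]
  have h : ((n : ℝ) / l) = ((n % l : ℕ) : ℝ) / l + ((n / l : ℕ) : ℤ) := by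
    have := Nat.mod_add_div n l
    have h2 : (n : ℝ) = ((n % l : ℕ) : ℝ) + l * ((n / l : ℕ) : ℝ) := by exact_mod_cast this.symm
    have hl' : (l : ℝ) ≠ 0 := by exact_mod_cast hl.ne'
    rw [div_eq_iff hl', add_mul, div_mul_cancel₀ _ hl', Int.cast_natCast]
    linarith
  rw [h, ee_add, ee_int, mul_one]

/-- The phase attached to a root `w` modulo `l` and `γ`. -/
noncomputable def ph (l : ℕ) (h : ℤ) (w : ℕ) (γ : ℕ × ℕ) : ℂ :=
  eZ l (-(h : ZMod l) * (((uu γ.1 γ.2 : ZMod l) * w + vv γ.1 γ.2)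
    * ((γ.1 : ZMod l) * w + γ.2)⁻¹))

lemma norm_ph (l : ℕ) (h : ℤ) (w : ℕ) (γ : ℕ × ℕ) : ‖ph l h w γ‖ = 1 := norm_eZ _ _

/-- The exponential sum over the roots modulo `n`. -/
noncomputable def asum (h n : ℕ) : ℂ := ∑ ν ∈ roots n, ee ((h : ℝ) * ν / n)

lemma norm_asum_le (h n : ℕ) : ‖asum h n‖ ≤ rho n := by
  refine (norm_sum_le _ _).trans ?_
  simp [norm_ee, rho]

lemma natCast_sq_add_one {l w : ℕ} (hw : l ∣ w ^ 2 + 1) : (w : ZMod l) ^ 2 + 1 = 0 := by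
  have := (ZMod.natCast_eq_zero_iff _ l).2 hw
  exact_mod_cast this

/-- Roots modulo `l * m` for a prime `l` not dividing `m`. -/
lemma sum_roots_mul_prime {M : Type*} [AddCommMonoid M] {l m : ℕ} (hl : l.Prime) (hm : 0 < m)
    (hlm : ¬ l ∣ m) (F : ℕ → M) :
    ∑ N ∈ roots (l * m), F N = ∑ ν ∈ roots m, ∑ w ∈ roots l,
      F (ν + m * ((-(w : ZMod l) - ν) * (m : ZMod l)⁻¹).val) := by
  have : Fact l.Prime := ⟨hl⟩
  have hml : (m : ZMod l) ≠ 0 := by rwa [Ne, ZMod.natCast_eq_zero_iff]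
  have hcop : Nat.Coprime l m := (Nat.Prime.coprime_iff_not_dvd hl).2 hlm
  rw [← Finset.sum_product' (roots m) (roots l)
    (fun ν w => F (ν + m * ((-(w : ZMod l) - ν) * (m : ZMod l)⁻¹).val))]
  symm
  refine Finset.sum_bij' (fun p _ => p.1 + m * ((-(p.2 : ZMod l) - p.1) * (m : ZMod l)⁻¹).val)
    (fun N _ => (N % m, (-(N : ZMod l)).val)) ?_ ?_ ?_ ?_ ?_
  · rintro ⟨ν, w⟩ hp
    obtain ⟨h1, h2⟩ := mem_product.1 hp
    simp only [roots, mem_filter, mem_range] at h1 h2 ⊢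
    set t := ((-(w : ZMod l) - ν) * (m : ZMod l)⁻¹).val with ht
    have htl : t < l := ZMod.val_lt _
    refine ⟨?_, hcop.mul_dvd_of_dvd_of_dvd ?_ ?_⟩
    · have : m * t + m ≤ l * m := by
        calc m * t + m = (t + 1) * m := by ring
          _ ≤ _ := Nat.mul_le_mul_right m htl
      omega
    · rw [← ZMod.natCast_eq_zero_iff]
      push_cast
      rw [ht, ZMod.natCast_zmod_val]
      have e1 := natCast_sq_add_one h2.2
      have e2 : (m : ZMod l) * ((-(w : ZMod l) - ν) * (m : ZMod l)⁻¹) = -(w : ZMod l) - ν := by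
        field_simp
      rw [e2]
      linear_combination e1
    · have : (ν + m * t) ^ 2 + 1 = (ν ^ 2 + 1) + m * (2 * ν * t + m * t ^ 2) := by ring
      rw [this]
      exact dvd_add h1.2 (Dvd.intro _ rfl)
  · intro N hN
    simp only [roots, mem_filter, mem_range, mem_product] at hN ⊢
    refine ⟨⟨Nat.mod_lt _ hm, ?_⟩, ZMod.val_lt _, ?_⟩
    · have h1 : m ∣ N ^ 2 + 1 := (Dvd.intro_left l rfl).trans hN.2
      have h2 : (N % m) ^ 2 + 1 ≡ N ^ 2 + 1 [MOD m] := ((Nat.mod_modEq N m).pow 2).add_right 1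
      exact (h2.dvd_iff dvd_rfl).2 h1
    · rw [← ZMod.natCast_eq_zero_iff]
      push_cast
      rw [ZMod.natCast_zmod_val, neg_sq]
      exact natCast_sq_add_one ((Dvd.intro m rfl).trans hN.2)
  · rintro ⟨ν, w⟩ hp
    obtain ⟨h1, h2⟩ := mem_product.1 hp
    simp only [roots, mem_filter, mem_range] at h1 h2 ⊢
    refine Prod.ext ?_ ?_
    · simp only [Nat.add_mul_mod_self_left]
      exact Nat.mod_eq_of_lt h1.1
    · simp only
      push_cast
      rw [ZMod.natCast_zmod_val]
      have e2 : (m : ZMod l) * ((-(w : ZMod l) - ν) * (m : ZMod l)⁻¹) = -(w : ZMod l) - ν := by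
        field_simp
      rw [e2, show -((ν : ZMod l) + (-(w : ZMod l) - ν)) = (w : ZMod l) by ring,
        ZMod.val_natCast, Nat.mod_eq_of_lt h2.1]
  · intro N hN
    simp only [roots, mem_filter, mem_range] at hN
    simp only [ZMod.natCast_zmod_val, neg_neg]
    have hq : N / m < l := Nat.div_lt_of_lt_mul (by rw [mul_comm]; exact hN.1)
    have e : ((N : ZMod l) - ((N % m : ℕ) : ZMod l)) * (m : ZMod l)⁻¹ = ((N / m : ℕ) : ZMod l) := by
      have := congrArg (Nat.cast : ℕ → ZMod l) (Nat.mod_add_div N m)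
      push_cast at this
      rw [← this]
      field_simp
      ring
    rw [e, ZMod.val_natCast, Nat.mod_eq_of_lt hq, Nat.mod_add_div]
  · intro p _; rfl

lemma row_ne_zero {l : ℕ} [Fact l.Prime] {w : ℕ} (hw : l ∣ w ^ 2 + 1) {γ : ℕ × ℕ}
    (h : ¬ l ∣ nm γ) : (γ.1 : ZMod l) * w + γ.2 ≠ 0 := by
  intro h0
  apply h
  rw [← ZMod.natCast_eq_zero_iff, nm]
  push_cast
  linear_combination (γ.1 : ZMod l) ^ 2 * natCast_sq_add_one hw
    - ((γ.1 : ZMod l) * w - γ.2) * h0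

/-- The exponential sum modulo `l * m` in terms of phases. -/
lemma asum_mul_prime {l m Y : ℕ} (h : ℕ) (hl : l.Prime) (hm : 2 ≤ m) (hY : m ≤ Y)
    (hlm : ¬ l ∣ m) :
    asum h (l * m) = ∑ γ ∈ (G Y).filter (fun γ => nm γ = m),
      ee ((h : ℝ) * nu γ / (l * m)) * ∑ w ∈ roots l, ph l h w γ := by
  have : Fact l.Prime := ⟨hl⟩
  have hm0 : 0 < m := by omega
  rw [asum, sum_roots_mul_prime hl hm0 hlm, sum_roots_eq hm Y hY]
  refine Finset.sum_congr rfl fun γ hγ => ?_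
  rw [Finset.mul_sum]
  refine Finset.sum_congr rfl fun w hw => ?_
  obtain ⟨hG, hγm⟩ := mem_filter.1 hγ
  obtain ⟨h1, h2, h3, h4⟩ := mem_G.1 hG
  have hw2 : l ∣ w ^ 2 + 1 := (mem_filter.1 hw).2
  have hml : (m : ZMod l) ≠ 0 := by rwa [Ne, ZMod.natCast_eq_zero_iff]
  have hrow := row_ne_zero hw2 (γ := γ) (by rwa [hγm])
  have et : (-(w : ZMod l) - nu γ) * (m : ZMod l)⁻¹
      = -(((uu γ.1 γ.2 : ZMod l) * w + vv γ.1 γ.2) * ((γ.1 : ZMod l) * w + γ.2)⁻¹) := by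
    have a1 := congrArg (Nat.cast : ℕ → ZMod l) (uu_mul_nm h2 h3)
    have a2 := congrArg (Nat.cast : ℕ → ZMod l) (vv_mul_nm h2 h3)
    have a3 := natCast_sq_add_one hw2
    rw [hγm] at a1 a2
    push_cast at a1 a2
    rw [← div_eq_mul_inv, ← div_eq_mul_inv, ← neg_div, div_eq_div_iff hml hrow]
    linear_combination -(γ.1 : ZMod l) * a3 + (w : ZMod l) * a1 + a2
  set t := (-(w : ZMod l) - nu γ) * (m : ZMod l)⁻¹ with ht
  have hph : ph l h w γ = eZ l ((h * t.val : ℕ) : ZMod l) := by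
    rw [ph]
    congr 1
    push_cast
    rw [ZMod.natCast_zmod_val, et]
    ring
  rw [hph, eZ_natCast l hl.pos, ← ee_add]
  congr 1
  have hl' : (l : ℝ) ≠ 0 := by exact_mod_cast hl.ne_zero
  have hm' : (m : ℝ) ≠ 0 := by exact_mod_cast hm0.ne'
  push_cast
  field_simp

lemma card_roots_prime_le {l : ℕ} (hl : l.Prime) : (roots l).card ≤ 2 := by
  have := rho_mul_prime_le 1 l hl
  rwa [mul_one, rho_one] at this

/-- Dropping the slowly varying factor. -/
lemma norm_asum_mul_prime_sub_le {l m Y : ℕ} (h : ℕ) (hl : l.Prime) (hm : 2 ≤ m) (hY : m ≤ Y)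
    (hlm : ¬ l ∣ m) :
    ‖asum h (l * m) - ∑ γ ∈ (G Y).filter (fun γ => nm γ = m), ∑ w ∈ roots l, ph l h w γ‖
      ≤ ((G Y).filter (fun γ => nm γ = m)).card * (14 * (h : ℝ) / l) := by
  rw [asum_mul_prime h hl hm hY hlm, ← Finset.sum_sub_distrib]
  refine (norm_sum_le _ _).trans ?_
  rw [← nsmul_eq_mul (_ : ℕ) (14 * (h : ℝ) / l)]
  refine (Finset.sum_le_card_nsmul _ _ _ fun γ hγ => ?_)
  obtain ⟨hG, hγm⟩ := mem_filter.1 hγ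
  obtain ⟨h1, h2, h3, h4⟩ := mem_G.1 hG
  have hlt := nu_lt h1 h2 h3
  rw [hγm] at hlt
  have e : ∀ z S : ℂ, z * S - S = (z - 1) * S := fun z S => by ring
  rw [e, norm_mul]
  have b1 : ‖∑ w ∈ roots l, ph l h w γ‖ ≤ 2 := by
    refine (norm_sum_le _ _).trans ?_
    simp only [norm_ph, sum_const, nsmul_eq_mul, mul_one]
    exact_mod_cast card_roots_prime_le hl
  have hl' : (0 : ℝ) < l := by exact_mod_cast hl.pos
  have hm' : (0 : ℝ) < m := by exact_mod_cast (by omega : 0 < m)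
  have b2 : |(h : ℝ) * nu γ / (l * m)| ≤ h / l := by
    rw [abs_of_nonneg (by positivity), div_le_div_iff₀ (by positivity) hl']
    have : (nu γ : ℝ) ≤ m := by exact_mod_cast hlt.le
    calc (h : ℝ) * nu γ * l ≤ h * m * l := by gcongr
      _ = _ := by ring
  calc _ ≤ (7 * ((h : ℝ) / l)) * 2 :=
        mul_le_mul ((norm_ee_sub_one_le _).trans (by gcongr)) b1 (norm_nonneg _) (by positivity)
    _ = _ := by ring

end Phases

section Farey

/-- The combination `c ρ₁ + d ρ₂`. -/
def act (α : ℕ × ℕ) (φ : (ℕ × ℕ) × (ℕ × ℕ)) : ℕ × ℕ :=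
  (α.1 * φ.1.1 + α.2 * φ.2.1, α.1 * φ.1.2 + α.2 * φ.2.2)

/-- The sum of the coordinates. -/
def nrm (ρ : ℕ × ℕ) : ℕ := ρ.1 + ρ.2

/-- Consecutive Farey-type pairs of level `Z`. -/
def Far (Z : ℕ) : Finset ((ℕ × ℕ) × (ℕ × ℕ)) :=
  ((range (Z + 1) ×ˢ range (Z + 1)) ×ˢ (range (Z + 1) ×ˢ range (Z + 1))).filter fun φ =>
    φ.1.1 * φ.2.2 = φ.1.2 * φ.2.1 + 1 ∧ nrm φ.1 ≤ Z ∧ nrm φ.2 ≤ Z ∧ Z < nrm φ.1 + nrm φ.2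

lemma mem_Far {Z : ℕ} {φ : (ℕ × ℕ) × (ℕ × ℕ)} : φ ∈ Far Z ↔
    φ.1.1 * φ.2.2 = φ.1.2 * φ.2.1 + 1 ∧ nrm φ.1 ≤ Z ∧ nrm φ.2 ≤ Z ∧
      Z < nrm φ.1 + nrm φ.2 := by
  rw [Far, mem_filter, mem_product, mem_product, mem_product, mem_range, mem_range, mem_range,
    mem_range]
  refine ⟨fun h => h.2, fun h => ⟨?_, h⟩⟩
  obtain ⟨-, h1, h2, -⟩ := h
  unfold nrm at h1 h2
  omega

lemma exists_act_eq_aux (Z : ℕ) (γ : ℕ × ℕ) (hγ : Z < nrm γ) (n : ℕ) :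
    ∀ (α : ℕ × ℕ) (φ : (ℕ × ℕ) × (ℕ × ℕ)), α.1 + α.2 ≤ n → 0 < α.1 → 0 < α.2 →
      α.1.Coprime α.2 → φ.1.1 * φ.2.2 = φ.1.2 * φ.2.1 + 1 → nrm φ.1 ≤ Z → nrm φ.2 ≤ Z →
      act α φ = γ →
      ∃ α' : ℕ × ℕ, ∃ φ' ∈ Far Z, 0 < α'.1 ∧ 0 < α'.2 ∧ α'.1.Coprime α'.2 ∧ act α' φ' = γ := by
  induction n with
  | zero => intro α φ h h1; omega
  | succ n ih =>
    rintro ⟨c, d⟩ ⟨⟨p, q⟩, ⟨r, s⟩⟩ hn hc hd hcop hdet h1 h2 hact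
    by_cases hZ : Z < nrm (p, q) + nrm (r, s)
    · exact ⟨(c, d), ((p, q), (r, s)), mem_Far.2 ⟨hdet, h1, h2, hZ⟩, hc, hd, hcop, hact⟩
    simp only [nrm, act] at *
    rcases lt_trichotomy c d with h | h | h
    · obtain ⟨e, rfl⟩ := Nat.exists_eq_add_of_lt h
      refine ih (c, e + 1) ((p + r, q + s), (r, s)) (by simp only; omega) hc (by simp only; omega)
        ?_ (by simp only; linarith) (by simp only; omega) (by simp only; omega) ?_
      · simpa [add_assoc] using hcop
      · rw [← hact]; ext <;> simp only <;> ring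
    · subst h
      have : c = 1 := by simpa using hcop
      subst this
      rw [← hact] at hγ
      simp only at hγ
      omega
    · obtain ⟨e, rfl⟩ := Nat.exists_eq_add_of_lt h
      refine ih (e + 1, d) ((p, q), (p + r, q + s)) (by simp only; omega) (by simp only; omega) hd
        ?_ (by simp only; linarith) (by simp only; omega) (by simp only; omega) ?_
      · simpa [add_assoc] using hcop
      · rw [← hact]; ext <;> simp only <;> ring

lemma exists_act_eq {Z : ℕ} (hZ : 1 ≤ Z) {γ : ℕ × ℕ} (h1 : 0 < γ.1) (h2 : 0 < γ.2)
    (h3 : γ.1.Coprime γ.2) (hγ : Z < nrm γ) :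
    ∃ α : ℕ × ℕ, ∃ φ ∈ Far Z, 0 < α.1 ∧ 0 < α.2 ∧ α.1.Coprime α.2 ∧ act α φ = γ :=
  exists_act_eq_aux Z γ hγ (γ.1 + γ.2) γ ((1, 0), (0, 1)) le_rfl h1 h2 h3 (by simp)
    (by simpa [nrm] using hZ) (by simpa [nrm] using hZ) (by simp [act])

lemma det_nonpos {Z : ℕ} {α α' : ℕ × ℕ} {φ φ' : (ℕ × ℕ) × (ℕ × ℕ)} (hφ : φ ∈ Far Z)
    (hφ' : φ' ∈ Far Z) (hc : 0 < α.1) (hd : 0 < α.2) (hd' : 0 < α'.2)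
    (h : act α φ = act α' φ') :
    (φ.1.1 : ℤ) * φ'.1.2 - φ.1.2 * φ'.1.1 ≤ 0 := by
  obtain ⟨f1, f2, f3, f4⟩ := mem_Far.1 hφ
  obtain ⟨g1, g2, g3, g4⟩ := mem_Far.1 hφ'
  obtain ⟨⟨p, q⟩, ⟨r, s⟩⟩ := φ
  obtain ⟨⟨p', q'⟩, ⟨r', s'⟩⟩ := φ'
  obtain ⟨c, d⟩ := α
  obtain ⟨c', d'⟩ := α'
  simp only [act, nrm, Prod.mk.injEq] at *
  obtain ⟨e1, e2⟩ := h
  by_contra! hb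
  zify at *
  set b : ℤ := p * q' - q * p' with hbdef
  set a : ℤ := p' * s - q' * r with hadef
  have hN : ((p' : ℤ) + q') = a * (p + q) + b * (r + s) := by
    rw [hadef, hbdef]; linear_combination -((p' : ℤ) + q') * f1
  have had : a * d - b * c = d' := by
    have k1 : (p : ℤ) * s - q * r = 1 := by linear_combination f1
    have k2 : (p' : ℤ) * s' - q' * r' = 1 := by linear_combination g1
    rw [hadef, hbdef]
    linear_combination (p' : ℤ) * e2 - (q' : ℤ) * e1 + (d' : ℤ) * k2
  have ha : 0 < a := by
    by_contra! h0
    have := mul_pos hb hc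
    have := mul_nonneg (neg_nonneg.2 h0) hd.le
    linarith
  have i1 : (0 : ℤ) ≤ p + q := by positivity
  have i2 : (0 : ℤ) ≤ r + s := by positivity
  have := mul_le_mul_of_nonneg_right (show 1 ≤ a by omega) i1
  have := mul_le_mul_of_nonneg_right (show 1 ≤ b by omega) i2
  linarith

lemma det_nonpos' {Z : ℕ} {α α' : ℕ × ℕ} {φ φ' : (ℕ × ℕ) × (ℕ × ℕ)} (hφ : φ ∈ Far Z)
    (hφ' : φ' ∈ Far Z) (hc : 0 < α.1) (hd : 0 < α.2) (hc' : 0 < α'.1)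
    (h : act α φ = act α' φ') :
    (φ'.2.1 : ℤ) * φ.2.2 - φ'.2.2 * φ.2.1 ≤ 0 := by
  have sw : ∀ ψ ∈ Far Z, (ψ.2.swap, ψ.1.swap) ∈ Far Z := by
    intro ψ hψ
    obtain ⟨f1, f2, f3, f4⟩ := mem_Far.1 hψ
    simp only [nrm] at f2 f3 f4
    refine mem_Far.2 ⟨?_, ?_, ?_, ?_⟩ <;> simp only [nrm, Prod.fst_swap, Prod.snd_swap]
    · nlinarith
    · omega
    · omega
    · omega
  have := det_nonpos (α := α.swap) (α' := α'.swap) (sw φ hφ) (sw φ' hφ') hd hc hc' (by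
    simp only [act, Prod.fst_swap, Prod.snd_swap, Prod.mk.injEq] at h ⊢
    constructor
    · linarith [h.2]
    · linarith [h.1])
  simp only [Prod.fst_swap, Prod.snd_swap] at this
  linarith

lemma act_injective {Z : ℕ} {α α' : ℕ × ℕ} {φ φ' : (ℕ × ℕ) × (ℕ × ℕ)} (hφ : φ ∈ Far Z)
    (hφ' : φ' ∈ Far Z) (hc : 0 < α.1) (hd : 0 < α.2) (hc' : 0 < α'.1) (hd' : 0 < α'.2)
    (h : act α φ = act α' φ') : α = α' ∧ φ = φ' := by
  have a1 := det_nonpos hφ hφ' hc hd hd' h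
  have a2 := det_nonpos hφ' hφ hc' hd' hd h.symm
  have b1 := det_nonpos' hφ hφ' hc hd hc' h
  have b2 := det_nonpos' hφ' hφ hc' hd' hc h.symm
  have hA : (φ.1.1 : ℤ) * φ'.1.2 - φ.1.2 * φ'.1.1 = 0 := by linarith
  have hB : (φ'.2.1 : ℤ) * φ.2.2 - φ'.2.2 * φ.2.1 = 0 := by linarith
  obtain ⟨f1, f2, f3, f4⟩ := mem_Far.1 hφ
  obtain ⟨g1, g2, g3, g4⟩ := mem_Far.1 hφ'
  obtain ⟨⟨p, q⟩, ⟨r, s⟩⟩ := φ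
  obtain ⟨⟨p', q'⟩, ⟨r', s'⟩⟩ := φ'
  obtain ⟨c, d⟩ := α
  obtain ⟨c', d'⟩ := α'
  simp only [act, Prod.mk.injEq] at *
  obtain ⟨e1, e2⟩ := h
  zify at f1 g1 e1 e2 hc hd hc' hd'
  set t : ℤ := p' * s - q' * r with ht
  set t' : ℤ := p * s' - q * r' with ht'
  have hp : (p' : ℤ) = t * p := by rw [ht]; linear_combination -(p' : ℤ) * f1 + r * hA
  have hq : (q' : ℤ) = t * q := by rw [ht]; linear_combination -(q' : ℤ) * f1 + s * hA
  have hr : (r' : ℤ) = t' * r := by rw [ht']; linear_combination -(r' : ℤ) * f1 + p * hB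
  have hs : (s' : ℤ) = t' * s := by rw [ht']; linear_combination -(s' : ℤ) * f1 + q * hB
  have htt : t * t' = 1 := by
    have : t * t' * (p * s - q * r) = 1 := by
      have h1 : (t * p) * (t' * s) - (t * q) * (t' * r) = 1 := by
        rw [← hp, ← hq, ← hr, ← hs]; linear_combination g1
      linear_combination h1
    linear_combination this - t * t' * f1
  have htd : t * d = d' := by
    have k2 : (p' : ℤ) * s' - q' * r' = 1 := by linear_combination g1
    rw [ht]
    linear_combination (p' : ℤ) * e2 - (q' : ℤ) * e1 + (d' : ℤ) * k2 + c * hA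
  have htpos : 0 < t := by
    by_contra! h0
    have := mul_nonneg (neg_nonneg.2 h0) hd.le
    linarith
  have t1 : t = 1 := Int.eq_one_of_dvd_one htpos.le (Dvd.intro _ htt)
  have t1' : t' = 1 := by rw [t1] at htt; linarith
  rw [t1, one_mul] at hp hq
  rw [t1', one_mul] at hr hs
  have k1 : (p : ℤ) * s - q * r = 1 := by linear_combination f1
  have hcc : (c : ℤ) = c' := by
    rw [hp, hr] at e1; rw [hq, hs] at e2
    linear_combination (-(c : ℤ) + c') * k1 + (s : ℤ) * e1 - (r : ℤ) * e2
  rw [t1, one_mul] at htd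
  refine ⟨⟨by exact_mod_cast hcc, by exact_mod_cast htd⟩, ⟨?_, ?_⟩, ?_, ?_⟩ <;> omega

lemma snd_snd_pos {Z : ℕ} {φ : (ℕ × ℕ) × (ℕ × ℕ)} (hφ : φ ∈ Far Z) :
    0 < φ.2.2 ∧ 0 < φ.1.1 := by
  have h := (mem_Far.1 hφ).1
  constructor <;> refine Nat.pos_of_ne_zero fun h0 => ?_ <;> rw [h0] at h <;> omega

lemma nrm_pos {Z : ℕ} {φ : (ℕ × ℕ) × (ℕ × ℕ)} (hφ : φ ∈ Far Z) :
    0 < nrm φ.1 ∧ 0 < nrm φ.2 := by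
  have := snd_snd_pos hφ
  unfold nrm; omega

/-- The top row of a product. -/
lemma top_row_act {Z : ℕ} {α : ℕ × ℕ} {φ : (ℕ × ℕ) × (ℕ × ℕ)} (hφ : φ ∈ Far Z)
    (hc : 0 < α.1) (hd : 0 < α.2) (hcop : α.1.Coprime α.2) :
    (act α φ).1.Coprime (act α φ).2 ∧
      uu (act α φ).1 (act α φ).2 = (act (uu α.1 α.2, vv α.1 α.2) φ).1 ∧
      vv (act α φ).1 (act α φ).2 = (act (uu α.1 α.2, vv α.1 α.2) φ).2 := by
  obtain ⟨p1, p2⟩ := snd_snd_pos hφ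
  have hdet := (mem_Far.1 hφ).1
  have k1 := uu_mul hd hcop
  have k2 := uu_le hc hd hcop
  have k3 := vv_lt (r := α.1) hd
  have := top_row_unique (r := (act α φ).1) (s := (act α φ).2)
    (u := (act (uu α.1 α.2, vv α.1 α.2) φ).1) (v := (act (uu α.1 α.2, vv α.1 α.2) φ).2)
    (by simp only [act]; positivity)
    (by
      simp only [act]
      have a1 := Nat.mul_le_mul_right φ.1.2 k2
      have a2 := Nat.mul_lt_mul_of_pos_right k3 p1
      omega)
    (by
      simp only [act]
      zify at hdet k1 ⊢
      linear_combination hdet * (uu α.1 α.2 * α.2 - vv α.1 α.2 * α.1) + k1)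
  exact ⟨this.1, this.2.1.symm, this.2.2.symm⟩

lemma nm_act (α : ℕ × ℕ) (φ : (ℕ × ℕ) × (ℕ × ℕ)) :
    nm (act α φ) = α.1 ^ 2 * nm φ.1 + 2 * (α.1 * α.2) * (φ.1.1 * φ.2.1 + φ.1.2 * φ.2.2)
      + α.2 ^ 2 * nm φ.2 := by
  unfold nm act; ring

/-- Splitting a sum over `G` according to Farey pairs. -/
lemma sum_G_eq_sum_Far {M : Type*} [AddCommMonoid M] {Z : ℕ} (hZ : 1 ≤ Z) (Y : ℕ)
    (F : ℕ × ℕ → M) :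
    ∑ γ ∈ (G Y).filter (fun γ => Z < nrm γ), F γ
      = ∑ φ ∈ Far Z, ∑ α ∈ (G Y).filter (fun α => nm (act α φ) ≤ Y), F (act α φ) := by
  rw [Finset.sum_sigma']
  symm
  refine Finset.sum_bij (fun x _ => act x.2 x.1) ?_ ?_ ?_ ?_
  · rintro ⟨φ, α⟩ hx
    obtain ⟨hφ, hα⟩ := mem_sigma.1 hx
    obtain ⟨hα, hY⟩ := mem_filter.1 hα
    obtain ⟨h1, h2, h3, -⟩ := mem_G.1 hα
    obtain ⟨p1, p2⟩ := snd_snd_pos hφ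
    refine mem_filter.2 ⟨mem_G.2 ⟨?_, ?_, (top_row_act hφ h1 h2 h3).1, hY⟩, ?_⟩
    · simp only [act]; positivity
    · simp only [act]; positivity
    · obtain ⟨-, -, -, f4⟩ := mem_Far.1 hφ
      simp only [nrm, act] at f4 ⊢
      dsimp only at h1 h2
      have a1 := Nat.mul_le_mul_right (φ.1.1 + φ.1.2) h1
      have a2 := Nat.mul_le_mul_right (φ.2.1 + φ.2.2) h2
      linarith
  · rintro ⟨φ, α⟩ hx ⟨φ', α'⟩ hx' h
    obtain ⟨hφ, hα⟩ := mem_sigma.1 hx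
    obtain ⟨hα, hY⟩ := mem_filter.1 hα
    obtain ⟨h1, h2, h3, -⟩ := mem_G.1 hα
    obtain ⟨hφ', hα'⟩ := mem_sigma.1 hx'
    obtain ⟨hα', hY'⟩ := mem_filter.1 hα'
    obtain ⟨h1', h2', h3', -⟩ := mem_G.1 hα'
    obtain ⟨rfl, rfl⟩ := act_injective hφ hφ' h1 h2 h1' h2' h
    rfl
  · intro γ hγ
    obtain ⟨hγ, hZγ⟩ := mem_filter.1 hγ
    obtain ⟨h1, h2, h3, h4⟩ := mem_G.1 hγ
    obtain ⟨α, φ, hφ, hc, hd, hcop, rfl⟩ := exists_act_eq hZ h1 h2 h3 hZγ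
    obtain ⟨p1, p2⟩ := snd_snd_pos hφ
    refine ⟨⟨φ, α⟩, mem_sigma.2 ⟨hφ, mem_filter.2 ⟨mem_G.2 ⟨hc, hd, hcop, ?_⟩, h4⟩⟩, rfl⟩
    refine le_trans ?_ h4
    rw [nm_act]
    have q1 : 1 ≤ nm φ.1 := by unfold nm; nlinarith
    have q2 : 1 ≤ nm φ.2 := by unfold nm; nlinarith
    have r1 := Nat.mul_le_mul_left (α.1 ^ 2) q1
    have r2 := Nat.mul_le_mul_left (α.2 ^ 2) q2
    have r3 : nm α = α.1 ^ 2 + α.2 ^ 2 := rfl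
    have r4 := Nat.zero_le (2 * (α.1 * α.2) * (φ.1.1 * φ.2.1 + φ.1.2 * φ.2.2))
    dsimp only
    rw [r3]
    linarith
  · intro x _; rfl

lemma Far_fst_unique {Z : ℕ} {φ φ' : (ℕ × ℕ) × (ℕ × ℕ)} (hφ : φ ∈ Far Z) (hφ' : φ' ∈ Far Z)
    (h : φ.2 = φ'.2) : φ = φ' := by
  obtain ⟨f1, f2, f3, f4⟩ := mem_Far.1 hφ
  obtain ⟨g1, g2, g3, g4⟩ := mem_Far.1 hφ'
  obtain ⟨p1, p2⟩ := nrm_pos hφ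
  obtain ⟨⟨p, q⟩, ⟨r, s⟩⟩ := φ
  obtain ⟨⟨p', q'⟩, ⟨r', s'⟩⟩ := φ'
  simp only [Prod.mk.injEq, nrm] at *
  obtain ⟨rfl, rfl⟩ := h
  zify at *
  set k : ℤ := p * q' - q * p' with hk
  have hp : (p' : ℤ) = p + k * r := by
    rw [hk]; linear_combination -(p' : ℤ) * f1 + (p : ℤ) * g1
  have hq : (q' : ℤ) = q + k * s := by
    rw [hk]; linear_combination -(q' : ℤ) * f1 + (q : ℤ) * g1
  have hk0 : k = 0 := by
    by_contra h0
    have hrs : (0 : ℤ) ≤ r + s := by positivity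
    rcases lt_or_gt_of_ne h0 with h1 | h1
    · have := mul_le_mul_of_nonneg_right (show k ≤ -1 by omega) hrs
      linarith
    · have := mul_le_mul_of_nonneg_right (show 1 ≤ k by omega) hrs
      linarith
  rw [hk0] at hp hq
  simp only [zero_mul, add_zero] at hp hq
  exact ⟨⟨hp.symm, hq.symm⟩, trivial, trivial⟩

lemma card_Far_le (Z : ℕ) : (Far Z).card ≤ (Z + 1) ^ 2 := by
  have hinj : Set.InjOn (fun φ : (ℕ × ℕ) × (ℕ × ℕ) => φ.2) (Far Z) :=
    fun φ hφ φ' hφ' h => Far_fst_unique hφ hφ' h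
  rw [← Finset.card_image_of_injOn hinj]
  calc _ ≤ (range (Z + 1) ×ˢ range (Z + 1)).card := by
        refine card_le_card fun ρ hρ => ?_
        obtain ⟨φ, hφ, rfl⟩ := mem_image.1 hρ
        exact (mem_product.1 (mem_filter.1 hφ).1).2
    _ = _ := by simp [sq]

lemma card_act_le {Z Y : ℕ} {φ : (ℕ × ℕ) × (ℕ × ℕ)} (hφ : φ ∈ Far Z) :
    (((G Y).filter fun α => nm (act α φ) ≤ Y).card : ℝ)
      ≤ 2 * Y / ((nrm φ.1 : ℝ) * nrm φ.2) := by
  obtain ⟨p1, p2⟩ := nrm_pos hφ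
  set S := Nat.sqrt (2 * Y)
  have hsub : ((G Y).filter fun α => nm (act α φ) ≤ Y) ⊆
      Icc 1 (S / nrm φ.1) ×ˢ Icc 1 (S / nrm φ.2) := by
    intro α hα
    obtain ⟨hα, hY⟩ := mem_filter.1 hα
    obtain ⟨h1, h2, h3, -⟩ := mem_G.1 hα
    have hS : α.1 * nrm φ.1 + α.2 * nrm φ.2 ≤ S := by
      refine Nat.le_sqrt'.2 ?_
      have : (α.1 * nrm φ.1 + α.2 * nrm φ.2) = (act α φ).1 + (act α φ).2 := by
        simp only [act, nrm]; ring
      rw [this]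
      unfold nm at hY
      zify at hY ⊢
      nlinarith [sq_nonneg (((act α φ).1 : ℤ) - (act α φ).2)]
    rw [mem_product, mem_Icc, mem_Icc, Nat.le_div_iff_mul_le p1, Nat.le_div_iff_mul_le p2]
    exact ⟨⟨h1, by omega⟩, h2, by omega⟩
  have h := card_le_card hsub
  rw [card_product, Nat.card_Icc, Nat.card_Icc] at h
  simp only [Nat.add_sub_cancel] at h
  have hS2 : (S : ℝ) ^ 2 ≤ 2 * Y := by exact_mod_cast Nat.sqrt_le' (2 * Y)
  calc _ ≤ ((S / nrm φ.1 * (S / nrm φ.2) : ℕ) : ℝ) := by exact_mod_cast h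
    _ ≤ ((S : ℝ) / nrm φ.1) * (S / nrm φ.2) := by
        push_cast
        gcongr <;> exact Nat.cast_div_le
    _ = (S : ℝ) ^ 2 / ((nrm φ.1 : ℝ) * nrm φ.2) := by
        rw [div_mul_div_comm, sq]
    _ ≤ _ := by gcongr

end Farey

section Dispersion

/-- The image of `w` under the matrix with rows `φ.1`, `φ.2`. -/
def tau (l w : ℕ) (φ : (ℕ × ℕ) × (ℕ × ℕ)) : ZMod l :=
  ((φ.1.1 : ZMod l) * w + φ.1.2) * ((φ.2.1 : ZMod l) * w + φ.2.2)⁻¹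

/-- The pairs for which `tau` is finite. -/
def Good (l w : ℕ) (φ : (ℕ × ℕ) × (ℕ × ℕ)) : Prop :=
  l = 1 ∨ ((φ.2.1 : ZMod l) * w + φ.2.2) ≠ 0

lemma ph_act {Z l w : ℕ} (hl : l.Prime ∨ l = 1) (h : ℤ) {α : ℕ × ℕ}
    {φ : (ℕ × ℕ) × (ℕ × ℕ)} (hφ : φ ∈ Far Z) (hg : Good l w φ) (hc : 0 < α.1) (hd : 0 < α.2)
    (hcop : α.1.Coprime α.2) :
    ph l h w (act α φ) = eZ l (-(h : ZMod l) * (((uu α.1 α.2 : ZMod l) * tau l w φ + vv α.1 α.2)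
      * ((α.1 : ZMod l) * tau l w φ + α.2)⁻¹)) := by
  rcases hl with hl | rfl
  · have : Fact l.Prime := ⟨hl⟩
    have hy : ((φ.2.1 : ZMod l) * w + φ.2.2) ≠ 0 := by
      rcases hg with h1 | h1
      · exact absurd h1 hl.one_lt.ne'
      · exact h1
    obtain ⟨-, h1, h2⟩ := top_row_act hφ hc hd hcop
    rw [ph, h1, h2, tau]
    simp only [act]
    push_cast
    set y2 := (φ.2.1 : ZMod l) * w + φ.2.2
    set y1 := (φ.1.1 : ZMod l) * w + φ.1.2
    congr 2
    have e1 : ∀ x y : ZMod l, x * (y1 * y2⁻¹) + y = (x * y1 + y * y2) * y2⁻¹ := by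
      intro x y; field_simp
    rw [e1, e1, mul_inv, inv_inv]
    have e2 : ∀ x y : ZMod l, x * y2⁻¹ * (y * y2) = x * y := by
      intro x y; field_simp
    rw [e2]
    congr 1
    · ring
    · congr 1; ring
  · rw [ph]
    exact congrArg _ (Subsingleton.elim (α := ZMod 1) _ _)

/-- Real part of the collision determinant. -/
def gRe (φ φ' : (ℕ × ℕ) × (ℕ × ℕ)) : ℤ :=
  ((φ.1.2 : ℤ) * φ'.2.2 - φ'.1.2 * φ.2.2) - (φ.1.1 * φ'.2.1 - φ'.1.1 * φ.2.1)

/-- Imaginary part of the collision determinant. -/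
def gIm (φ φ' : (ℕ × ℕ) × (ℕ × ℕ)) : ℤ :=
  (φ.1.1 : ℤ) * φ'.2.2 + φ.1.2 * φ'.2.1 - φ'.1.1 * φ.2.2 - φ'.1.2 * φ.2.1

/-- The norm of the collision determinant. -/
def gNorm (φ φ' : (ℕ × ℕ) × (ℕ × ℕ)) : ℕ := (gRe φ φ' ^ 2 + gIm φ φ' ^ 2).toNat

lemma gNorm_cast (φ φ' : (ℕ × ℕ) × (ℕ × ℕ)) :
    (gNorm φ φ' : ℤ) = gRe φ φ' ^ 2 + gIm φ φ' ^ 2 := Int.toNat_of_nonneg (by positivity)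

lemma gNorm_pos {Z : ℕ} {φ φ' : (ℕ × ℕ) × (ℕ × ℕ)} (hφ : φ ∈ Far Z) (hφ' : φ' ∈ Far Z)
    (hne : φ ≠ φ') : 0 < gNorm φ φ' := by
  by_contra! h0
  have h0' : (gNorm φ φ' : ℤ) = 0 := by exact_mod_cast Nat.le_zero.1 h0
  rw [gNorm_cast] at h0'
  have e0 : gRe φ φ' = 0 :=
    pow_eq_zero_iff two_ne_zero |>.1 (by linarith [sq_nonneg (gRe φ φ'), sq_nonneg (gIm φ φ')])
  have e1 : gIm φ φ' = 0 :=
    pow_eq_zero_iff two_ne_zero |>.1 (by linarith [sq_nonneg (gRe φ φ'), sq_nonneg (gIm φ φ')])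
  refine hne ?_
  have p0 := (snd_snd_pos hφ).2
  have p0' := (snd_snd_pos hφ').2
  obtain ⟨f1, -, -, -⟩ := mem_Far.1 hφ
  obtain ⟨f1', -, -, -⟩ := mem_Far.1 hφ'
  obtain ⟨⟨p, q⟩, ⟨r, s⟩⟩ := φ
  obtain ⟨⟨p', q'⟩, ⟨r', s'⟩⟩ := φ'
  simp only [gRe, gIm] at *
  zify at f1 f1' p0 p0'
  set x : ℤ := s * p' - q * r' with hx
  set y : ℤ := q * s' - s * q' with hy
  have a1 : (p' : ℤ) = x * p + y * q := by
    rw [hx, hy]; linear_combination -(p' : ℤ) * f1 - (q : ℤ) * e0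
  have a2 : (q' : ℤ) = x * q - y * p := by
    rw [hx, hy]; linear_combination -(q' : ℤ) * f1 + (q : ℤ) * e1
  have a3 : (r' : ℤ) = x * r + y * s := by
    rw [hx, hy]; linear_combination -(r' : ℤ) * f1 - (s : ℤ) * e0
  have a4 : (s' : ℤ) = x * s - y * r := by
    rw [hx, hy]; linear_combination -(s' : ℤ) * f1 + (s : ℤ) * e1
  have a5 : x ^ 2 + y ^ 2 = 1 := by
    have : (p' : ℤ) * s' - q' * r' = 1 := by linear_combination f1'
    rw [a1, a2, a3, a4] at this
    linear_combination this - (x ^ 2 + y ^ 2) * f1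
  obtain ⟨hx2, hx1⟩ := abs_le.1 ((sq_le_one_iff_abs_le_one x).1 (by linarith [sq_nonneg y]))
  obtain ⟨hy2, hy1⟩ := abs_le.1 ((sq_le_one_iff_abs_le_one y).1 (by linarith [sq_nonneg x]))
  clear_value x y
  have hq : (0 : ℤ) ≤ q := by positivity
  have hq' : (0 : ℤ) ≤ q' := by positivity
  have key : x = 1 ∧ y = 0 := by
    interval_cases x <;> interval_cases y <;>
      first | exact ⟨rfl, rfl⟩ | (exfalso; linarith)
  obtain ⟨rfl, rfl⟩ := key
  simp only [one_mul, zero_mul, add_zero, sub_zero] at a1 a2 a3 a4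
  simp only [Prod.mk.injEq]
  omega

lemma gNorm_le {Z : ℕ} {φ φ' : (ℕ × ℕ) × (ℕ × ℕ)} (hφ : φ ∈ Far Z) (hφ' : φ' ∈ Far Z) :
    gNorm φ φ' ≤ 8 * Z ^ 4 := by
  obtain ⟨-, f2, f3, -⟩ := mem_Far.1 hφ
  obtain ⟨-, g2, g3, -⟩ := mem_Far.1 hφ'
  obtain ⟨⟨p, q⟩, ⟨r, s⟩⟩ := φ
  obtain ⟨⟨p', q'⟩, ⟨r', s'⟩⟩ := φ'
  simp only [nrm] at *
  have hb : ∀ x y : ℕ, x ≤ Z → y ≤ Z → (0 : ℤ) ≤ (x : ℤ) * y ∧ (x : ℤ) * y ≤ Z ^ 2 := by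
    intro x y hx hy
    refine ⟨by positivity, ?_⟩
    rw [sq]; exact_mod_cast Nat.mul_le_mul hx hy
  have b1 := hb q s' (by omega) (by omega)
  have b2 := hb q' s (by omega) (by omega)
  have b3 := hb p r' (by omega) (by omega)
  have b4 := hb p' r (by omega) (by omega)
  have b5 := hb p s' (by omega) (by omega)
  have b6 := hb q r' (by omega) (by omega)
  have b7 := hb p' s (by omega) (by omega)
  have b8 := hb q' r (by omega) (by omega)
  have c1 : |gRe ((p, q), (r, s)) ((p', q'), (r', s'))| ≤ 2 * (Z : ℤ) ^ 2 := by
    rw [abs_le]; simp only [gRe]; constructor <;> linarith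
  have c2 : |gIm ((p, q), (r, s)) ((p', q'), (r', s'))| ≤ 2 * (Z : ℤ) ^ 2 := by
    rw [abs_le]; simp only [gIm]; constructor <;> linarith
  zify
  rw [gNorm_cast]
  have d1 := sq_le_sq' (abs_le.1 c1).1 (abs_le.1 c1).2
  have d2 := sq_le_sq' (abs_le.1 c2).1 (abs_le.1 c2).2
  linarith [show (2 * (Z : ℤ) ^ 2) ^ 2 = 4 * Z ^ 4 by ring]

lemma dvd_gNorm {l w : ℕ} (hl : l.Prime ∨ l = 1) (hw : l ∣ w ^ 2 + 1)
    {φ φ' : (ℕ × ℕ) × (ℕ × ℕ)} (hg : Good l w φ) (hg' : Good l w φ')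
    (h : tau l w φ = tau l w φ') : l ∣ gNorm φ φ' := by
  rcases hl with hl | rfl
  swap
  · exact one_dvd _
  have : Fact l.Prime := ⟨hl⟩
  have hy : ((φ.2.1 : ZMod l) * w + φ.2.2) ≠ 0 := hg.resolve_left hl.one_lt.ne'
  have hy' : ((φ'.2.1 : ZMod l) * w + φ'.2.2) ≠ 0 := hg'.resolve_left hl.one_lt.ne'
  have hw' := natCast_sq_add_one hw
  rw [tau, tau, ← div_eq_mul_inv, ← div_eq_mul_inv, div_eq_div_iff hy hy'] at h
  have e : (gRe φ φ' : ZMod l) + gIm φ φ' * w = 0 := by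
    simp only [gRe, gIm]; push_cast
    linear_combination h - ((φ.1.1 : ZMod l) * φ'.2.1 - φ'.1.1 * φ.2.1) * hw'
  rw [← Int.natCast_dvd_natCast, gNorm_cast, ← ZMod.intCast_zmod_eq_zero_iff_dvd]
  push_cast
  linear_combination ((gRe φ φ' : ZMod l) - gIm φ φ' * w) * e + (gIm φ φ' : ZMod l) ^ 2 * hw'

lemma sum_comp_le {α β : Type*} [DecidableEq β] [Fintype β] (S : Finset α) (f : α → β)
    (g : β → ℝ) :
    ∑ x ∈ S, g (f x) ≤ √(((S ×ˢ S).filter fun xy => f xy.1 = f xy.2).card : ℝ)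
      * √(∑ y, g y ^ 2) := by
  have h1 : ∑ x ∈ S, g (f x) = ∑ y, ((S.filter fun x => f x = y).card : ℝ) * g y := by
    rw [← Finset.sum_fiberwise S f]
    refine Finset.sum_congr rfl fun y _ => ?_
    rw [Finset.sum_congr rfl (g := fun _ => g y), sum_const, nsmul_eq_mul]
    intro x hx
    rw [(mem_filter.1 hx).2]
  have h2 : (((S ×ˢ S).filter fun xy => f xy.1 = f xy.2).card : ℝ)
      = ∑ y, ((S.filter fun x => f x = y).card : ℝ) ^ 2 := by
    have : ((S ×ˢ S).filter fun xy => f xy.1 = f xy.2).card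
        = ∑ y, (((S ×ˢ S).filter fun xy => f xy.1 = f xy.2).filter fun xy => f xy.1 = y).card :=
      card_eq_sum_card_fiberwise fun x _ => mem_univ _
    rw [this]
    push_cast
    refine Finset.sum_congr rfl fun y _ => ?_
    rw [sq, ← Nat.cast_mul, ← card_product, filter_filter]
    congr 2
    ext ⟨x, x'⟩
    simp only [mem_filter, mem_product]
    constructor
    · rintro ⟨⟨a, b⟩, c, d⟩; exact ⟨⟨a, d⟩, b, c ▸ d⟩
    · rintro ⟨⟨a, d⟩, b, c⟩; exact ⟨⟨a, b⟩, d.trans c.symm, d⟩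
  rw [h1, h2]
  exact Real.sum_mul_le_sqrt_mul_sqrt _ _ _

lemma card_det_le {l T : ℕ} (hl : l.Prime) (𝒜 : Finset (ℕ × ℕ))
    (h𝒜 : ∀ α ∈ 𝒜, 0 < α.1 ∧ α.1 ≤ T ∧ α.2 ≤ T) :
    ((𝒜 ×ˢ 𝒜).filter fun ij => (ij.1.1 : ZMod l) * ij.2.2 = ij.2.1 * ij.1.2).card
      ≤ T / l * (T + 1) ^ 3 + (T + 1) ^ 3 * (T / l + 1) := by
  have : Fact l.Prime := ⟨hl⟩
  set R := range (T + 1)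
  set P := (((R ×ˢ R) ×ˢ R) ×ˢ R).filter fun x =>
    (x.1.1.1 : ZMod l) * x.2 = x.1.2 * x.1.1.2 ∧ ¬ l ∣ x.1.1.1
  set Q := ((Ioc 0 T).filter fun c => l ∣ c) ×ˢ ((R ×ˢ R) ×ˢ R)
  have hQ : Q.card = T / l * (T + 1) ^ 3 := by
    simp only [Q, R, card_product, card_range, Nat.Ioc_filter_dvd_card_eq_div]
    ring
  have hP : P.card ≤ (T + 1) ^ 3 * (T / l + 1) := by
    simp only [P]
    rw [card_filter, sum_product]
    refine (sum_le_card_nsmul _ _ (T / l + 1) fun x _ => ?_).trans_eq ?_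
    · rw [← card_filter]
      by_cases hx : l ∣ x.1.1
      · simp [hx]
      have hx' : (x.1.1 : ZMod l) ≠ 0 := by rwa [Ne, ZMod.natCast_eq_zero_iff]
      refine (card_le_card ?_).trans
        (card_filter_mod_le T l ((x.2 : ZMod l) * x.1.2 * (x.1.1 : ZMod l)⁻¹).val)
      intro d hd
      obtain ⟨h1, h2, -⟩ := mem_filter.1 hd
      refine mem_filter.2 ⟨h1, ?_⟩
      rw [← h2, mul_comm (x.1.1 : ZMod l), mul_assoc, mul_inv_cancel₀ hx', mul_one,
        ZMod.val_natCast]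
    · simp only [R, card_product, card_range, smul_eq_mul]
      ring
  have hmap : ((𝒜 ×ˢ 𝒜).filter fun ij => (ij.1.1 : ZMod l) * ij.2.2 = ij.2.1 * ij.1.2).card
      ≤ (Q.disjSum P).card := by
    classical
    refine card_le_card_of_injOn (fun ij => if l ∣ ij.1.1 then
      Sum.inl (ij.1.1, ((ij.1.2, ij.2.1), ij.2.2)) else
      Sum.inr (((ij.1.1, ij.1.2), ij.2.1), ij.2.2)) ?_ ?_
    · rintro ⟨i, j⟩ hij
      obtain ⟨hij, he⟩ := mem_filter.1 hij
      obtain ⟨hi, hj⟩ := mem_product.1 hij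
      obtain ⟨i1, i2, i3⟩ := h𝒜 _ hi
      obtain ⟨j1, j2, j3⟩ := h𝒜 _ hj
      dsimp only at i1 i2 i3 j1 j2 j3 he ⊢
      split_ifs with hd
      · refine mem_coe.2 (inl_mem_disjSum.2 ?_)
        simp only [Q, R, mem_product, mem_filter, mem_Ioc, mem_range]
        exact ⟨⟨⟨i1, i2⟩, hd⟩, ⟨by omega, by omega⟩, by omega⟩
      · refine mem_coe.2 (inr_mem_disjSum.2 ?_)
        simp only [P, R, mem_product, mem_filter, mem_range]
        exact ⟨⟨⟨⟨by omega, by omega⟩, by omega⟩, by omega⟩, he, hd⟩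
    · rintro ⟨⟨a, b⟩, c, d⟩ - ⟨⟨a', b'⟩, c', d'⟩ - h
      dsimp only at h
      split_ifs at h <;> simp only [Sum.inl.injEq, Sum.inr.injEq, Prod.mk.injEq]
        at h ⊢ <;> tauto
  rw [card_disjSum, hQ] at hmap
  exact hmap.trans (Nat.add_le_add_left hP _)

section Cell

variable {ι : Type*} {Z : ℕ} (l₁ w₁ l₂ w₂ : ι → ℕ)

/-- The pairs that are admissible for both moduli. -/
def Good₂ (κ : ι) (φ : (ℕ × ℕ) × (ℕ × ℕ)) : Prop :=
  Good (l₁ κ) (w₁ κ) φ ∧ Good (l₂ κ) (w₂ κ) φ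

/-- The hypotheses on the family of moduli. -/
structure Moduli (Z C₀ : ℕ) (h₁ : ℤ) (𝒦 : Finset ι) : Prop where
  prime₁ : ∀ κ ∈ 𝒦, (l₁ κ).Prime
  prime₂ : ∀ κ ∈ 𝒦, (l₂ κ).Prime ∨ l₂ κ = 1
  dvd₁ : ∀ κ ∈ 𝒦, l₁ κ ∣ w₁ κ ^ 2 + 1
  dvd₂ : ∀ κ ∈ 𝒦, l₂ κ ∣ w₂ κ ^ 2 + 1
  ndvd : ∀ κ ∈ 𝒦, ¬ (l₁ κ : ℤ) ∣ h₁
  prod_le : ∀ κ ∈ 𝒦, l₁ κ * l₂ κ ≤ 16 * Z ^ 2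
  card_le : 𝒦.card ≤ 64 * Z ^ 2
  coll : ∀ g : ℕ, 0 < g → g ≤ 8 * Z ^ 4 → (𝒦.filter fun κ => l₁ κ ∣ g ∧ l₂ κ ∣ g).card ≤ C₀

variable {l₁ w₁ l₂ w₂} {C₀ : ℕ} {h₁ : ℤ} {𝒦 : Finset ι}

open scoped Classical in
lemma Moduli.sum_coll_le (H : Moduli l₁ w₁ l₂ w₂ Z C₀ h₁ 𝒦) (𝒞 : Finset ((ℕ × ℕ) × (ℕ × ℕ)))
    (h𝒞 : 𝒞 ⊆ Far Z) :
    ∑ κ ∈ 𝒦, (((𝒞.filter (Good₂ l₁ w₁ l₂ w₂ κ)) ×ˢ (𝒞.filter (Good₂ l₁ w₁ l₂ w₂ κ))).filter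
      fun xy => (tau (l₁ κ) (w₁ κ) xy.1, tau (l₂ κ) (w₂ κ) xy.1)
        = (tau (l₁ κ) (w₁ κ) xy.2, tau (l₂ κ) (w₂ κ) xy.2)).card
      ≤ 𝒦.card * 𝒞.card + C₀ * 𝒞.card ^ 2 := by
  set D := (𝒞 ×ˢ 𝒞).filter fun xy => xy.1 ≠ xy.2
  have h1 : ∀ κ ∈ 𝒦, (((𝒞.filter (Good₂ l₁ w₁ l₂ w₂ κ)) ×ˢ
      (𝒞.filter (Good₂ l₁ w₁ l₂ w₂ κ))).filter
      fun xy => (tau (l₁ κ) (w₁ κ) xy.1, tau (l₂ κ) (w₂ κ) xy.1)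
        = (tau (l₁ κ) (w₁ κ) xy.2, tau (l₂ κ) (w₂ κ) xy.2)).card
      ≤ 𝒞.card + ∑ xy ∈ D, if l₁ κ ∣ gNorm xy.1 xy.2 ∧ l₂ κ ∣ gNorm xy.1 xy.2 then 1 else 0 := by
    intro κ hκ
    rw [← card_filter, ← diag_card 𝒞]
    refine (card_le_card ?_).trans (card_union_le _ _)
    intro xy hxy
    obtain ⟨hxy, he⟩ := mem_filter.1 hxy
    obtain ⟨hx, hy⟩ := mem_product.1 hxy
    obtain ⟨hx, gx1, gx2⟩ := mem_filter.1 hx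
    obtain ⟨hy, gy1, gy2⟩ := mem_filter.1 hy
    obtain ⟨e1, e2⟩ := Prod.mk.injEq _ _ _ _ ▸ he
    by_cases h : xy.1 = xy.2
    · exact mem_union_left _ (mem_diag.2 ⟨hx, h⟩)
    · exact mem_union_right _ (mem_filter.2 ⟨mem_filter.2 ⟨mem_product.2 ⟨hx, hy⟩, h⟩,
        dvd_gNorm (.inl (H.prime₁ κ hκ)) (H.dvd₁ κ hκ) gx1 gy1 e1,
        dvd_gNorm (H.prime₂ κ hκ) (H.dvd₂ κ hκ) gx2 gy2 e2⟩)
  refine (sum_le_sum h1).trans ?_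
  rw [sum_add_distrib, sum_const, smul_eq_mul, sum_comm]
  refine Nat.add_le_add_left ?_ _
  have h2 : ∀ xy ∈ D, (∑ κ ∈ 𝒦,
      if l₁ κ ∣ gNorm xy.1 xy.2 ∧ l₂ κ ∣ gNorm xy.1 xy.2 then 1 else 0) ≤ C₀ := by
    intro xy hxy
    obtain ⟨hxy, hne⟩ := mem_filter.1 hxy
    obtain ⟨hx, hy⟩ := mem_product.1 hxy
    rw [← card_filter]
    exact H.coll _ (gNorm_pos (h𝒞 hx) (h𝒞 hy) hne) (gNorm_le (h𝒞 hx) (h𝒞 hy))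
  refine (sum_le_card_nsmul _ _ _ h2).trans ?_
  rw [smul_eq_mul, mul_comm, sq, ← card_product]
  exact Nat.mul_le_mul_left _ (card_filter_le _ _)

open scoped Classical in
lemma Moduli.sum_sq_le (H : Moduli l₁ w₁ l₂ w₂ Z C₀ h₁ 𝒦) (h₂ : ℤ) {k T : ℕ} (hk : 0 < k)
    (hkT : k ≤ T) (hkl : ∀ κ ∈ 𝒦, k ^ 4 ≤ l₁ κ) (𝒜 : ι → Finset (ℕ × ℕ))
    (h𝒜 : ∀ κ ∈ 𝒦, ∀ α ∈ 𝒜 κ, 0 < α.1 ∧ 0 < α.2 ∧ α.1.Coprime α.2 ∧ α.1 ≤ T ∧ α.2 ≤ T)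
    {κ : ι} (hκ : κ ∈ 𝒦) [NeZero (l₁ κ)] [NeZero (l₂ κ)] :
    ∑ t : ZMod (l₁ κ) × ZMod (l₂ κ), ‖∑ α ∈ 𝒜 κ,
      eZ (l₁ κ) (-(h₁ : ZMod (l₁ κ)) * (((uu α.1 α.2 : ZMod (l₁ κ)) * t.1 + vv α.1 α.2)
        * ((α.1 : ZMod (l₁ κ)) * t.1 + α.2)⁻¹)) *
      eZ (l₂ κ) (-(h₂ : ZMod (l₂ κ)) * (((uu α.1 α.2 : ZMod (l₂ κ)) * t.2 + vv α.1 α.2)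
        * ((α.1 : ZMod (l₂ κ)) * t.2 + α.2)⁻¹))‖ ^ 2
      ≤ 2 ^ 10 * (Z : ℝ) ^ 2 * (T : ℝ) ^ 4 / k := by
  have hl := H.prime₁ κ hκ
  have : Fact (l₁ κ).Prime := ⟨hl⟩
  have hh : (-(h₁ : ZMod (l₁ κ))) ≠ 0 := by
    rw [Ne, neg_eq_zero, ZMod.intCast_zmod_eq_zero_iff_dvd]
    exact H.ndvd κ hκ
  have hdet : ∀ α ∈ 𝒜 κ, (uu α.1 α.2 : ZMod (l₁ κ)) * (α.2 : ZMod (l₁ κ))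
      - (vv α.1 α.2 : ZMod (l₁ κ)) * (α.1 : ZMod (l₁ κ)) = 1 := by
    intro α hα
    obtain ⟨-, a2, a3, -⟩ := h𝒜 κ hκ α hα
    have := congrArg (Nat.cast : ℕ → ZMod (l₁ κ)) (uu_mul a2 a3)
    push_cast at this
    rw [this]; ring
  have key := sum_norm_sq_moebius_le hk (hkl κ hκ) hh (univ : Finset (ZMod (l₂ κ))) (𝒜 κ)
    (fun α => (uu α.1 α.2 : ZMod (l₁ κ))) (fun α => (vv α.1 α.2 : ZMod (l₁ κ)))
    (fun α => (α.1 : ZMod (l₁ κ))) (fun α => (α.2 : ZMod (l₁ κ))) hdet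
    (fun α t => eZ (l₂ κ) (-(h₂ : ZMod (l₂ κ)) * (((uu α.1 α.2 : ZMod (l₂ κ)) * t + vv α.1 α.2)
        * ((α.1 : ZMod (l₂ κ)) * t + α.2)⁻¹))) (fun _ _ => (norm_eZ _ _).le)
  have hT : 1 ≤ T := le_trans hk hkT
  have hdc := card_det_le (T := T) hl (𝒜 κ) fun α hα => by
    obtain ⟨a1, -, -, a4, a5⟩ := h𝒜 κ hκ α hα; exact ⟨a1, a4, a5⟩
  have hA : (𝒜 κ).card ≤ T ^ 2 := by
    have hs : 𝒜 κ ⊆ Ioc 0 T ×ˢ Ioc 0 T := fun α hα => by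
      obtain ⟨a1, a2, -, a4, a5⟩ := h𝒜 κ hκ α hα
      simp only [mem_product, mem_Ioc]; exact ⟨⟨a1, a4⟩, a2, a5⟩
    simpa [sq] using card_le_card hs
  rw [Fintype.sum_prod_type_right]
  simp only [eZ_eq_psi (l₁ κ)]
  refine key.trans ?_
  rw [card_univ, ZMod.card]
  set N := (((𝒜 κ ×ˢ 𝒜 κ).filter fun ij =>
    (ij.1.1 : ZMod (l₁ κ)) * ij.2.2 = ij.2.1 * ij.1.2).card : ℝ) with hN
  have hk' : (0 : ℝ) < k := by exact_mod_cast hk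
  have hT' : (1 : ℝ) ≤ T := by exact_mod_cast hT
  have hkT' : (k : ℝ) ≤ T := by exact_mod_cast hkT
  have hl0 : (0 : ℝ) < l₁ κ := by exact_mod_cast hl.pos
  have hkl' : (k : ℝ) ≤ l₁ κ := by
    exact_mod_cast (Nat.le_self_pow (by norm_num) k).trans (hkl κ hκ)
  have hN1 : N ≤ 24 * (T : ℝ) ^ 4 / k := by
    have h1 : N ≤ (T / l₁ κ : ℝ) * (T + 1) ^ 3 + (T + 1) ^ 3 * (T / l₁ κ + 1) := by
      have h0 : ((T / l₁ κ : ℕ) : ℝ) ≤ T / l₁ κ := Nat.cast_div_le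
      refine (Nat.cast_le.2 hdc).trans ?_
      push_cast
      gcongr
    have h2 : (T / l₁ κ : ℝ) ≤ T / k := by gcongr
    have h3 : (1 : ℝ) ≤ T / k := by rwa [one_le_div hk']
    have h4 : ((T : ℝ) + 1) ^ 3 ≤ 8 * (T : ℝ) ^ 3 := by
      have : ((T : ℝ) + 1) ≤ 2 * T := by linarith
      calc ((T : ℝ) + 1) ^ 3 ≤ (2 * T) ^ 3 := by gcongr
        _ = _ := by ring
    calc N ≤ (T / k : ℝ) * (8 * (T : ℝ) ^ 3) + (8 * (T : ℝ) ^ 3) * (T / k + T / k) := by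
          refine h1.trans ?_
          gcongr
      _ = _ := by ring
  have hA' : ((𝒜 κ).card : ℝ) ≤ (T : ℝ) ^ 2 := by exact_mod_cast hA
  have hp : (l₁ κ : ℝ) * l₂ κ ≤ 16 * (Z : ℝ) ^ 2 := by exact_mod_cast H.prod_le κ hκ
  calc (l₂ κ : ℝ) * ((l₁ κ : ℝ) * N + 5 * ((l₁ κ : ℝ) / k) * ((𝒜 κ).card : ℝ) ^ 2)
      ≤ (l₂ κ : ℝ) * ((l₁ κ : ℝ) * (24 * (T : ℝ) ^ 4 / k)
        + 5 * ((l₁ κ : ℝ) / k) * ((T : ℝ) ^ 2) ^ 2) := by gcongr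
    _ = (l₁ κ * l₂ κ : ℝ) * (29 * (T : ℝ) ^ 4 / k) := by ring
    _ ≤ (16 * (Z : ℝ) ^ 2) * (64 * (T : ℝ) ^ 4 / k) := by gcongr; norm_num
    _ = _ := by ring

lemma card_Far_le' (hZ : 1 ≤ Z) : (Far Z).card ≤ 4 * Z ^ 2 := by
  refine (card_Far_le Z).trans ?_
  calc (Z + 1) ^ 2 ≤ (2 * Z) ^ 2 := Nat.pow_le_pow_left (by omega) 2
    _ = _ := by ring

open scoped Classical in
/-- The dispersion estimate over a set of Farey pairs. -/
lemma Moduli.sum_norm_le (H : Moduli l₁ w₁ l₂ w₂ Z C₀ h₁ 𝒦) (h₂ : ℤ) {k T : ℕ} (hZ : 1 ≤ Z)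
    (hk : 0 < k)
    (hkT : k ≤ T) (hkl : ∀ κ ∈ 𝒦, k ^ 4 ≤ l₁ κ) (𝒜 : ι → Finset (ℕ × ℕ))
    (h𝒜 : ∀ κ ∈ 𝒦, ∀ α ∈ 𝒜 κ, 0 < α.1 ∧ 0 < α.2 ∧ α.1.Coprime α.2 ∧ α.1 ≤ T ∧ α.2 ≤ T)
    (𝒞 : Finset ((ℕ × ℕ) × (ℕ × ℕ))) (h𝒞 : 𝒞 ⊆ Far Z) :
    ∑ κ ∈ 𝒦, ∑ φ ∈ 𝒞.filter (Good₂ l₁ w₁ l₂ w₂ κ),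
      ‖∑ α ∈ 𝒜 κ, ph (l₁ κ) h₁ (w₁ κ) (act α φ) * ph (l₂ κ) h₂ (w₂ κ) (act α φ)‖
      ≤ √((256 + 16 * C₀) * (Z : ℝ) ^ 4) * √(2 ^ 16 * (Z : ℝ) ^ 4 * (T : ℝ) ^ 4 / k) := by
  set N : ι → ℝ := fun κ => ((((𝒞.filter (Good₂ l₁ w₁ l₂ w₂ κ)) ×ˢ
      (𝒞.filter (Good₂ l₁ w₁ l₂ w₂ κ))).filter
      fun xy => (tau (l₁ κ) (w₁ κ) xy.1, tau (l₂ κ) (w₂ κ) xy.1)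
        = (tau (l₁ κ) (w₁ κ) xy.2, tau (l₂ κ) (w₂ κ) xy.2)).card : ℝ) with hN
  have h1 : ∀ κ ∈ 𝒦, ∑ φ ∈ 𝒞.filter (Good₂ l₁ w₁ l₂ w₂ κ),
      ‖∑ α ∈ 𝒜 κ, ph (l₁ κ) h₁ (w₁ κ) (act α φ) * ph (l₂ κ) h₂ (w₂ κ) (act α φ)‖
      ≤ √(N κ) * √(2 ^ 10 * (Z : ℝ) ^ 2 * (T : ℝ) ^ 4 / k) := by
    intro κ hκ
    have n1 : NeZero (l₁ κ) := ⟨(H.prime₁ κ hκ).ne_zero⟩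
    have n2 : NeZero (l₂ κ) := ⟨by
      rcases H.prime₂ κ hκ with h | h
      · exact h.ne_zero
      · omega⟩
    set g : ZMod (l₁ κ) × ZMod (l₂ κ) → ℝ := fun t => ‖∑ α ∈ 𝒜 κ,
      eZ (l₁ κ) (-(h₁ : ZMod (l₁ κ)) * (((uu α.1 α.2 : ZMod (l₁ κ)) * t.1 + vv α.1 α.2)
        * ((α.1 : ZMod (l₁ κ)) * t.1 + α.2)⁻¹)) *
      eZ (l₂ κ) (-(h₂ : ZMod (l₂ κ)) * (((uu α.1 α.2 : ZMod (l₂ κ)) * t.2 + vv α.1 α.2)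
        * ((α.1 : ZMod (l₂ κ)) * t.2 + α.2)⁻¹))‖ with hg
    have h2 : ∑ φ ∈ 𝒞.filter (Good₂ l₁ w₁ l₂ w₂ κ),
      ‖∑ α ∈ 𝒜 κ, ph (l₁ κ) h₁ (w₁ κ) (act α φ) * ph (l₂ κ) h₂ (w₂ κ) (act α φ)‖
      = ∑ φ ∈ 𝒞.filter (Good₂ l₁ w₁ l₂ w₂ κ),
        g (tau (l₁ κ) (w₁ κ) φ, tau (l₂ κ) (w₂ κ) φ) := by
      refine Finset.sum_congr rfl fun φ hφ => ?_
      obtain ⟨hφ, g1, g2⟩ := mem_filter.1 hφ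
      rw [hg]
      refine congrArg _ (Finset.sum_congr rfl fun α hα => ?_)
      obtain ⟨a1, a2, a3, -⟩ := h𝒜 κ hκ α hα
      rw [ph_act (.inl (H.prime₁ κ hκ)) h₁ (h𝒞 hφ) g1 a1 a2 a3,
        ph_act (H.prime₂ κ hκ) h₂ (h𝒞 hφ) g2 a1 a2 a3]
    rw [h2]
    refine (sum_comp_le _ _ g).trans ?_
    refine mul_le_mul_of_nonneg_left (Real.sqrt_le_sqrt ?_) (Real.sqrt_nonneg _)
    exact H.sum_sq_le h₂ hk hkT hkl 𝒜 h𝒜 hκ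
  refine (sum_le_sum h1).trans ?_
  refine (Real.sum_sqrt_mul_sqrt_le _ (fun κ => Nat.cast_nonneg _)
    (fun _ => by positivity)).trans ?_
  have hC : 𝒞.card ≤ 4 * Z ^ 2 := (card_le_card h𝒞).trans (card_Far_le' hZ)
  gcongr
  · have h3 := H.sum_coll_le 𝒞 h𝒞
    have h4 : 𝒦.card * 𝒞.card + C₀ * 𝒞.card ^ 2 ≤ (256 + 16 * C₀) * Z ^ 4 := by
      calc _ ≤ (64 * Z ^ 2) * (4 * Z ^ 2) + C₀ * (4 * Z ^ 2) ^ 2 := by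
            gcongr
            exact H.card_le
        _ = _ := by ring
    rw [← Nat.cast_sum]
    exact_mod_cast h3.trans h4
  · rw [sum_const, nsmul_eq_mul]
    have : (𝒦.card : ℝ) ≤ 64 * (Z : ℝ) ^ 2 := by exact_mod_cast H.card_le
    calc _ ≤ (64 * (Z : ℝ) ^ 2) * (2 ^ 10 * (Z : ℝ) ^ 2 * (T : ℝ) ^ 4 / k) := by gcongr
      _ = _ := by ring

end Cell

end Dispersion

section Core

lemma card_annulus_le (Y y D : ℕ) :
    ((G Y).filter fun γ => nm γ ≤ y ∧ y < nm γ + D).card ≤ Nat.sqrt Y * (Nat.sqrt D + 1) := by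
  set S := (G Y).filter fun γ => nm γ ≤ y ∧ y < nm γ + D
  have h1 : ∀ γ ∈ S, γ.1 ∈ Ioc 0 (Nat.sqrt Y) := fun γ hγ => by
    have := (mem_filter.1 hγ).1
    exact mem_Ioc.2 ⟨(mem_G.1 this).1, fst_le_sqrt (mem_G.1 this).2.2.2⟩
  rw [card_eq_sum_card_fiberwise h1]
  refine (sum_le_card_nsmul _ _ (Nat.sqrt D + 1) fun r _ => ?_).trans_eq (by simp)
  set F := S.filter fun γ => γ.1 = r
  rcases F.eq_empty_or_nonempty with h | h
  · rw [h]; simp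
  obtain ⟨γ₀, hγ₀, hmin⟩ := exists_min_image F (fun γ => γ.2) h
  have hc : F.card = (F.image fun γ => γ.2).card := by
    rw [card_image_of_injOn]
    intro γ hγ γ' hγ' he
    exact Prod.ext ((mem_filter.1 hγ).2.trans (mem_filter.1 hγ').2.symm) he
  rw [hc]
  have hs : (F.image fun γ => γ.2) ⊆ Icc γ₀.2 (γ₀.2 + Nat.sqrt D) := by
    intro s hs
    obtain ⟨γ, hγ, rfl⟩ := mem_image.1 hs
    have h3 := hmin γ hγ
    refine mem_Icc.2 ⟨h3, ?_⟩
    obtain ⟨hγS, h4⟩ := mem_filter.1 hγ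
    obtain ⟨hγ₀S, h5⟩ := mem_filter.1 hγ₀
    have a1 := (mem_filter.1 hγS).2.1
    have b2 := (mem_filter.1 hγ₀S).2.2
    unfold nm at a1 b2
    rw [h4] at a1
    rw [h5] at b2
    have : γ.2 - γ₀.2 ≤ Nat.sqrt D := by
      rw [Nat.le_sqrt']
      obtain ⟨e, he⟩ := Nat.exists_eq_add_of_le h3
      rw [he] at a1 ⊢
      rw [Nat.add_sub_cancel_left]
      nlinarith
    omega
  refine (card_le_card hs).trans ?_
  rw [Nat.card_Icc]; omega

lemma Far_swap {Z : ℕ} {φ : (ℕ × ℕ) × (ℕ × ℕ)} (hφ : φ ∈ Far Z) :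
    (φ.2.swap, φ.1.swap) ∈ Far Z := by
  obtain ⟨f1, f2, f3, f4⟩ := mem_Far.1 hφ
  simp only [nrm] at f2 f3 f4
  refine mem_Far.2 ⟨?_, ?_, ?_, ?_⟩ <;> simp only [nrm, Prod.fst_swap, Prod.snd_swap]
  · linarith
  · omega
  · omega
  · omega

lemma Far_snd_unique {Z : ℕ} {φ φ' : (ℕ × ℕ) × (ℕ × ℕ)} (hφ : φ ∈ Far Z) (hφ' : φ' ∈ Far Z)
    (h : φ.1 = φ'.1) : φ = φ' := by
  have := Far_fst_unique (Far_swap hφ) (Far_swap hφ') (by simp [h])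
  rw [Prod.mk.injEq] at this
  exact Prod.ext h (Prod.swap_injective this.1)

lemma sum_inv_nrm_le (M : ℕ) (S : Finset (ℕ × ℕ)) (hS : ∀ ρ ∈ S, 0 < nrm ρ ∧ nrm ρ ≤ M) :
    ∑ ρ ∈ S, (1 : ℝ) / nrm ρ ≤ 2 * M := by
  have h1 : ∀ ρ ∈ S, nrm ρ ∈ Ioc 0 M := fun ρ hρ => mem_Ioc.2 (hS ρ hρ)
  rw [← sum_fiberwise_of_maps_to h1]
  refine (sum_le_card_nsmul _ _ 2 fun N hN => ?_).trans_eq (by simp [mul_comm])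
  have hN0 := (mem_Ioc.1 hN).1
  rw [Finset.sum_congr rfl (g := fun _ => (1 : ℝ) / N) (fun ρ hρ => by
    rw [(mem_filter.1 hρ).2]), sum_const, nsmul_eq_mul, mul_one_div,
    div_le_iff₀ (by exact_mod_cast hN0)]
  have hc : (S.filter fun ρ => nrm ρ = N).card ≤ N + 1 := by
    rw [← card_range (N + 1)]
    refine card_le_card_of_injOn (fun ρ => ρ.1) (fun ρ hρ => ?_) ?_
    · have := (mem_filter.1 hρ).2
      unfold nrm at this
      simp only [coe_range, Set.mem_Iio]; omega
    · intro ρ hρ ρ' hρ' he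
      have h1 := (mem_filter.1 hρ).2
      have h2 := (mem_filter.1 hρ').2
      unfold nrm at h1 h2
      dsimp only at he
      exact Prod.ext he (by omega)
  have : ((S.filter fun ρ => nrm ρ = N).card : ℝ) ≤ N + 1 := by exact_mod_cast hc
  have : (1 : ℝ) ≤ N := by exact_mod_cast hN0
  linarith

/-- The contribution of Farey pairs with a short row. -/
lemma sum_unbalanced_le {Z K Y : ℕ} (hK : 2 ≤ K) :
    ∑ φ ∈ (Far Z).filter (fun φ => nrm φ.1 * K < Z ∨ nrm φ.2 * K < Z),
      (2 * Y / ((nrm φ.1 : ℝ) * nrm φ.2)) ≤ 16 * Y / K := by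
  classical
  rcases Nat.eq_zero_or_pos Z with rfl | hZ
  · rw [filter_false_of_mem (by simp)]
    simp only [sum_empty]; positivity
  have hZ' : (0 : ℝ) < Z := by exact_mod_cast hZ
  have hK' : (0 : ℝ) < K := by exact_mod_cast (by omega : 0 < K)
  have hM : ((Z / K : ℕ) : ℝ) ≤ Z / K := Nat.cast_div_le
  have key : ∀ (S : Finset ((ℕ × ℕ) × (ℕ × ℕ))) (f g : (ℕ × ℕ) × (ℕ × ℕ) → ℕ × ℕ),
      Set.InjOn f S → (∀ φ ∈ S, 0 < nrm (f φ) ∧ nrm (f φ) * K < Z ∧ Z < nrm (f φ) + nrm (g φ)) →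
      ∑ φ ∈ S, (2 * Y / ((nrm (f φ) : ℝ) * nrm (g φ))) ≤ 8 * Y / K := by
    intro S f g hf h
    have h1 : ∀ φ ∈ S, (2 * Y / ((nrm (f φ) : ℝ) * nrm (g φ)))
        ≤ (4 * Y / Z) * (1 / nrm (f φ)) := by
      intro φ hφ
      obtain ⟨a1, a2, a3⟩ := h φ hφ
      have a4 : Z ≤ 2 * nrm (g φ) := by nlinarith
      have a4' : (Z : ℝ) ≤ 2 * nrm (g φ) := by exact_mod_cast a4
      have a1' : (0 : ℝ) < nrm (f φ) := by exact_mod_cast a1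
      rw [div_mul_div_comm, mul_one, div_le_div_iff₀ (by nlinarith) (by positivity)]
      have : (0 : ℝ) ≤ Y * nrm (f φ) := by positivity
      nlinarith
    refine (sum_le_sum h1).trans ?_
    rw [← mul_sum, ← sum_image (f := fun ρ => (1 : ℝ) / nrm ρ) hf]
    have h2 := sum_inv_nrm_le (Z / K) (S.image f) fun ρ hρ => by
      obtain ⟨φ, hφ, rfl⟩ := mem_image.1 hρ
      obtain ⟨a1, a2, a3⟩ := h φ hφ
      exact ⟨a1, (Nat.le_div_iff_mul_le (by omega)).2 a2.le⟩
    calc _ ≤ (4 * Y / Z : ℝ) * (2 * (Z / K)) := by gcongr; exact h2.trans (by gcongr)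
      _ = _ := by field_simp; ring
  rw [filter_or]
  have h1 := key ((Far Z).filter fun φ => nrm φ.1 * K < Z) Prod.fst Prod.snd
    (fun φ hφ φ' hφ' h => Far_snd_unique (mem_filter.1 hφ).1 (mem_filter.1 hφ').1 h)
    fun φ hφ => by
      obtain ⟨hφ, h⟩ := mem_filter.1 hφ
      exact ⟨(nrm_pos hφ).1, h, (mem_Far.1 hφ).2.2.2⟩
  have h2 := key ((Far Z).filter fun φ => nrm φ.2 * K < Z) Prod.snd Prod.fst
    (fun φ hφ φ' hφ' h => Far_fst_unique (mem_filter.1 hφ).1 (mem_filter.1 hφ').1 h)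
    fun φ hφ => by
      obtain ⟨hφ, h⟩ := mem_filter.1 hφ
      exact ⟨(nrm_pos hφ).2, h, by rw [add_comm]; exact (mem_Far.1 hφ).2.2.2⟩
  simp only [mul_comm ((nrm (Prod.snd _) : ℝ))] at h2
  have h3 := sum_union_inter (s₁ := (Far Z).filter fun φ => nrm φ.1 * K < Z)
    (s₂ := (Far Z).filter fun φ => nrm φ.2 * K < Z)
    (f := fun φ => (2 * Y / ((nrm φ.1 : ℝ) * nrm φ.2)))
  have h4 : 0 ≤ ∑ φ ∈ ((Far Z).filter fun φ => nrm φ.1 * K < Z) ∩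
      ((Far Z).filter fun φ => nrm φ.2 * K < Z), (2 * Y / ((nrm φ.1 : ℝ) * nrm φ.2)) :=
    sum_nonneg fun φ _ => by positivity
  have h5 : (16 * Y / K : ℝ) = 8 * Y / K + 8 * Y / K := by ring
  rw [h5]
  linarith

open scoped Classical in
lemma card_not_good_le {Z l w : ℕ} (hl : l.Prime ∨ l = 1) (K : ℕ) (hK : 0 < K)
    (hlK : l = 1 ∨ K ≤ l) :
    ((Far Z).filter fun φ => ¬ Good l w φ).card ≤ (Z + 1) * (Z / K + 1) := by
  rcases hl with hl | rfl
  swap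
  · simp [Good]
  have : Fact l.Prime := ⟨hl⟩
  have hKl : K ≤ l := hlK.resolve_left hl.one_lt.ne'
  set R := (range (Z + 1) ×ˢ range (Z + 1)).filter fun ρ => ((ρ.1 : ZMod l) * w + ρ.2) = 0
  have h1 : ((Far Z).filter fun φ => ¬ Good l w φ).card ≤ R.card := by
    refine card_le_card_of_injOn (fun φ => φ.2) (fun φ hφ => ?_) ?_
    · obtain ⟨hφ, hg⟩ := mem_filter.1 hφ
      simp only [Good, not_or, not_not] at hg
      exact mem_filter.2 ⟨(mem_product.1 (mem_filter.1 hφ).1).2, hg.2⟩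
    · intro φ hφ φ' hφ' h
      exact Far_fst_unique (mem_filter.1 hφ).1 (mem_filter.1 hφ').1 h
  refine h1.trans ?_
  simp only [R]
  rw [card_filter, sum_product]
  refine (sum_le_card_nsmul _ _ (Z / K + 1) fun x _ => ?_).trans_eq (by simp)
  rw [← card_filter]
  refine (card_le_card (t := (range (Z + 1)).filter fun y =>
    y % l = (-((x : ZMod l) * w)).val) fun y hy => ?_).trans
    ((card_filter_mod_le Z l _).trans (by gcongr))
  obtain ⟨h1, h2⟩ := mem_filter.1 hy
  refine mem_filter.2 ⟨h1, ?_⟩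
  rw [← ZMod.val_natCast, eq_neg_of_add_eq_zero_right h2]

/-- The key of the cell containing a Farey pair. -/
def cellKey (Δ b : ℕ) (φ : (ℕ × ℕ) × (ℕ × ℕ)) : (ℕ × ℕ × ℕ) × (ℕ × ℕ × ℕ) :=
  ((nm φ.1 / Δ, (φ.1.1 * φ.2.1 + φ.1.2 * φ.2.2) / Δ, nm φ.2 / Δ),
    (nm φ.1 % b, (φ.1.1 * φ.2.1 + φ.1.2 * φ.2.2) % b, nm φ.2 % b))

/-- The summation range that replaces `nm (act α φ) ≤ y` on a cell. -/
def cellSet (T Y y b Δ : ℕ) (t : (ℕ × ℕ × ℕ) × (ℕ × ℕ × ℕ)) : Finset (ℕ × ℕ) :=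
  (G Y).filter fun α => (α.1 ≤ T ∧ α.2 ≤ T) ∧
    α.1 ^ 2 * ((t.1.1 + 1) * Δ) + 2 * (α.1 * α.2) * ((t.1.2.1 + 1) * Δ)
      + α.2 ^ 2 * ((t.1.2.2 + 1) * Δ) ≤ y ∧
    b ∣ α.1 ^ 2 * t.2.1 + 2 * (α.1 * α.2) * t.2.2.1 + α.2 ^ 2 * t.2.2.2

lemma sq_mul_le_of_balanced {Z K Y c : ℕ} {ρ : ℕ × ℕ} (hb : Z ≤ nrm ρ * K)
    (h : c ^ 2 * nm ρ ≤ Y) : c ^ 2 * Z ^ 2 ≤ 2 * Y * K ^ 2 := by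
  have h1 : nrm ρ ^ 2 ≤ 2 * nm ρ := by
    unfold nrm nm; zify; nlinarith [sq_nonneg ((ρ.1 : ℤ) - ρ.2)]
  calc c ^ 2 * Z ^ 2 ≤ c ^ 2 * (nrm ρ * K) ^ 2 := by gcongr
    _ = c ^ 2 * (nrm ρ ^ 2) * K ^ 2 := by ring
    _ ≤ c ^ 2 * (2 * nm ρ) * K ^ 2 := by gcongr
    _ = 2 * (c ^ 2 * nm ρ) * K ^ 2 := by ring
    _ ≤ _ := by gcongr

lemma cell_approx {Z K Y y b Δ : ℕ} {φ : (ℕ × ℕ) × (ℕ × ℕ)} (hZ : 0 < Z) (hK : 0 < K)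
    (hΔ : 0 < Δ) (hΔZ : Δ * K ^ 5 ≤ Z ^ 2)
    (hb1 : Z ≤ nrm φ.1 * K) (hb2 : Z ≤ nrm φ.2 * K) (hy : y ≤ Y) (f : ℕ × ℕ → ℂ)
    (hf : ∀ γ, ‖f γ‖ ≤ 1) :
    ‖∑ α ∈ (G Y).filter (fun α => nm (act α φ) ≤ Y),
        (if nm (act α φ) ≤ y ∧ b ∣ nm (act α φ) then f (act α φ) else 0)
      - ∑ α ∈ cellSet (Nat.sqrt (2 * Y * K ^ 2 / Z ^ 2)) Y y b Δ (cellKey Δ b φ), f (act α φ)‖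
      ≤ (∑ α ∈ (G Y).filter (fun α => nm (act α φ) ≤ Y),
        if nm (act α φ) ≤ y ∧ y < nm (act α φ) + 8 * Y / K ^ 3 then 1 else 0 : ℕ) := by
  classical
  set T := Nat.sqrt (2 * Y * K ^ 2 / Z ^ 2)
  set E := (G Y).filter fun α => nm (act α φ) ≤ y ∧ b ∣ nm (act α φ)
  set A := nm φ.1 with hA
  set B := φ.1.1 * φ.2.1 + φ.1.2 * φ.2.2 with hB
  set C := nm φ.2 with hC
  have hm : ∀ α : ℕ × ℕ, nm (act α φ) = α.1 ^ 2 * A + 2 * (α.1 * α.2) * B + α.2 ^ 2 * C :=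
    fun α => nm_act α φ
  have hlt : ∀ x : ℕ, x ≤ (x / Δ + 1) * Δ := fun x => by
    exact (Nat.lt_mul_of_div_lt (Nat.lt_succ_self _) hΔ).le
  have hle : ∀ x : ℕ, (x / Δ + 1) * Δ ≤ x + Δ := fun x => by
    rw [add_mul, one_mul]; exact Nat.add_le_add_right (Nat.div_mul_le_self x Δ) Δ
  have hmod : ∀ α : ℕ × ℕ, b ∣ nm (act α φ) ↔
      b ∣ α.1 ^ 2 * (A % b) + 2 * (α.1 * α.2) * (B % b) + α.2 ^ 2 * (C % b) := by
    intro α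
    rw [hm]
    refine Nat.ModEq.dvd_iff ?_ dvd_rfl
    exact (((Nat.mod_modEq A b).symm.mul_left _).add
      ((Nat.mod_modEq B b).symm.mul_left _)).add ((Nat.mod_modEq C b).symm.mul_left _)
  have hsub : cellSet T Y y b Δ (cellKey Δ b φ) ⊆ E := by
    intro α hα
    obtain ⟨h1, -, h2, h3⟩ := mem_filter.1 hα
    refine mem_filter.2 ⟨h1, ?_, (hmod α).2 h3⟩
    rw [hm]
    refine le_trans ?_ h2
    simp only [cellKey]
    gcongr <;> exact hlt _
  have hE : ∑ α ∈ (G Y).filter (fun α => nm (act α φ) ≤ Y),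
        (if nm (act α φ) ≤ y ∧ b ∣ nm (act α φ) then f (act α φ) else 0)
        = ∑ α ∈ E, f (act α φ) := by
    rw [← sum_filter, filter_filter]
    refine Finset.sum_congr (filter_congr fun α _ => ?_) fun _ _ => rfl
    constructor
    · rintro ⟨-, h⟩; exact h
    · intro h; exact ⟨h.1.trans hy, h⟩
  rw [hE, ← sum_sdiff hsub, add_sub_cancel_right]
  refine (norm_sum_le_of_le _ fun α _ => hf _).trans ?_
  rw [sum_const, nsmul_eq_mul, mul_one, ← card_filter, Nat.cast_le]
  refine card_le_card fun α hα => ?_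
  obtain ⟨hα, hn⟩ := mem_sdiff.1 hα
  obtain ⟨h1, h2, h3⟩ := mem_filter.1 hα
  refine mem_filter.2 ⟨mem_filter.2 ⟨h1, h2.trans hy⟩, h2, ?_⟩
  have hAY : α.1 ^ 2 * A ≤ Y := by
    have := h2.trans hy
    rw [hm] at this
    exact le_trans (by rw [add_assoc]; exact Nat.le_add_right _ _) this
  have hCY : α.2 ^ 2 * C ≤ Y := by
    have := h2.trans hy
    rw [hm] at this
    exact le_trans (Nat.le_add_left _ _) this
  have hc := sq_mul_le_of_balanced hb1 hAY
  have hd := sq_mul_le_of_balanced hb2 hCY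
  have hT : ∀ c : ℕ, c ^ 2 * Z ^ 2 ≤ 2 * Y * K ^ 2 → c ≤ T := fun c hc => by
    rw [Nat.le_sqrt', Nat.le_div_iff_mul_le (by positivity)]; exact hc
  by_contra! hcon
  refine hn (mem_filter.2 ⟨h1, ⟨hT _ hc, hT _ hd⟩, ?_, (hmod α).1 h3⟩)
  refine le_trans ?_ hcon
  have hD : ∀ c : ℕ, c ^ 2 * Z ^ 2 ≤ 2 * Y * K ^ 2 → Δ * c ^ 2 * K ^ 3 ≤ 2 * Y := fun c hc => by
    have hK2 : 0 < K ^ 2 := by positivity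
    refine Nat.le_of_mul_le_mul_right ?_ hK2
    calc Δ * c ^ 2 * K ^ 3 * K ^ 2 = c ^ 2 * (Δ * K ^ 5) := by ring
      _ ≤ c ^ 2 * Z ^ 2 := by gcongr
      _ ≤ _ := hc
  have hD2 : Δ * (α.1 + α.2) ^ 2 ≤ 8 * Y / K ^ 3 := by
    rw [Nat.le_div_iff_mul_le (by positivity)]
    have e1 := hD _ hc
    have e2 := hD _ hd
    have e3 : (α.1 + α.2) ^ 2 ≤ 2 * α.1 ^ 2 + 2 * α.2 ^ 2 := by
      zify; nlinarith [sq_nonneg ((α.1 : ℤ) - α.2)]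
    calc Δ * (α.1 + α.2) ^ 2 * K ^ 3 ≤ Δ * (2 * α.1 ^ 2 + 2 * α.2 ^ 2) * K ^ 3 := by gcongr
      _ = 2 * (Δ * α.1 ^ 2 * K ^ 3) + 2 * (Δ * α.2 ^ 2 * K ^ 3) := by ring
      _ ≤ _ := by omega
  calc α.1 ^ 2 * ((A / Δ + 1) * Δ) + 2 * (α.1 * α.2) * ((B / Δ + 1) * Δ)
      + α.2 ^ 2 * ((C / Δ + 1) * Δ)
      ≤ α.1 ^ 2 * (A + Δ) + 2 * (α.1 * α.2) * (B + Δ) + α.2 ^ 2 * (C + Δ) := by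
        gcongr <;> exact hle _
    _ = nm (act α φ) + Δ * (α.1 + α.2) ^ 2 := by rw [hm]; ring
    _ ≤ _ := by gcongr

/-- The admissible keys. -/
def cellKeys (R b : ℕ) : Finset ((ℕ × ℕ × ℕ) × (ℕ × ℕ × ℕ)) :=
  (range R ×ˢ range R ×ˢ range R) ×ˢ (range b ×ˢ range b ×ˢ range b)

lemma card_cellKeys (R b : ℕ) : (cellKeys R b).card = R ^ 3 * b ^ 3 := by
  simp only [cellKeys, card_product, card_range]; ring

lemma nm_le_nrm_sq (ρ : ℕ × ℕ) : nm ρ ≤ nrm ρ ^ 2 := by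
  unfold nm nrm
  have : 0 ≤ 2 * (ρ.1 * ρ.2) := Nat.zero_le _
  linarith [add_sq ρ.1 ρ.2]

lemma cellKey_mem {Z R b Δ : ℕ} (hb : 0 < b) (hΔ : 0 < Δ) (hR : Z ^ 2 < R * Δ)
    {φ : (ℕ × ℕ) × (ℕ × ℕ)} (hφ : φ ∈ Far Z) : cellKey Δ b φ ∈ cellKeys R b := by
  obtain ⟨-, h1, h2, -⟩ := mem_Far.1 hφ
  have e1 : nm φ.1 ≤ Z ^ 2 := (nm_le_nrm_sq _).trans (Nat.pow_le_pow_left h1 2)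
  have e2 : nm φ.2 ≤ Z ^ 2 := (nm_le_nrm_sq _).trans (Nat.pow_le_pow_left h2 2)
  have e3 : φ.1.1 * φ.2.1 + φ.1.2 * φ.2.2 ≤ Z ^ 2 := by
    calc φ.1.1 * φ.2.1 + φ.1.2 * φ.2.2 ≤ nrm φ.1 * nrm φ.2 := by
          unfold nrm
          nlinarith [Nat.zero_le (φ.1.1 * φ.2.2), Nat.zero_le (φ.1.2 * φ.2.1)]
      _ ≤ Z * Z := Nat.mul_le_mul h1 h2
      _ = _ := (sq Z).symm
  simp only [cellKey, cellKeys, mem_product, mem_range, Nat.div_lt_iff_lt_mul hΔ]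
  exact ⟨⟨e1.trans_lt hR, e3.trans_lt hR, e2.trans_lt hR⟩, Nat.mod_lt _ hb, Nat.mod_lt _ hb,
    Nat.mod_lt _ hb⟩

/-- The balanced pairs with a given key. -/
def cellPairs (Z K Δ b : ℕ) (t : (ℕ × ℕ × ℕ) × (ℕ × ℕ × ℕ)) : Finset ((ℕ × ℕ) × (ℕ × ℕ)) :=
  (Far Z).filter fun φ => ¬ (nrm φ.1 * K < Z ∨ nrm φ.2 * K < Z) ∧ cellKey Δ b φ = t

open scoped Classical in
lemma norm_sum_le_cells {Z K Y y b Δ R Nb : ℕ} (P : (ℕ × ℕ) × (ℕ × ℕ) → Prop) (hZ : 0 < Z)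
    (hK : 2 ≤ K) (hΔ : 0 < Δ) (hΔZ : Δ * K ^ 5 ≤ Z ^ 2) (hR : Z ^ 2 < R * Δ) (hb : 0 < b)
    (hy : y ≤ Y) (hNb : ((Far Z).filter fun φ => ¬ P φ).card ≤ Nb) (f : ℕ × ℕ → ℂ)
    (hf : ∀ γ, ‖f γ‖ ≤ 1) :
    ‖∑ γ ∈ (G Y).filter (fun γ => nm γ ≤ y ∧ b ∣ nm γ), f γ‖ ≤
      (Z : ℝ) ^ 2 + 16 * Y / K + Nb * (2 * Y * K ^ 2 / Z ^ 2)
        + (Nat.sqrt Y * (Nat.sqrt (8 * Y / K ^ 3) + 1) : ℕ)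
        + ∑ t ∈ cellKeys R b, ∑ φ ∈ (cellPairs Z K Δ b t).filter P,
          ‖∑ α ∈ cellSet (Nat.sqrt (2 * Y * K ^ 2 / Z ^ 2)) Y y b Δ t, f (act α φ)‖ := by
  set D := 8 * Y / K ^ 3
  set T := Nat.sqrt (2 * Y * K ^ 2 / Z ^ 2)
  set F : ℕ × ℕ → ℂ := fun γ => if nm γ ≤ y ∧ b ∣ nm γ then f γ else 0 with hF
  have hF1 : ∀ γ, ‖F γ‖ ≤ 1 := fun γ => by
    simp only [hF]; split_ifs
    · exact hf γ
    · simp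
  set S : (ℕ × ℕ) × (ℕ × ℕ) → ℂ := fun φ =>
    ∑ α ∈ (G Y).filter (fun α => nm (act α φ) ≤ Y), F (act α φ) with hS
  set U : (ℕ × ℕ) × (ℕ × ℕ) → Prop := fun φ => nrm φ.1 * K < Z ∨ nrm φ.2 * K < Z with hU
  set ann : (ℕ × ℕ) × (ℕ × ℕ) → ℕ := fun φ =>
    ∑ α ∈ (G Y).filter (fun α => nm (act α φ) ≤ Y),
      if nm (act α φ) ≤ y ∧ y < nm (act α φ) + D then 1 else 0 with hann
  set cell : (ℕ × ℕ) × (ℕ × ℕ) → ℝ := fun φ =>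
    ‖∑ α ∈ cellSet T Y y b Δ (cellKey Δ b φ), f (act α φ)‖ with hcell
  have hsplit : ∑ γ ∈ (G Y).filter (fun γ => nm γ ≤ y ∧ b ∣ nm γ), f γ
      = ∑ γ ∈ (G Y).filter (fun γ => ¬ Z < nrm γ), F γ + ∑ φ ∈ Far Z, S φ := by
    rw [sum_filter, ← sum_G_eq_sum_Far hZ Y F, add_comm]
    exact (sum_filter_add_sum_filter_not _ _ _).symm
  have h1 : ‖∑ γ ∈ (G Y).filter (fun γ => ¬ Z < nrm γ), F γ‖ ≤ (Z : ℝ) ^ 2 := by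
    refine (norm_sum_le_of_le _ fun γ _ => hF1 γ).trans ?_
    rw [sum_const, nsmul_eq_mul, mul_one]
    have : ((G Y).filter (fun γ => ¬ Z < nrm γ)).card ≤ ((Ioc 0 Z) ×ˢ (Ioc 0 Z)).card := by
      refine card_le_card fun γ hγ => ?_
      obtain ⟨h, h'⟩ := mem_filter.1 hγ
      obtain ⟨a1, a2, -⟩ := mem_G.1 h
      unfold nrm at h'
      simp only [mem_product, mem_Ioc]; omega
    rw [card_product, Nat.card_Ioc, Nat.sub_zero] at this
    rw [sq]; exact_mod_cast this
  have hSle : ∀ φ ∈ Far Z, ‖S φ‖ ≤ 2 * Y / ((nrm φ.1 : ℝ) * nrm φ.2) := fun φ hφ => by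
    refine le_trans ?_ (card_act_le hφ)
    refine (norm_sum_le_of_le _ fun α _ => hF1 _).trans ?_
    rw [sum_const, nsmul_eq_mul, mul_one]
  have hK0 : (0 : ℝ) < K := by exact_mod_cast (by omega : 0 < K)
  have hZ0 : (0 : ℝ) < Z := by exact_mod_cast hZ
  have hpt : ∀ φ ∈ Far Z, ‖S φ‖ ≤ (if U φ then 2 * Y / ((nrm φ.1 : ℝ) * nrm φ.2) else 0)
      + (if ¬ P φ then 2 * Y * K ^ 2 / (Z : ℝ) ^ 2 else 0) + ann φ
      + (if ¬ U φ ∧ P φ then cell φ else 0) := by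
    intro φ hφ
    have p1 : (0 : ℝ) ≤ ann φ := Nat.cast_nonneg _
    have p2 : (0 : ℝ) ≤ 2 * Y * K ^ 2 / (Z : ℝ) ^ 2 := by positivity
    by_cases hu : U φ
    · rw [if_pos hu, if_neg (c := ¬ U φ ∧ P φ) (fun h => h.1 hu)]
      have := hSle φ hφ
      split_ifs <;> linarith
    · have hu' := hu
      simp only [hU, not_or, not_lt] at hu'
      rw [if_neg hu]
      by_cases hp : P φ
      · rw [if_neg (not_not.2 hp), if_pos ⟨hu, hp⟩]
        have := cell_approx hZ (by omega : 0 < K) hΔ hΔZ hu'.1 hu'.2 hy f hf (b := b)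
        have h3 := norm_le_norm_sub_add (S φ)
          (∑ α ∈ cellSet T Y y b Δ (cellKey Δ b φ), f (act α φ))
        simp only [hann, hcell, hS, hF] at *
        linarith
      · rw [if_pos hp, if_neg (c := ¬ U φ ∧ P φ) (fun h => hp h.2)]
        have h3 := hSle φ hφ
        have h4 : 2 * Y / ((nrm φ.1 : ℝ) * nrm φ.2) ≤ 2 * Y * K ^ 2 / (Z : ℝ) ^ 2 := by
          obtain ⟨q1, q2⟩ := nrm_pos hφ
          have e1 : (Z : ℝ) ≤ nrm φ.1 * K := by exact_mod_cast hu'.1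
          have e2 : (Z : ℝ) ≤ nrm φ.2 * K := by exact_mod_cast hu'.2
          have q1' : (0 : ℝ) < nrm φ.1 := by exact_mod_cast q1
          have q2' : (0 : ℝ) < nrm φ.2 := by exact_mod_cast q2
          rw [div_le_div_iff₀ (by positivity) (by positivity)]
          have := mul_le_mul e1 e2 hZ0.le (by positivity)
          calc 2 * (Y : ℝ) * (Z : ℝ) ^ 2 = 2 * Y * (Z * Z) := by ring
            _ ≤ 2 * Y * ((nrm φ.1 * K) * (nrm φ.2 * K)) := by gcongr
            _ = _ := by ring
        linarith
  have hA : ∑ φ ∈ Far Z, (ann φ : ℝ) ≤ (Nat.sqrt Y * (Nat.sqrt D + 1) : ℕ) := by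
    rw [← Nat.cast_sum, Nat.cast_le]
    refine le_trans ?_ (card_annulus_le Y y D)
    have := sum_G_eq_sum_Far hZ Y (fun γ => if nm γ ≤ y ∧ y < nm γ + D then 1 else 0)
    simp only [hann]
    rw [← this, ← card_filter, filter_filter]
    exact card_le_card (monotone_filter_right _ fun γ _ h => h.2)
  have hC : ∑ φ ∈ Far Z, (if ¬ U φ ∧ P φ then cell φ else 0)
      = ∑ t ∈ cellKeys R b, ∑ φ ∈ (cellPairs Z K Δ b t).filter P,
          ‖∑ α ∈ cellSet T Y y b Δ t, f (act α φ)‖ := by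
    rw [← sum_filter, ← sum_fiberwise_of_maps_to (g := cellKey Δ b) (t := cellKeys R b)
      (fun φ hφ => cellKey_mem hb hΔ hR (mem_filter.1 hφ).1)]
    refine Finset.sum_congr rfl fun t _ => ?_
    have he : ((Far Z).filter fun φ => ¬ U φ ∧ P φ).filter (fun φ => cellKey Δ b φ = t)
        = (cellPairs Z K Δ b t).filter P := by
      ext φ
      simp only [cellPairs, mem_filter, hU]
      tauto
    rw [he]
    refine Finset.sum_congr rfl fun φ hφ => ?_
    simp only [hcell]
    rw [(mem_filter.1 (mem_filter.1 hφ).1).2.2]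
  have hB : ∑ φ ∈ Far Z, (if ¬ P φ then 2 * Y * K ^ 2 / (Z : ℝ) ^ 2 else 0)
      ≤ Nb * (2 * Y * K ^ 2 / (Z : ℝ) ^ 2) := by
    rw [← sum_filter, sum_const, nsmul_eq_mul]
    gcongr
  have hUn := sum_unbalanced_le (Z := Z) (Y := Y) hK
  rw [sum_filter] at hUn
  rw [hsplit]
  refine (norm_add_le _ _).trans ?_
  have h5 := (norm_sum_le (Far Z) S).trans (sum_le_sum hpt)
  rw [sum_add_distrib, sum_add_distrib, sum_add_distrib, hC] at h5
  linarith

lemma annulus_bound {K Y : ℕ} (hK : 2 ≤ K) (hY : K ^ 2 ≤ Y) :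
    ((Nat.sqrt Y * (Nat.sqrt (8 * Y / K ^ 3) + 1) : ℕ) : ℝ) ≤ 4 * Y / K := by
  have hK0 : (0 : ℝ) < K := by exact_mod_cast (by omega : 0 < K)
  have h2K : (2 : ℝ) ≤ K := by exact_mod_cast hK
  have hY' : (K : ℝ) ^ 2 ≤ Y := by exact_mod_cast hY
  have e1 : (Nat.sqrt Y : ℝ) ≤ √Y := Real.nat_sqrt_le_real_sqrt
  have e2 : (Nat.sqrt (8 * Y / K ^ 3) : ℝ) ≤ √(4 * Y / K ^ 2) := by
    refine Real.nat_sqrt_le_real_sqrt.trans (Real.sqrt_le_sqrt ?_)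
    refine Nat.cast_div_le.trans ?_
    push_cast
    rw [div_le_div_iff₀ (by positivity) (by positivity)]
    calc 8 * (Y : ℝ) * (K : ℝ) ^ 2 = 4 * Y * ((K : ℝ) ^ 2 * 2) := by ring
      _ ≤ 4 * Y * ((K : ℝ) ^ 2 * K) := by gcongr
      _ = _ := by ring
  have e3 : √(4 * Y / K ^ 2) = 2 * √Y / K := by
    rw [Real.sqrt_div (by positivity), Real.sqrt_sq hK0.le, Real.sqrt_mul (by norm_num),
      show (4 : ℝ) = 2 ^ 2 by norm_num, Real.sqrt_sq (by norm_num)]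
  have e4 : √(Y : ℝ) * √Y = Y := Real.mul_self_sqrt (Nat.cast_nonneg _)
  have e5 : (K : ℝ) ≤ √Y := Real.le_sqrt_of_sq_le hY'
  push_cast
  calc (Nat.sqrt Y : ℝ) * (Nat.sqrt (8 * Y / K ^ 3) + 1) ≤ √Y * (2 * √Y / K + √Y / K) := by
        gcongr
        · exact e2.trans_eq e3
        · rw [le_div_iff₀ hK0, one_mul]; exact e5
    _ = 3 * (√Y * √Y) / K := by ring
    _ = 3 * Y / K := by rw [e4]
    _ ≤ _ := by gcongr; norm_num

section

variable {ι : Type*} {Z C₀ : ℕ} {l₁ w₁ l₂ w₂ : ι → ℕ} {h₁ : ℤ} {𝒦 : Finset ι}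

open scoped Classical in
lemma Moduli.card_not_good₂_le (H : Moduli l₁ w₁ l₂ w₂ Z C₀ h₁ 𝒦) {K : ℕ} (hK : 0 < K)
    (hKZ : K ≤ Z) (hl1 : ∀ κ ∈ 𝒦, K ≤ l₁ κ) (hl2 : ∀ κ ∈ 𝒦, l₂ κ = 1 ∨ K ≤ l₂ κ) {κ : ι}
    (hκ : κ ∈ 𝒦) :
    (((Far Z).filter fun φ => ¬ Good₂ l₁ w₁ l₂ w₂ κ φ).card : ℝ) ≤ 8 * Z ^ 2 / K := by
  have hK0 : (0 : ℝ) < K := by exact_mod_cast hK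
  have e1 := card_not_good_le (Z := Z) (w := w₁ κ) (Or.inl (H.prime₁ κ hκ)) K hK
    (Or.inr (hl1 κ hκ))
  have e2 := card_not_good_le (Z := Z) (w := w₂ κ) (H.prime₂ κ hκ) K hK (hl2 κ hκ)
  have e3 : ((Far Z).filter fun φ => ¬ Good₂ l₁ w₁ l₂ w₂ κ φ).card
      ≤ 2 * ((Z + 1) * (Z / K + 1)) := by
    rw [two_mul]
    refine le_trans (card_le_card ?_) ((card_union_le _ _).trans (Nat.add_le_add e1 e2))
    intro φ hφ
    obtain ⟨h, h'⟩ := mem_filter.1 hφ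
    simp only [Good₂, not_and_or] at h'
    exact mem_union.2 (h'.imp (fun g => mem_filter.2 ⟨h, g⟩) fun g => mem_filter.2 ⟨h, g⟩)
  have e4 : (((Far Z).filter fun φ => ¬ Good₂ l₁ w₁ l₂ w₂ κ φ).card : ℝ)
      ≤ 2 * ((Z + 1) * ((Z / K : ℕ) + 1)) := by exact_mod_cast e3
  have e5 : ((Z / K : ℕ) : ℝ) ≤ Z / K := Nat.cast_div_le
  have e6 : (K : ℝ) ≤ Z := by exact_mod_cast hKZ
  have e7 : (1 : ℝ) ≤ Z := by exact_mod_cast hK.trans_le hKZ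
  have e8 : (1 : ℝ) ≤ Z / K := by rw [le_div_iff₀ hK0, one_mul]; exact e6
  refine e4.trans ?_
  calc 2 * (((Z : ℝ) + 1) * ((Z / K : ℕ) + 1)) ≤ 2 * ((Z + Z) * (Z / K + Z / K)) := by gcongr
    _ = _ := by ring

/-- Cancellation in sums over quadratic roots twisted by families of prime moduli. -/
theorem Moduli.sum_norm_sum_le (H : Moduli l₁ w₁ l₂ w₂ Z C₀ h₁ 𝒦) (h₂ : ℤ) {K b Y : ℕ}
    (hK : 2 ≤ K) (hb : 0 < b) (hbK : b ≤ K) (hl1 : ∀ κ ∈ 𝒦, K ^ 168 ≤ l₁ κ)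
    (hl2 : ∀ κ ∈ 𝒦, l₂ κ = 1 ∨ K ^ 3 ≤ l₂ κ) (hZK : K ^ 5 ≤ Z) (hY : Z ^ 2 * K ^ 84 ≤ Y)
    (y : ι → ℕ) (hy : ∀ κ ∈ 𝒦, y κ ≤ Y) :
    ∑ κ ∈ 𝒦, ‖∑ γ ∈ (G Y).filter (fun γ => nm γ ≤ y κ ∧ b ∣ nm γ),
      ph (l₁ κ) h₁ (w₁ κ) γ * ph (l₂ κ) h₂ (w₂ κ) γ‖
      ≤ 2 ^ 17 * (1 + C₀) * (Z : ℝ) ^ 2 * Y / K := by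
  classical
  have hK1 : 1 ≤ K := by omega
  have hK0 : (0 : ℝ) < K := by exact_mod_cast hK1
  have hK1' : (1 : ℝ) ≤ K := by exact_mod_cast hK1
  have hZ : 0 < Z := (pow_pos hK1 5).trans_le hZK
  have hZ0 : (0 : ℝ) < Z := by exact_mod_cast hZ
  set Δ := Z ^ 2 / K ^ 5 with hΔ
  have hK5 : 0 < K ^ 5 := by positivity
  have hΔ1 : 0 < Δ := Nat.div_pos (hZK.trans (Nat.le_self_pow (by norm_num) _)) hK5
  have hΔZ : Δ * K ^ 5 ≤ Z ^ 2 := Nat.div_mul_le_self _ _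
  have hR : Z ^ 2 < (2 * K ^ 5) * Δ := by
    have := Nat.lt_mul_div_succ (Z ^ 2) hK5
    calc Z ^ 2 < K ^ 5 * (Δ + 1) := this
      _ ≤ K ^ 5 * (Δ + Δ) := by gcongr; exact hΔ1
      _ = _ := by ring
  have hK3 : K ^ 3 ≤ Z := (Nat.pow_le_pow_right hK1 (by norm_num)).trans hZK
  set T := Nat.sqrt (2 * Y * K ^ 2 / Z ^ 2) with hT
  have hTle : T ^ 2 * Z ^ 2 ≤ 2 * Y * K ^ 2 :=
    (Nat.mul_le_mul_right _ (Nat.sqrt_le' _)).trans (Nat.div_mul_le_self _ _)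
  have hkT : K ^ 42 ≤ T := by
    rw [hT, Nat.le_sqrt', Nat.le_div_iff_mul_le (by positivity)]
    calc (K ^ 42) ^ 2 * Z ^ 2 = Z ^ 2 * K ^ 84 := by ring
      _ ≤ Y := hY
      _ = Y * 1 := (mul_one _).symm
      _ ≤ Y * (2 * K ^ 2) := by gcongr; have := Nat.one_le_pow 2 K hK1; omega
      _ = _ := by ring
  have hZY : (Z : ℝ) ^ 2 ≤ Y / K := by
    rw [le_div_iff₀ hK0]
    have : Z ^ 2 * K ≤ Y := le_trans (by gcongr; exact Nat.le_self_pow (by norm_num) _) hY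
    exact_mod_cast this
  have hK2Y : K ^ 2 ≤ Y := by
    refine le_trans ?_ hY
    calc K ^ 2 = 1 * K ^ 2 := (one_mul _).symm
      _ ≤ Z ^ 2 * K ^ 84 := Nat.mul_le_mul (Nat.one_le_pow _ _ hZ)
          (Nat.pow_le_pow_right hK1 (by norm_num))
  have hcell : ∀ t ∈ cellKeys (2 * K ^ 5) b, ∑ κ ∈ 𝒦,
      ∑ φ ∈ (cellPairs Z K Δ b t).filter (Good₂ l₁ w₁ l₂ w₂ κ),
        ‖∑ α ∈ cellSet T Y (y κ) b Δ t,
          ph (l₁ κ) h₁ (w₁ κ) (act α φ) * ph (l₂ κ) h₂ (w₂ κ) (act α φ)‖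
      ≤ 2 ^ 13 * (1 + C₀) * (Z : ℝ) ^ 2 * Y / K ^ 19 := by
    intro t _
    refine (H.sum_norm_le h₂ hZ (by positivity : 0 < K ^ 42) hkT (fun κ hκ => ?_)
      (fun κ => cellSet T Y (y κ) b Δ t) (fun κ _ α hα => ?_) (cellPairs Z K Δ b t)
      (filter_subset _ _)).trans ?_
    · rw [← pow_mul]; exact hl1 κ hκ
    · obtain ⟨h1, h2, -⟩ := mem_filter.1 hα
      obtain ⟨a1, a2, a3, -⟩ := mem_G.1 h1
      exact ⟨a1, a2, a3, h2⟩
    · have c0 : (0 : ℝ) ≤ C₀ := Nat.cast_nonneg _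
      have s1 : √((256 + 16 * C₀) * (Z : ℝ) ^ 4) ≤ 16 * (1 + C₀) * Z ^ 2 := by
        refine Real.sqrt_le_iff.2 ⟨by positivity, ?_⟩
        have : (256 + 16 * C₀ : ℝ) ≤ (16 * (1 + C₀)) ^ 2 := by nlinarith
        calc (256 + 16 * C₀) * (Z : ℝ) ^ 4 ≤ (16 * (1 + C₀)) ^ 2 * (Z : ℝ) ^ 4 := by gcongr
          _ = _ := by ring
      have s2 : √(2 ^ 16 * (Z : ℝ) ^ 4 * (T : ℝ) ^ 4 / (K ^ 42 : ℕ)) ≤ 2 ^ 9 * Y / K ^ 19 := by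
        refine Real.sqrt_le_iff.2 ⟨by positivity, ?_⟩
        have : (T : ℝ) ^ 2 * Z ^ 2 ≤ 2 * Y * K ^ 2 := by exact_mod_cast hTle
        push_cast
        calc 2 ^ 16 * (Z : ℝ) ^ 4 * (T : ℝ) ^ 4 / (K : ℝ) ^ 42
            = 2 ^ 16 * ((T : ℝ) ^ 2 * (Z : ℝ) ^ 2) ^ 2 / (K : ℝ) ^ 42 := by ring
          _ ≤ 2 ^ 16 * (2 * Y * (K : ℝ) ^ 2) ^ 2 / (K : ℝ) ^ 42 := by gcongr
          _ = _ := by field_simp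
      calc _ ≤ (16 * (1 + C₀) * (Z : ℝ) ^ 2) * (2 ^ 9 * Y / K ^ 19) := by gcongr
        _ = _ := by ring
  have hone : ∀ κ ∈ 𝒦, ‖∑ γ ∈ (G Y).filter (fun γ => nm γ ≤ y κ ∧ b ∣ nm γ),
      ph (l₁ κ) h₁ (w₁ κ) γ * ph (l₂ κ) h₂ (w₂ κ) γ‖ ≤ 37 * (Y / K : ℝ)
        + ∑ t ∈ cellKeys (2 * K ^ 5) b, ∑ φ ∈ (cellPairs Z K Δ b t).filter (Good₂ l₁ w₁ l₂ w₂ κ),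
        ‖∑ α ∈ cellSet T Y (y κ) b Δ t,
          ph (l₁ κ) h₁ (w₁ κ) (act α φ) * ph (l₂ κ) h₂ (w₂ κ) (act α φ)‖ := by
    intro κ hκ
    refine (norm_sum_le_cells (Good₂ l₁ w₁ l₂ w₂ κ) hZ hK hΔ1 hΔZ hR hb (hy κ hκ) le_rfl
      (fun γ => ph (l₁ κ) h₁ (w₁ κ) γ * ph (l₂ κ) h₂ (w₂ κ) γ)
      (fun γ => by rw [norm_mul, norm_ph, norm_ph, mul_one])).trans ?_
    have hg := H.card_not_good₂_le (K := K ^ 3) (by positivity) hK3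
      (fun κ hκ => (Nat.pow_le_pow_right hK1 (by norm_num)).trans (hl1 κ hκ)) hl2 hκ
    have hg2 : (((Far Z).filter fun φ => ¬ Good₂ l₁ w₁ l₂ w₂ κ φ).card : ℝ)
        * (2 * Y * K ^ 2 / Z ^ 2) ≤ 16 * (Y / K : ℝ) := by
      calc _ ≤ (8 * Z ^ 2 / (K ^ 3 : ℕ) : ℝ) * (2 * Y * K ^ 2 / Z ^ 2) := by gcongr
        _ = _ := by push_cast; field_simp; ring
    have ha := annulus_bound hK hK2Y
    have e1 : (16 * Y / K : ℝ) = 16 * (Y / K : ℝ) := by ring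
    have e2 : (4 * Y / K : ℝ) = 4 * (Y / K : ℝ) := by ring
    linarith
  refine (sum_le_sum hone).trans ?_
  rw [sum_add_distrib, sum_const, nsmul_eq_mul, sum_comm]
  have h5 := sum_le_sum hcell
  rw [sum_const, nsmul_eq_mul, card_cellKeys] at h5
  have h6 : (𝒦.card : ℝ) ≤ 64 * Z ^ 2 := by exact_mod_cast H.card_le
  have hbK' : (b : ℝ) ≤ K := by exact_mod_cast hbK
  have h7 : (((2 * K ^ 5) ^ 3 * b ^ 3 : ℕ) : ℝ) * (2 ^ 13 * (1 + C₀) * (Z : ℝ) ^ 2 * Y / K ^ 19)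
      ≤ 2 ^ 16 * (1 + C₀) * (Z : ℝ) ^ 2 * Y / K := by
    push_cast
    calc ((2 * (K : ℝ) ^ 5) ^ 3 * b ^ 3) * (2 ^ 13 * (1 + C₀) * (Z : ℝ) ^ 2 * Y / K ^ 19)
        ≤ ((2 * (K : ℝ) ^ 5) ^ 3 * K ^ 3) * (2 ^ 13 * (1 + C₀) * (Z : ℝ) ^ 2 * Y / K ^ 19) := by
          gcongr
      _ = _ := by field_simp
  have h8 : (𝒦.card : ℝ) * (37 * (Y / K : ℝ)) ≤ 2 ^ 16 * (1 + C₀) * (Z : ℝ) ^ 2 * Y / K := by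
    calc (𝒦.card : ℝ) * (37 * (Y / K : ℝ)) ≤ (64 * Z ^ 2) * (37 * (Y / K : ℝ)) := by gcongr
      _ = 2368 * 1 * (Z : ℝ) ^ 2 * Y / K := by ring
      _ ≤ _ := by
        have c0 : (0 : ℝ) ≤ C₀ := Nat.cast_nonneg _
        gcongr
        · norm_num
        · linarith
  calc _ ≤ 2 ^ 16 * (1 + C₀) * (Z : ℝ) ^ 2 * Y / K + 2 ^ 16 * (1 + C₀) * (Z : ℝ) ^ 2 * Y / K :=
        add_le_add h8 (h5.trans h7)
    _ = _ := by ring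

end

end Core

section TypeSums

lemma card_primes_dvd_le {P j g : ℕ} (hg : 0 < g) (hgP : g < P ^ (j + 1)) (S : Finset ℕ)
    (hS : ∀ p ∈ S, p.Prime ∧ P ≤ p ∧ p ∣ g) : S.card ≤ j := by
  by_contra! h
  have h1 : ∏ p ∈ S, p ∣ g := Finset.prod_primes_dvd g (fun p hp => (hS p hp).1.prime)
    fun p hp => (hS p hp).2.2
  have h2 : P ^ S.card ≤ ∏ p ∈ S, p := by
    rw [← prod_const]
    exact prod_le_prod' fun p hp => (hS p hp).2.1
  have h3 := Nat.le_of_dvd hg h1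
  rcases Nat.eq_zero_or_pos P with rfl | hP
  · simp at hgP
  have h4 : P ^ (j + 1) ≤ P ^ S.card := Nat.pow_le_pow_right hP h
  omega

/-- Replacing a weighted sum of exponential sums by a sum of phases. -/
lemma norm_sum_asum_mul_sub_le {l y Y h : ℕ} (hl : l.Prime) (hy : y ≤ Y) (c : ℕ → ℂ)
    (hc : ∀ m, ‖c m‖ ≤ 1) :
    ‖∑ m ∈ (Icc 1 y).filter (fun m => ¬ l ∣ m), c m * asum h (l * m)
      - ∑ γ ∈ (G Y).filter (fun γ => nm γ ≤ y), c (nm γ) * ∑ w ∈ roots l, ph l h w γ‖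
      ≤ 2 + 14 * h * Y / l + 4 * (Y / l + √Y) := by
  classical
  have hl0 : (0 : ℝ) < l := by exact_mod_cast hl.pos
  set A : ℕ → ℂ := fun m => if ¬ l ∣ m then c m * asum h (l * m) else 0 with hA
  set W : ℕ × ℕ → ℂ := fun γ => c (nm γ) * ∑ w ∈ roots l, ph l h w γ with hW
  have hWle : ∀ γ, ‖W γ‖ ≤ 2 := fun γ => by
    have b1 : ‖∑ w ∈ roots l, ph l h w γ‖ ≤ 2 := by
      refine (norm_sum_le _ _).trans ?_
      simp only [norm_ph, sum_const, nsmul_eq_mul, mul_one]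
      exact_mod_cast card_roots_prime_le hl
    rw [hW, norm_mul]
    calc _ ≤ 1 * (2 : ℝ) := mul_le_mul (hc _) b1 (norm_nonneg _) zero_le_one
      _ = 2 := one_mul 2
  have e1 : ∑ m ∈ (Icc 1 y).filter (fun m => ¬ l ∣ m), c m * asum h (l * m)
      = ∑ m ∈ (Icc 1 y).filter (fun m => m = 1), A m
        + ∑ m ∈ (Icc 1 y).filter (fun m => ¬ m = 1), A m := by
    rw [sum_filter_add_sum_filter_not, sum_filter]
  have hone : ‖∑ m ∈ (Icc 1 y).filter (fun m => m = 1), A m‖ ≤ 2 := by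
    rw [sum_filter, sum_ite_eq']
    split_ifs
    · simp only [hA]
      split_ifs
      · simp
      · rw [norm_mul, mul_one]
        calc _ ≤ 1 * (2 : ℝ) := mul_le_mul (hc _) ((norm_asum_le _ _).trans (by
              exact_mod_cast card_roots_prime_le hl)) (norm_nonneg _) zero_le_one
          _ = 2 := one_mul 2
    · simp
  have e2 : (Icc 1 y).filter (fun m => ¬ m = 1) = Icc 2 y := by
    ext m; simp only [mem_filter, mem_Icc]; omega
  have hmaps : ∀ γ ∈ (G Y).filter (fun γ => nm γ ≤ y), nm γ ∈ Icc 2 y := fun γ hγ => by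
    obtain ⟨hG, h1⟩ := mem_filter.1 hγ
    obtain ⟨a1, a2, -⟩ := mem_G.1 hG
    exact mem_Icc.2 ⟨two_le_nm a1 a2, h1⟩
  have hfib : ∀ m ∈ Icc 2 y, ((G Y).filter (fun γ => nm γ ≤ y)).filter (fun γ => nm γ = m)
      = (G Y).filter (fun γ => nm γ = m) := fun m hm => by
    rw [filter_filter]
    refine filter_congr fun γ _ => ⟨fun h => h.2, fun h => ⟨?_, h⟩⟩
    rw [h]; exact (mem_Icc.1 hm).2
  have e3 : ∑ γ ∈ (G Y).filter (fun γ => nm γ ≤ y), W γ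
      = ∑ m ∈ Icc 2 y, ∑ γ ∈ (G Y).filter (fun γ => nm γ = m), W γ := by
    rw [← sum_fiberwise_of_maps_to hmaps]
    exact Finset.sum_congr rfl fun m hm => by rw [hfib m hm]
  have hterm : ∀ m ∈ Icc 2 y, ‖A m - ∑ γ ∈ (G Y).filter (fun γ => nm γ = m), W γ‖
      ≤ ((G Y).filter (fun γ => nm γ = m)).card * (14 * (h : ℝ) / l)
        + 2 * ((G Y).filter fun γ => nm γ = m ∧ l ∣ nm γ).card := by
    intro m hm
    obtain ⟨m1, m2⟩ := mem_Icc.1 hm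
    by_cases hlm : l ∣ m
    · have : A m = 0 := by simp only [hA]; rw [if_neg (not_not.2 hlm)]
      rw [this, zero_sub, norm_neg]
      have h1 : ‖∑ γ ∈ (G Y).filter (fun γ => nm γ = m), W γ‖
          ≤ 2 * ((G Y).filter fun γ => nm γ = m ∧ l ∣ nm γ).card := by
        refine (norm_sum_le_of_le _ fun γ _ => hWle γ).trans_eq ?_
        rw [sum_const, nsmul_eq_mul, mul_comm]
        congr 3
        refine filter_congr fun γ _ => ⟨fun h => ⟨h, h ▸ hlm⟩, fun h => h.1⟩
      have h2 : (0 : ℝ) ≤ ((G Y).filter (fun γ => nm γ = m)).card * (14 * (h : ℝ) / l) := by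
        positivity
      linarith
    · have h1 : A m = c m * asum h (l * m) := by simp only [hA]; rw [if_pos hlm]
      have h2 : ∑ γ ∈ (G Y).filter (fun γ => nm γ = m), W γ
          = c m * ∑ γ ∈ (G Y).filter (fun γ => nm γ = m), ∑ w ∈ roots l, ph l h w γ := by
        rw [mul_sum]
        refine Finset.sum_congr rfl fun γ hγ => ?_
        simp only [hW]; rw [(mem_filter.1 hγ).2]
      rw [h1, h2, ← mul_sub, norm_mul]
      have h3 := norm_asum_mul_prime_sub_le h hl m1 (m2.trans hy) hlm
      have h4 : (0 : ℝ) ≤ 2 * ((G Y).filter fun γ => nm γ = m ∧ l ∣ nm γ).card := by positivity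
      have h5 := mul_le_mul (hc m) h3 (norm_nonneg _) zero_le_one
      linarith
  rw [e1, e2, e3, add_sub_assoc, ← sum_sub_distrib]
  refine (norm_add_le _ _).trans ?_
  have h6 := (norm_sum_le _ _).trans (sum_le_sum hterm)
  rw [sum_add_distrib, ← sum_mul, ← mul_sum, ← Nat.cast_sum, ← Nat.cast_sum] at h6
  have h7 : ∑ m ∈ Icc 2 y, ((G Y).filter (fun γ => nm γ = m)).card ≤ Y := by
    rw [Finset.sum_congr rfl fun m hm => by rw [← hfib m hm], ← card_eq_sum_card_fiberwise hmaps]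
    exact (card_filter_le _ _).trans (card_G_le Y)
  have h8 : ∑ m ∈ Icc 2 y, ((G Y).filter fun γ => nm γ = m ∧ l ∣ nm γ).card
      ≤ 2 * (Nat.sqrt Y * (Nat.sqrt Y / l + 1)) := by
    refine le_trans ?_ ((card_G_dvd_le Y l hl.pos).trans
      (Nat.mul_le_mul_right _ (card_roots_prime_le hl)))
    have hm2 : ∀ γ ∈ (G Y).filter (fun γ => nm γ ≤ y ∧ l ∣ nm γ), nm γ ∈ Icc 2 y :=
      fun γ hγ => hmaps γ (mem_filter.2 ⟨(mem_filter.1 hγ).1, (mem_filter.1 hγ).2.1⟩)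
    calc ∑ m ∈ Icc 2 y, ((G Y).filter fun γ => nm γ = m ∧ l ∣ nm γ).card
        = ((G Y).filter (fun γ => nm γ ≤ y ∧ l ∣ nm γ)).card := by
          rw [card_eq_sum_card_fiberwise hm2]
          refine Finset.sum_congr rfl fun m hm => ?_
          rw [filter_filter]
          congr 1
          refine filter_congr fun γ _ => ⟨fun h => ⟨⟨?_, h.2⟩, h.1⟩, fun h => ⟨h.2, h.1.2⟩⟩
          rw [h.1]; exact (mem_Icc.1 hm).2
      _ ≤ _ := card_le_card (monotone_filter_right _ fun γ _ h => h.2)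
  have h9 : ((Nat.sqrt Y * (Nat.sqrt Y / l + 1) : ℕ) : ℝ) ≤ Y / l + √Y := by
    have s1 : (Nat.sqrt Y : ℝ) ≤ √Y := Real.nat_sqrt_le_real_sqrt
    have s2 : ((Nat.sqrt Y / l : ℕ) : ℝ) ≤ Nat.sqrt Y / l := Nat.cast_div_le
    push_cast
    calc (Nat.sqrt Y : ℝ) * ((Nat.sqrt Y / l : ℕ) + 1) ≤ √Y * (√Y / l + 1) := by
          gcongr; exact s2.trans (by gcongr)
      _ = (√Y * √Y) / l + √Y := by ring
      _ = _ := by rw [Real.mul_self_sqrt (Nat.cast_nonneg _)]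
  have h10 : ((∑ m ∈ Icc 2 y, ((G Y).filter (fun γ => nm γ = m)).card : ℕ) : ℝ)
      * (14 * (h : ℝ) / l) ≤ 14 * h * Y / l := by
    have : ((∑ m ∈ Icc 2 y, ((G Y).filter (fun γ => nm γ = m)).card : ℕ) : ℝ) ≤ Y := by
      exact_mod_cast h7
    calc _ ≤ (Y : ℝ) * (14 * (h : ℝ) / l) := by gcongr
      _ = _ := by ring
  have h11 : ((∑ m ∈ Icc 2 y, ((G Y).filter fun γ => nm γ = m ∧ l ∣ nm γ).card : ℕ) : ℝ)
      ≤ 2 * (Nat.sqrt Y * (Nat.sqrt Y / l + 1) : ℕ) := by exact_mod_cast h8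
  linarith

/-- The primes in a dyadic block. -/
def block (P : ℕ) : Finset ℕ := (Ico P (2 * P)).filter Nat.Prime

lemma mem_block {P p : ℕ} : p ∈ block P ↔ p.Prime ∧ P ≤ p ∧ p < 2 * P := by
  simp only [block, mem_filter, mem_Ico]; tauto

lemma card_block_le (P : ℕ) : (block P).card ≤ P := by
  refine (card_filter_le _ _).trans ?_
  rw [Nat.card_Ico]; omega

/-- The total cost of replacing exponential sums by phases over a block. -/
lemma sum_block_error_le {P X K h : ℕ} (S : Finset ℕ) (hS : S ⊆ block P) (hP : 0 < P)
    (hK : 0 < K) (hh : 0 < h) (hhP : h * K ≤ P) (hX : P * K ^ 2 ≤ X) :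
    ∑ l ∈ S, (2 + 14 * (h : ℝ) * (X / P : ℕ) / l + 4 * ((X / P : ℕ) / l + √(X / P : ℕ)))
      ≤ 24 * X / K := by
  have hP0 : (0 : ℝ) < P := by exact_mod_cast hP
  have hK0 : (0 : ℝ) < K := by exact_mod_cast hK
  have hh1 : (1 : ℝ) ≤ h := by exact_mod_cast hh
  have hK1 : (1 : ℝ) ≤ K := by exact_mod_cast hK
  have hY : ((X / P : ℕ) : ℝ) ≤ X / P := Nat.cast_div_le
  have h1 : ∀ l ∈ S, (2 + 14 * (h : ℝ) * (X / P : ℕ) / l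
      + 4 * ((X / P : ℕ) / l + √(X / P : ℕ)))
      ≤ 2 + 14 * (h : ℝ) * (X / P) / P + 4 * ((X / P : ℝ) / P + √(X / P)) := by
    intro l hl
    have : (P : ℝ) ≤ l := by exact_mod_cast (mem_block.1 (hS hl)).2.1
    gcongr
  refine (sum_le_sum h1).trans ?_
  rw [sum_const, nsmul_eq_mul]
  have hc : (S.card : ℝ) ≤ P := by exact_mod_cast (card_le_card hS).trans (card_block_le P)
  have hPX : (P : ℝ) * K ^ 2 ≤ X := by exact_mod_cast hX
  have hhP' : (h : ℝ) * K ≤ P := by exact_mod_cast hhP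
  have a1 : (P : ℝ) ≤ X / K := by
    rw [le_div_iff₀ hK0]
    calc (P : ℝ) * K = P * (K * 1) := by ring
      _ ≤ P * (K * K) := by gcongr
      _ = P * (K : ℝ) ^ 2 := by ring
      _ ≤ X := hPX
  have a2 : (h : ℝ) * X / P ≤ X / K := by
    rw [div_le_div_iff₀ hP0 hK0]
    calc (h : ℝ) * X * K = X * (h * K) := by ring
      _ ≤ X * P := by gcongr
  have a3 : (X : ℝ) / P ≤ X / K := le_trans (by gcongr; nlinarith [Nat.cast_nonneg (α := ℝ) X]) a2
  have a4 : (P : ℝ) * √(X / P) ≤ X / K := by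
    rw [le_div_iff₀ hK0]
    have : √((X : ℝ) / P) * (K * √P) ≤ √(X / P) * √X := by
      gcongr
      rw [Real.le_sqrt (by positivity) (by positivity), mul_pow, Real.sq_sqrt hP0.le]
      linarith
    have e1 : √((X : ℝ) / P) * √P = √X := by
      rw [Real.sqrt_div (by positivity), div_mul_cancel₀ _ (by positivity)]
    have e2 : (P : ℝ) = √P * √P := (Real.mul_self_sqrt hP0.le).symm
    calc (P : ℝ) * √(X / P) * K = √P * (√(X / P) * (K * √P)) := by
          nth_rewrite 1 [e2]; ring
      _ ≤ √P * (√(X / P) * √X) := by gcongr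
      _ = (√(X / P) * √P) * √X := by ring
      _ = X := by rw [e1, Real.mul_self_sqrt (Nat.cast_nonneg _)]
  calc (S.card : ℝ) * (2 + 14 * (h : ℝ) * (X / P) / P + 4 * ((X / P : ℝ) / P + √(X / P)))
      ≤ P * (2 + 14 * (h : ℝ) * (X / P) / P + 4 * ((X / P : ℝ) / P + √(X / P))) := by
        gcongr
    _ = 2 * P + 14 * (h * X / P) + 4 * (X / P) + 4 * (P * √(X / P)) := by field_simp; ring
    _ ≤ 2 * (X / K) + 14 * (X / K) + 4 * (X / K) + 4 * (X / K) := by gcongr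
    _ = _ := by ring

end TypeSums

section BlockSums

lemma card_sigma_roots_dvd_le {P j g : ℕ} (hg : 0 < g) (hgP : g < P ^ (j + 1)) {S : Finset ℕ}
    (hS : S ⊆ block P) :
    ((S.sigma roots).filter fun κ => κ.1 ∣ g).card ≤ 2 * j := by
  have h1 : ((S.sigma roots).filter fun κ => κ.1 ∣ g) ⊆ (S.filter (· ∣ g)).sigma roots := by
    intro κ hκ
    obtain ⟨a, b⟩ := mem_filter.1 hκ
    obtain ⟨c, d⟩ := mem_sigma.1 a
    exact mem_sigma.2 ⟨mem_filter.2 ⟨c, b⟩, d⟩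
  refine (card_le_card h1).trans ?_
  rw [card_sigma]
  calc ∑ p ∈ S.filter (· ∣ g), (roots p).card ≤ ∑ p ∈ S.filter (· ∣ g), 2 :=
        sum_le_sum fun p hp => card_roots_prime_le (mem_block.1 (hS (mem_filter.1 hp).1)).1
    _ = 2 * (S.filter (· ∣ g)).card := by rw [sum_const, smul_eq_mul, mul_comm]
    _ ≤ 2 * j := Nat.mul_le_mul_left _ (card_primes_dvd_le hg hgP _ fun p hp => by
        obtain ⟨a, b⟩ := mem_filter.1 hp
        exact ⟨(mem_block.1 (hS a)).1, (mem_block.1 (hS a)).2.1, b⟩)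

lemma card_sigma_roots_le {P : ℕ} {S : Finset ℕ} (hS : S ⊆ block P) :
    (S.sigma roots).card ≤ 2 * P := by
  rw [card_sigma]
  calc ∑ p ∈ S, (roots p).card ≤ ∑ p ∈ S, 2 :=
        sum_le_sum fun p hp => card_roots_prime_le (mem_block.1 (hS hp)).1
    _ = 2 * S.card := by rw [sum_const, smul_eq_mul, mul_comm]
    _ ≤ 2 * P := Nat.mul_le_mul_left _ ((card_le_card hS).trans (card_block_le P))

lemma ph_one_zero (γ : ℕ × ℕ) : ph 1 0 0 γ = 1 := by
  simp [ph, eZ, ee_zero]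

lemma mem_roots_dvd {n w : ℕ} (hw : w ∈ roots n) : n ∣ w ^ 2 + 1 := (mem_filter.1 hw).2

/-- Linear sums over a block of primes. -/
theorem sum_norm_linear_le {P X K b h : ℕ} (hK : 2 ≤ K) (hb : 0 < b) (hbK : b ≤ K) (hh : 0 < h)
    (hhK : h ≤ K) (hKP : K ^ 168 ≤ P) (hPX : P ^ 2 * K ^ 84 ≤ X) :
    ∑ p ∈ block P, ‖∑ m ∈ (Icc 1 (X / p)).filter (fun m => ¬ p ∣ m),
      (if b ∣ m then 1 else 0) * asum h (p * m)‖ ≤ 2 ^ 20 * (X : ℝ) / K := by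
  classical
  have hK1 : 1 ≤ K := by omega
  have hP : 0 < P := (pow_pos hK1 _).trans_le hKP
  have hKpow : ∀ {i : ℕ}, i ≤ 168 → K ^ i ≤ P := fun hi =>
    (Nat.pow_le_pow_right hK1 hi).trans hKP
  have hP9 : 9 ≤ P := by
    have : 2 ^ 4 ≤ K ^ 4 := Nat.pow_le_pow_left hK 4
    have := hKpow (i := 4) (by norm_num)
    omega
  set Z := Nat.sqrt P with hZ
  set Y := X / P with hY
  have hZP : Z ^ 2 ≤ P := Nat.sqrt_le' P
  have hZ0 : 0 < Z := Nat.sqrt_pos.2 hP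
  have hPZ : P ≤ 4 * Z ^ 2 := by
    have h1 : P < (Z + 1) ^ 2 := Nat.lt_succ_sqrt' P
    have h2 : (Z + 1) ^ 2 ≤ (2 * Z) ^ 2 := Nat.pow_le_pow_left (by omega) 2
    linarith [mul_pow 2 Z 2]
  have hyY : ∀ p ∈ block P, X / p ≤ Y := fun p hp =>
    Nat.div_le_div_left (mem_block.1 hp).2.1 hP
  have H : Moduli (fun κ : (_ : ℕ) × ℕ => κ.1) (fun κ => κ.2) (fun _ => 1) (fun _ => 0) Z 4 h
      ((block P).sigma roots) := by
    refine ⟨fun κ hκ => (mem_block.1 (mem_sigma.1 hκ).1).1, fun _ _ => .inr rfl,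
      fun κ hκ => mem_roots_dvd (mem_sigma.1 hκ).2, fun _ _ => one_dvd _, fun κ hκ => ?_,
      fun κ hκ => ?_, ?_, fun g hg hgZ => ?_⟩
    · have h1 := (mem_block.1 (mem_sigma.1 hκ).1).2.1
      intro h2
      have h3 := Nat.le_of_dvd hh (Int.natCast_dvd_natCast.1 h2)
      have h4 : K ^ 2 ≤ P := hKpow (by norm_num)
      have h5 : 2 * K ≤ K ^ 2 := by rw [pow_two]; exact Nat.mul_le_mul_right _ hK
      omega
    · have h1 := (mem_block.1 (mem_sigma.1 hκ).1).2.2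
      simp only [mul_one]; omega
    · have := card_sigma_roots_le (subset_refl (block P))
      omega
    · refine (card_le_card ?_).trans (card_sigma_roots_dvd_le (P := P) (j := 2) hg ?_
        (subset_refl _))
      · exact monotone_filter_right _ fun κ _ h => h.1
      · calc g ≤ 8 * (Z ^ 2) ^ 2 := by rw [← pow_mul]; exact hgZ
          _ ≤ 8 * P ^ 2 := Nat.mul_le_mul_left _ (Nat.pow_le_pow_left hZP 2)
          _ < 9 * P ^ 2 := Nat.mul_lt_mul_of_pos_right (by norm_num) (by positivity)
          _ ≤ P * P ^ 2 := Nat.mul_le_mul_right _ hP9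
          _ = P ^ (2 + 1) := by ring
  have hcore := H.sum_norm_sum_le 0 hK hb hbK
    (fun κ hκ => hKP.trans (mem_block.1 (mem_sigma.1 hκ).1).2.1) (fun _ _ => .inl rfl)
    (Nat.le_sqrt'.2 (by rw [← pow_mul]; exact hKpow (by norm_num)))
    ((Nat.le_div_iff_mul_le hP).2 (by
      calc Z ^ 2 * K ^ 84 * P ≤ P * K ^ 84 * P := by gcongr
        _ = P ^ 2 * K ^ 84 := by ring
        _ ≤ X := hPX)) (fun κ => X / κ.1) (fun κ hκ => hyY _ (mem_sigma.1 hκ).1)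
  rw [sum_sigma] at hcore
  have hterm : ∀ p ∈ block P, ‖∑ m ∈ (Icc 1 (X / p)).filter (fun m => ¬ p ∣ m),
      (if b ∣ m then 1 else 0) * asum h (p * m)‖
      ≤ ∑ w ∈ roots p, ‖∑ γ ∈ (G Y).filter (fun γ => nm γ ≤ X / p ∧ b ∣ nm γ),
        ph p h w γ * ph 1 0 0 γ‖
        + (2 + 14 * (h : ℝ) * Y / p + 4 * ((Y : ℝ) / p + √Y)) := by
    intro p hp
    have h1 := norm_sum_asum_mul_sub_le (h := h) (mem_block.1 hp).1 (hyY p hp)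
      (fun m => if b ∣ m then 1 else 0) (fun m => by split_ifs <;> simp)
    have h2 : ∑ γ ∈ (G Y).filter (fun γ => nm γ ≤ X / p),
        (if b ∣ nm γ then 1 else 0) * ∑ w ∈ roots p, ph p h w γ
        = ∑ w ∈ roots p, ∑ γ ∈ (G Y).filter (fun γ => nm γ ≤ X / p ∧ b ∣ nm γ),
          ph p h w γ * ph 1 0 0 γ := by
      rw [sum_comm, ← filter_filter, sum_filter (fun γ => b ∣ nm γ)]
      refine Finset.sum_congr rfl fun γ _ => ?_
      simp only [ph_one_zero, mul_one, ite_mul, one_mul, zero_mul]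
    rw [h2] at h1
    have h3 := norm_le_norm_add_norm_sub
      (∑ w ∈ roots p, ∑ γ ∈ (G Y).filter (fun γ => nm γ ≤ X / p ∧ b ∣ nm γ),
          ph p h w γ * ph 1 0 0 γ) (∑ m ∈ (Icc 1 (X / p)).filter (fun m => ¬ p ∣ m),
      (if b ∣ m then 1 else 0) * asum h (p * m))
    rw [norm_sub_rev] at h1
    have h4 := norm_sum_le (roots p) fun w =>
      ∑ γ ∈ (G Y).filter (fun γ => nm γ ≤ X / p ∧ b ∣ nm γ), ph p h w γ * ph 1 0 0 γ
    linarith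
  refine (sum_le_sum hterm).trans ?_
  rw [sum_add_distrib]
  have herr := sum_block_error_le (X := X) (block P) (subset_refl _) hP hK1 hh (by
      calc h * K ≤ K * K := by gcongr
        _ = K ^ 2 := by ring
        _ ≤ P := hKpow (by norm_num)) (by
      calc P * K ^ 2 ≤ P ^ 2 * K ^ 84 :=
            Nat.mul_le_mul (Nat.le_self_pow (by norm_num) _)
              (Nat.pow_le_pow_right hK1 (by norm_num))
        _ ≤ X := hPX)
  have hZY : (Z : ℝ) ^ 2 * Y ≤ X := by
    have : Z ^ 2 * Y ≤ X := (Nat.mul_le_mul_right _ hZP).trans (Nat.mul_div_le X P)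
    exact_mod_cast this
  have hfin : 2 ^ 17 * (1 + (4 : ℕ)) * (Z : ℝ) ^ 2 * Y / K ≤ 2 ^ 17 * 5 * (X : ℝ) / K := by
    push_cast
    have : 2 ^ 17 * (1 + 4) * (Z : ℝ) ^ 2 * Y = 2 ^ 17 * 5 * ((Z : ℝ) ^ 2 * Y) := by ring
    rw [this]
    gcongr
  have hX0 : 0 ≤ (X : ℝ) / K := by positivity
  calc _ ≤ 2 ^ 17 * 5 * (X : ℝ) / K + 24 * X / K := add_le_add (hcore.trans hfin) herr
    _ = (2 ^ 17 * 5 + 24) * ((X : ℝ) / K) := by ring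
    _ ≤ 2 ^ 20 * ((X : ℝ) / K) := by gcongr; norm_num
    _ = _ := by ring

lemma conj_ph {l : ℕ} (hl : 0 < l) (h : ℤ) (w : ℕ) (γ : ℕ × ℕ) :
    (starRingEnd ℂ) (ph l h w γ) = ph l (-h) w γ := by
  have : NeZero l := ⟨hl.ne'⟩
  rw [ph, ph, eZ_eq_psi, eZ_eq_psi, ← AddChar.map_neg_eq_conj]
  congr 1; push_cast; ring

/-- The inequality of Cauchy and Schwarz, expanding the square. -/
lemma sq_norm_sum_sum_le {α β : Type*} (S : Finset α) (T : Finset β) (c : α → ℂ)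
    (hc : ∀ a, ‖c a‖ ≤ 1) (f : β → α → ℂ) :
    ‖∑ a ∈ S, c a * ∑ t ∈ T, f t a‖ ^ 2
      ≤ S.card * ∑ x ∈ T ×ˢ T, ‖∑ a ∈ S, f x.1 a * (starRingEnd ℂ) (f x.2 a)‖ := by
  have h1 : ‖∑ a ∈ S, c a * ∑ t ∈ T, f t a‖ ≤ ∑ a ∈ S, ‖∑ t ∈ T, f t a‖ := by
    refine norm_sum_le_of_le _ fun a _ => ?_
    rw [norm_mul]
    exact mul_le_of_le_one_left (norm_nonneg _) (hc a)
  have h2 : (∑ a ∈ S, ‖∑ t ∈ T, f t a‖) ^ 2 ≤ S.card * ∑ a ∈ S, ‖∑ t ∈ T, f t a‖ ^ 2 :=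
    sq_sum_le_card_mul_sum_sq
  refine (pow_le_pow_left₀ (norm_nonneg _) h1 2).trans (h2.trans ?_)
  gcongr
  have h3 : ((∑ a ∈ S, ‖∑ t ∈ T, f t a‖ ^ 2 : ℝ) : ℂ)
      = ∑ x ∈ T ×ˢ T, ∑ a ∈ S, f x.1 a * (starRingEnd ℂ) (f x.2 a) := by
    rw [sum_comm]
    push_cast
    refine Finset.sum_congr rfl fun a _ => ?_
    rw [← Complex.mul_conj', map_sum, sum_mul_sum, sum_product]
  calc ∑ a ∈ S, ‖∑ t ∈ T, f t a‖ ^ 2 ≤ ‖((∑ a ∈ S, ‖∑ t ∈ T, f t a‖ ^ 2 : ℝ) : ℂ)‖ := by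
        rw [Complex.norm_real]; exact Real.le_norm_self _
    _ ≤ _ := by rw [h3]; exact norm_sum_le _ _

/-- Bilinear sums over a block of primes. -/
theorem norm_sum_bilinear_le {P X K h : ℕ} (hK : 2 ≤ K) (hh : 0 < h) (hhK : h ≤ K)
    (hKP : K ^ 168 ≤ P) (hPX : P ^ 3 * K ^ 84 ≤ X) {S : Finset ℕ} (hS : S ⊆ block P)
    (c : ℕ → ℂ) (hc : ∀ m, ‖c m‖ ≤ 1) :
    ‖∑ l ∈ S, ∑ m ∈ (Icc 1 (X / l)).filter (fun m => ¬ l ∣ m), c m * asum h (l * m)‖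
      ≤ 2 ^ 13 * (X : ℝ) / √K := by
  classical
  have hK1 : 1 ≤ K := by omega
  have hK0 : (0 : ℝ) < K := by exact_mod_cast hK1
  have hP : 0 < P := (pow_pos hK1 _).trans_le hKP
  have hKpow : ∀ {i : ℕ}, i ≤ 168 → K ^ i ≤ P := fun hi =>
    (Nat.pow_le_pow_right hK1 hi).trans hKP
  have hP9 : 9 ≤ P := by
    have : 2 ^ 4 ≤ K ^ 4 := Nat.pow_le_pow_left hK 4
    have := hKpow (i := 4) (by norm_num)
    omega
  have hP2 : P ^ 2 * K ^ 84 ≤ X / P := (Nat.le_div_iff_mul_le hP).2 (by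
      calc P ^ 2 * K ^ 84 * P = P ^ 3 * K ^ 84 := by ring
        _ ≤ X := hPX)
  set Y := X / P with hY
  have hyY : ∀ p ∈ S, X / p ≤ Y := fun p hp =>
    Nat.div_le_div_left (mem_block.1 (hS hp)).2.1 hP
  set T := S.sigma roots with hT
  have hTP : ∀ κ ∈ T, κ.1.Prime ∧ P ≤ κ.1 ∧ κ.1 < 2 * P := fun κ hκ =>
    mem_block.1 (hS (mem_sigma.1 hκ).1)
  have hTcard : T.card ≤ 2 * P := card_sigma_roots_le hS
  set f : (_ : ℕ) × ℕ → ℕ × ℕ → ℂ := fun κ γ =>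
    if nm γ ≤ X / κ.1 then ph κ.1 h κ.2 γ else 0 with hf
  set M := ∑ γ ∈ G Y, c (nm γ) * ∑ κ ∈ T, f κ γ with hM
  have hdiff : ‖∑ l ∈ S, ∑ m ∈ (Icc 1 (X / l)).filter (fun m => ¬ l ∣ m), c m * asum h (l * m)
      - M‖ ≤ 24 * X / K := by
    have e1 : M = ∑ l ∈ S, ∑ γ ∈ (G Y).filter (fun γ => nm γ ≤ X / l),
        c (nm γ) * ∑ w ∈ roots l, ph l h w γ := by
      rw [hM]
      simp only [hT, sum_sigma, mul_sum]
      rw [sum_comm]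
      refine Finset.sum_congr rfl fun l _ => ?_
      rw [sum_filter]
      refine Finset.sum_congr rfl fun γ _ => ?_
      simp only [hf]
      split_ifs <;> simp
    rw [e1, ← sum_sub_distrib]
    refine (norm_sum_le_of_le _ fun l hl => norm_sum_asum_mul_sub_le (mem_block.1 (hS hl)).1
      (hyY l hl) c hc).trans ?_
    refine sum_block_error_le S hS hP hK1 hh (by
      calc h * K ≤ K * K := by gcongr
        _ = K ^ 2 := by ring
        _ ≤ P := hKpow (by norm_num)) (by
      calc P * K ^ 2 ≤ P ^ 3 * K ^ 84 :=
            Nat.mul_le_mul (Nat.le_self_pow (by norm_num) _)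
              (Nat.pow_le_pow_right hK1 (by norm_num))
        _ ≤ X := hPX)
  have hMsq : ‖M‖ ^ 2 ≤ 2 ^ 24 * (X : ℝ) ^ 2 / K := by
    have hcs := sq_norm_sum_sum_le (G Y) T (fun γ => c (nm γ)) (fun γ => hc _) f
    have hexp : ∀ x ∈ T ×ˢ T, ∑ γ ∈ G Y, f x.1 γ * (starRingEnd ℂ) (f x.2 γ)
        = ∑ γ ∈ (G Y).filter (fun γ => nm γ ≤ min (X / x.1.1) (X / x.2.1) ∧ 1 ∣ nm γ),
          ph x.1.1 h x.1.2 γ * ph x.2.1 (-h) x.2.2 γ := by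
      intro x hx
      rw [sum_filter]
      refine Finset.sum_congr rfl fun γ _ => ?_
      simp only [hf, le_min_iff, one_dvd, and_true, ite_and]
      have := (hTP _ (mem_product.1 hx).2).1.pos
      split_ifs <;> simp [conj_ph this]
    have hsum : ∑ x ∈ T ×ˢ T, ‖∑ γ ∈ G Y, f x.1 γ * (starRingEnd ℂ) (f x.2 γ)‖
        = ∑ x ∈ T ×ˢ T, ‖∑ γ ∈ (G Y).filter
          (fun γ => nm γ ≤ min (X / x.1.1) (X / x.2.1) ∧ 1 ∣ nm γ),
          ph x.1.1 h x.1.2 γ * ph x.2.1 (-h) x.2.2 γ‖ :=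
      Finset.sum_congr rfl fun x hx => by rw [hexp x hx]
    rw [hsum] at hcs
    have hGY : ((G Y).card : ℝ) ≤ Y := by exact_mod_cast card_G_le Y
    have H : Moduli (fun κ : ((_ : ℕ) × ℕ) × ((_ : ℕ) × ℕ) => κ.1.1) (fun κ => κ.1.2)
        (fun κ => κ.2.1) (fun κ => κ.2.2) P 64 h
        ((T ×ˢ T).filter fun κ => κ.1.1 ≠ κ.2.1) := by
      have hm : ∀ κ ∈ (T ×ˢ T).filter (fun κ => κ.1.1 ≠ κ.2.1), κ.1 ∈ T ∧ κ.2 ∈ T :=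
        fun κ hκ => mem_product.1 (mem_filter.1 hκ).1
      refine ⟨fun κ hκ => (hTP _ (hm κ hκ).1).1, fun κ hκ => .inl (hTP _ (hm κ hκ).2).1,
        fun κ hκ => mem_roots_dvd (mem_sigma.1 (hm κ hκ).1).2,
        fun κ hκ => mem_roots_dvd (mem_sigma.1 (hm κ hκ).2).2, fun κ hκ => ?_,
        fun κ hκ => ?_, ?_, fun g hg hgZ => ?_⟩
      · have h1 := (hTP _ (hm κ hκ).1).2.1
        intro h2
        have h3 := Nat.le_of_dvd hh (Int.natCast_dvd_natCast.1 h2)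
        have h4 : K ^ 2 ≤ P := hKpow (by norm_num)
        have h5 : 2 * K ≤ K ^ 2 := by rw [pow_two]; exact Nat.mul_le_mul_right _ hK
        omega
      · calc κ.1.1 * κ.2.1 ≤ (2 * P) * (2 * P) :=
              Nat.mul_le_mul (hTP _ (hm κ hκ).1).2.2.le (hTP _ (hm κ hκ).2).2.2.le
          _ ≤ 16 * P ^ 2 := by rw [pow_two]; linarith [Nat.zero_le (P * P)]
      · calc ((T ×ˢ T).filter fun κ => κ.1.1 ≠ κ.2.1).card ≤ (T ×ˢ T).card := card_filter_le _ _
          _ = T.card * T.card := card_product _ _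
          _ ≤ (2 * P) * (2 * P) := Nat.mul_le_mul hTcard hTcard
          _ ≤ 64 * P ^ 2 := by rw [pow_two]; linarith [Nat.zero_le (P * P)]
      · have hgP : g < P ^ (4 + 1) := by
          calc g ≤ 8 * P ^ 4 := hgZ
            _ < 9 * P ^ 4 := Nat.mul_lt_mul_of_pos_right (by norm_num) (by positivity)
            _ ≤ P * P ^ 4 := Nat.mul_le_mul_right _ hP9
            _ = P ^ (4 + 1) := by ring
        have hd := card_sigma_roots_dvd_le hg hgP hS
        calc _ ≤ ((T.filter fun κ => κ.1 ∣ g) ×ˢ (T.filter fun κ => κ.1 ∣ g)).card := by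
              refine card_le_card fun κ hκ => ?_
              obtain ⟨a, b, d⟩ := mem_filter.1 hκ
              exact mem_product.2 ⟨mem_filter.2 ⟨(hm κ a).1, b⟩, mem_filter.2 ⟨(hm κ a).2, d⟩⟩
          _ ≤ (2 * 4) * (2 * 4) := by rw [card_product]; exact Nat.mul_le_mul hd hd
          _ = 64 := rfl
    have hmem : ∀ κ ∈ (T ×ˢ T).filter (fun κ => κ.1.1 ≠ κ.2.1), κ.1 ∈ T ∧ κ.2 ∈ T :=
      fun κ hκ => mem_product.1 (mem_filter.1 hκ).1
    have hcore := H.sum_norm_sum_le (-h) hK one_pos hK1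
      (fun κ hκ => hKP.trans (hTP _ (hmem κ hκ).1).2.1)
      (fun κ hκ => .inr ((hKpow (by norm_num)).trans (hTP _ (hmem κ hκ).2).2.1))
      (hKpow (by norm_num)) hP2
      (fun κ => min (X / κ.1.1) (X / κ.2.1)) (fun κ hκ =>
        (min_le_left _ _).trans (hyY _ (mem_sigma.1 (hmem κ hκ).1).1))
    have hdiag : ∑ x ∈ (T ×ˢ T).filter (fun κ => ¬ κ.1.1 ≠ κ.2.1),
        ‖∑ γ ∈ (G Y).filter (fun γ => nm γ ≤ min (X / x.1.1) (X / x.2.1) ∧ 1 ∣ nm γ),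
          ph x.1.1 h x.1.2 γ * ph x.2.1 (-h) x.2.2 γ‖ ≤ 4 * P * (Y : ℝ) := by
      have hcard : ((T ×ˢ T).filter (fun κ => ¬ κ.1.1 ≠ κ.2.1)).card ≤ 4 * P := by
        have : ((T ×ˢ T).filter (fun κ => ¬ κ.1.1 ≠ κ.2.1))
            ⊆ T.biUnion fun x => (roots x.1).image fun w => (x, (⟨x.1, w⟩ : (_ : ℕ) × ℕ)) := by
          rintro ⟨x, ⟨y1, y2⟩⟩ hx
          obtain ⟨hx1, hx2⟩ := mem_filter.1 hx
          obtain ⟨hx3, hx4⟩ := mem_product.1 hx1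
          have hx5 : x.1 = y1 := not_not.1 hx2
          subst hx5
          exact mem_biUnion.2 ⟨x, hx3, mem_image.2 ⟨y2, (mem_sigma.1 hx4).2, rfl⟩⟩
        refine (card_le_card this).trans (card_biUnion_le.trans ?_)
        calc _ ≤ ∑ x ∈ T, 2 := sum_le_sum fun x hx =>
              card_image_le.trans (card_roots_prime_le (hTP x hx).1)
          _ = T.card * 2 := by rw [sum_const, smul_eq_mul]
          _ ≤ 4 * P := by omega
      have hone : ∀ x ∈ (T ×ˢ T).filter (fun κ => ¬ κ.1.1 ≠ κ.2.1),
          ‖∑ γ ∈ (G Y).filter (fun γ => nm γ ≤ min (X / x.1.1) (X / x.2.1) ∧ 1 ∣ nm γ),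
          ph x.1.1 h x.1.2 γ * ph x.2.1 (-h) x.2.2 γ‖ ≤ (Y : ℝ) := by
        intro x _
        refine (norm_sum_le_of_le _ fun γ _ => (by rw [norm_mul, norm_ph, norm_ph, mul_one] :
          _ ≤ (1 : ℝ))).trans ?_
        rw [sum_const, nsmul_eq_mul, mul_one]
        exact le_trans (by exact_mod_cast card_filter_le _ _) hGY
      refine (sum_le_sum hone).trans ?_
      rw [sum_const, nsmul_eq_mul]
      have : (((T ×ˢ T).filter (fun κ => ¬ κ.1.1 ≠ κ.2.1)).card : ℝ) ≤ 4 * P := by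
        exact_mod_cast hcard
      gcongr
    have hPY : (P : ℝ) * Y ≤ X := by exact_mod_cast Nat.mul_div_le X P
    have hKP' : (K : ℝ) ≤ P := by exact_mod_cast (pow_one K ▸ hKpow (i := 1) (by norm_num))
    rw [← sum_filter_add_sum_filter_not (T ×ˢ T) (fun κ => κ.1.1 ≠ κ.2.1)] at hcs
    have hP0 : (0 : ℝ) < P := by exact_mod_cast hP
    calc ‖M‖ ^ 2 ≤ (Y : ℝ) * (2 ^ 17 * (1 + (64 : ℕ)) * (P : ℝ) ^ 2 * Y / K + 4 * P * Y) := by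
          refine hcs.trans ?_
          gcongr
      _ = 2 ^ 17 * 65 * ((P : ℝ) * Y) ^ 2 / K + 4 * ((P : ℝ) * Y) ^ 2 / P := by
          push_cast; field_simp; ring
      _ ≤ 2 ^ 17 * 65 * (X : ℝ) ^ 2 / K + 4 * (X : ℝ) ^ 2 / K := by gcongr
      _ = (2 ^ 17 * 65 + 4) * ((X : ℝ) ^ 2 / K) := by ring
      _ ≤ 2 ^ 24 * ((X : ℝ) ^ 2 / K) := by gcongr; norm_num
      _ = _ := by ring
  have hMle : ‖M‖ ≤ 2 ^ 12 * (X : ℝ) / √K := by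
    refine abs_le_of_sq_le_sq' ?_ (by positivity) |>.2
    rw [div_pow, Real.sq_sqrt hK0.le]
    calc _ ≤ _ := hMsq
      _ = _ := by ring
  have hKs : 24 * (X : ℝ) / K ≤ 24 * X / √K := by
    gcongr
    rw [Real.sqrt_le_left (by positivity)]
    have : (1 : ℝ) ≤ K := by exact_mod_cast hK1
    nlinarith
  have h3 := norm_le_norm_add_norm_sub M (∑ l ∈ S, ∑ m ∈ (Icc 1 (X / l)).filter
    (fun m => ¬ l ∣ m), c m * asum h (l * m))
  rw [norm_sub_rev] at hdiff
  calc _ ≤ 2 ^ 12 * (X : ℝ) / √K + 24 * X / √K := by linarith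
    _ = (2 ^ 12 + 24) * ((X : ℝ) / √K) := by ring
    _ ≤ 2 ^ 13 * ((X : ℝ) / √K) := by gcongr; norm_num
    _ = _ := by ring

end BlockSums

section Incomplete

/-- Summing a non-negative periodic function over an interval. -/
lemma sum_range_periodic_le (l J : ℕ) [NeZero l] (g : ZMod l → ℝ) (hg : ∀ x, 0 ≤ g x)
    (τ₀ : ZMod l) :
    ∑ j ∈ range J, g (τ₀ + j) ≤ ((J : ℝ) / l + 1) * ∑ τ, g τ := by
  rw [← sum_fiberwise (range J) (fun j : ℕ => τ₀ + (j : ZMod l)), mul_sum]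
  refine sum_le_sum fun τ _ => ?_
  have h1 : ∑ j ∈ (range J).filter (fun j : ℕ => τ₀ + (j : ZMod l) = τ), g (τ₀ + j)
      = ((range J).filter (fun j : ℕ => τ₀ + (j : ZMod l) = τ)).card * g τ := by
    rw [← nsmul_eq_mul, ← sum_const]
    exact Finset.sum_congr rfl fun j hj => by rw [(mem_filter.1 hj).2]
  rw [h1]
  refine mul_le_mul_of_nonneg_right ?_ (hg τ)
  rcases Nat.eq_zero_or_pos J with rfl | hJ
  · simp
  have h2 : (range J).filter (fun j : ℕ => τ₀ + (j : ZMod l) = τ)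
      ⊆ (range (J - 1 + 1)).filter fun r => r % l = (τ - τ₀).val := by
    intro j hj
    obtain ⟨a, b⟩ := mem_filter.1 hj
    refine mem_filter.2 ⟨by rwa [Nat.sub_add_cancel hJ], ?_⟩
    rw [← b, add_sub_cancel_left, ZMod.val_natCast]
  have h3 := (card_le_card h2).trans (card_filter_mod_le (J - 1) l _)
  have h4 : (J - 1) / l ≤ J / l := Nat.div_le_div_right (Nat.sub_le _ _)
  have h5 : ((J / l : ℕ) : ℝ) ≤ J / l := Nat.cast_div_le
  have h6 : (((range J).filter (fun j : ℕ => τ₀ + (j : ZMod l) = τ)).card : ℝ)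
      ≤ (J / l : ℕ) + 1 := by exact_mod_cast h3.trans (by omega)
  linarith

/-- Incomplete Kloosterman-type sums, by shifting. -/
lemma norm_sum_psi_inv_le {l : ℕ} [Fact l.Prime] {k : ℕ} (hk : 0 < k) (hkl : k ^ 4 ≤ l)
    {H : ZMod l} (hH : H ≠ 0) (τ₀ : ZMod l) (J : ℕ) :
    ‖∑ j ∈ range J, psi l (H * (τ₀ + j)⁻¹)‖ ≤ ((J : ℝ) / l + 1) * (5 * (l : ℝ) / √k) := by
  have hk0 : (0 : ℝ) < k := by exact_mod_cast hk
  have hk1 : (1 : ℝ) ≤ k := by exact_mod_cast hk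
  have hl0 : (0 : ℝ) < l := by exact_mod_cast (Fact.out : l.Prime).pos
  have hkl' : (k : ℝ) ^ 4 ≤ l := by exact_mod_cast hkl
  set g : ZMod l → ℂ := fun τ => psi l (H * τ⁻¹) with hg
  have hA := sum_norm_sq_moebius_le (l := l) hk hkl (neg_ne_zero.2 hH) ({()} : Finset Unit)
    (range k) (fun _ => 0) (fun _ => -1) (fun _ => 1) (fun i : ℕ => (i : ZMod l))
    (fun i _ => by ring) (fun _ _ => 1) (fun _ _ => by simp)
  have hdiag : (((range k ×ˢ range k).filter fun ij : ℕ × ℕ =>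
      (1 : ZMod l) * (ij.2 : ZMod l) = 1 * (ij.1 : ZMod l)).card : ℝ) ≤ k := by
    have : ((range k ×ˢ range k).filter fun ij : ℕ × ℕ =>
      (1 : ZMod l) * (ij.2 : ZMod l) = 1 * (ij.1 : ZMod l)) ⊆ (range k).image fun i => (i, i) := by
      rintro ⟨i, j⟩ hij
      obtain ⟨a, b⟩ := mem_filter.1 hij
      obtain ⟨a1, a2⟩ := mem_product.1 a
      rw [mem_range] at a1 a2
      have hkl1 : k ≤ l := (Nat.le_self_pow (by norm_num) k).trans hkl
      rw [one_mul, one_mul, ZMod.natCast_eq_natCast_iff', Nat.mod_eq_of_lt (a2.trans_le hkl1),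
        Nat.mod_eq_of_lt (a1.trans_le hkl1)] at b
      exact mem_image.2 ⟨i, mem_range.2 a1, by simp only at b; rw [b]⟩
    exact_mod_cast (card_le_card this).trans (card_image_le.trans (card_range k).le)
  have hA2 : ∑ τ : ZMod l, ‖∑ i ∈ range k, g (τ + i)‖ ^ 2 ≤ 6 * (l : ℝ) * k := by
    have e : ∀ τ : ZMod l, ∑ i ∈ range k, g (τ + i)
        = ∑ i ∈ range k, psi l (-H * ((0 * τ + -1) * (1 * τ + (i : ZMod l))⁻¹)) * 1 := by
      intro τ
      refine Finset.sum_congr rfl fun i _ => ?_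
      simp only [hg, mul_one]
      congr 1; ring
    rw [Finset.sum_congr rfl fun τ _ => by rw [e τ]]
    rw [sum_singleton] at hA
    refine hA.trans ?_
    rw [card_singleton, card_range]
    have : (5 : ℝ) * ((l : ℝ) / k) * (k : ℝ) ^ 2 = 5 * l * k := by field_simp
    rw [this, Nat.cast_one, one_mul]
    nlinarith [mul_le_mul_of_nonneg_left hdiag hl0.le]
  have hA1 : ∑ τ : ZMod l, ‖∑ i ∈ range k, g (τ + i)‖ ≤ 5 / 2 * ((l : ℝ) * √k) := by
    have h1 := sq_sum_le_card_mul_sum_sq (s := (univ : Finset (ZMod l)))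
      (f := fun τ => ‖∑ i ∈ range k, g (τ + i)‖)
    rw [card_univ, ZMod.card] at h1
    refine abs_le_of_sq_le_sq' ?_ (by positivity) |>.2
    rw [mul_pow, mul_pow, Real.sq_sqrt hk0.le]
    nlinarith [mul_le_mul_of_nonneg_left hA2 hl0.le, mul_pos (mul_pos hl0 hl0) hk0]
  have hshift : ∀ i : ℕ, ‖∑ j ∈ range J, g (τ₀ + j) - ∑ j ∈ range J, g (τ₀ + j + i)‖
      ≤ 2 * i := by
    intro i
    have e1 : ∑ j ∈ range J, g (τ₀ + j) + ∑ j ∈ range i, g (τ₀ + ((J + j : ℕ) : ZMod l))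
        = ∑ j ∈ range i, g (τ₀ + j) + ∑ j ∈ range J, g (τ₀ + j + i) := by
      rw [← sum_range_add (fun j : ℕ => g (τ₀ + j)) J i, add_comm J i,
        sum_range_add (fun j : ℕ => g (τ₀ + j)) i J]
      congr 1
      refine Finset.sum_congr rfl fun j _ => ?_
      congr 1; push_cast; ring
    have e2 : ∑ j ∈ range J, g (τ₀ + j) - ∑ j ∈ range J, g (τ₀ + j + i)
        = ∑ j ∈ range i, g (τ₀ + j) - ∑ j ∈ range i, g (τ₀ + ((J + j : ℕ) : ZMod l)) := by
      linear_combination e1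
    have e3 : ∀ f : ℕ → ZMod l, ‖∑ j ∈ range i, g (f j)‖ ≤ i := fun f => by
      refine (norm_sum_le _ _).trans ?_
      simp [hg]
    rw [e2]
    refine (norm_sub_le _ _).trans ?_
    linarith [e3 fun j => τ₀ + j, e3 fun j => τ₀ + ((J + j : ℕ) : ZMod l)]
  set T := ∑ j ∈ range J, g (τ₀ + j) with hT
  have hk2 : (k : ℝ) * ‖T‖ ≤ 2 * (k : ℝ) ^ 2
      + ((J : ℝ) / l + 1) * (5 / 2 * ((l : ℝ) * √k)) := by
    have e1 : (k : ℂ) * T = ∑ i ∈ range k, (T - ∑ j ∈ range J, g (τ₀ + j + i))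
        + ∑ j ∈ range J, ∑ i ∈ range k, g (τ₀ + j + i) := by
      rw [sum_sub_distrib, sum_const, card_range, nsmul_eq_mul, sum_comm (s := range J)]
      ring
    have e2 : (k : ℝ) * ‖T‖ = ‖(k : ℂ) * T‖ := by rw [norm_mul, Complex.norm_natCast]
    rw [e2, e1]
    refine (norm_add_le _ _).trans (add_le_add ?_ ?_)
    · refine (norm_sum_le_of_le _ fun i hi => (hshift i).trans
        (by have : (i : ℝ) ≤ k := by exact_mod_cast (mem_range.1 hi).le
            linarith : (2 * i : ℝ) ≤ 2 * k)).trans_eq ?_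
      rw [sum_const, card_range, nsmul_eq_mul]; ring
    · refine (norm_sum_le _ _).trans ((sum_range_periodic_le l J
        (fun τ => ‖∑ i ∈ range k, g (τ + i)‖) (fun _ => norm_nonneg _) τ₀).trans ?_)
      gcongr
  have hs : √(k : ℝ) * √k = k := Real.mul_self_sqrt hk0.le
  have hs1 : 1 ≤ √(k : ℝ) := by rwa [Real.one_le_sqrt]
  have hJl : (0 : ℝ) ≤ (J : ℝ) / l := by positivity
  have hkk : 2 * (k : ℝ) ^ 2 ≤ ((J : ℝ) / l + 1) * (5 / 2 * ((l : ℝ) * √k)) := by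
    calc 2 * (k : ℝ) ^ 2 ≤ 2 * (k : ℝ) ^ 4 := by
          gcongr 2 * ?_
          exact pow_le_pow_right₀ hk1 (by norm_num)
      _ ≤ 1 * (5 / 2 * ((l : ℝ) * 1)) := by linarith
      _ ≤ _ := by gcongr; linarith
  have : (k : ℝ) * ‖T‖ ≤ k * (((J : ℝ) / l + 1) * (5 * (l : ℝ) / √k)) := by
    calc (k : ℝ) * ‖T‖ ≤ ((J : ℝ) / l + 1) * (5 * ((l : ℝ) * √k)) := by linarith
      _ = (√k * √k) * (((J : ℝ) / l + 1) * (5 * (l : ℝ) / √k)) := by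
        field_simp
      _ = _ := by rw [hs]
  exact le_of_mul_le_mul_left this hk0

/-- The exponential attached to `vv r s`, split at a prime factor of `s`. -/
lemma ee_vv_eq {l s' r : ℕ} [Fact l.Prime] (hs' : 0 < s') (hls : ¬ l ∣ s')
    (hr : r.Coprime (l * s')) (h : ℕ) :
    ee ((h : ℝ) * vv r (l * s') / ((l * s' : ℕ) : ℝ))
      = ee ((h : ℝ) * (-(r : ZMod s')⁻¹).val / ((l * s' : ℕ) : ℝ))
        * psi l (-(h : ZMod l) * (s' : ZMod l)⁻¹ * ((-(r : ZMod s')⁻¹).val : ZMod l))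
        * psi l (-(h : ZMod l) * (s' : ZMod l)⁻¹ * (r : ZMod l)⁻¹) := by
  have hl : l.Prime := Fact.out
  have hl0 : (l : ℝ) ≠ 0 := by exact_mod_cast hl.ne_zero
  have hs0 : (s' : ℝ) ≠ 0 := by exact_mod_cast hs'.ne'
  have : NeZero s' := ⟨hs'.ne'⟩
  set v := vv r (l * s') with hv
  set c := (-(r : ZMod s')⁻¹).val with hc
  have hvr : uu r (l * s') * (l * s') = v * r + 1 := uu_mul (Nat.mul_pos hl.pos hs') hr
  have hvc : v % s' = c := by
    have h1 : (v : ZMod s') * r + 1 = 0 := by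
      have := congrArg (Nat.cast : ℕ → ZMod s') hvr
      push_cast at this
      rw [← this, ZMod.natCast_self]; ring
    have h2 : (r : ZMod s') * (r : ZMod s')⁻¹ = 1 :=
      ZMod.coe_mul_inv_eq_one r (Nat.Coprime.coprime_mul_left_right hr)
    rw [hc, ← ZMod.val_natCast]
    congr 1
    linear_combination (r : ZMod s')⁻¹ * h1 - (v : ZMod s') * h2
  have hdiv : v = c + s' * (v / s') := by rw [← hvc]; exact (Nat.mod_add_div v s').symm
  set t := v / s' with ht
  have hr0 : (r : ZMod l) ≠ 0 := by
    intro h0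
    have h1 := (ZMod.natCast_eq_zero_iff r l).1 h0
    exact hl.one_lt.ne' (Nat.eq_one_of_dvd_coprimes hr h1 (dvd_mul_right _ _))
  have hs1 : (s' : ZMod l) ≠ 0 := fun h0 => hls ((ZMod.natCast_eq_zero_iff s' l).1 h0)
  have htl : (t : ZMod l) = -(s' : ZMod l)⁻¹ * ((r : ZMod l)⁻¹ + c) := by
    have h1 : ((c : ZMod l) + s' * t) * r + 1 = 0 := by
      have := congrArg (Nat.cast : ℕ → ZMod l) hvr
      rw [hdiv] at this
      push_cast at this
      rw [← this, ZMod.natCast_self]; ring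
    have h2 : (s' : ZMod l) * t * r = -(1 + c * r) := by linear_combination h1
    field_simp
    linear_combination h2
  have e1 : (h : ℝ) * v / ((l * s' : ℕ) : ℝ)
      = (h : ℝ) * c / ((l * s' : ℕ) : ℝ) + ((h * t : ℕ) : ℝ) / l := by
    have : (v : ℝ) = c + s' * t := by exact_mod_cast hdiv
    rw [this]
    push_cast
    field_simp
  rw [e1, ee_add, ← eZ_natCast l hl.pos, eZ_eq_psi, mul_assoc, ← AddChar.map_add_eq_mul]
  congr 2
  push_cast
  rw [htl]; ring

/-- Sums over an arithmetic progression. -/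
lemma sum_filter_mod_eq {A : Type*} [AddCommMonoid A] {R M a : ℕ} (ha : a < M) (F : ℕ → A) :
    ∑ r ∈ (range (R + 1)).filter (fun r => r % M = a), F r
      = ∑ j ∈ range ((R + M - a) / M), F (a + M * j) := by
  have hM : 0 < M := by omega
  symm
  refine sum_bij (fun j _ => a + M * j) (fun j hj => ?_) (fun j _ j' _ h => ?_)
    (fun r hr => ?_) (fun _ _ => rfl)
  · have h1 : (j + 1) * M ≤ R + M - a := (Nat.le_div_iff_mul_le hM).1 (mem_range.1 hj)
    refine mem_filter.2 ⟨mem_range.2 ?_, by rw [Nat.add_mul_mod_self_left, Nat.mod_eq_of_lt ha]⟩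
    have : (j + 1) * M = M * j + M := by ring
    omega
  · exact Nat.eq_of_mul_eq_mul_left hM (by simpa using h)
  · obtain ⟨h1, h2⟩ := mem_filter.1 hr
    have h3 := Nat.mod_add_div r M
    rw [mem_range] at h1
    refine ⟨r / M, mem_range.2 ((Nat.le_div_iff_mul_le hM).2 ?_), by rw [← h2, h3]⟩
    have : (r / M).succ * M = M * (r / M) + M := by rw [Nat.succ_mul]; ring
    omega

/-- The sum over one row, when the row index has a large simple prime factor. -/
lemma norm_row_sum_le {l s' b h k R : ℕ} (hl : l.Prime) (hs' : 0 < s') (hls : ¬ l ∣ s')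
    (hlb : ¬ l ∣ b) (hlh : ¬ l ∣ h) (hk : 0 < k) (hkl : k ^ 4 ≤ l) :
    ‖∑ r ∈ (range (R + 1)).filter (fun r => r.Coprime (l * s') ∧ b ∣ r ^ 2 + (l * s') ^ 2),
      ee ((h : ℝ) * vv r (l * s') / ((l * s' : ℕ) : ℝ))‖
      ≤ 6 * ((R : ℝ) + 2 * (l * s' * b)) / √k := by
  classical
  have : Fact l.Prime := ⟨hl⟩
  have hl0 : (0 : ℝ) < l := by exact_mod_cast hl.pos
  have hk0 : (0 : ℝ) < k := by exact_mod_cast hk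
  have hb : 0 < b := Nat.pos_of_ne_zero fun h0 => hlb (h0 ▸ dvd_zero _)
  set M := s' * b with hM
  have hM0 : 0 < M := Nat.mul_pos hs' hb
  have hMr : (0 : ℝ) < M := by exact_mod_cast hM0
  have hlM : ¬ l ∣ M := fun hd => (hl.dvd_mul.1 hd).elim hls hlb
  set s := l * s' with hs
  have hmaps : ∀ r ∈ (range (R + 1)).filter (fun r => r.Coprime s ∧ b ∣ r ^ 2 + s ^ 2),
      r % M ∈ range M := fun r _ => mem_range.2 (Nat.mod_lt _ hM0)
  rw [← sum_fiberwise_of_maps_to hmaps]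
  have hclass : ∀ a ∈ range M, ‖∑ r ∈ ((range (R + 1)).filter
      (fun r => r.Coprime s ∧ b ∣ r ^ 2 + s ^ 2)).filter (fun r => r % M = a),
      ee ((h : ℝ) * vv r s / (s : ℝ))‖
      ≤ (((R : ℝ) / M + 1) / l + 1) * (6 * (l : ℝ) / √k) := by
    intro a ha
    have ha := mem_range.1 ha
    set J := (R + M - a) / M with hJ
    have hJle : (J : ℝ) ≤ (R : ℝ) / M + 1 := by
      have h1 : (J : ℝ) ≤ ((R + M - a : ℕ) : ℝ) / M := Nat.cast_div_le
      have h2 : ((R + M - a : ℕ) : ℝ) ≤ R + M := by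
        exact_mod_cast Nat.sub_le _ _
      calc (J : ℝ) ≤ ((R : ℝ) + M) / M := h1.trans (by gcongr)
        _ = _ := by field_simp
    rw [filter_filter]
    have e1 : ∑ r ∈ (range (R + 1)).filter (fun r => (r.Coprime s ∧ b ∣ r ^ 2 + s ^ 2) ∧ r % M = a),
        ee ((h : ℝ) * vv r s / (s : ℝ))
        = ∑ j ∈ range J, if (a + M * j).Coprime s ∧ b ∣ (a + M * j) ^ 2 + s ^ 2 then
          ee ((h : ℝ) * vv (a + M * j) s / (s : ℝ)) else 0 := by
      rw [← sum_filter_mod_eq ha (F := fun r => if r.Coprime s ∧ b ∣ r ^ 2 + s ^ 2 then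
          ee ((h : ℝ) * vv r s / (s : ℝ)) else 0), ← sum_filter, filter_filter]
      refine Finset.sum_congr (filter_congr fun r _ => and_comm) fun _ _ => rfl
    rw [e1]
    have hbd : ∀ j, b ∣ (a + M * j) ^ 2 + s ^ 2 ↔ b ∣ a ^ 2 + s ^ 2 := by
      intro j
      have : (a + M * j) ^ 2 + s ^ 2 = (a ^ 2 + s ^ 2) + b * (s' * j * (2 * a + M * j)) := by
        rw [hM]; ring
      rw [this, Nat.dvd_add_left (dvd_mul_right _ _)]
    have hcs : ∀ j, (a + M * j).Coprime s ↔ ¬ l ∣ a + M * j ∧ a.Coprime s' := by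
      intro j
      rw [hs, Nat.coprime_mul_iff_right, Nat.coprime_comm, hl.coprime_iff_not_dvd]
      have : a + M * j = a + s' * (b * j) := by rw [hM]; ring
      rw [this, Nat.coprime_add_mul_left_left]
    by_cases hgood : a.Coprime s' ∧ b ∣ a ^ 2 + s ^ 2
    swap
    · rw [sum_eq_zero fun j _ => if_neg fun hj =>
        hgood ⟨((hcs j).1 hj.1).2, (hbd j).1 hj.2⟩, norm_zero]
      positivity
    set H : ZMod l := -(h : ZMod l) * (s' : ZMod l)⁻¹ with hH
    have hH0 : H ≠ 0 := mul_ne_zero (neg_ne_zero.2 fun h0 =>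
      hlh ((ZMod.natCast_eq_zero_iff h l).1 h0)) (inv_ne_zero fun h0 =>
      hls ((ZMod.natCast_eq_zero_iff s' l).1 h0))
    have hM1 : (M : ZMod l) ≠ 0 := fun h0 => hlM ((ZMod.natCast_eq_zero_iff M l).1 h0)
    set τ₀ : ZMod l := a * (M : ZMod l)⁻¹ with hτ₀
    set H' : ZMod l := H * (M : ZMod l)⁻¹ with hH'
    have hH'0 : H' ≠ 0 := mul_ne_zero hH0 (inv_ne_zero hM1)
    have hτ : ∀ j : ℕ, ((a + M * j : ℕ) : ZMod l) = M * (τ₀ + j) := by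
      intro j; push_cast; rw [hτ₀]; field_simp
    obtain ⟨C, hC, hCeq⟩ : ∃ C : ℂ, ‖C‖ = 1 ∧ ∀ j, ¬ l ∣ a + M * j →
        ee ((h : ℝ) * vv (a + M * j) s / (s : ℝ)) = C * psi l (H' * (τ₀ + j)⁻¹) := by
      refine ⟨ee ((h : ℝ) * (-(a : ZMod s')⁻¹).val / (s : ℝ))
        * psi l (H * ((-(a : ZMod s')⁻¹).val : ZMod l)), by
          rw [norm_mul, norm_ee, norm_psi, one_mul], fun j hj => ?_⟩
      rw [hs, ee_vv_eq hs' hls ((hcs j).2 ⟨hj, hgood.1⟩)]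
      have e2 : ((a + M * j : ℕ) : ZMod s') = a := by
        rw [hM]; push_cast; rw [ZMod.natCast_self]; ring
      rw [e2, hτ, mul_inv, ← hH, hH', mul_assoc H (M : ZMod l)⁻¹]
    have hterm : ∀ j ∈ range J, (if (a + M * j).Coprime s ∧ b ∣ (a + M * j) ^ 2 + s ^ 2 then
          ee ((h : ℝ) * vv (a + M * j) s / (s : ℝ)) else 0)
        = C * psi l (H' * (τ₀ + j)⁻¹) - C * (if τ₀ + j = 0 then 1 else 0) := by
      intro j _
      have hz : τ₀ + j = 0 ↔ l ∣ a + M * j := by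
        rw [← ZMod.natCast_eq_zero_iff, hτ, mul_eq_zero, or_iff_right hM1]
      by_cases hd : l ∣ a + M * j
      · rw [if_neg fun hj => ((hcs j).1 hj.1).1 hd, if_pos (hz.2 hd), hz.2 hd, inv_zero, mul_zero,
          AddChar.map_zero_eq_one, sub_self]
      · rw [if_pos ⟨(hcs j).2 ⟨hd, hgood.1⟩, (hbd j).2 hgood.2⟩, if_neg (mt hz.1 hd), hCeq j hd,
          mul_zero, sub_zero]
    rw [Finset.sum_congr rfl hterm, sum_sub_distrib, ← mul_sum, ← mul_sum]
    have b1 := norm_sum_psi_inv_le hk hkl hH'0 τ₀ J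
    have b2 : ‖∑ j ∈ range J, if τ₀ + (j : ZMod l) = 0 then (1 : ℂ) else 0‖ ≤ (J : ℝ) / l + 1 := by
      have h1 := sum_range_periodic_le l J (fun τ => if τ = 0 then 1 else 0)
        (fun x => by split_ifs <;> norm_num) τ₀
      rw [sum_ite_eq' univ (0 : ZMod l), if_pos (mem_univ _), mul_one] at h1
      refine le_trans ?_ h1
      refine norm_sum_le_of_le _ fun j _ => ?_
      split_ifs <;> simp
    have hkl2 : (1 : ℝ) ≤ (l : ℝ) / √k := by
      rw [le_div_iff₀ (by positivity), one_mul, Real.sqrt_le_left hl0.le]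
      have h1 : k ≤ l := (Nat.le_self_pow (by norm_num) k).trans hkl
      exact_mod_cast h1.trans (Nat.le_self_pow (by norm_num) l)
    calc _ ≤ ‖C‖ * ‖∑ j ∈ range J, psi l (H' * (τ₀ + j)⁻¹)‖
          + ‖C‖ * ‖∑ j ∈ range J, if τ₀ + (j : ZMod l) = 0 then (1 : ℂ) else 0‖ := by
          rw [← norm_mul, ← norm_mul]; exact norm_sub_le _ _
      _ ≤ ((J : ℝ) / l + 1) * (5 * (l : ℝ) / √k) + ((J : ℝ) / l + 1) * ((l : ℝ) / √k) := by
          rw [hC, one_mul, one_mul]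
          refine add_le_add b1 (b2.trans ?_)
          exact le_mul_of_one_le_right (by positivity) hkl2
      _ = ((J : ℝ) / l + 1) * (6 * (l : ℝ) / √k) := by ring
      _ ≤ _ := by gcongr
  refine (norm_sum_le_of_le _ hclass).trans ?_
  rw [sum_const, card_range, nsmul_eq_mul]
  have e3 : (M : ℝ) * ((((R : ℝ) / M + 1) / l + 1) * (6 * (l : ℝ) / √k))
      = 6 * (R + M + M * l) / √k := by field_simp
  have e4 : (M : ℝ) * l = l * s' * b := by rw [hM]; push_cast; ring
  have e5 : (M : ℝ) ≤ M * l := by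
    have : (1 : ℝ) ≤ l := by exact_mod_cast hl.one_le
    nlinarith
  rw [e3]
  exact div_le_div_of_nonneg_right (by linarith) (Real.sqrt_nonneg _)

end Incomplete

section Smooth

/-- The completely multiplicative function `n ↦ n ^ (-σ)`. -/
noncomputable def rpowHom (σ : ℝ) : ℕ →* ℝ where
  toFun n := (n : ℝ) ^ (-σ)
  map_one' := by simp
  map_mul' m n := by rw [Nat.cast_mul, Real.mul_rpow (Nat.cast_nonneg _) (Nat.cast_nonneg _)]

lemma rpowHom_apply (σ : ℝ) (n : ℕ) : rpowHom σ n = (n : ℝ) ^ (-σ) := rfl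

lemma rpowHom_nonneg (σ : ℝ) (n : ℕ) : 0 ≤ rpowHom σ n := Real.rpow_nonneg (Nat.cast_nonneg _) _

lemma rpowHom_prime_le {σ : ℝ} (hσ : 1 / 2 ≤ σ) {p : ℕ} (hp : p.Prime) : rpowHom σ p ≤ 3 / 4 := by
  have h2 : (2 : ℝ) ≤ p := by exact_mod_cast hp.two_le
  rw [rpowHom_apply]
  calc (p : ℝ) ^ (-σ) ≤ (p : ℝ) ^ (-(1 / 2) : ℝ) :=
        Real.rpow_le_rpow_of_exponent_le (by linarith) (by linarith)
    _ ≤ (2 : ℝ) ^ (-(1 / 2) : ℝ) :=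
        Real.rpow_le_rpow_of_nonpos (by norm_num) h2 (by norm_num)
    _ = (√2)⁻¹ := by rw [Real.rpow_neg (by norm_num), ← Real.sqrt_eq_rpow]
    _ ≤ 3 / 4 := by
        rw [inv_le_comm₀ (by positivity) (by norm_num)]
        apply Real.le_sqrt_of_sq_le
        norm_num

/-- Rankin's bound for smooth numbers. -/
lemma card_smooth_le {S y : ℕ} (hy : 12 ≤ Real.log y) (hS : 14 * Real.log y ^ 2 ≤ Real.log S) :
    (((Icc 1 S).filter fun n => n ∈ Nat.smoothNumbers y).card : ℝ) ≤ S / y := by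
  classical
  have hy0 : (0 : ℝ) < y := by
    rcases Nat.eq_zero_or_pos y with rfl | h
    · norm_num at hy
    · exact_mod_cast h
  have hS0 : (0 : ℝ) < S := by
    rcases Nat.eq_zero_or_pos S with rfl | h
    · have : 0 < Real.log y ^ 2 := by positivity
      norm_num at hS; linarith
    · exact_mod_cast h
  set L := Real.log y with hL
  have hL0 : 0 < L := by linarith
  set σ := 1 - L⁻¹ with hσ
  have hLi : L⁻¹ ≤ 1 / 12 := by
    rw [inv_le_comm₀ hL0 (by norm_num)]; linarith
  have hσ1 : 1 / 2 ≤ σ := by rw [hσ]; linarith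
  have hf1 : ∀ {p : ℕ}, p.Prime → ‖rpowHom σ p‖ < 1 := fun {p} hp => by
    rw [Real.norm_of_nonneg (rpowHom_nonneg _ _)]
    linarith [rpowHom_prime_le hσ1 hp]
  have hsum := (EulerProduct.summable_and_hasSum_smoothNumbers_prod_primesBelow_geometric hf1 y).2
  have hle := sum_le_hasSum ((Icc 1 S).subtype (· ∈ Nat.smoothNumbers y))
    (fun i _ => rpowHom_nonneg σ i) hsum
  rw [sum_subtype_eq_sum_filter] at hle
  have hprod : ∏ p ∈ y.primesBelow, (1 - rpowHom σ p)⁻¹ ≤ Real.exp (12 * (1 + L)) := by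
    have h1 : ∀ p ∈ y.primesBelow, (1 - rpowHom σ p)⁻¹ ≤ Real.exp (12 * (p : ℝ)⁻¹) := by
      intro p hp
      obtain ⟨hpy, hpp⟩ := Nat.mem_primesBelow.1 hp
      have hp0 : (0 : ℝ) < p := by exact_mod_cast hpp.pos
      have a1 := rpowHom_prime_le hσ1 hpp
      have a0 := rpowHom_nonneg σ p
      have a2 : rpowHom σ p ≤ 3 * (p : ℝ)⁻¹ := by
        rw [rpowHom_apply, hσ, neg_sub, sub_eq_add_neg, Real.rpow_add hp0, Real.rpow_neg_one]
        gcongr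
        rw [Real.rpow_def_of_pos hp0]
        have : Real.log p * L⁻¹ ≤ 1 := by
          rw [← div_eq_mul_inv, div_le_one hL0]
          exact Real.log_le_log hp0 (by exact_mod_cast hpy.le)
        linarith [Real.exp_le_exp.2 this, Real.exp_one_lt_d9]
      calc (1 - rpowHom σ p)⁻¹ ≤ 1 + 4 * rpowHom σ p := by
            rw [inv_le_iff_one_le_mul₀ (by linarith)]
            nlinarith [mul_nonneg a0 (sub_nonneg.2 a1)]
        _ ≤ Real.exp (4 * rpowHom σ p) := by linarith [Real.add_one_le_exp (4 * rpowHom σ p)]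
        _ ≤ Real.exp (12 * (p : ℝ)⁻¹) := Real.exp_le_exp.2 (by linarith)
    refine (prod_le_prod (fun p hp => inv_nonneg.2 ?_) h1).trans ?_
    · linarith [rpowHom_prime_le hσ1 (Nat.mem_primesBelow.1 hp).2]
    rw [← Real.exp_sum, ← mul_sum]
    gcongr
    have h2 : ∑ p ∈ y.primesBelow, (p : ℝ)⁻¹ ≤ ∑ n ∈ Icc 1 y, (n : ℝ)⁻¹ := by
      refine sum_le_sum_of_subset_of_nonneg (fun p hp => ?_) fun _ _ _ => by positivity
      obtain ⟨hpy, hpp⟩ := Nat.mem_primesBelow.1 hp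
      exact mem_Icc.2 ⟨hpp.one_le, hpy.le⟩
    have h3 := harmonic_le_one_add_log y
    rw [harmonic_eq_sum_Icc] at h3
    push_cast at h3
    exact h2.trans h3
  have hSσ : (S : ℝ) ^ σ = S * Real.exp (-(Real.log S / L)) := by
    rw [hσ, sub_eq_add_neg, Real.rpow_add hS0, Real.rpow_one, Real.rpow_def_of_pos hS0]
    congr 2; rw [div_eq_mul_inv]; ring
  have hcard : (((Icc 1 S).filter fun n => n ∈ Nat.smoothNumbers y).card : ℝ)
      ≤ (S : ℝ) ^ σ * ∑ n ∈ (Icc 1 S).filter (fun n => n ∈ Nat.smoothNumbers y), rpowHom σ n := by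
    rw [mul_sum, card_eq_sum_ones]
    push_cast
    refine sum_le_sum fun n hn => ?_
    obtain ⟨h1, h2⟩ := mem_Icc.1 (mem_filter.1 hn).1
    have hn0 : (0 : ℝ) < n := by exact_mod_cast h1
    rw [rpowHom_apply, Real.rpow_neg hn0.le, ← div_eq_mul_inv,
      ← Real.div_rpow hS0.le hn0.le]
    refine Real.one_le_rpow ?_ (by linarith)
    rw [one_le_div hn0]
    exact_mod_cast h2
  calc _ ≤ _ := hcard
    _ ≤ (S * Real.exp (-(Real.log S / L))) * Real.exp (12 * (1 + L)) := by
        rw [hSσ]; gcongr; exact hle.trans hprod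
    _ = S * Real.exp (-(Real.log S / L) + 12 * (1 + L)) := by rw [mul_assoc, ← Real.exp_add]
    _ ≤ S * Real.exp (-L) := by
        gcongr
        have : 14 * L ≤ Real.log S / L := by rw [le_div_iff₀ hL0]; linarith
        linarith
    _ = S / y := by rw [Real.exp_neg, hL, Real.exp_log hy0]; rfl

open scoped Classical in
/-- Few integers lack a large simple prime factor. -/
lemma card_no_simple_prime_le {S D : ℕ} (hy : 12 ≤ Real.log D)
    (hS : 14 * Real.log D ^ 2 ≤ Real.log S) :
    (((Icc 1 S).filter fun s => ¬ ∃ l s', l.Prime ∧ D ≤ l ∧ ¬ l ∣ s' ∧ s = l * s').card : ℝ)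
      ≤ 3 * S / D := by
  classical
  have hD0 : 0 < D := by
    rcases Nat.eq_zero_or_pos D with rfl | h
    · norm_num at hy
    · exact h
  have hsub : ((Icc 1 S).filter fun s => ¬ ∃ l s', l.Prime ∧ D ≤ l ∧ ¬ l ∣ s' ∧ s = l * s')
      ⊆ ((Icc 1 S).filter fun n => n ∈ Nat.smoothNumbers D)
        ∪ (Ioo (D - 1) (S + 1)).biUnion fun l => (Ioc 0 S).filter fun s => l ^ 2 ∣ s := by
    intro s hs
    obtain ⟨h1, h2⟩ := mem_filter.1 hs
    obtain ⟨h3, h4⟩ := mem_Icc.1 h1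
    by_cases hsm : s ∈ Nat.smoothNumbers D
    · exact mem_union_left _ (mem_filter.2 ⟨h1, hsm⟩)
    refine mem_union_right _ ?_
    rw [Nat.mem_smoothNumbers'] at hsm
    push Not at hsm
    obtain ⟨l, hl, hls, hDl⟩ := hsm
    have hlS : l ≤ S := (Nat.le_of_dvd h3 hls).trans h4
    refine mem_biUnion.2 ⟨l, mem_Ioo.2 ⟨by omega, by omega⟩,
      mem_filter.2 ⟨mem_Ioc.2 ⟨h3, h4⟩, ?_⟩⟩
    obtain ⟨s', rfl⟩ := hls
    by_contra hnd
    exact h2 ⟨l, s', hl, hDl, fun hd => hnd (by rw [pow_two]; exact mul_dvd_mul_left l hd), rfl⟩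
  have h1 := (card_le_card hsub).trans ((card_union_le _ _).trans
    (Nat.add_le_add_left card_biUnion_le _))
  simp only [Nat.Ioc_filter_dvd_card_eq_div] at h1
  have h2 : ((∑ l ∈ Ioo (D - 1) (S + 1), S / l ^ 2 : ℕ) : ℝ) ≤ 2 * S / D := by
    push_cast
    calc ∑ l ∈ Ioo (D - 1) (S + 1), ((S / l ^ 2 : ℕ) : ℝ)
        ≤ ∑ l ∈ Ioo (D - 1) (S + 1), (S : ℝ) * ((l : ℝ) ^ 2)⁻¹ := by
          refine sum_le_sum fun l _ => ?_
          have := Nat.cast_div_le (α := ℝ) (m := S) (n := l ^ 2)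
          rw [← div_eq_mul_inv]
          exact_mod_cast this
      _ = S * ∑ l ∈ Ioo (D - 1) (S + 1), ((l : ℝ) ^ 2)⁻¹ := by rw [mul_sum]
      _ ≤ S * (2 / (((D - 1 : ℕ) : ℝ) + 1)) := by
          gcongr
          exact sum_Ioo_inv_sq_le _ _
      _ = 2 * S / D := by
          rw [Nat.cast_sub hD0, Nat.cast_one, sub_add_cancel]; ring
  have h3 := card_smooth_le hy hS
  have h4 : (((Icc 1 S).filter fun s => ¬ ∃ l s', l.Prime ∧ D ≤ l ∧ ¬ l ∣ s' ∧ s = l * s').card : ℝ)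
      ≤ ((Icc 1 S).filter fun n => n ∈ Nat.smoothNumbers D).card
        + ((∑ l ∈ Ioo (D - 1) (S + 1), S / l ^ 2 : ℕ) : ℝ) := by exact_mod_cast h1
  calc _ ≤ (S : ℝ) / D + 2 * S / D := by linarith
    _ = _ := by ring

end Smooth

section Progression

/-- Exponential sums over moduli divisible by a small integer. -/
theorem norm_sum_dvd_le {X b h k : ℕ} (hb : 0 < b) (hbk : b < k ^ 4) (hh : 0 < h) (hhk : h < k ^ 4)
    (hk : 12 ≤ Real.log (k ^ 4 : ℕ))
    (hX : 14 * Real.log (k ^ 4 : ℕ) ^ 2 ≤ Real.log (Nat.sqrt X)) :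
    ‖∑ m ∈ (Icc 2 X).filter (fun m => b ∣ m), asum h m‖
      ≤ 7 * h * √X + 18 * b * X / √k + 3 * X / (k : ℝ) ^ 4 := by
  classical
  set S := Nat.sqrt X with hS
  have hSX : (S : ℝ) ≤ √X := Real.nat_sqrt_le_real_sqrt
  have hSS : (S : ℝ) * S ≤ X := by exact_mod_cast Nat.sqrt_le X
  have hk0 : 0 < k := by
    rcases Nat.eq_zero_or_pos k with rfl | h
    · simp at hbk
    · exact h
  have hkr : (0 : ℝ) < k := by exact_mod_cast hk0
  have hb1 : (1 : ℝ) ≤ b := by exact_mod_cast hb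
  set 𝒢 := (G X).filter fun γ => b ∣ nm γ with h𝒢
  have hmem : ∀ γ ∈ 𝒢, 0 < γ.1 ∧ 0 < γ.2 ∧ γ.1.Coprime γ.2 ∧ nm γ ≤ X ∧ b ∣ nm γ := fun γ hγ => by
    obtain ⟨h1, h2⟩ := mem_filter.1 hγ
    obtain ⟨a, b, c, d⟩ := mem_G.1 h1
    exact ⟨a, b, c, d, h2⟩
  have hmaps : ∀ γ ∈ 𝒢, γ.2 ∈ Icc 1 S := fun γ hγ =>
    mem_Icc.2 ⟨(hmem γ hγ).2.1, snd_le_sqrt (hmem γ hγ).2.2.2.1⟩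
  have hrow : ∀ s, (𝒢.filter fun γ => γ.2 = s).card ≤ S := fun s => by
    have : (𝒢.filter fun γ => γ.2 = s) ⊆ (Icc 1 S).image fun r => (r, s) := by
      intro γ hγ
      obtain ⟨h1, h2⟩ := mem_filter.1 hγ
      exact mem_image.2 ⟨γ.1, mem_Icc.2 ⟨(hmem γ h1).1, fst_le_sqrt (hmem γ h1).2.2.2.1⟩,
        by rw [← h2]⟩
    exact (card_le_card this).trans (card_image_le.trans (by rw [Nat.card_Icc]; omega))
  have e1 : ∑ m ∈ (Icc 2 X).filter (fun m => b ∣ m), asum h m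
      = ∑ γ ∈ 𝒢, ee ((h : ℝ) * nu γ / nm γ) := by
    rw [sum_filter, h𝒢, sum_filter, ← sum_Icc_roots_eq X fun m ν =>
      if b ∣ m then ee ((h : ℝ) * ν / m) else 0]
    refine Finset.sum_congr rfl fun m _ => ?_
    split_ifs
    · rfl
    · simp
  have hrepl : ‖∑ γ ∈ 𝒢, ee ((h : ℝ) * nu γ / nm γ)
      - ∑ γ ∈ 𝒢, ee ((h : ℝ) * vv γ.1 γ.2 / γ.2)‖ ≤ 7 * h * √X := by
    rw [← sum_sub_distrib]
    have h1 : ∀ γ ∈ 𝒢, ‖ee ((h : ℝ) * nu γ / nm γ) - ee ((h : ℝ) * vv γ.1 γ.2 / γ.2)‖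
        ≤ 7 * h / 2 * ((γ.2 : ℝ) ^ 2)⁻¹ := by
      intro γ hγ
      obtain ⟨g1, g2, g3, -, -⟩ := hmem γ hγ
      have hs0 : (0 : ℝ) < γ.2 := by exact_mod_cast g2
      have hm0 : (0 : ℝ) < nm γ := by exact_mod_cast (two_le_nm g1 g2).trans_lt' two_pos
      have hvn : (vv γ.1 γ.2 : ℝ) * nm γ + γ.1 = nu γ * γ.2 := by
        exact_mod_cast vv_mul_nm g2 g3
      refine (norm_ee_sub_le _ _).trans ?_
      have e2 : (h : ℝ) * nu γ / nm γ - (h : ℝ) * vv γ.1 γ.2 / γ.2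
          = h * (γ.1 / (γ.2 * nm γ)) := by
        field_simp
        linear_combination -hvn
      rw [e2, abs_of_nonneg (by positivity)]
      have e3 : (γ.1 : ℝ) / (γ.2 * nm γ) ≤ 1 / 2 * ((γ.2 : ℝ) ^ 2)⁻¹ := by
        rw [div_le_iff₀ (by positivity)]
        have : (nm γ : ℝ) = (γ.1 : ℝ) ^ 2 + (γ.2 : ℝ) ^ 2 := by unfold nm; push_cast; ring
        rw [this]
        have e4 : 1 / 2 * ((γ.2 : ℝ) ^ 2)⁻¹ * (γ.2 * ((γ.1 : ℝ) ^ 2 + (γ.2 : ℝ) ^ 2))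
            = ((γ.1 : ℝ) ^ 2 + (γ.2 : ℝ) ^ 2) / (2 * γ.2) := by field_simp
        rw [e4, le_div_iff₀ (by positivity)]
        nlinarith [sq_nonneg ((γ.1 : ℝ) - γ.2)]
      calc 7 * ((h : ℝ) * (γ.1 / (γ.2 * nm γ))) ≤ 7 * (h * (1 / 2 * ((γ.2 : ℝ) ^ 2)⁻¹)) := by
            gcongr
        _ = _ := by ring
    refine (norm_sum_le_of_le _ h1).trans ?_
    rw [← sum_fiberwise_of_maps_to hmaps]
    have h2 : ∀ s ∈ Icc 1 S, ∑ γ ∈ 𝒢.filter (fun γ => γ.2 = s), 7 * (h : ℝ) / 2 * ((γ.2 : ℝ) ^ 2)⁻¹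
        ≤ S * (7 * h / 2) * ((s : ℝ) ^ 2)⁻¹ := by
      intro s _
      rw [Finset.sum_congr rfl fun γ hγ => by rw [(mem_filter.1 hγ).2], sum_const, nsmul_eq_mul,
        mul_assoc (S : ℝ)]
      have : ((𝒢.filter fun γ => γ.2 = s).card : ℝ) ≤ S := by exact_mod_cast hrow s
      gcongr
    refine (sum_le_sum h2).trans ?_
    rw [← mul_sum]
    have h3 := sum_Ioo_inv_sq_le (α := ℝ) 0 (S + 1)
    have h4 : Ioo 0 (S + 1) = Icc 1 S := by ext; simp only [mem_Ioo, mem_Icc]; omega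
    rw [h4, Nat.cast_zero, zero_add, div_one] at h3
    calc (S : ℝ) * (7 * h / 2) * ∑ s ∈ Icc 1 S, ((s : ℝ) ^ 2)⁻¹ ≤ √X * (7 * h / 2) * 2 := by
          gcongr
      _ = _ := by ring
  have hmain : ‖∑ γ ∈ 𝒢, ee ((h : ℝ) * vv γ.1 γ.2 / γ.2)‖
      ≤ 18 * b * X / √k + 3 * X / (k : ℝ) ^ 4 := by
    rw [← sum_fiberwise_of_maps_to hmaps,
      ← sum_filter_add_sum_filter_not (Icc 1 S)
        (fun s => ∃ l s', l.Prime ∧ k ^ 4 ≤ l ∧ ¬ l ∣ s' ∧ s = l * s')]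
    refine (norm_add_le _ _).trans (add_le_add ?_ ?_)
    · have h1 : ∀ s ∈ (Icc 1 S).filter
            (fun s => ∃ l s', l.Prime ∧ k ^ 4 ≤ l ∧ ¬ l ∣ s' ∧ s = l * s'),
          ‖∑ γ ∈ 𝒢.filter (fun γ => γ.2 = s), ee ((h : ℝ) * vv γ.1 γ.2 / γ.2)‖
          ≤ 18 * b * S / √k := by
        intro s hs
        obtain ⟨hs1, l, s', hl, hkl, hls, rfl⟩ := mem_filter.1 hs
        obtain ⟨hs2, hs3⟩ := mem_Icc.1 hs1
        have hs' : 0 < s' := Nat.pos_of_ne_zero fun h0 => hls (h0 ▸ dvd_zero _)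
        set R := Nat.sqrt (X - (l * s') ^ 2) with hR
        have hsX : (l * s') ^ 2 ≤ X := Nat.le_sqrt'.1 hs3
        have e2 : ∑ γ ∈ 𝒢.filter (fun γ => γ.2 = l * s'), ee ((h : ℝ) * vv γ.1 γ.2 / γ.2)
            = ∑ r ∈ (range (R + 1)).filter
              (fun r => r.Coprime (l * s') ∧ b ∣ r ^ 2 + (l * s') ^ 2),
              ee ((h : ℝ) * vv r (l * s') / ((l * s' : ℕ) : ℝ)) := by
          refine sum_bij (fun γ _ => γ.1) (fun γ hγ => ?_) (fun γ hγ γ' hγ' hh => ?_)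
            (fun r hr => ?_) (fun γ hγ => ?_)
          · obtain ⟨g, g5⟩ := mem_filter.1 hγ
            obtain ⟨g1, g2, g3, g4, g6⟩ := hmem γ g
            rw [nm, g5] at g4 g6
            rw [g5] at g3
            exact mem_filter.2 ⟨mem_range.2 (Nat.lt_succ_of_le (Nat.le_sqrt'.2 (by omega))), g3, g6⟩
          · exact Prod.ext hh ((mem_filter.1 hγ).2.trans (mem_filter.1 hγ').2.symm)
          · obtain ⟨g1, g2, g3⟩ := mem_filter.1 hr
            have g4 : r ^ 2 ≤ X - (l * s') ^ 2 :=
              Nat.le_sqrt'.1 (Nat.lt_succ_iff.1 (mem_range.1 g1))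
            have g5 : 0 < r := Nat.pos_of_ne_zero fun h0 => by
              rw [h0, Nat.coprime_zero_left] at g2
              exact hl.one_lt.ne' (Nat.eq_one_of_mul_eq_one_right g2)
            refine ⟨(r, l * s'), mem_filter.2 ⟨mem_filter.2 ⟨mem_G.2 ⟨g5, hs2, g2, ?_⟩, g3⟩, rfl⟩,
              rfl⟩
            unfold nm; simp only; omega
          · rw [(mem_filter.1 hγ).2]
        rw [e2]
        have hRS : (R : ℝ) ≤ S := by exact_mod_cast Nat.sqrt_le_sqrt (Nat.sub_le _ _)
        have hsS : (l : ℝ) * s' ≤ S := by exact_mod_cast hs3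
        refine (norm_row_sum_le hl hs' hls (fun hd => ?_) (fun hd => ?_) hk0 hkl).trans ?_
        · exact absurd (Nat.le_of_dvd hb hd) (by omega)
        · exact absurd (Nat.le_of_dvd hh hd) (by omega)
        · have : 6 * ((R : ℝ) + 2 * (l * s' * b)) ≤ 18 * b * S := by
            nlinarith [mul_le_mul_of_nonneg_right hsS (Nat.cast_nonneg (α := ℝ) b),
              mul_le_mul_of_nonneg_left hb1 (Nat.cast_nonneg (α := ℝ) S)]
          gcongr
      refine (norm_sum_le_of_le _ h1).trans ?_
      rw [sum_const, nsmul_eq_mul]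
      have h2 : (((Icc 1 S).filter (fun s => ∃ l s', l.Prime ∧ k ^ 4 ≤ l ∧ ¬ l ∣ s' ∧
          s = l * s')).card : ℝ) ≤ S := by
        have := card_filter_le (Icc 1 S)
          (fun s => ∃ l s', l.Prime ∧ k ^ 4 ≤ l ∧ ¬ l ∣ s' ∧ s = l * s')
        rw [Nat.card_Icc, Nat.add_sub_cancel] at this
        exact_mod_cast this
      calc _ ≤ (S : ℝ) * (18 * b * S / √k) := by gcongr
        _ = 18 * b * (S * S) / √k := by ring
        _ ≤ _ := by gcongr
    · have h1 : ∀ s, ‖∑ γ ∈ 𝒢.filter (fun γ => γ.2 = s), ee ((h : ℝ) * vv γ.1 γ.2 / γ.2)‖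
          ≤ (S : ℝ) := by
        intro s
        refine (norm_sum_le _ _).trans ?_
        simp only [norm_ee, sum_const, nsmul_eq_mul, mul_one]
        exact_mod_cast hrow s
      refine (norm_sum_le_of_le _ fun s _ => h1 s).trans ?_
      rw [sum_const, nsmul_eq_mul]
      have h2 := card_no_simple_prime_le hk hX
      calc _ ≤ (3 * (S : ℝ) / (k ^ 4 : ℕ)) * S := by gcongr
        _ = 3 * (S * S) / (k : ℝ) ^ 4 := by push_cast; ring
        _ ≤ _ := by gcongr
  rw [e1]
  have := norm_le_norm_add_norm_sub (∑ γ ∈ 𝒢, ee ((h : ℝ) * vv γ.1 γ.2 / γ.2))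
    (∑ γ ∈ 𝒢, ee ((h : ℝ) * nu γ / nm γ))
  rw [norm_sub_rev] at hrepl
  linarith

end Progression

section Weights

/-- The primes in `[A, B)`. -/
def pr (A B : ℕ) : Finset ℕ := (Ico A B).filter Nat.Prime

lemma mem_pr {A B p : ℕ} : p ∈ pr A B ↔ p.Prime ∧ A ≤ p ∧ p < B := by
  simp only [pr, mem_filter, mem_Ico]; tauto

lemma sum_pr_eq_sum_block {M : Type*} [AddCommMonoid M] {a c : ℕ} (hac : a ≤ c) (f : ℕ → M) :
    ∑ p ∈ pr (2 ^ a) (2 ^ c), f p = ∑ j ∈ Ico a c, ∑ p ∈ block (2 ^ j), f p := by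
  induction c, hac using Nat.le_induction with
  | base => simp [pr]
  | succ c hac ih =>
    rw [sum_Ico_succ_top hac, ← ih, pr, pr, block, sum_filter, sum_filter, sum_filter, pow_succ',
      sum_Ico_consecutive _ (Nat.pow_le_pow_right two_pos hac)
        (Nat.le_mul_of_pos_left _ two_pos)]

/-- Sums over integers exactly divisible by `p`. -/
lemma sum_simple_eq {M : Type*} [AddCommMonoid M] {X p : ℕ} (hp : 2 ≤ p) (F : ℕ → M) :
    ∑ n ∈ (Icc 2 X).filter (fun n => p ∣ n ∧ ¬ p ∣ n / p), F n
      = ∑ m ∈ (Icc 1 (X / p)).filter (fun m => ¬ p ∣ m), F (p * m) := by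
  have hp0 : 0 < p := by omega
  symm
  refine sum_bij (fun m _ => p * m) (fun m hm => ?_) (fun m _ m' _ h => ?_) (fun n hn => ?_)
    (fun _ _ => rfl)
  · obtain ⟨h1, h2⟩ := mem_filter.1 hm
    obtain ⟨h3, h4⟩ := mem_Icc.1 h1
    refine mem_filter.2 ⟨mem_Icc.2 ⟨?_, ?_⟩, dvd_mul_right _ _, ?_⟩
    · exact hp.trans (Nat.le_mul_of_pos_right _ h3)
    · rw [mul_comm]; exact (Nat.le_div_iff_mul_le hp0).1 h4
    · rwa [Nat.mul_div_cancel_left _ hp0]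
  · exact Nat.eq_of_mul_eq_mul_left hp0 h
  · obtain ⟨h1, ⟨m, rfl⟩, h2⟩ := mem_filter.1 hn
    obtain ⟨h3, h4⟩ := mem_Icc.1 h1
    rw [Nat.mul_div_cancel_left _ hp0] at h2
    refine ⟨m, mem_filter.2 ⟨mem_Icc.2 ⟨Nat.pos_of_ne_zero fun h => ?_, ?_⟩, h2⟩, rfl⟩
    · rw [h, mul_zero] at h3; omega
    · rw [Nat.le_div_iff_mul_le hp0, mul_comm]; exact h4

/-- The number of primes of `[A, B)` dividing `n`. -/
def kk (A B n : ℕ) : ℕ := ((pr A B).filter (· ∣ n)).card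

/-- The number of primes of `[A, B)` exactly dividing `n`. -/
def om (A B n : ℕ) : ℕ := ((pr A B).filter fun p => p ∣ n ∧ ¬ p ∣ n / p).card

lemma kk_mul_of_notMem {A B l m : ℕ} (hl : l.Prime) (h : l ∉ pr A B) :
    kk A B (l * m) = kk A B m := by
  unfold kk
  congr 1
  refine filter_congr fun p hp => ?_
  rw [(mem_pr.1 hp).1.dvd_mul, Nat.prime_dvd_prime_iff_eq (mem_pr.1 hp).1 hl]
  exact or_iff_right fun e => h (e ▸ hp)

lemma kk_mul_of_mem {A B l m : ℕ} (h : l ∈ pr A B) (hlm : ¬ l ∣ m) :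
    kk A B (l * m) = kk A B m + 1 := by
  unfold kk
  have : (pr A B).filter (· ∣ l * m) = insert l ((pr A B).filter (· ∣ m)) := by
    ext p
    simp only [mem_filter, mem_insert]
    constructor
    · rintro ⟨hp, hd⟩
      rcases (mem_pr.1 hp).1.dvd_mul.1 hd with h1 | h1
      · exact Or.inl ((Nat.prime_dvd_prime_iff_eq (mem_pr.1 hp).1 (mem_pr.1 h).1).1 h1)
      · exact Or.inr ⟨hp, h1⟩
    · rintro (rfl | ⟨hp, hd⟩)
      · exact ⟨h, dvd_mul_right _ _⟩
      · exact ⟨hp, hd.mul_left _⟩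
  rw [this, card_insert_of_notMem (by simp [hlm])]

lemma om_mul_of_notMem {A B l m : ℕ} (hl : l.Prime) (h : l ∉ pr A B) :
    om A B (l * m) = om A B m := by
  unfold om
  congr 1
  refine filter_congr fun p hp => ?_
  have hpp := (mem_pr.1 hp).1
  have hpl : ¬ p ∣ l := fun hd => h ((Nat.prime_dvd_prime_iff_eq hpp hl).1 hd ▸ hp)
  have h1 : p ∣ l * m ↔ p ∣ m := by rw [hpp.dvd_mul]; exact or_iff_right hpl
  rw [h1]
  refine and_congr_right fun hd => ?_
  rw [Nat.mul_div_assoc _ hd, hpp.dvd_mul]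
  exact not_congr (or_iff_right hpl)

lemma om_le_kk (A B n : ℕ) : om A B n ≤ kk A B n :=
  card_le_card (monotone_filter_right _ fun _ _ h => h.1)

lemma pow_kk_le {A B n : ℕ} (hn : 0 < n) : A ^ kk A B n ≤ n := by
  refine le_trans ?_ (Nat.le_of_dvd hn (prod_primes_dvd n
    (s := (pr A B).filter (· ∣ n)) (fun p hp => ?_) fun p hp => (mem_filter.1 hp).2))
  · exact pow_card_le_prod _ _ _ fun _ hp => (mem_pr.1 (mem_filter.1 hp).1).2.1
  · exact (mem_pr.1 (mem_filter.1 hp).1).1.prime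

lemma om_le_three {A B n : ℕ} (hA : 0 < A) (hn : 0 < n) (hnA : n < A ^ 4) : om A B n ≤ 3 := by
  by_contra h
  have h1 : 4 ≤ kk A B n := by have := om_le_kk A B n; omega
  exact absurd ((Nat.pow_le_pow_right hA h1).trans (pow_kk_le hn)) (by omega)

lemma kk_split {A B C : ℕ} (hAB : A ≤ B) (hBC : B ≤ C) (n : ℕ) :
    kk A C n = kk A B n + kk B C n := by
  unfold kk pr
  rw [← card_union_of_disjoint, ← filter_union, ← filter_union, Ico_union_Ico_eq_Ico hAB hBC]
  refine disjoint_left.2 fun p h1 h2 => ?_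
  have h3 := (mem_Ico.1 (mem_filter.1 (mem_filter.1 h1).1).1).2
  have h4 := (mem_Ico.1 (mem_filter.1 (mem_filter.1 h2).1).1).1
  omega

lemma sum_dvd_rho_eq (X D : ℕ) :
    ∑ n ∈ (Icc 2 X).filter (fun n => D ∣ n), rho n = ((G X).filter fun γ => D ∣ nm γ).card := by
  rw [card_filter, ← sum_Icc_roots_eq X fun m _ => if D ∣ m then 1 else 0, sum_filter]
  refine Finset.sum_congr rfl fun n _ => ?_
  split_ifs <;> simp [rho]

lemma sum_rho_le (X : ℕ) : ∑ n ∈ Icc 2 X, rho n ≤ X := by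
  have := sum_dvd_rho_eq X 1
  simp only [one_dvd, filter_true] at this
  rw [this]; exact card_G_le X

lemma sum_dvd_rho_le {X D : ℕ} (hD : 0 < D) :
    (∑ n ∈ (Icc 2 X).filter (fun n => D ∣ n), (rho n : ℝ)) ≤ rho D * (X / D + √X) := by
  have h := card_G_dvd_le X D hD
  rw [← sum_dvd_rho_eq] at h
  have h1 : (∑ n ∈ (Icc 2 X).filter (fun n => D ∣ n), (rho n : ℝ))
      ≤ rho D * (Nat.sqrt X * ((Nat.sqrt X / D : ℕ) + 1)) := by exact_mod_cast h
  refine h1.trans ?_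
  have h2 : (Nat.sqrt X : ℝ) ≤ √X := Real.nat_sqrt_le_real_sqrt
  have h3 : (Nat.sqrt X : ℝ) * Nat.sqrt X ≤ X := by exact_mod_cast Nat.sqrt_le X
  have h4 : ((Nat.sqrt X / D : ℕ) : ℝ) ≤ Nat.sqrt X / D := Nat.cast_div_le
  gcongr
  calc (Nat.sqrt X : ℝ) * ((Nat.sqrt X / D : ℕ) + 1) ≤ Nat.sqrt X * (Nat.sqrt X / D + 1) := by
        gcongr
    _ = Nat.sqrt X * Nat.sqrt X / D + Nat.sqrt X := by ring
    _ ≤ X / D + √X := by gcongr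

end Weights

section Bonferroni

/-- A truncated inclusion-exclusion sum over a set of primes. -/
noncomputable def bonf (T : Finset ℕ) (r n : ℕ) : ℝ :=
  ∑ S ∈ T.powerset.filter (fun S => S.card ≤ r), (-1 : ℝ) ^ S.card * if ∏ p ∈ S, p ∣ n then 1 else 0

lemma prod_dvd_iff {S : Finset ℕ} (hS : ∀ p ∈ S, p.Prime) {n : ℕ} :
    ∏ p ∈ S, p ∣ n ↔ ∀ p ∈ S, p ∣ n :=
  ⟨fun h _ hp => (dvd_prod_of_mem _ hp).trans h,
    fun h => prod_primes_dvd n (fun p hp => (hS p hp).prime) h⟩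

lemma bonf_eq {T : Finset ℕ} (hT : ∀ p ∈ T, p.Prime) (r n : ℕ) :
    bonf T r n
      = ((∑ i ∈ range (r + 1), (-1 : ℤ) ^ i * ((T.filter (· ∣ n)).card.choose i) : ℤ) : ℝ) := by
  unfold bonf
  have h1 : ∀ S ∈ T.powerset, (∏ p ∈ S, p ∣ n ↔ S ⊆ T.filter (· ∣ n)) := fun S hS => by
    have hST := mem_powerset.1 hS
    rw [prod_dvd_iff fun p hp => hT p (hST hp)]
    exact ⟨fun h p hp => mem_filter.2 ⟨hST hp, h p hp⟩, fun h p hp => (mem_filter.1 (h hp)).2⟩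
  simp only [mul_ite, mul_one, mul_zero]
  rw [← sum_filter, filter_filter]
  have h2 : T.powerset.filter (fun S => S.card ≤ r ∧ ∏ p ∈ S, p ∣ n)
      = (range (r + 1)).biUnion fun i => (T.filter (· ∣ n)).powersetCard i := by
    ext S
    simp only [mem_filter, mem_biUnion, mem_range, mem_powersetCard]
    constructor
    · rintro ⟨h, hr, hd⟩
      exact ⟨S.card, by omega, (h1 S h).1 hd, rfl⟩
    · rintro ⟨i, hi, hS, rfl⟩
      have h : S ∈ T.powerset := mem_powerset.2 (hS.trans (filter_subset _ _))
      exact ⟨h, by omega, (h1 S h).2 hS⟩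
  rw [h2, sum_biUnion]
  · push_cast
    refine Finset.sum_congr rfl fun i _ => ?_
    rw [Finset.sum_congr rfl fun S hS => by rw [(mem_powersetCard.1 hS).2], sum_const,
      card_powersetCard, nsmul_eq_mul, mul_comm]
  · intro i _ j _ hij
    refine disjoint_left.2 fun S h3 h4 => hij ?_
    rw [← (mem_powersetCard.1 h3).2, ← (mem_powersetCard.1 h4).2]

/-- Bonferroni's inequality. -/
lemma abs_bonf_sub_le {T : Finset ℕ} (hT : ∀ p ∈ T, p.Prime) (r n : ℕ) :
    |bonf T r n - if (T.filter (· ∣ n)).card = 0 then 1 else 0|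
      ≤ (T.filter (· ∣ n)).card.choose (r + 1) := by
  rw [bonf_eq hT]
  set g := (T.filter (· ∣ n)).card
  rcases Nat.eq_zero_or_pos g with h | h
  · rw [h, sum_range_succ']
    simp
  · rw [if_neg h.ne', sub_zero]
    obtain ⟨q, hq⟩ : ∃ q, g = q + 1 := ⟨g - 1, by omega⟩
    rw [hq, Int.alternating_sum_range_choose_eq_choose]
    push_cast
    rw [abs_mul, abs_pow, abs_neg, abs_one, one_pow, one_mul, Nat.abs_cast]
    rw [Nat.choose_succ_succ]
    push_cast
    linarith [Nat.cast_nonneg (α := ℝ) (q.choose (r + 1))]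

lemma choose_card_filter_eq {T : Finset ℕ} (hT : ∀ p ∈ T, p.Prime) (k n : ℕ) :
    (T.filter (· ∣ n)).card.choose k
      = ∑ S ∈ T.powersetCard k, if ∏ p ∈ S, p ∣ n then 1 else 0 := by
  rw [← card_powersetCard, ← card_filter]
  congr 1
  ext S
  simp only [mem_filter, mem_powersetCard]
  constructor
  · rintro ⟨h, rfl⟩
    have hST := h.trans (filter_subset _ _)
    exact ⟨⟨hST, rfl⟩, (prod_dvd_iff fun p hp => hT p (hST hp)).2 fun p hp =>
      (mem_filter.1 (h hp)).2⟩
  · rintro ⟨⟨h, rfl⟩, hd⟩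
    exact ⟨fun p hp => mem_filter.2 ⟨h hp, (dvd_prod_of_mem _ hp).trans hd⟩, rfl⟩

lemma rho_prod_le {S : Finset ℕ} (hS : ∀ p ∈ S, p.Prime) : rho (∏ p ∈ S, p) ≤ 2 ^ S.card := by
  induction S using Finset.induction_on with
  | empty => simp [rho_one]
  | insert p S hp ih =>
    rw [prod_insert hp, card_insert_of_notMem hp, pow_succ']
    refine (rho_mul_prime_le _ _ (hS p (mem_insert_self _ _))).trans ?_
    exact Nat.mul_le_mul_left _ (ih fun q hq => hS q (mem_insert_of_mem hq))


lemma sum_inv_pr_le (t : ℕ) : ∑ p ∈ pr 0 (2 ^ t), (p : ℝ)⁻¹ ≤ t * Real.log 2 := by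
  have h3 := harmonic_le_one_add_log (2 ^ t)
  rw [harmonic_eq_sum_Icc] at h3
  push_cast at h3
  rw [Real.log_pow] at h3
  have h1 : ∑ p ∈ pr 0 (2 ^ t), (p : ℝ)⁻¹ + 1 ≤ ∑ n ∈ Icc 1 (2 ^ t : ℕ), ((n : ℕ) : ℝ)⁻¹ := by
    rw [show Icc 1 (2 ^ t) = insert 1 (Icc 2 (2 ^ t)) from by
      ext n
      have := Nat.one_le_two_pow (n := t)
      simp only [mem_insert, mem_Icc]; omega, sum_insert (by simp), Nat.cast_one, inv_one, add_comm]
    gcongr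
    intro p hp
    obtain ⟨h1, -, h2⟩ := mem_pr.1 hp
    exact mem_Icc.2 ⟨h1.two_le, h2.le⟩
  linarith

lemma sum_rho_choose_le (X t k : ℕ) :
    ∑ n ∈ Icc 2 X, (rho n : ℝ) * (((pr 0 (2 ^ t)).filter (· ∣ n)).card.choose k : ℕ)
      ≤ X * 2 ^ (4 * t) / 2 ^ k + 2 ^ k * 2 ^ (t * k) * √X := by
  set T := pr 0 (2 ^ t) with hT
  have hTp : ∀ p ∈ T, p.Prime := fun p hp => (mem_pr.1 hp).1
  have hTc : T.card ≤ 2 ^ t := (card_filter_le _ _).trans (by rw [Nat.card_Ico, Nat.sub_zero])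
  have hSp : ∀ S ∈ T.powersetCard k, ∀ p ∈ S, p.Prime := fun S hS p hp =>
    hTp p ((mem_powersetCard.1 hS).1 hp)
  have e1 : ∑ n ∈ Icc 2 X, (rho n : ℝ) * ((T.filter (· ∣ n)).card.choose k : ℕ)
      = ∑ S ∈ T.powersetCard k, ∑ n ∈ (Icc 2 X).filter (fun n => ∏ p ∈ S, p ∣ n), (rho n : ℝ) := by
    simp only [sum_filter]
    rw [sum_comm]
    refine Finset.sum_congr rfl fun n _ => ?_
    rw [choose_card_filter_eq hTp]
    push_cast
    rw [mul_sum]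
    exact Finset.sum_congr rfl fun S _ => by rw [mul_ite, mul_one, mul_zero]
  have e2 : ∀ S ∈ T.powersetCard k,
      (∑ n ∈ (Icc 2 X).filter (fun n => ∏ p ∈ S, p ∣ n), (rho n : ℝ))
        ≤ X / 2 ^ k * ∏ p ∈ S, (4 * (p : ℝ)⁻¹) + 2 ^ k * √X := by
    intro S hS
    have hc := (mem_powersetCard.1 hS).2
    have hpos : 0 < ∏ p ∈ S, p := prod_pos fun p hp => (hSp S hS p hp).pos
    refine (sum_dvd_rho_le hpos).trans ?_
    have h1 : (rho (∏ p ∈ S, p) : ℝ) ≤ 2 ^ k := by exact_mod_cast hc ▸ rho_prod_le (hSp S hS)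
    rw [prod_mul_distrib, prod_const, hc, prod_inv_distrib]
    calc (rho (∏ p ∈ S, p) : ℝ) * (X / (∏ p ∈ S, p : ℕ) + √X)
        ≤ 2 ^ k * (X / (∏ p ∈ S, p : ℕ) + √X) := by gcongr
      _ = X / 2 ^ k * (4 ^ k * (∏ p ∈ S, (p : ℝ))⁻¹) + 2 ^ k * √X := by
          rw [show (4 : ℝ) = 2 * 2 by norm_num, mul_pow]
          push_cast
          field_simp
  rw [e1]
  refine (sum_le_sum e2).trans ?_
  rw [sum_add_distrib, ← mul_sum, sum_const, card_powersetCard, nsmul_eq_mul]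
  have h3 : ∑ S ∈ T.powersetCard k, ∏ p ∈ S, (4 * (p : ℝ)⁻¹) ≤ 2 ^ (4 * t) := by
    calc ∑ S ∈ T.powersetCard k, ∏ p ∈ S, (4 * (p : ℝ)⁻¹)
        ≤ ∑ S ∈ T.powerset, ∏ p ∈ S, (4 * (p : ℝ)⁻¹) :=
          sum_le_sum_of_subset_of_nonneg
            (fun S hS => mem_powerset.2 (mem_powersetCard.1 hS).1)
            fun S _ _ => prod_nonneg fun p _ => by positivity
      _ = ∏ p ∈ T, (4 * (p : ℝ)⁻¹ + 1) := by rw [prod_add_one]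
      _ ≤ ∏ p ∈ T, Real.exp (4 * (p : ℝ)⁻¹) :=
          prod_le_prod (fun p _ => by positivity) fun p _ => Real.add_one_le_exp _
      _ = Real.exp (4 * ∑ p ∈ T, (p : ℝ)⁻¹) := by rw [← Real.exp_sum, mul_sum]
      _ ≤ Real.exp (Real.log (2 ^ (4 * t))) := by
          rw [Real.log_pow]
          have := sum_inv_pr_le t
          push_cast
          exact Real.exp_le_exp.2 (by linarith)
      _ = _ := Real.exp_log (by positivity)
  have h4 : ((T.card.choose k : ℕ) : ℝ) ≤ 2 ^ (t * k) := by
    rw [pow_mul]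
    exact_mod_cast (Nat.choose_le_pow _ _).trans (Nat.pow_le_pow_left hTc _)
  calc _ ≤ X / 2 ^ k * 2 ^ (4 * t) + 2 ^ (t * k) * (2 ^ k * √X) := by gcongr
    _ = _ := by ring

end Bonferroni

section Rough

lemma sum_mul_om_eq {X A B : ℕ} (F : ℕ → ℂ) :
    ∑ n ∈ Icc 2 X, (om A B n : ℂ) * F n
      = ∑ p ∈ pr A B, ∑ m ∈ (Icc 1 (X / p)).filter (fun m => ¬ p ∣ m), F (p * m) := by
  have h1 : ∀ p ∈ pr A B, ∑ m ∈ (Icc 1 (X / p)).filter (fun m => ¬ p ∣ m), F (p * m)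
      = ∑ n ∈ Icc 2 X, if p ∣ n ∧ ¬ p ∣ n / p then F n else 0 := fun p hp => by
    rw [← sum_simple_eq (mem_pr.1 hp).1.two_le, sum_filter]
  rw [Finset.sum_congr rfl h1, sum_comm]
  refine Finset.sum_congr rfl fun n _ => ?_
  rw [← sum_filter, sum_const, nsmul_eq_mul, om]

lemma norm_sum_dvd_one_sub_om_le {X a c K k b h : ℕ} (hK : 2 ≤ K) (hb : 0 < b) (hbK : b ≤ K)
    (hh : 0 < h) (hhK : h ≤ K) (hac : a ≤ c) (hKa : K ^ 168 ≤ 2 ^ a)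
    (hcX : 2 ^ (2 * c) * K ^ 84 ≤ X) (hbw : ∀ p, p.Prime → 2 ^ a ≤ p → b.Coprime p)
    (hKk : K < k ^ 4) (hk : 12 ≤ Real.log (k ^ 4 : ℕ))
    (hX : 14 * Real.log (k ^ 4 : ℕ) ^ 2 ≤ Real.log (Nat.sqrt X)) :
    ‖∑ n ∈ Icc 2 X, (if b ∣ n then 1 else 0) * (1 - (om (2 ^ a) (2 ^ c) n : ℂ)) * asum h n‖
      ≤ 7 * h * √X + 18 * b * X / √k + 3 * X / (k : ℝ) ^ 4 + c * (2 ^ 20 * (X : ℝ) / K) := by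
  have e1 : ∑ n ∈ Icc 2 X, (if b ∣ n then 1 else 0) * (1 - (om (2 ^ a) (2 ^ c) n : ℂ)) * asum h n
      = ∑ n ∈ (Icc 2 X).filter (fun n => b ∣ n), asum h n
        - ∑ n ∈ Icc 2 X, (om (2 ^ a) (2 ^ c) n : ℂ) * ((if b ∣ n then 1 else 0) * asum h n) := by
    rw [sum_filter, ← sum_sub_distrib]
    refine Finset.sum_congr rfl fun n _ => ?_
    split_ifs <;> ring
  rw [e1]
  refine (norm_sub_le _ _).trans (add_le_add
    (norm_sum_dvd_le hb (hbK.trans_lt hKk) hh (hhK.trans_lt hKk) hk hX) ?_)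
  rw [sum_mul_om_eq, sum_pr_eq_sum_block hac]
  have h1 : ∀ j ∈ Ico a c, ‖∑ p ∈ block (2 ^ j), ∑ m ∈ (Icc 1 (X / p)).filter (fun m => ¬ p ∣ m),
      (if b ∣ p * m then 1 else 0) * asum h (p * m)‖ ≤ 2 ^ 20 * (X : ℝ) / K := by
    intro j hj
    obtain ⟨hj1, hj2⟩ := mem_Ico.1 hj
    refine (norm_sum_le _ _).trans (le_trans (le_of_eq ?_) (sum_norm_linear_le hK hb hbK hh hhK
      (hKa.trans (Nat.pow_le_pow_right two_pos hj1)) (le_trans ?_ hcX)))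
    · refine Finset.sum_congr rfl fun p hp => ?_
      obtain ⟨g1, g2, -⟩ := mem_block.1 hp
      have := hbw p g1 ((Nat.pow_le_pow_right two_pos hj1).trans g2)
      simp only [this.dvd_mul_left]
    · rw [← pow_mul]
      exact Nat.mul_le_mul_right _ (Nat.pow_le_pow_right two_pos (by omega))
  refine (norm_sum_le_of_le _ h1).trans ?_
  rw [sum_const, Nat.card_Ico, nsmul_eq_mul]
  gcongr
  omega

lemma norm_sum_bonf_le {X a c K k h t r D : ℕ} (hK : 2 ≤ K) (hh : 0 < h) (hhK : h ≤ K)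
    (hac : a ≤ c) (hta : t ≤ a) (hD : 2 ^ (t * r) ≤ D) (hDK : D ≤ K) (hKa : K ^ 168 ≤ 2 ^ a)
    (hcX : 2 ^ (2 * c) * K ^ 84 ≤ X) (hKk : K < k ^ 4) (hk : 12 ≤ Real.log (k ^ 4 : ℕ))
    (hX : 14 * Real.log (k ^ 4 : ℕ) ^ 2 ≤ Real.log (Nat.sqrt X)) :
    ‖∑ n ∈ Icc 2 X, (bonf (pr 0 (2 ^ t)) r n : ℂ) * (1 - (om (2 ^ a) (2 ^ c) n : ℂ)) * asum h n‖
      ≤ D * (7 * h * √X + 18 * D * X / √k + 3 * X / (k : ℝ) ^ 4 + c * (2 ^ 20 * (X : ℝ) / K)) := by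
  set T := pr 0 (2 ^ t) with hT
  set 𝒮 := T.powerset.filter (fun S => S.card ≤ r) with h𝒮
  have hSp : ∀ S ∈ 𝒮, ∀ p ∈ S, p.Prime ∧ p ≤ 2 ^ t := fun S hS p hp => by
    obtain ⟨h1, -, h2⟩ := mem_pr.1 (mem_powerset.1 (mem_filter.1 hS).1 hp)
    exact ⟨h1, h2.le⟩
  have hpos : ∀ S ∈ 𝒮, 0 < ∏ p ∈ S, p := fun S hS => prod_pos fun p hp => (hSp S hS p hp).1.pos
  have hSD : ∀ S ∈ 𝒮, ∏ p ∈ S, p ≤ D := fun S hS => by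
    refine (prod_le_pow_card _ _ _ fun p hp => (hSp S hS p hp).2).trans (le_trans ?_ hD)
    rw [← pow_mul]
    exact Nat.pow_le_pow_right two_pos (Nat.mul_le_mul_left _ (mem_filter.1 hS).2)
  have hcard : 𝒮.card ≤ D := by
    have : (Icc 1 D).card = D := by rw [Nat.card_Icc, Nat.add_sub_cancel]
    rw [← this]
    refine card_le_card_of_injOn (fun S => ∏ p ∈ S, p)
      (fun S hS => mem_coe.2 (mem_Icc.2 ⟨hpos S hS, hSD S hS⟩)) fun S hS S' hS' hSS => ?_
    have h1 := Nat.primeFactors_prod fun p hp => (hSp S hS p hp).1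
    have h2 := Nat.primeFactors_prod fun p hp => (hSp S' hS' p hp).1
    simp only at hSS
    rw [← h1, ← h2, hSS]
  have e1 : ∑ n ∈ Icc 2 X, (bonf T r n : ℂ) * (1 - (om (2 ^ a) (2 ^ c) n : ℂ)) * asum h n
      = ∑ S ∈ 𝒮, (-1 : ℂ) ^ S.card * ∑ n ∈ Icc 2 X, (if ∏ p ∈ S, p ∣ n then 1 else 0)
        * (1 - (om (2 ^ a) (2 ^ c) n : ℂ)) * asum h n := by
    simp only [mul_sum]
    rw [sum_comm]
    refine Finset.sum_congr rfl fun n _ => ?_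
    rw [bonf]
    push_cast
    rw [sum_mul, sum_mul]
    refine Finset.sum_congr rfl fun S _ => ?_
    split_ifs <;> push_cast <;> ring
  rw [e1]
  have h1 : ∀ S ∈ 𝒮, ‖(-1 : ℂ) ^ S.card * ∑ n ∈ Icc 2 X, (if ∏ p ∈ S, p ∣ n then 1 else 0)
        * (1 - (om (2 ^ a) (2 ^ c) n : ℂ)) * asum h n‖
      ≤ 7 * h * √X + 18 * D * X / √k + 3 * X / (k : ℝ) ^ 4 + c * (2 ^ 20 * (X : ℝ) / K) := by
    intro S hS
    rw [norm_mul, norm_pow, norm_neg, norm_one, one_pow, one_mul]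
    refine (norm_sum_dvd_one_sub_om_le hK (hpos S hS) ((hSD S hS).trans hDK) hh hhK hac hKa hcX
      (fun q hq hqa => ?_) hKk hk hX).trans ?_
    · refine Nat.Coprime.prod_left fun p hp => ?_
      obtain ⟨g1, -, g2⟩ := mem_pr.1 (mem_powerset.1 (mem_filter.1 hS).1 hp)
      refine (Nat.coprime_primes g1 hq).2 ?_
      have := Nat.pow_le_pow_right two_pos hta
      omega
    · have : ((∏ p ∈ S, p : ℕ) : ℝ) ≤ D := by exact_mod_cast hSD S hS
      gcongr
  refine (norm_sum_le_of_le _ h1).trans ?_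
  rw [sum_const, nsmul_eq_mul]
  gcongr

lemma sqrt_le_div_two_pow {X e : ℕ} (h : 2 ^ (2 * e) ≤ X) : √(X : ℝ) ≤ X / 2 ^ e := by
  have h1 : (2 : ℝ) ^ e ≤ √X := by
    refine Real.le_sqrt_of_sq_le ?_
    rw [← pow_mul, mul_comm]
    exact_mod_cast h
  rw [le_div_iff₀ (by positivity)]
  calc √(X : ℝ) * 2 ^ e ≤ √X * √X := by gcongr
    _ = X := Real.mul_self_sqrt (Nat.cast_nonneg _)

/-- Integers without small prime factors, weighted by `1 - om`. -/
theorem norm_sum_rough_le {X N a c h t : ℕ} (ht : 1 ≤ t) (hN : 2 ^ N ≤ X) (hX : X < 2 ^ (N + 1))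
    (hNt : 2 ^ 21 * t ^ 4 ≤ N) (ha : 2688 * t ^ 2 ≤ a) (ha' : N + 1 ≤ 4 * a) (hac : a ≤ c)
    (hc : 2 * c + 1344 * t ^ 2 ≤ N) (hh : 0 < h) (hht : h ≤ 2 ^ t) :
    ‖∑ n ∈ Icc 2 X, (if kk 0 (2 ^ t) n = 0 then 1 else 0)
      * (1 - (om (2 ^ a) (2 ^ c) n : ℂ)) * asum h n‖ ≤ 2 ^ 21 * N * (X : ℝ) / 2 ^ t := by
  have ht2 : t ≤ t ^ 2 := Nat.le_self_pow two_ne_zero t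
  have ht4 : t ^ 2 ≤ t ^ 4 := Nat.pow_le_pow_right ht (by norm_num)
  have ht1 : 1 ≤ t ^ 2 := Nat.one_le_pow _ _ ht
  set u := t ^ 2 with hu
  have hXr : (0 : ℝ) < X := by exact_mod_cast (pow_pos two_pos N).trans_le hN
  have hpX : ∀ e, e ≤ N → 2 ^ e ≤ X := fun e he => (Nat.pow_le_pow_right two_pos he).trans hN
  have hk : Real.log (((2 ^ (64 * u)) ^ 4 : ℕ)) = 256 * u * Real.log 2 := by
    rw [← pow_mul]; push_cast; rw [Real.log_pow]; push_cast; ring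
  have hl2 := Real.log_two_gt_d9
  have hl2' := Real.log_two_lt_d9
  have hur : (1 : ℝ) ≤ u := by exact_mod_cast ht1
  have hhK : h ≤ 2 ^ (16 * u) := hht.trans (Nat.pow_le_pow_right two_pos (by omega))
  have hmain := norm_sum_bonf_le (X := X) (a := a) (c := c) (K := 2 ^ (16 * u)) (k := 2 ^ (64 * u))
    (h := h) (t := t) (r := 8 * t) (D := 2 ^ (8 * u))
    (by calc 2 = 2 ^ 1 := rfl
          _ ≤ _ := Nat.pow_le_pow_right two_pos (by omega))
    hh hhK hac (by omega) (le_of_eq (by rw [hu]; congr 1; ring))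
    (Nat.pow_le_pow_right two_pos (by omega))
    (by rw [← pow_mul]; exact Nat.pow_le_pow_right two_pos (by omega))
    (by rw [← pow_mul, ← pow_add]; exact hpX _ (by omega))
    (by rw [← pow_mul]; exact Nat.pow_lt_pow_right one_lt_two (by omega))
    (by rw [hk]; nlinarith)
    (by
      rw [hk]
      have h1 : 2 ^ (N / 2) ≤ Nat.sqrt X := by
        rw [Nat.le_sqrt', ← pow_mul]; exact hpX _ (by omega)
      have h2 : Real.log ((2 ^ (N / 2) : ℕ)) ≤ Real.log (Nat.sqrt X) :=
        Real.log_le_log (by positivity) (by exact_mod_cast h1)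
      refine le_trans ?_ h2
      push_cast
      rw [Real.log_pow]
      have h3 : 2 ^ 20 * u ^ 2 ≤ N / 2 := by
        have : t ^ 4 = u ^ 2 := by rw [hu]; ring
        omega
      have h4 : (2 : ℝ) ^ 20 * (u : ℝ) ^ 2 ≤ ((N / 2 : ℕ) : ℝ) := by exact_mod_cast h3
      calc 14 * (256 * (u : ℝ) * Real.log 2) ^ 2
          = (917504 * (u : ℝ) ^ 2) * Real.log 2 * Real.log 2 := by ring
        _ ≤ (917504 * (u : ℝ) ^ 2) * Real.log 2 * 1 := by
            gcongr
            linarith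
        _ ≤ (2 : ℝ) ^ 20 * (u : ℝ) ^ 2 * Real.log 2 := by
            rw [mul_one]; gcongr; norm_num
        _ ≤ _ := by gcongr)
  have hX4 : X < (2 ^ a) ^ 4 := by
    refine hX.trans_le ?_
    rw [← pow_mul]; exact Nat.pow_le_pow_right two_pos (by omega)
  have herr : ‖∑ n ∈ Icc 2 X, (if kk 0 (2 ^ t) n = 0 then 1 else 0)
        * (1 - (om (2 ^ a) (2 ^ c) n : ℂ)) * asum h n
      - ∑ n ∈ Icc 2 X, (bonf (pr 0 (2 ^ t)) (8 * t) n : ℂ)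
        * (1 - (om (2 ^ a) (2 ^ c) n : ℂ)) * asum h n‖
      ≤ 3 * (X * 2 ^ (4 * t) / 2 ^ (8 * t + 1) + 2 ^ (8 * t + 1) * 2 ^ (t * (8 * t + 1)) * √X) := by
    rw [← sum_sub_distrib]
    refine le_trans (norm_sum_le_of_le (f := _) (n := fun n => 3 * ((rho n : ℝ)
      * (((pr 0 (2 ^ t)).filter (· ∣ n)).card.choose (8 * t + 1) : ℕ))) _ fun n hn => ?_) ?_
    · obtain ⟨hn1, hn2⟩ := mem_Icc.1 hn
      have h1 := abs_bonf_sub_le (T := pr 0 (2 ^ t)) (fun p hp => (mem_pr.1 hp).1) (8 * t) n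
      have h2 : ‖(1 - (om (2 ^ a) (2 ^ c) n : ℂ))‖ ≤ 3 := by
        have h3 := om_le_three (A := 2 ^ a) (B := 2 ^ c) (pow_pos two_pos _) (by omega)
          (hn2.trans_lt hX4)
        set o := om (2 ^ a) (2 ^ c) n
        interval_cases o <;> norm_num
      have h3 := norm_asum_le h n
      rw [← sub_mul, ← sub_mul, norm_mul, norm_mul]
      have h4 : ‖((if kk 0 (2 ^ t) n = 0 then 1 else 0 : ℂ)) - (bonf (pr 0 (2 ^ t)) (8 * t) n : ℂ)‖
          ≤ (((pr 0 (2 ^ t)).filter (· ∣ n)).card.choose (8 * t + 1) : ℕ) := by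
        rw [norm_sub_rev]
        refine le_trans (le_of_eq ?_) h1
        rw [← Real.norm_eq_abs, ← Complex.norm_real]
        unfold kk
        split_ifs <;> simp
      calc _ ≤ ((((pr 0 (2 ^ t)).filter (· ∣ n)).card.choose (8 * t + 1) : ℕ) : ℝ) * 3 * rho n := by
            gcongr
        _ = _ := by ring
    · rw [← mul_sum]
      have := sum_rho_choose_le X t (8 * t + 1)
      gcongr
  have hs1 : √(X : ℝ) ≤ X / 2 ^ (25 * u) := sqrt_le_div_two_pow (hpX _ (by omega))
  have hp : ∀ {x y : ℕ}, x ≤ y → (2 : ℝ) ^ x ≤ 2 ^ y := fun hxy =>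
    pow_le_pow_right₀ one_le_two hxy
  have hhr : (h : ℝ) ≤ 2 ^ t := by exact_mod_cast hht
  have b1 : (2 : ℝ) ^ (8 * u) * (7 * h * √X) ≤ 7 * (X / 2 ^ t) := by
    calc (2 : ℝ) ^ (8 * u) * (7 * h * √X) ≤ 2 ^ (8 * u) * (7 * 2 ^ t * (X / 2 ^ (25 * u))) := by
          gcongr
      _ = 7 * X * (2 ^ (8 * u + t) / 2 ^ (25 * u)) := by rw [pow_add]; ring
      _ ≤ 7 * X * (1 / 2 ^ t) := by
          gcongr 7 * (X : ℝ) * ?_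
          rw [div_le_div_iff₀ (by positivity) (by positivity), one_mul, ← pow_add]
          exact hp (by omega)
      _ = _ := by ring
  have b2 : (2 : ℝ) ^ (8 * u) * (18 * 2 ^ (8 * u) * X / √((2 ^ (64 * u) : ℕ) : ℝ))
      ≤ 18 * (X / 2 ^ t) := by
    have : √((2 ^ (64 * u) : ℕ) : ℝ) = 2 ^ (32 * u) := by
      push_cast
      rw [show 64 * u = 32 * u * 2 by ring, pow_mul, Real.sqrt_sq (by positivity)]
    rw [this]
    calc (2 : ℝ) ^ (8 * u) * (18 * 2 ^ (8 * u) * X / 2 ^ (32 * u))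
        = 18 * X * (2 ^ (8 * u + 8 * u) / 2 ^ (32 * u)) := by rw [pow_add]; ring
      _ ≤ 18 * X * (1 / 2 ^ t) := by
          gcongr 18 * (X : ℝ) * ?_
          rw [div_le_div_iff₀ (by positivity) (by positivity), one_mul, ← pow_add]
          exact hp (by omega)
      _ = _ := by ring
  have b3 : (2 : ℝ) ^ (8 * u) * (3 * X / ((2 ^ (64 * u) : ℕ) : ℝ) ^ 4) ≤ 3 * (X / 2 ^ t) := by
    push_cast
    rw [← pow_mul]
    calc (2 : ℝ) ^ (8 * u) * (3 * X / 2 ^ (64 * u * 4))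
        = 3 * X * (2 ^ (8 * u) / 2 ^ (64 * u * 4)) := by ring
      _ ≤ 3 * X * (1 / 2 ^ t) := by
          gcongr 3 * (X : ℝ) * ?_
          rw [div_le_div_iff₀ (by positivity) (by positivity), one_mul, ← pow_add]
          exact hp (by omega)
      _ = _ := by ring
  have b4 : (2 : ℝ) ^ (8 * u) * (c * (2 ^ 20 * (X : ℝ) / ((2 ^ (16 * u) : ℕ) : ℝ)))
      ≤ N * 2 ^ 20 * (X / 2 ^ t) := by
    push_cast
    have hcN : (c : ℝ) ≤ N := by exact_mod_cast (by omega : c ≤ N)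
    calc (2 : ℝ) ^ (8 * u) * ((c : ℝ) * (2 ^ 20 * (X : ℝ) / 2 ^ (16 * u)))
        = (c : ℝ) * 2 ^ 20 * X * (2 ^ (8 * u) / 2 ^ (16 * u)) := by ring
      _ ≤ (N : ℝ) * 2 ^ 20 * X * (1 / 2 ^ t) := by
          have : (2 : ℝ) ^ (8 * u) / 2 ^ (16 * u) ≤ 1 / 2 ^ t := by
            rw [div_le_div_iff₀ (by positivity) (by positivity), one_mul, ← pow_add]
            exact hp (by omega)
          gcongr
      _ = _ := by ring
  have b5 : (X : ℝ) * 2 ^ (4 * t) / 2 ^ (8 * t + 1) ≤ X / 2 ^ t := by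
    rw [div_le_div_iff₀ (by positivity) (by positivity), mul_assoc, ← pow_add]
    exact mul_le_mul_of_nonneg_left (hp (by omega)) hXr.le
  have b6 : (2 : ℝ) ^ (8 * t + 1) * 2 ^ (t * (8 * t + 1)) * √X ≤ X / 2 ^ t := by
    calc (2 : ℝ) ^ (8 * t + 1) * 2 ^ (t * (8 * t + 1)) * √X
        ≤ 2 ^ (8 * t + 1) * 2 ^ (t * (8 * t + 1)) * (X / 2 ^ (25 * u)) := by gcongr
      _ = X * (2 ^ (8 * t + 1 + t * (8 * t + 1)) / 2 ^ (25 * u)) := by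
          rw [pow_add (2 : ℝ) (8 * t + 1)]; ring
      _ ≤ X * (1 / 2 ^ t) := by
          gcongr (X : ℝ) * ?_
          rw [div_le_div_iff₀ (by positivity) (by positivity), one_mul, ← pow_add]
          refine hp ?_
          have : t * (8 * t + 1) = 8 * u + t := by rw [hu]; ring
          omega
      _ = _ := by ring
  have hN1 : (1 : ℝ) ≤ N := by exact_mod_cast (by omega : 1 ≤ N)
  have hsub := norm_le_norm_add_norm_sub' (∑ n ∈ Icc 2 X, (if kk 0 (2 ^ t) n = 0 then 1 else 0)
        * (1 - (om (2 ^ a) (2 ^ c) n : ℂ)) * asum h n)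
    (∑ n ∈ Icc 2 X, (bonf (pr 0 (2 ^ t)) (8 * t) n : ℂ)
        * (1 - (om (2 ^ a) (2 ^ c) n : ℂ)) * asum h n)
  have hq : 0 ≤ (X : ℝ) / 2 ^ t := by positivity
  have hqN : (X : ℝ) / 2 ^ t ≤ N * ((X : ℝ) / 2 ^ t) := le_mul_of_one_le_left hq hN1
  rw [mul_add, mul_add, mul_add] at hmain
  have e2 : 2 ^ 21 * N * (X : ℝ) / 2 ^ t = 2 ^ 21 * (N * ((X : ℝ) / 2 ^ t)) := by ring
  have hmain' := hmain.trans (add_le_add (add_le_add (add_le_add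
    (by push_cast; exact b1) (by push_cast at b2 ⊢; exact b2)) (by push_cast at b3 ⊢; exact b3))
    (by push_cast at b4 ⊢; exact b4))
  rw [e2]
  linarith

end Rough

section PrimeCounts

lemma card_pr_le {a : ℕ} (ha : 0 < a) (x : ℕ) : ((pr (2 ^ a) (x + 1)).card : ℝ) ≤ 6 * x / a := by
  have har : (0 : ℝ) < a := by exact_mod_cast ha
  rcases lt_or_ge x (2 ^ a) with hx | hx
  · have : pr (2 ^ a) (x + 1) = ∅ := by
      rw [pr, Ico_eq_empty (by omega), filter_empty]
    rw [this, card_empty, Nat.cast_zero]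
    positivity
  have hxr : (2 : ℝ) ^ a ≤ x := by exact_mod_cast hx
  have hx1 : (1 : ℝ) < x := lt_of_lt_of_le (one_lt_pow₀ one_lt_two ha.ne') hxr
  have hx0 : (0 : ℝ) < x := by linarith
  have h1 := Chebyshev.pi_le_log4_mul_div hx1
  rw [Nat.floor_natCast] at h1
  have h2 : ((pr (2 ^ a) (x + 1)).card : ℝ) ≤ Nat.primeCounting x := by
    rw [Nat.primeCounting, Nat.primeCounting', Nat.count_eq_card_filter_range]
    exact_mod_cast card_le_card (filter_subset_filter _ fun p hp =>
      mem_range.2 (mem_Ico.1 hp).2)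
  have hl : a / 2 * Real.log 2 ≤ Real.log √x := by
    rw [Real.log_sqrt hx0.le]
    have := Real.log_le_log (by positivity) hxr
    rw [Real.log_pow] at this
    linarith
  have hl2 : 0 < Real.log 2 := Real.log_pos one_lt_two
  have h4 : Real.log 4 = 2 * Real.log 2 := by
    rw [show (4 : ℝ) = 2 ^ 2 by norm_num, Real.log_pow]; push_cast; ring
  have h5 : Real.log 4 * x / Real.log √x ≤ 4 * x / a := by
    rw [h4, div_le_div_iff₀ (lt_of_lt_of_le (by positivity) hl) har]
    calc 2 * Real.log 2 * x * a = 4 * x * (a / 2 * Real.log 2) := by ring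
      _ ≤ 4 * x * Real.log √x := by gcongr
  have h6 : √(x : ℝ) ≤ 2 * x / a := by
    have h7 : (a : ℝ) / 2 ≤ √x := by
      refine Real.le_sqrt_of_sq_le (le_trans ?_ hxr)
      have h8 : a ^ 2 ≤ 4 * 2 ^ a := by
        have key : ∀ n : ℕ, n ^ 2 ≤ 4 * 2 ^ n ∧ 2 * n + 1 ≤ 4 * 2 ^ n := fun n => by
          induction n with
          | zero => simp
          | succ n ih =>
            obtain ⟨i1, i2⟩ := ih
            have := Nat.one_le_two_pow (n := n)
            rw [pow_succ 2 n]
            constructor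
            · nlinarith
            · omega
        exact (key a).1
      have h8' : (a : ℝ) ^ 2 ≤ 4 * 2 ^ a := by exact_mod_cast h8
      linarith [show ((a : ℝ) / 2) ^ 2 = (a : ℝ) ^ 2 / 4 by ring]
    rw [le_div_iff₀ har]
    calc √(x : ℝ) * a = 2 * (√x * (a / 2)) := by ring
      _ ≤ 2 * (√x * √x) := by gcongr
      _ = 2 * x := by rw [Real.mul_self_sqrt hx0.le]
  calc _ ≤ 4 * (x : ℝ) / a + 2 * x / a := by linarith
    _ = _ := by ring

lemma sum_inv_pr_dyadic_le {a j₀ : ℕ} (ha : 0 < a) (haj : a ≤ j₀) (M : ℕ) :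
    ∑ p ∈ pr (2 ^ j₀) (2 ^ (j₀ + M)), (p : ℝ)⁻¹ ≤ 12 * M / a := by
  rw [sum_pr_eq_sum_block (Nat.le_add_right _ _)]
  have h1 : ∀ j ∈ Ico j₀ (j₀ + M), ∑ p ∈ block (2 ^ j), (p : ℝ)⁻¹ ≤ 12 / a := by
    intro j hj
    have haj' := haj.trans (mem_Ico.1 hj).1
    have h2 : ∀ p ∈ block (2 ^ j), (p : ℝ)⁻¹ ≤ (2 ^ j)⁻¹ := fun p hp => by
      have : (2 : ℝ) ^ j ≤ p := by exact_mod_cast (mem_block.1 hp).2.1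
      gcongr
    refine (sum_le_sum h2).trans ?_
    rw [sum_const, nsmul_eq_mul]
    have h3 : ((block (2 ^ j)).card : ℝ) ≤ 6 * (2 * 2 ^ j : ℕ) / a := by
      refine le_trans ?_ (card_pr_le ha (2 * 2 ^ j))
      exact_mod_cast card_le_card fun p hp => by
        obtain ⟨g1, g2, g3⟩ := mem_block.1 hp
        exact mem_pr.2 ⟨g1, (Nat.pow_le_pow_right two_pos haj').trans g2, by omega⟩
    calc _ ≤ 6 * ((2 * 2 ^ j : ℕ) : ℝ) / a * (2 ^ j)⁻¹ := by gcongr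
      _ = 12 / a := by push_cast; field_simp; norm_num
  refine (sum_le_sum h1).trans (le_of_eq ?_)
  rw [sum_const, Nat.card_Ico, Nat.add_sub_cancel_left, nsmul_eq_mul]
  ring

open scoped Classical in
/-- Products of two large primes below `X`. -/
lemma card_pairs_le {a c M X : ℕ} (ha : 0 < a) (hac : a ≤ c) (hX : X < 2 ^ (2 * (c + M))) :
    (((Icc 2 X).filter fun n => ∃ p q, p.Prime ∧ q.Prime ∧ 2 ^ c ≤ p ∧ p ≤ q ∧ n = p * q).card : ℝ)
      ≤ 72 * X * M / a ^ 2 := by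
  have hsub : ((Icc 2 X).filter fun n => ∃ p q, p.Prime ∧ q.Prime ∧ 2 ^ c ≤ p ∧ p ≤ q ∧ n = p * q)
      ⊆ (pr (2 ^ c) (2 ^ (c + M))).biUnion fun p =>
        (pr (2 ^ a) (X / p + 1)).image fun q => p * q := by
    intro n hn
    obtain ⟨h1, p, q, hp, hq, hcp, hpq, rfl⟩ := mem_filter.1 hn
    have h2 := (mem_Icc.1 h1).2
    refine mem_biUnion.2 ⟨p, mem_pr.2 ⟨hp, hcp, ?_⟩, mem_image.2 ⟨q, mem_pr.2 ⟨hq, ?_, ?_⟩, rfl⟩⟩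
    · refine lt_of_pow_lt_pow_left₀ 2 (Nat.zero_le _) ?_
      rw [← pow_mul, mul_comm (c + M), pow_two]
      exact (Nat.mul_le_mul_left _ hpq).trans_lt (h2.trans_lt hX)
    · exact (Nat.pow_le_pow_right two_pos hac).trans (hcp.trans hpq)
    · rw [Nat.lt_succ_iff, Nat.le_div_iff_mul_le hp.pos, mul_comm]; exact h2
  have h1 := (card_le_card hsub).trans (card_biUnion_le.trans
    (sum_le_sum fun p _ => card_image_le))
  have h2 : (((Icc 2 X).filter fun n => ∃ p q, p.Prime ∧ q.Prime ∧ 2 ^ c ≤ p ∧ p ≤ q ∧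
      n = p * q).card : ℝ) ≤
      ∑ p ∈ pr (2 ^ c) (2 ^ (c + M)), ((pr (2 ^ a) (X / p + 1)).card : ℝ) := by
    exact_mod_cast h1
  refine h2.trans ?_
  have h3 : ∀ p ∈ pr (2 ^ c) (2 ^ (c + M)), ((pr (2 ^ a) (X / p + 1)).card : ℝ)
      ≤ 6 * X / a * (p : ℝ)⁻¹ := fun p _ => by
    refine (card_pr_le ha _).trans ?_
    calc 6 * ((X / p : ℕ) : ℝ) / a ≤ 6 * (X / p) / a := by gcongr; exact Nat.cast_div_le
      _ = _ := by ring
  refine (sum_le_sum h3).trans ?_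
  rw [← mul_sum]
  calc _ ≤ 6 * (X : ℝ) / a * (12 * M / a) := by gcongr; exact sum_inv_pr_dyadic_le ha hac M
    _ = _ := by ring

open scoped Classical in
/-- Products of three large primes below `X`. -/
lemma card_triples_le {a M X : ℕ} (ha : 0 < a) (hX : X < 2 ^ (3 * a + M)) :
    (((Icc 2 X).filter fun n => ∃ p q r, p.Prime ∧ q.Prime ∧ r.Prime ∧
      2 ^ a ≤ p ∧ 2 ^ a ≤ q ∧ 2 ^ a ≤ r ∧ n = p * (q * r)).card : ℝ) ≤ 864 * X * M ^ 2 / a ^ 3 := by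
  set A := pr (2 ^ a) (2 ^ (a + M)) with hA
  have hlt : ∀ {p q r : ℕ}, 2 ^ a ≤ q → 2 ^ a ≤ r → p * (q * r) ≤ X → p < 2 ^ (a + M) :=
    fun {p q r} hq hr h => by
      by_contra! hp
      have h1 : 2 ^ (a + M) * (2 ^ a * 2 ^ a) ≤ X :=
        (Nat.mul_le_mul hp (Nat.mul_le_mul hq hr)).trans h
      rw [← pow_add, ← pow_add, show a + M + (a + a) = 3 * a + M by ring] at h1
      omega
  have hsub : ((Icc 2 X).filter fun n => ∃ p q r, p.Prime ∧ q.Prime ∧ r.Prime ∧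
      2 ^ a ≤ p ∧ 2 ^ a ≤ q ∧ 2 ^ a ≤ r ∧ n = p * (q * r))
      ⊆ (A ×ˢ A).biUnion fun pq =>
        (pr (2 ^ a) (X / (pq.1 * pq.2) + 1)).image fun r => pq.1 * (pq.2 * r) := by
    intro n hn
    obtain ⟨h1, p, q, r, hp, hq, hr, hap, haq, har, rfl⟩ := mem_filter.1 hn
    have h2 := (mem_Icc.1 h1).2
    refine mem_biUnion.2 ⟨(p, q), mem_product.2 ⟨mem_pr.2 ⟨hp, hap, hlt haq har h2⟩,
      mem_pr.2 ⟨hq, haq, hlt hap har (q := p) (r := r) ?_⟩⟩,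
      mem_image.2 ⟨r, mem_pr.2 ⟨hr, har, ?_⟩, rfl⟩⟩
    · refine le_trans (le_of_eq ?_) h2; ring
    · rw [Nat.lt_succ_iff, Nat.le_div_iff_mul_le (Nat.mul_pos hp.pos hq.pos)]
      refine le_trans (le_of_eq ?_) h2; ring
  have h1 := (card_le_card hsub).trans (card_biUnion_le.trans
    (sum_le_sum fun p _ => card_image_le))
  have h2 : (((Icc 2 X).filter fun n => ∃ p q r, p.Prime ∧ q.Prime ∧ r.Prime ∧
      2 ^ a ≤ p ∧ 2 ^ a ≤ q ∧ 2 ^ a ≤ r ∧ n = p * (q * r)).card : ℝ)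
      ≤ ∑ pq ∈ A ×ˢ A, ((pr (2 ^ a) (X / (pq.1 * pq.2) + 1)).card : ℝ) := by
    exact_mod_cast h1
  refine h2.trans ?_
  have h3 : ∀ pq ∈ A ×ˢ A, ((pr (2 ^ a) (X / (pq.1 * pq.2) + 1)).card : ℝ)
      ≤ 6 * X / a * ((pq.1 : ℝ)⁻¹ * (pq.2 : ℝ)⁻¹) := fun pq _ => by
    refine (card_pr_le ha _).trans ?_
    calc 6 * ((X / (pq.1 * pq.2) : ℕ) : ℝ) / a ≤ 6 * (X / (pq.1 * pq.2 : ℕ)) / a := by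
          gcongr; exact Nat.cast_div_le
      _ = _ := by push_cast; ring
  refine (sum_le_sum h3).trans ?_
  have h6 : ∑ pq ∈ A ×ˢ A, ((pq.1 : ℝ)⁻¹ * (pq.2 : ℝ)⁻¹)
      = (∑ p ∈ A, (p : ℝ)⁻¹) * ∑ p ∈ A, (p : ℝ)⁻¹ := by
    rw [sum_mul_sum, sum_product]
  rw [← mul_sum, h6]
  have h4 := sum_inv_pr_dyadic_le ha le_rfl M
  have h5 : 0 ≤ ∑ p ∈ A, (p : ℝ)⁻¹ := sum_nonneg fun _ _ => by positivity
  calc _ ≤ 6 * (X : ℝ) / a * ((12 * M / a) * (12 * M / a)) := by gcongr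
    _ = _ := by ring

end PrimeCounts

section Identity

/-- The combinatorial identity detecting primes. -/
lemma sieve_weight_eq_zero {a c n : ℕ} (hac : a ≤ c) (hn : 2 ≤ n) (hna : n < (2 ^ a) ^ 4)
    (hnc : 2 ^ (2 * c) < n)
    (h2 : ¬ ∃ p q, p.Prime ∧ q.Prime ∧ 2 ^ c ≤ p ∧ p ≤ q ∧ n = p * q)
    (h3 : ¬ ∃ p q r, p.Prime ∧ q.Prime ∧ r.Prime ∧ 2 ^ a ≤ p ∧ 2 ^ a ≤ q ∧ 2 ^ a ≤ r ∧
      n = p * (q * r)) :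
    (if kk 0 (2 ^ a) n = 0 then 1 else 0) * (1 - (om (2 ^ a) (2 ^ c) n : ℂ))
      = if n.Prime then 1 else 0 := by
  have hac' : 2 ^ a ≤ 2 ^ c := Nat.pow_le_pow_right two_pos hac
  have hcc : 2 ^ c ≤ 2 ^ (2 * c) := Nat.pow_le_pow_right two_pos (by omega)
  by_cases hk : kk 0 (2 ^ a) n = 0
  · rw [if_pos hk, one_mul]
    have hlarge : ∀ p, p.Prime → p ∣ n → 2 ^ a ≤ p := fun p hp hd => by
      by_contra! hlt
      rw [kk, card_eq_zero, filter_eq_empty_iff] at hk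
      exact hk (mem_pr.2 ⟨hp, Nat.zero_le _, hlt⟩) hd
    have hp := Nat.minFac_prime (n := n) (by omega)
    set p := n.minFac with hpdef
    obtain ⟨m, hm⟩ := n.minFac_dvd
    rw [← hpdef] at hm
    rcases Nat.lt_or_ge m 2 with hm2 | hm2
    · have hm1 : m = 1 := by
        interval_cases m
        · omega
        · rfl
      have hnp : n = p := by rw [hm, hm1, mul_one]
      rw [if_pos (hnp ▸ hp)]
      have : om (2 ^ a) (2 ^ c) n = 0 := by
        rw [om, card_eq_zero, filter_eq_empty_iff]
        rintro q hq ⟨hd, -⟩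
        obtain ⟨g1, -, g2⟩ := mem_pr.1 hq
        rw [hnp, Nat.prime_dvd_prime_iff_eq g1 hp] at hd
        omega
      rw [this, Nat.cast_zero, sub_zero]
    · have hnp : ¬ n.Prime := by
        rw [hm]; exact Nat.not_prime_mul hp.one_lt.ne' (by omega)
      rw [if_neg hnp]
      have hq := Nat.minFac_prime (n := m) (by omega)
      set q := m.minFac with hqdef
      obtain ⟨m', hm'⟩ := m.minFac_dvd
      rw [← hqdef] at hm'
      have hpn : p ∣ n := ⟨m, hm⟩
      have hqn : q ∣ n := (Dvd.intro _ hm'.symm).trans ⟨p, by rw [hm, mul_comm]⟩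
      have hpq : p ≤ q := Nat.minFac_le_of_dvd hq.two_le hqn
      rcases Nat.lt_or_ge m' 2 with hm2' | hm2'
      · have hm1 : m' = 1 := by
          interval_cases m'
          · omega
          · rfl
        have hnpq : n = p * q := by rw [hm, hm', hm1, mul_one]
        have hpc : p < 2 ^ c := by
          by_contra! hge
          exact h2 ⟨p, q, hp, hq, hge, hpq, hnpq⟩
        have hqc : 2 ^ c ≤ q := by
          by_contra! hlt
          have : p * q ≤ 2 ^ c * 2 ^ c := Nat.mul_le_mul hpc.le hlt.le
          rw [← pow_add, ← two_mul] at this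
          omega
        have : om (2 ^ a) (2 ^ c) n = 1 := by
          rw [om, card_eq_one]
          refine ⟨p, ?_⟩
          ext s
          rw [mem_filter, mem_singleton]
          constructor
          · rintro ⟨hs, hd, -⟩
            obtain ⟨g1, -, g2⟩ := mem_pr.1 hs
            rw [hnpq, g1.dvd_mul, Nat.prime_dvd_prime_iff_eq g1 hp,
              Nat.prime_dvd_prime_iff_eq g1 hq] at hd
            omega
          · rintro rfl
            refine ⟨mem_pr.2 ⟨hp, hlarge _ hp hpn, hpc⟩, hpn, ?_⟩
            rw [hnpq, Nat.mul_div_cancel_left _ hp.pos, Nat.prime_dvd_prime_iff_eq hp hq]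
            omega
        rw [this, Nat.cast_one, sub_self]
      · exfalso
        have hr := Nat.minFac_prime (n := m') (by omega)
        set r := m'.minFac with hrdef
        obtain ⟨s, hs⟩ := m'.minFac_dvd
        rw [← hrdef] at hs
        have hnn : n = p * (q * (r * s)) := by rw [hm, hm', hs]
        have hrn : r ∣ n := ⟨p * (q * s), by rw [hnn]; ring⟩
        have hap := hlarge _ hp hpn
        have haq := hlarge _ hq hqn
        have har := hlarge _ hr hrn
        rcases Nat.lt_or_ge s 2 with hs2 | hs2
        · have hs1 : s = 1 := by
            interval_cases s
            · simp at hs; omega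
            · rfl
          exact h3 ⟨p, q, r, hp, hq, hr, hap, haq, har, by rw [hnn, hs1, mul_one]⟩
        · have hx := Nat.minFac_prime (n := s) (by omega)
          have hxs := Nat.minFac_dvd s
          have hxn : s.minFac ∣ n := hxs.trans ⟨p * (q * r), by rw [hnn]; ring⟩
          have h4 : 2 ^ a ≤ s := (hlarge _ hx hxn).trans (Nat.le_of_dvd (by omega) hxs)
          have : 2 ^ a * (2 ^ a * (2 ^ a * 2 ^ a)) ≤ n := by
            rw [hnn]
            exact Nat.mul_le_mul hap (Nat.mul_le_mul haq (Nat.mul_le_mul har h4))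
          rw [show (2 ^ a) ^ 4 = 2 ^ a * (2 ^ a * (2 ^ a * 2 ^ a)) by ring] at hna
          omega
  · rw [if_neg hk, zero_mul, if_neg]
    intro hnp
    apply hk
    rw [kk, card_eq_zero, filter_eq_empty_iff]
    intro q hq hd
    obtain ⟨g1, -, g2⟩ := mem_pr.1 hq
    rw [Nat.prime_dvd_prime_iff_eq g1 hnp] at hd
    omega

open scoped Classical in
/-- Reduction of sums over primes to sieve-weighted sums. -/
lemma norm_sum_primes_le {X a c M M' h : ℕ} (ha : 0 < a) (hac : a ≤ c) (hXa : X < (2 ^ a) ^ 4)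
    (hM : X < 2 ^ (2 * (c + M))) (hM' : X < 2 ^ (3 * a + M')) (hcX : 2 ^ (2 * c) ≤ X) :
    ‖∑ p ∈ (Icc 2 X).filter Nat.Prime, asum h p‖
      ≤ ‖∑ n ∈ Icc 2 X, (if kk 0 (2 ^ a) n = 0 then 1 else 0)
          * (1 - (om (2 ^ a) (2 ^ c) n : ℂ)) * asum h n‖
        + 4 * 2 ^ (2 * c) + 32 * (72 * X * M / (a : ℝ) ^ 2)
        + 32 * (864 * X * M' ^ 2 / (a : ℝ) ^ 3) := by
  set A₂ := (Icc 2 X).filter fun n => ∃ p q, p.Prime ∧ q.Prime ∧ 2 ^ c ≤ p ∧ p ≤ q ∧ n = p * q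
  set A₃ := (Icc 2 X).filter fun n => ∃ p q r, p.Prime ∧ q.Prime ∧ r.Prime ∧
      2 ^ a ≤ p ∧ 2 ^ a ≤ q ∧ 2 ^ a ≤ r ∧ n = p * (q * r)
  set W : ℕ → ℂ := fun n => (if kk 0 (2 ^ a) n = 0 then 1 else 0)
          * (1 - (om (2 ^ a) (2 ^ c) n : ℂ)) with hW
  have hW4 : ∀ n ∈ Icc 2 X, ‖(if n.Prime then 1 else 0) - W n‖ ≤ 4 := fun n hn => by
    obtain ⟨hn1, hn2⟩ := mem_Icc.1 hn
    have h3 := om_le_three (A := 2 ^ a) (B := 2 ^ c) (pow_pos two_pos _) (by omega)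
      (hn2.trans_lt hXa)
    simp only [hW]
    set o := om (2 ^ a) (2 ^ c) n
    split_ifs <;> interval_cases o <;> norm_num
  have h1 : ∀ n ∈ Icc 2 X, ‖((if n.Prime then 1 else 0) - W n) * asum h n‖
      ≤ (if n ≤ 2 ^ (2 * c) then 4 * (rho n : ℝ) else 0) + (if n ∈ A₂ then 32 else 0)
        + (if n ∈ A₃ then 32 else 0) := by
    intro n hn
    obtain ⟨hn1, hn2⟩ := mem_Icc.1 hn
    have hb : ‖((if n.Prime then 1 else 0) - W n) * asum h n‖ ≤ 4 * rho n := by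
      rw [norm_mul]
      exact mul_le_mul (hW4 n hn) (norm_asum_le h n) (norm_nonneg _) (by norm_num)
    have p1 : (0 : ℝ) ≤ if n ≤ 2 ^ (2 * c) then 4 * (rho n : ℝ) else 0 := by positivity
    have p2 : (0 : ℝ) ≤ if n ∈ A₂ then 32 else 0 := by positivity
    have p3 : (0 : ℝ) ≤ if n ∈ A₃ then 32 else 0 := by positivity
    by_cases c1 : n ≤ 2 ^ (2 * c)
    · rw [if_pos c1]; linarith
    by_cases c2 : n ∈ A₂
    · rw [if_pos c2]
      obtain ⟨-, p, q, hp, hq, -, -, rfl⟩ := mem_filter.1 c2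
      have r1 := rho_mul_prime_le q p hp
      have r2 := rho_mul_prime_le 1 q hq
      rw [mul_one, rho_one] at r2
      have : (rho (p * q) : ℝ) ≤ 4 := by exact_mod_cast (by omega : rho (p * q) ≤ 4)
      linarith
    by_cases c3 : n ∈ A₃
    · rw [if_pos c3]
      obtain ⟨-, p, q, r, hp, hq, hr, -, -, -, rfl⟩ := mem_filter.1 c3
      have r1 := rho_mul_prime_le (q * r) p hp
      have r2 := rho_mul_prime_le r q hq
      have r3 := rho_mul_prime_le 1 r hr
      rw [mul_one, rho_one] at r3
      have : (rho (p * (q * r)) : ℝ) ≤ 8 := by exact_mod_cast (by omega : rho (p * (q * r)) ≤ 8)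
      linarith
    · have := sieve_weight_eq_zero hac hn1 (hn2.trans_lt hXa) (not_le.1 c1)
        (fun hh => c2 (mem_filter.2 ⟨hn, hh⟩)) fun hh => c3 (mem_filter.2 ⟨hn, hh⟩)
      simp only [hW]
      rw [this, sub_self, zero_mul, norm_zero]
      linarith
  have e1 : ∑ p ∈ (Icc 2 X).filter Nat.Prime, asum h p
      = ∑ n ∈ Icc 2 X, W n * asum h n
        + ∑ n ∈ Icc 2 X, ((if n.Prime then 1 else 0) - W n) * asum h n := by
    rw [← sum_add_distrib, sum_filter]
    refine Finset.sum_congr rfl fun n _ => ?_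
    split_ifs <;> ring
  have h2 := norm_sum_le_of_le _ h1
  rw [sum_add_distrib, sum_add_distrib, ← sum_filter, ← sum_filter, ← sum_filter, sum_const,
    sum_const, nsmul_eq_mul, nsmul_eq_mul, ← mul_sum] at h2
  have h3 : ∑ n ∈ (Icc 2 X).filter (fun n => n ≤ 2 ^ (2 * c)), (rho n : ℝ) ≤ 2 ^ (2 * c) := by
    have : (Icc 2 X).filter (fun n => n ≤ 2 ^ (2 * c)) = Icc 2 (2 ^ (2 * c)) := by
      ext n; simp only [mem_filter, mem_Icc]; omega
    rw [this]
    exact_mod_cast sum_rho_le (2 ^ (2 * c))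
  have h4 : (((Icc 2 X).filter fun n => n ∈ A₂).card : ℝ) ≤ 72 * X * M / (a : ℝ) ^ 2 := by
    refine le_trans ?_ (card_pairs_le ha hac hM)
    exact_mod_cast card_le_card fun n hn => (mem_filter.1 hn).2
  have h5 : (((Icc 2 X).filter fun n => n ∈ A₃).card : ℝ) ≤ 864 * X * M' ^ 2 / (a : ℝ) ^ 3 := by
    refine le_trans ?_ (card_triples_le ha hM')
    exact_mod_cast card_le_card fun n hn => (mem_filter.1 hn).2
  rw [e1]
  refine (norm_add_le _ _).trans ?_
  linarith

end Identity

section Ramare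

lemma sum_inv_sq_pr_le (t a : ℕ) : ∑ l ∈ pr (2 ^ t) (2 ^ a), ((l : ℝ) ^ 2)⁻¹ ≤ 2 / 2 ^ t := by
  have h1 : pr (2 ^ t) (2 ^ a) ⊆ Ioo (2 ^ t - 1) (2 ^ a) := fun l hl => by
    have h2 := mem_pr.1 hl
    have h3 : 0 < 2 ^ t := pow_pos two_pos t
    exact mem_Ioo.2 ⟨by omega, h2.2.2⟩
  refine (sum_le_sum_of_subset_of_nonneg h1 fun _ _ _ => by positivity).trans ?_
  refine (sum_Ioo_inv_sq_le _ _).trans (le_of_eq ?_)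
  rw [Nat.cast_sub (Nat.one_le_two_pow)]
  push_cast
  ring

lemma sum_sq_dvd_rho_le (X t a : ℕ) :
    ∑ l ∈ pr (2 ^ t) (2 ^ a), ∑ n ∈ (Icc 2 X).filter (fun n => l ^ 2 ∣ n), (rho n : ℝ)
      ≤ 8 * X / 2 ^ t + 4 * 2 ^ a * √X := by
  have h1 : ∀ l ∈ pr (2 ^ t) (2 ^ a),
      ∑ n ∈ (Icc 2 X).filter (fun n => l ^ 2 ∣ n), (rho n : ℝ)
        ≤ 4 * (X * ((l : ℝ) ^ 2)⁻¹) + 4 * √X := fun l hl => by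
    have hl' := (mem_pr.1 hl).1
    have r1 := rho_mul_prime_le l l hl'
    have r2 := rho_mul_prime_le 1 l hl'
    rw [mul_one, rho_one] at r2
    have r3 : (rho (l ^ 2) : ℝ) ≤ 4 := by
      rw [sq]; exact_mod_cast (by omega : rho (l * l) ≤ 4)
    refine (sum_dvd_rho_le (pow_pos hl'.pos 2)).trans ?_
    push_cast
    calc (rho (l ^ 2) : ℝ) * (X / (l : ℝ) ^ 2 + √X) ≤ 4 * (X / (l : ℝ) ^ 2 + √X) := by gcongr
      _ = _ := by ring
  refine (sum_le_sum h1).trans ?_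
  rw [sum_add_distrib, ← mul_sum, ← mul_sum, sum_const, nsmul_eq_mul]
  have h2 := sum_inv_sq_pr_le t a
  have h3 : ((pr (2 ^ t) (2 ^ a)).card : ℝ) ≤ 2 ^ a := by
    have : (pr (2 ^ t) (2 ^ a)).card ≤ 2 ^ a :=
      (card_filter_le _ _).trans (by rw [Nat.card_Ico]; exact Nat.sub_le _ _)
    exact_mod_cast this
  have h4 := mul_le_mul_of_nonneg_left h2 (Nat.cast_nonneg (α := ℝ) X)
  have h5 := mul_le_mul_of_nonneg_right h3 (Real.sqrt_nonneg X)
  calc _ ≤ 4 * (X * (2 / 2 ^ t)) + 2 ^ a * √X * 4 := by linarith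
    _ = _ := by ring

/-- Ramaré's weights lead to bilinear sums. -/
lemma norm_sum_mul_kk_le {X N κ a h : ℕ} (hκ : 1 ≤ κ) (hN : 2 ^ N ≤ X)
    (haN : 3 * a + 168 * κ ≤ N) (hta : 336 * κ ≤ a) (hh : 0 < h) (hhκ : h ≤ 2 ^ (2 * κ))
    {w c : ℕ → ℂ} {B : ℝ} (hB : 0 < B) (hw : ∀ n ∈ Icc 2 X, ‖w n‖ ≤ B)
    (hc : ∀ m ∈ Icc 1 X, ‖c m‖ ≤ B)
    (hwc : ∀ l ∈ pr (2 ^ (336 * κ)) (2 ^ a), ∀ m, ¬ l ∣ m → w (l * m) = c m) :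
    ‖∑ n ∈ Icc 2 X, w n * kk (2 ^ (336 * κ)) (2 ^ a) n * asum h n‖
      ≤ B * (2 ^ 13 * a * (X : ℝ) / 2 ^ κ + (8 * X / 2 ^ (336 * κ) + 4 * 2 ^ a * √X)) := by
  set A := pr (2 ^ (336 * κ)) (2 ^ a) with hA
  set c' : ℕ → ℂ := fun m => if m ∈ Icc 1 X then c m / B else 0 with hc'
  have hc1 : ∀ m, ‖c' m‖ ≤ 1 := fun m => by
    simp only [hc']
    split_ifs with hm
    · rw [norm_div, Complex.norm_real, Real.norm_of_nonneg hB.le]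
      exact div_le_one_of_le₀ (hc m hm) hB.le
    · simp
  have e1 : ∑ n ∈ Icc 2 X, w n * kk (2 ^ (336 * κ)) (2 ^ a) n * asum h n
      = ∑ l ∈ A, ∑ n ∈ (Icc 2 X).filter (fun n => l ∣ n), w n * asum h n := by
    simp only [sum_filter]
    rw [sum_comm]
    refine Finset.sum_congr rfl fun n _ => ?_
    rw [← sum_filter, sum_const, nsmul_eq_mul, kk]
    ring
  have e2 : ∀ l ∈ A, ∑ n ∈ (Icc 2 X).filter (fun n => l ∣ n), w n * asum h n
      = B * ∑ m ∈ (Icc 1 (X / l)).filter (fun m => ¬ l ∣ m), c' m * asum h (l * m)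
        + ∑ n ∈ (Icc 2 X).filter (fun n => l ^ 2 ∣ n), w n * asum h n := fun l hl => by
    have hlp := (mem_pr.1 hl).1
    have h1 : ∑ m ∈ (Icc 1 (X / l)).filter (fun m => ¬ l ∣ m), c' m * asum h (l * m)
        = ∑ m ∈ (Icc 1 (X / l)).filter (fun m => ¬ l ∣ m),
          (B : ℂ)⁻¹ * (w (l * m) * asum h (l * m)) := Finset.sum_congr rfl fun m hm => by
      obtain ⟨h2, h3⟩ := mem_filter.1 hm
      obtain ⟨h4, h5⟩ := mem_Icc.1 h2
      simp only [hc']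
      rw [if_pos (mem_Icc.2 ⟨h4, h5.trans (Nat.div_le_self _ _)⟩), hwc l hl m h3]
      ring
    have hB' : (B : ℂ) ≠ 0 := by exact_mod_cast hB.ne'
    rw [h1, ← mul_sum, mul_inv_cancel_left₀ hB',
      ← sum_simple_eq hlp.two_le (fun n => w n * asum h n), sum_filter, sum_filter, sum_filter,
      ← sum_add_distrib]
    refine Finset.sum_congr rfl fun n _ => ?_
    have h6 : l ^ 2 ∣ n ↔ l ∣ n ∧ l ∣ n / l := by
      rw [sq]
      constructor
      · intro hd
        exact ⟨(Dvd.intro _ rfl).trans hd, Nat.dvd_div_of_mul_dvd hd⟩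
      · rintro ⟨g1, g2⟩
        exact Nat.mul_dvd_of_dvd_div g1 g2
    by_cases g1 : l ∣ n <;> by_cases g2 : l ∣ n / l <;> simp [h6, g1, g2]
  rw [e1, Finset.sum_congr rfl e2, sum_add_distrib, ← mul_sum, mul_add]
  refine (norm_add_le _ _).trans (add_le_add ?_ ?_)
  · rw [norm_mul, Complex.norm_real, Real.norm_of_nonneg hB.le]
    refine mul_le_mul_of_nonneg_left ?_ hB.le
    rw [hA, sum_pr_eq_sum_block hta]
    have hb : ∀ j ∈ Ico (336 * κ) a, ‖∑ l ∈ block (2 ^ j),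
        ∑ m ∈ (Icc 1 (X / l)).filter (fun m => ¬ l ∣ m), c' m * asum h (l * m)‖
          ≤ 2 ^ 13 * (X : ℝ) / 2 ^ κ := fun j hj => by
      obtain ⟨hj1, hj2⟩ := mem_Ico.1 hj
      have hs : √((2 ^ (2 * κ) : ℕ) : ℝ) = 2 ^ κ := by
        push_cast
        rw [mul_comm, pow_mul]
        exact Real.sqrt_sq (by positivity)
      rw [← hs]
      refine norm_sum_bilinear_le ?_ hh hhκ ?_ ?_ (Finset.Subset.refl _) c' hc1
      · calc 2 = 2 ^ 1 := rfl
          _ ≤ 2 ^ (2 * κ) := Nat.pow_le_pow_right two_pos (by omega)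
      · rw [← pow_mul]
        exact Nat.pow_le_pow_right two_pos (by omega)
      · rw [← pow_mul, ← pow_mul, ← pow_add]
        exact (Nat.pow_le_pow_right two_pos (by omega)).trans hN
    refine (norm_sum_le_of_le _ hb).trans ?_
    rw [sum_const, nsmul_eq_mul, Nat.card_Ico]
    have : ((a - 336 * κ : ℕ) : ℝ) ≤ a := by exact_mod_cast Nat.sub_le _ _
    calc ((a - 336 * κ : ℕ) : ℝ) * (2 ^ 13 * (X : ℝ) / 2 ^ κ)
        ≤ a * (2 ^ 13 * (X : ℝ) / 2 ^ κ) := by gcongr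
      _ = _ := by ring
  · have hb : ∀ l ∈ A, ‖∑ n ∈ (Icc 2 X).filter (fun n => l ^ 2 ∣ n), w n * asum h n‖
        ≤ B * ∑ n ∈ (Icc 2 X).filter (fun n => l ^ 2 ∣ n), (rho n : ℝ) := fun l _ => by
      rw [mul_sum]
      refine norm_sum_le_of_le _ fun n hn => ?_
      rw [norm_mul]
      exact mul_le_mul (hw n (mem_filter.1 hn).1) (norm_asum_le h n) (norm_nonneg _) hB.le
    refine (norm_sum_le_of_le _ hb).trans ?_
    rw [← mul_sum]
    exact mul_le_mul_of_nonneg_left (sum_sq_dvd_rho_le X _ a) hB.le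

/-- The sieve-weighted sum. -/
lemma norm_sum_sieve_le {X N κ a c h : ℕ} (hκ : 1 ≤ κ) (hN : 2 ^ N ≤ X) (hX : X < 2 ^ (N + 1))
    (hNt : 2 ^ 21 * (336 * κ) ^ 4 ≤ N) (haN : 3 * a + 168 * κ ≤ N)
    (ha : 2688 * (336 * κ) ^ 2 ≤ a) (ha' : N + 1 ≤ 4 * a) (hac : a ≤ c)
    (hc : 2 * c + 1344 * (336 * κ) ^ 2 ≤ N) (hh : 0 < h) (hhκ : h ≤ 2 ^ (2 * κ)) :
    ‖∑ n ∈ Icc 2 X, (if kk 0 (2 ^ a) n = 0 then 1 else 0)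
      * (1 - (om (2 ^ a) (2 ^ c) n : ℂ)) * asum h n‖
      ≤ 2 ^ 21 * N * (X : ℝ) / 2 ^ (336 * κ)
        + 2 * (2 ^ 13 * a * (X : ℝ) / 2 ^ κ + (8 * X / 2 ^ (336 * κ) + 4 * 2 ^ a * √X)) := by
  have hta : 336 * κ ≤ a := by
    have : 336 * κ ≤ (336 * κ) ^ 2 := Nat.le_self_pow two_ne_zero _
    omega
  have hXa : X < (2 ^ a) ^ 4 := by
    rw [← pow_mul]
    exact hX.trans_le (Nat.pow_le_pow_right two_pos (by omega))
  have hpa : 2 ^ (336 * κ) ≤ 2 ^ a := Nat.pow_le_pow_right two_pos hta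
  set R : ℕ → ℂ := fun n => (if kk 0 (2 ^ (336 * κ)) n = 0 then 1 else 0)
      * (1 - (om (2 ^ a) (2 ^ c) n : ℂ)) with hR
  set k : ℕ → ℕ := kk (2 ^ (336 * κ)) (2 ^ a) with hk
  have hRle : ∀ n ∈ Icc 1 X, ‖R n‖ ≤ 2 := fun n hn => by
    obtain ⟨hn1, hn2⟩ := mem_Icc.1 hn
    have h3 := om_le_three (A := 2 ^ a) (B := 2 ^ c) (pow_pos two_pos _) (by omega)
      (hn2.trans_lt hXa)
    simp only [hR]
    set o := om (2 ^ a) (2 ^ c) n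
    split_ifs <;> interval_cases o <;> norm_num
  have hdiv : ∀ n ∈ Icc 1 X, ∀ j : ℕ, ‖R n / j‖ ≤ 2 := fun n hn j => by
    rw [norm_div, Complex.norm_natCast]
    rcases Nat.eq_zero_or_pos j with rfl | hj
    · simp
    · exact (div_le_self (norm_nonneg _) (by exact_mod_cast hj)).trans (hRle n hn)
  have hw : ∀ n ∈ Icc 2 X, ‖R n / k n‖ ≤ 2 := fun n hn =>
    hdiv n (mem_Icc.2 ⟨by have := (mem_Icc.1 hn).1; omega, (mem_Icc.1 hn).2⟩) _
  have hcb : ∀ m ∈ Icc 1 X, ‖R m / ((k m + 1 : ℕ) : ℂ)‖ ≤ 2 := fun m hm => hdiv m hm _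
  have hwc : ∀ l ∈ pr (2 ^ (336 * κ)) (2 ^ a), ∀ m, ¬ l ∣ m →
      R (l * m) / k (l * m) = R m / ((k m + 1 : ℕ) : ℂ) := fun l hl m hlm => by
    obtain ⟨g1, g2, g3⟩ := mem_pr.1 hl
    simp only [hR, hk]
    rw [kk_mul_of_mem hl hlm, kk_mul_of_notMem g1 fun g => by have := mem_pr.1 g; omega,
      om_mul_of_notMem g1 fun g => by have := mem_pr.1 g; omega]
  have key := norm_sum_mul_kk_le hκ hN haN hta hh hhκ (w := fun n => R n / k n)
    (c := fun m => R m / ((k m + 1 : ℕ) : ℂ)) two_pos hw hcb hwc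
  have hht : h ≤ 2 ^ (336 * κ) := hhκ.trans (Nat.pow_le_pow_right two_pos (by omega))
  have hrough := norm_sum_rough_le (by omega) hN hX hNt ha ha' hac hc hh hht
  have e : ∑ n ∈ Icc 2 X, (if kk 0 (2 ^ a) n = 0 then 1 else 0)
      * (1 - (om (2 ^ a) (2 ^ c) n : ℂ)) * asum h n
      = ∑ n ∈ Icc 2 X, R n * asum h n
        - ∑ n ∈ Icc 2 X, R n / k n * k n * asum h n := by
    rw [← sum_sub_distrib]
    refine Finset.sum_congr rfl fun n _ => ?_
    have h1 := kk_split (Nat.zero_le (2 ^ (336 * κ))) hpa n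
    simp only [hR, hk]
    rw [h1]
    by_cases g1 : kk 0 (2 ^ (336 * κ)) n = 0 <;> by_cases g2 : kk (2 ^ (336 * κ)) (2 ^ a) n = 0
    · simp [g1, g2]
    · have g3 : (kk (2 ^ (336 * κ)) (2 ^ a) n : ℂ) ≠ 0 := by exact_mod_cast g2
      rw [div_mul_cancel₀ _ g3]
      simp [g1, g2]
    · simp [g1]
    · simp [g1]
  rw [e]
  exact (norm_sub_le _ _).trans (add_le_add hrough key)

lemma norm_sum_primes_bound {X N κ h : ℕ} (hκ : 1 ≤ κ) (hN : 2 ^ N ≤ X) (hX : X < 2 ^ (N + 1))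
    (hNt : 2 ^ 21 * (336 * κ) ^ 4 ≤ N) (hh : 0 < h) (hhκ : h ≤ 2 ^ (2 * κ)) :
    ‖∑ p ∈ (Icc 2 X).filter Nat.Prime, asum h p‖
      ≤ 2 ^ 42 * X * ((κ : ℝ) ^ 2 / N ^ 2) + 2 ^ 22 * X * (N / 2 ^ κ) := by
  obtain ⟨T, hT⟩ : ∃ T, T = (336 * κ) ^ 2 := ⟨_, rfl⟩
  have hTκ : T = 112896 * κ ^ 2 := by rw [hT]; ring
  have hκ2 : κ ≤ κ ^ 2 := Nat.le_self_pow two_ne_zero _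
  have hNT : 2 ^ 21 * T ≤ N := by
    refine le_trans (Nat.mul_le_mul_left _ ?_) hNt
    rw [hT]
    exact Nat.pow_le_pow_right (by omega) (by norm_num)
  obtain ⟨a, ha⟩ : ∃ a, a = (N - 168 * κ) / 3 := ⟨_, rfl⟩
  obtain ⟨c, hc⟩ : ∃ c, c = (N - 1344 * T) / 2 := ⟨_, rfl⟩
  have haN : 3 * a + 168 * κ ≤ N := by omega
  have haT : 2688 * T ≤ a := by omega
  have haN' : N + 1 ≤ 4 * a := by omega
  have hac : a ≤ c := by omega
  have hcN : 2 * c + 1344 * T ≤ N := by omega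
  have hs := norm_sum_sieve_le hκ hN hX hNt haN (hT ▸ haT) haN' hac (hT ▸ hcN) hh hhκ
  have hp := norm_sum_primes_le (X := X) (a := a) (c := c) (M := 672 * T + 2)
    (M' := 168 * κ + 4) (h := h) (by omega) hac
    (by rw [← pow_mul]; exact hX.trans_le (Nat.pow_le_pow_right two_pos (by omega)))
    (hX.trans_le (Nat.pow_le_pow_right two_pos (by omega)))
    (hX.trans_le (Nat.pow_le_pow_right two_pos (by omega)))
    ((Nat.pow_le_pow_right two_pos (by omega)).trans hN)
  have hX0 : (0 : ℝ) ≤ X := Nat.cast_nonneg X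
  have hκr : (1 : ℝ) ≤ κ := by exact_mod_cast hκ
  have hN0 : 0 < N := by omega
  have hN1 : (1 : ℝ) ≤ N := by exact_mod_cast hN0
  have har : (N : ℝ) / 4 ≤ a := by
    have : ((N + 1 : ℕ) : ℝ) ≤ (4 * a : ℕ) := by exact_mod_cast haN'
    push_cast at this
    linarith
  have har' : (a : ℝ) ≤ N := by exact_mod_cast (by omega : a ≤ N)
  have hN4 : (0 : ℝ) < N / 4 := by positivity
  have t1 : 2 ^ 21 * N * (X : ℝ) / 2 ^ (336 * κ) ≤ 2 ^ 21 * N * (X : ℝ) / 2 ^ κ := by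
    gcongr
    · norm_num
    · omega
  have t2 : 2 ^ 13 * a * (X : ℝ) / 2 ^ κ ≤ 2 ^ 13 * N * (X : ℝ) / 2 ^ κ := by gcongr
  have t3 : 8 * (X : ℝ) / 2 ^ (336 * κ) ≤ 8 * N * X / 2 ^ κ := by
    refine div_le_div₀ (by positivity) ?_ (by positivity)
      (pow_le_pow_right₀ one_le_two (by omega))
    have := mul_le_mul_of_nonneg_right hN1 hX0
    linarith
  have t4 : 4 * 2 ^ a * √X ≤ 4 * N * X / 2 ^ κ := by
    have h1 := sqrt_le_div_two_pow (X := X) (e := a + κ)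
      ((Nat.pow_le_pow_right two_pos (by omega)).trans hN)
    calc 4 * 2 ^ a * √(X : ℝ) ≤ 4 * 2 ^ a * (X / 2 ^ (a + κ)) := by gcongr
      _ = 4 * 1 * X / 2 ^ κ := by rw [pow_add]; field_simp
      _ ≤ _ := by gcongr
  have t5 : (4 : ℝ) * 2 ^ (2 * c) ≤ 4 * N * X / 2 ^ κ := by
    have h1 : (2 : ℝ) ^ (2 * c) * 2 ^ κ ≤ X := by
      rw [← pow_add]
      exact_mod_cast (Nat.pow_le_pow_right two_pos (by omega)).trans hN
    rw [le_div_iff₀ (by positivity)]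
    have := mul_le_mul_of_nonneg_right hN1 hX0
    linarith
  have t6 : 32 * (72 * (X : ℝ) * (672 * T + 2 : ℕ) / (a : ℝ) ^ 2)
      ≤ 36864 * 76091904 * X * (κ ^ 2 / N ^ 2) := by
    have hM : ((672 * T + 2 : ℕ) : ℝ) ≤ 76091904 * κ ^ 2 := by
      exact_mod_cast (by omega : 672 * T + 2 ≤ 76091904 * κ ^ 2)
    calc 32 * (72 * (X : ℝ) * (672 * T + 2 : ℕ) / (a : ℝ) ^ 2)
        ≤ 32 * (72 * (X : ℝ) * (76091904 * κ ^ 2) / ((N : ℝ) / 4) ^ 2) := by gcongr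
      _ = _ := by field_simp; ring
  have t7 : 32 * (864 * (X : ℝ) * (168 * κ + 4 : ℕ) ^ 2 / (a : ℝ) ^ 3)
      ≤ 1769472 * 29584 * X * (κ ^ 2 / N ^ 2) := by
    have hM : ((168 * κ + 4 : ℕ) : ℝ) ≤ 172 * κ := by
      exact_mod_cast (by omega : 168 * κ + 4 ≤ 172 * κ)
    have ha3 : ((N : ℝ) / 4) ^ 2 * (1 / 4) ≤ (a : ℝ) ^ 3 := by
      rw [pow_succ (a : ℝ) 2]
      have : (1 : ℝ) / 4 ≤ a := by linarith
      gcongr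
    calc 32 * (864 * (X : ℝ) * (168 * κ + 4 : ℕ) ^ 2 / (a : ℝ) ^ 3)
        ≤ 32 * (864 * (X : ℝ) * (172 * κ) ^ 2 / (((N : ℝ) / 4) ^ 2 * (1 / 4))) := by gcongr
      _ = _ := by field_simp; ring
  have t8 : 0 ≤ (X : ℝ) * (κ ^ 2 / N ^ 2) := by positivity
  have t9 : 0 ≤ (X : ℝ) * (N / 2 ^ κ) := by positivity
  have e1 : ∀ q : ℝ, q * N * (X : ℝ) / 2 ^ κ = q * ((X : ℝ) * (N / 2 ^ κ)) := fun q => by ring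
  rw [e1] at t1 t2 t3 t4 t5
  refine hp.trans ?_
  linarith

end Ramare

section Weyl

open Filter

lemma exists_weyl_parameter : ∃ M₀ : ℕ, ∀ M ≥ M₀, ∃ κ : ℕ, 1 ≤ κ ∧
    2 ^ 21 * (336 * κ) ^ 4 ≤ M / 2 ∧ M ^ 4 ≤ 2 ^ κ ∧ (κ : ℝ) ^ 2 ≤ (M : ℝ) ^ (1 / 20 : ℝ) := by
  have hMt : Tendsto (fun M : ℕ => (M : ℝ)) atTop atTop := tendsto_natCast_atTop_atTop
  have h1 : Tendsto (fun M : ℕ => (M : ℝ) ^ (1 / 40 : ℝ)) atTop atTop :=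
    (tendsto_rpow_atTop (by norm_num)).comp hMt
  have h2 : Tendsto (fun M : ℕ => ⌊(M : ℝ) ^ (1 / 40 : ℝ)⌋₊) atTop atTop :=
    tendsto_nat_floor_atTop.comp h1
  have h3 : ∀ᶠ k : ℕ in atTop, (k + 1) ^ 160 ≤ 2 ^ k := by
    have := (tendsto_pow_const_div_const_pow_of_one_lt 160 (one_lt_two (α := ℝ))).comp
      (tendsto_add_atTop_nat 1)
    filter_upwards [this.eventually_le_const (show (0 : ℝ) < 1 / 2 by norm_num)] with k hk
    simp only [Function.comp_apply] at hk
    rw [div_le_iff₀ (by positivity), pow_succ (2 : ℝ)] at hk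
    have hk' : ((k : ℝ) + 1) ^ 160 ≤ 2 ^ k := by
      push_cast at hk
      refine hk.trans (le_of_eq ?_)
      ring
    exact_mod_cast hk'
  have h4 : ∀ᶠ M : ℕ in atTop, (2 ^ 21 * 336 ^ 4 * 2 + 2 : ℝ) ≤ (M : ℝ) ^ (9 / 10 : ℝ) :=
    ((tendsto_rpow_atTop (by norm_num)).comp hMt).eventually_ge_atTop _
  obtain ⟨M₀, hM₀⟩ := eventually_atTop.1 ((h2.eventually h3).and
    ((h2.eventually_ge_atTop 1).and (h4.and (eventually_ge_atTop 1))))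
  refine ⟨M₀, fun M hM => ?_⟩
  obtain ⟨g1, g2, g3, g4⟩ := hM₀ M hM
  set κ := ⌊(M : ℝ) ^ (1 / 40 : ℝ)⌋₊
  have hM1 : (1 : ℝ) ≤ M := by exact_mod_cast g4
  have hM0 : (0 : ℝ) ≤ M := by linarith
  have hκ : (κ : ℝ) ≤ (M : ℝ) ^ (1 / 40 : ℝ) := Nat.floor_le (by positivity)
  have hκ' : (M : ℝ) ^ (1 / 40 : ℝ) ≤ κ + 1 := (Nat.lt_floor_add_one _).le
  refine ⟨κ, g2, ?_, ?_, ?_⟩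
  · rw [Nat.le_div_iff_mul_le two_pos]
    have h5 : (κ : ℝ) ^ 4 ≤ (M : ℝ) ^ (1 / 10 : ℝ) := by
      calc (κ : ℝ) ^ 4 ≤ ((M : ℝ) ^ (1 / 40 : ℝ)) ^ 4 := by gcongr
        _ = _ := by rw [← Real.rpow_mul_natCast hM0]; norm_num
    have h6 : (M : ℝ) = (M : ℝ) ^ (9 / 10 : ℝ) * (M : ℝ) ^ (1 / 10 : ℝ) := by
      rw [← Real.rpow_add (by linarith)]; norm_num
    have h7 : (2 : ℝ) ^ 21 * (336 * κ) ^ 4 * 2 ≤ M := by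
      rw [h6]
      calc (2 : ℝ) ^ 21 * (336 * κ) ^ 4 * 2 = (2 ^ 21 * 336 ^ 4 * 2) * κ ^ 4 := by ring
        _ ≤ (M : ℝ) ^ (9 / 10 : ℝ) * (M : ℝ) ^ (1 / 10 : ℝ) := by
          refine mul_le_mul ?_ h5 (by positivity) (by positivity)
          linarith
    exact_mod_cast h7
  · refine le_trans ?_ g1
    have h5 : (M : ℝ) ^ 4 ≤ ((κ : ℝ) + 1) ^ 160 := by
      calc (M : ℝ) ^ 4 = ((M : ℝ) ^ (1 / 40 : ℝ)) ^ 160 := by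
            rw [← Real.rpow_mul_natCast hM0, ← Real.rpow_natCast]; norm_num
        _ ≤ _ := by gcongr
    exact_mod_cast h5
  · calc (κ : ℝ) ^ 2 ≤ ((M : ℝ) ^ (1 / 40 : ℝ)) ^ 2 := by gcongr
      _ = _ := by rw [← Real.rpow_mul_natCast hM0]; norm_num

/-- The Weyl sum over roots modulo primes up to `X`. -/
noncomputable def wsum (h X : ℕ) : ℂ := ∑ p ∈ (Icc 2 X).filter Nat.Prime, asum h p

lemma norm_wsum_le_self (h X : ℕ) : ‖wsum h X‖ ≤ X := by
  calc ‖wsum h X‖ ≤ ∑ p ∈ (Icc 2 X).filter Nat.Prime, (rho p : ℝ) :=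
        norm_sum_le_of_le _ fun p _ => norm_asum_le h p
    _ ≤ ∑ p ∈ Icc 2 X, (rho p : ℝ) :=
        sum_le_sum_of_subset_of_nonneg (filter_subset _ _) fun _ _ _ => Nat.cast_nonneg _
    _ ≤ X := by exact_mod_cast sum_rho_le X

/-- Cancellation in the Weyl sums. -/
theorem exists_norm_wsum_le : ∃ C : ℝ, 0 < C ∧ ∀ X Y h : ℕ, 2 ≤ X → Y ≤ X → 0 < h →
    h ≤ (Nat.log 2 X) ^ 4 → ‖wsum h Y‖ ≤ C * X / (Nat.log 2 X : ℝ) ^ (39 / 20 : ℝ) := by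
  obtain ⟨M₀, hM₀⟩ := exists_weyl_parameter
  refine ⟨2 ^ 48 + (M₀ : ℝ) ^ (39 / 20 : ℝ), by positivity, fun X Y h hX hY hh hhM => ?_⟩
  obtain ⟨M, hM⟩ : ∃ M, M = Nat.log 2 X := ⟨_, rfl⟩
  rw [← hM] at hhM ⊢
  have hM1 : 1 ≤ M := by rw [hM]; exact Nat.log_pos one_lt_two hX
  have hM1r : (1 : ℝ) ≤ M := by exact_mod_cast hM1
  have hM0r : (0 : ℝ) < M := by linarith
  have hYX : (Y : ℝ) ≤ X := by exact_mod_cast hY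
  have hX0 : (0 : ℝ) ≤ X := Nat.cast_nonneg X
  rw [le_div_iff₀ (by positivity)]
  rcases lt_or_ge M M₀ with hMM | hMM
  · calc ‖wsum h Y‖ * (M : ℝ) ^ (39 / 20 : ℝ) ≤ X * (M₀ : ℝ) ^ (39 / 20 : ℝ) := by
          have : (M : ℝ) ≤ M₀ := by exact_mod_cast hMM.le
          have := (norm_wsum_le_self h Y).trans hYX
          gcongr
      _ ≤ _ := by
          have : 0 ≤ (X : ℝ) * 2 ^ 48 := by positivity
          linarith
  obtain ⟨κ, hκ, hκ1, hκ2, hκ3⟩ := hM₀ M hMM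
  have hκM : κ ≤ M / 2 := by
    refine le_trans ?_ hκ1
    have : 336 * κ ≤ (336 * κ) ^ 4 := Nat.le_self_pow four_ne_zero _
    omega
  have hXM : 2 ^ M ≤ X := by rw [hM]; exact Nat.pow_log_le_self 2 (by omega)
  have hM3 : (M : ℝ) ^ 3 ≤ 2 ^ κ := by
    exact_mod_cast (Nat.pow_le_pow_right hM1 (by norm_num : 3 ≤ 4)).trans hκ2
  have hM2 : (M : ℝ) ^ (39 / 20 : ℝ) ≤ M ^ 2 := by
    rw [← Real.rpow_natCast]
    exact Real.rpow_le_rpow_of_exponent_le hM1r (by norm_num)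
  have hM4 : (M : ℝ) ^ (1 / 20 : ℝ) * (M : ℝ) ^ (39 / 20 : ℝ) = M ^ 2 := by
    rw [← Real.rpow_add hM0r, ← Real.rpow_natCast]; norm_num
  have hM23 : (M : ℝ) ^ 2 ≤ M ^ 3 := pow_le_pow_right₀ hM1r (by norm_num)
  have hpos : 0 ≤ (X : ℝ) * (M₀ : ℝ) ^ (39 / 20 : ℝ) := by positivity
  rcases Nat.lt_or_ge Y (2 ^ (M / 2)) with hYM | hYM
  · have h1 : (Y : ℝ) * 2 ^ κ ≤ X := by
      have : Y * 2 ^ κ ≤ X := by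
        calc Y * 2 ^ κ ≤ 2 ^ (M / 2) * 2 ^ (M / 2) :=
              Nat.mul_le_mul hYM.le (Nat.pow_le_pow_right two_pos hκM)
          _ ≤ 2 ^ M := by rw [← pow_add]; exact Nat.pow_le_pow_right two_pos (by omega)
          _ ≤ X := hXM
      exact_mod_cast this
    calc ‖wsum h Y‖ * (M : ℝ) ^ (39 / 20 : ℝ) ≤ Y * 2 ^ κ :=
          mul_le_mul (norm_wsum_le_self h Y) (by linarith) (by positivity) (by positivity)
      _ ≤ _ := by linarith
  have hY0 : Y ≠ 0 := by have := Nat.two_pow_pos (M / 2); omega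
  obtain ⟨N, hN⟩ : ∃ N, N = Nat.log 2 Y := ⟨_, rfl⟩
  have hNM : M / 2 ≤ N := by
    rw [hN]; exact Nat.le_log_of_pow_le one_lt_two hYM
  have hNM' : N ≤ M := by rw [hN, hM]; exact Nat.log_mono_right hY
  have key := norm_sum_primes_bound (X := Y) (N := N) hκ
    (by rw [hN]; exact Nat.pow_log_le_self 2 hY0)
    (by rw [hN]; exact Nat.lt_pow_succ_log_self one_lt_two Y) (hκ1.trans hNM) hh
    (hhM.trans (hκ2.trans (Nat.pow_le_pow_right two_pos (by omega))))
  have hNr : (M : ℝ) / 4 ≤ N := by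
    have : (M : ℝ) ≤ (4 * N : ℕ) := by exact_mod_cast (by omega : M ≤ 4 * N)
    push_cast at this
    linarith
  have hNr' : (N : ℝ) ≤ M := by exact_mod_cast hNM'
  have b1 : (κ : ℝ) ^ 2 / N ^ 2 ≤ 16 / (M : ℝ) ^ (39 / 20 : ℝ) := by
    calc (κ : ℝ) ^ 2 / N ^ 2 ≤ (M : ℝ) ^ (1 / 20 : ℝ) / ((M : ℝ) / 4) ^ 2 := by gcongr
      _ = _ := by rw [div_pow, ← hM4]; field_simp; norm_num
  have b2 : (N : ℝ) / 2 ^ κ ≤ 1 / (M : ℝ) ^ (39 / 20 : ℝ) := by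
    calc (N : ℝ) / 2 ^ κ ≤ M / M ^ 3 := by gcongr
      _ = 1 / M ^ 2 := by field_simp
      _ ≤ _ := by gcongr
  rw [← le_div_iff₀ (by positivity)]
  calc ‖wsum h Y‖ ≤ 2 ^ 42 * Y * ((κ : ℝ) ^ 2 / N ^ 2) + 2 ^ 22 * Y * (N / 2 ^ κ) := key
    _ ≤ 2 ^ 42 * X * (16 / (M : ℝ) ^ (39 / 20 : ℝ))
        + 2 ^ 22 * X * (1 / (M : ℝ) ^ (39 / 20 : ℝ)) := by gcongr
    _ = (2 ^ 46 + 2 ^ 22) * X / (M : ℝ) ^ (39 / 20 : ℝ) := by ring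
    _ ≤ _ := by
      refine div_le_div_of_nonneg_right (mul_le_mul_of_nonneg_right ?_ hX0) (by positivity)
      have : 0 ≤ (M₀ : ℝ) ^ (39 / 20 : ℝ) := by positivity
      linarith

end Weyl

section Discrepancy

open Filter

/-- The periodic quadratic `{y}² - {y}`. -/
noncomputable def bb (y : ℝ) : ℝ := Int.fract y ^ 2 - Int.fract y

lemma ee_re (x : ℝ) : (ee x).re = Real.cos (2 * Real.pi * x) := by
  rw [ee, show (2 * Real.pi * x * Complex.I : ℂ) = ((2 * Real.pi * x : ℝ) : ℂ) * Complex.I by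
    push_cast; ring, Complex.exp_ofReal_mul_I_re]

lemma ee_mul_fract (n : ℕ) (y : ℝ) : ee (n * Int.fract y) = ee (n * y) := by
  have : (n : ℝ) * Int.fract y = n * y + ((-(n * ⌊y⌋) : ℤ) : ℝ) := by
    rw [Int.fract]; push_cast; ring
  rw [this, ee_add, ee_int, mul_one]

lemma hasSum_bb (y : ℝ) : HasSum (fun n : ℕ => ((n : ℝ) ^ 2)⁻¹ * (ee (n * y)).re)
    (Real.pi ^ 2 * (bb y + 1 / 6)) := by
  have h := hasSum_one_div_nat_pow_mul_cos one_ne_zero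
    (x := Int.fract y) ⟨Int.fract_nonneg y, (Int.fract_lt_one y).le⟩
  have e := bernoulliFun_two (Int.fract y)
  rw [bernoulliFun] at e
  rw [mul_one, e] at h
  convert! h using 1
  · ext n
    rw [← ee_mul_fract, ee_re, one_div, mul_assoc (2 * Real.pi)]
  · rw [bb, Nat.factorial_two]
    push_cast
    ring

variable {ι : Type*}

lemma abs_sum_bb_sub_le {s : Finset ι} {x : ι → ℝ} {B η : ℝ} {H : ℕ} (t : ℝ) (hη : 0 ≤ η)
    (hB0 : 0 ≤ B) (hB : ∀ n : ℕ, 0 < n → n ≤ H → ‖∑ i ∈ s, ee (n * x i)‖ ≤ B) :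
    |∑ i ∈ s, (bb (x i - (t + η)) - bb (x i - t))|
      ≤ 7 * η * B * (1 + Real.log H) + 4 * s.card / (H + 1) := by
  set f : ℕ → ℝ := fun n => ∑ i ∈ s, (((n : ℝ) ^ 2)⁻¹ * (ee (n * (x i - (t + η)))).re
    - ((n : ℝ) ^ 2)⁻¹ * (ee (n * (x i - t))).re) with hf
  have h1 : HasSum f (∑ i ∈ s, (Real.pi ^ 2 * (bb (x i - (t + η)) + 1 / 6)
      - Real.pi ^ 2 * (bb (x i - t) + 1 / 6))) :=
    hasSum_sum fun i _ => (hasSum_bb _).sub (hasSum_bb _)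
  have e1 : ∑ i ∈ s, (Real.pi ^ 2 * (bb (x i - (t + η)) + 1 / 6)
      - Real.pi ^ 2 * (bb (x i - t) + 1 / 6))
      = Real.pi ^ 2 * ∑ i ∈ s, (bb (x i - (t + η)) - bb (x i - t)) := by
    rw [mul_sum]
    exact Finset.sum_congr rfl fun i _ => by ring
  rw [e1] at h1
  have e2 : ∀ n : ℕ, f n = ((n : ℝ) ^ 2)⁻¹ *
      ((∑ i ∈ s, ee (n * x i)) * (ee (-(n * (t + η))) - ee (-(n * t)))).re := fun n => by
    simp only [hf]
    rw [sum_mul, Complex.re_sum, mul_sum]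
    refine Finset.sum_congr rfl fun i _ => ?_
    have a1 : ∀ u : ℝ, ee (n * (x i - u)) = ee (n * x i) * ee (-(n * u)) := fun u => by
      rw [← ee_add]; ring_nf
    rw [a1, a1, mul_sub (ee _), Complex.sub_re, mul_sub]
  have hlow : ∀ n : ℕ, 0 < n → n ≤ H → |f n| ≤ 7 * η * B * (n : ℝ)⁻¹ := fun n hn hnH => by
    have hnr : (0 : ℝ) < n := by exact_mod_cast hn
    have g1 := norm_ee_sub_le (-(n * (t + η))) (-(n * t))
    rw [show -((n : ℝ) * (t + η)) - -(n * t) = -(n * η) by ring, abs_neg,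
      abs_of_nonneg (by positivity)] at g1
    rw [e2, abs_mul, abs_of_nonneg (by positivity)]
    calc ((n : ℝ) ^ 2)⁻¹ * |((∑ i ∈ s, ee (n * x i)) *
          (ee (-(n * (t + η))) - ee (-(n * t)))).re|
        ≤ ((n : ℝ) ^ 2)⁻¹ * (B * (7 * (n * η))) := by
          refine mul_le_mul_of_nonneg_left ((Complex.abs_re_le_norm _).trans ?_) (by positivity)
          rw [norm_mul]
          exact mul_le_mul (hB n hn hnH) g1 (norm_nonneg _) hB0
      _ = _ := by field_simp
  have hhigh : ∀ n : ℕ, |f n| ≤ 2 * s.card * ((n : ℝ) ^ 2)⁻¹ := fun n => by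
    rw [e2, abs_mul, abs_of_nonneg (by positivity), mul_comm]
    refine mul_le_mul_of_nonneg_right ((Complex.abs_re_le_norm _).trans ?_) (by positivity)
    rw [norm_mul, mul_comm]
    refine mul_le_mul ?_ ?_ (norm_nonneg _) (by norm_num)
    · refine (norm_sub_le _ _).trans ?_
      rw [norm_ee, norm_ee]
      norm_num
    · refine (norm_sum_le _ _).trans (le_of_eq ?_)
      simp [norm_ee]
  have hsum : ∀ R : ℕ, |∑ n ∈ range R, f n|
      ≤ 7 * η * B * (1 + Real.log H) + 4 * s.card / (H + 1) := fun R => by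
    have g1 : ∀ n ∈ range R, |f n| ≤ (if n ∈ Icc 1 H then 7 * η * B * (n : ℝ)⁻¹ else 0)
        + if n ∈ Ioo H R then 2 * s.card * ((n : ℝ) ^ 2)⁻¹ else 0 := fun n hn => by
      have p1 : (0 : ℝ) ≤ if n ∈ Icc 1 H then 7 * η * B * (n : ℝ)⁻¹ else 0 := by positivity
      have p2 : (0 : ℝ) ≤ if n ∈ Ioo H R then 2 * s.card * ((n : ℝ) ^ 2)⁻¹ else 0 := by
        positivity
      rcases Nat.eq_zero_or_pos n with rfl | hn0
      · have : f 0 = 0 := by rw [e2]; simp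
        rw [this, abs_zero]
        exact add_nonneg p1 p2
      rcases le_or_gt n H with hnH | hnH
      · have := hlow n hn0 hnH
        rw [if_pos (mem_Icc.2 ⟨hn0, hnH⟩)]
        linarith
      · have := hhigh n
        rw [if_pos (mem_Ioo.2 ⟨hnH, mem_range.1 hn⟩)]
        linarith
    refine (abs_sum_le_sum_abs _ _).trans ((sum_le_sum g1).trans ?_)
    rw [sum_add_distrib, ← sum_filter, ← sum_filter, ← mul_sum, ← mul_sum]
    refine add_le_add (mul_le_mul_of_nonneg_left ?_ (by positivity)) ?_
    · have g2 := harmonic_le_one_add_log H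
      rw [harmonic_eq_sum_Icc, Rat.cast_sum] at g2
      refine le_trans ?_ g2
      refine (sum_le_sum_of_subset_of_nonneg (fun n hn => (mem_filter.1 hn).2)
        fun _ _ _ => by positivity).trans (le_of_eq ?_)
      exact Finset.sum_congr rfl fun n _ => by push_cast; rfl
    · have g2 := sum_Ioo_inv_sq_le (α := ℝ) H R
      have g3 : ∑ n ∈ (range R).filter (fun n => n ∈ Ioo H R), ((n : ℝ) ^ 2)⁻¹
          ≤ ∑ n ∈ Ioo H R, ((n : ℝ) ^ 2)⁻¹ :=
        sum_le_sum_of_subset_of_nonneg (fun n hn => (mem_filter.1 hn).2)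
          fun _ _ _ => by positivity
      calc _ ≤ 2 * (s.card : ℝ) * (2 / (H + 1)) :=
            mul_le_mul_of_nonneg_left (g3.trans g2) (by positivity)
        _ = _ := by ring
  have h2 := le_of_tendsto h1.tendsto_sum_nat.abs (Eventually.of_forall hsum)
  refine le_trans ?_ h2
  rw [abs_mul, abs_of_nonneg (sq_nonneg Real.pi)]
  refine le_mul_of_one_le_left (abs_nonneg _) ?_
  have := Real.pi_gt_three
  exact one_le_pow₀ (by linarith)

lemma bb_of_mem {y : ℝ} (h0 : 0 ≤ y) (h1 : y < 1) : bb y = y ^ 2 - y := by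
  rw [bb, Int.fract_eq_self.2 ⟨h0, h1⟩]

lemma bb_of_mem_neg {y : ℝ} (h0 : -1 ≤ y) (h1 : y < 0) : bb y = y ^ 2 + y := by
  have : Int.fract y = y + 1 :=
    Int.fract_eq_iff.2 ⟨by linarith, by linarith, -1, by push_cast; ring⟩
  rw [bb, this]
  ring

lemma bb_difference_bounds {K k : ℕ} {x : ℝ} (hK : k < K) (h0 : 0 ≤ x) (h1 : x < 1) :
    (1 - 2 * x + 2 * (k / K) + 1 / K) - 2 * (if ⌊K * x⌋₊ < k + 1 then 1 else 0)
        ≤ K * (bb (x - (k / K + 1 / K)) - bb (x - k / K)) ∧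
      K * (bb (x - (k / K + 1 / K)) - bb (x - k / K))
        ≤ (1 - 2 * x + 2 * (k / K) + 1 / K) - 2 * (if ⌊K * x⌋₊ < k then 1 else 0) := by
  have hK0 : (0 : ℝ) < K := by exact_mod_cast (Nat.zero_le k).trans_lt hK
  have hkK : (k : ℝ) / K + 1 / K ≤ 1 := by
    rw [← add_div, div_le_one hK0]; exact_mod_cast hK
  have hk0 : (0 : ℝ) ≤ k / K := by positivity
  obtain ⟨t, ht⟩ : ∃ t : ℝ, t = k / K := ⟨_, rfl⟩
  obtain ⟨η, hη⟩ : ∃ η : ℝ, η = 1 / K := ⟨_, rfl⟩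
  have hη0 : 0 < η := by rw [hη]; positivity
  have hKη : K * η = 1 := by rw [hη]; field_simp
  have htk : (k : ℝ) = K * t := by rw [ht]; field_simp
  rw [← ht, ← hη] at hkK ⊢
  rw [← ht] at hk0
  have hKx : 0 ≤ K * x := by positivity
  rw [show x - (t + η) = x - t - η by ring]
  obtain ⟨u, hu⟩ : ∃ u : ℝ, u = x - t := ⟨_, rfl⟩
  rcases lt_trichotomy ⌊(K : ℝ) * x⌋₊ k with hj | hj | hj
  · have hxt : x < t := by
      rw [Nat.floor_lt hKx, htk] at hj
      exact lt_of_mul_lt_mul_left hj hK0.le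
    rw [if_pos (by omega), if_pos hj, bb_of_mem_neg (by linarith) (by linarith),
      bb_of_mem_neg (by linarith) (by linarith), ← hu]
    have e : K * ((u - η) ^ 2 + (u - η) - (u ^ 2 + u)) = -2 * u + η - 1 := by
      linear_combination (-2 * u + η - 1) * hKη
    rw [e]
    constructor <;> linarith
  · have hxt : t ≤ x := by
      have := Nat.floor_le hKx
      rw [hj, htk] at this
      exact le_of_mul_le_mul_left this hK0
    have hxt' : x - t < η := by
      have := Nat.lt_floor_add_one ((K : ℝ) * x)
      rw [hj, htk, ← hKη, ← mul_add] at this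
      linarith [lt_of_mul_lt_mul_left this hK0.le]
    rw [if_pos (by omega), if_neg (by omega), bb_of_mem_neg (by linarith) (by linarith),
      bb_of_mem (by linarith) (by linarith), ← hu]
    have e : K * ((u - η) ^ 2 + (u - η) - (u ^ 2 - u)) = -2 * u + η + 2 * (K * u) - 1 := by
      linear_combination (-2 * u + η - 1) * hKη
    rw [e]
    have h2 : 0 ≤ K * u := mul_nonneg hK0.le (by linarith)
    have h3 : K * u ≤ 1 := by
      rw [← hKη]; exact mul_le_mul_of_nonneg_left (by linarith) hK0.le
    constructor <;> linarith
  · have hxt : t + η ≤ x := by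
      have h2 := Nat.floor_le hKx
      have h3 : ((k + 1 : ℕ) : ℝ) ≤ ⌊(K : ℝ) * x⌋₊ := by exact_mod_cast hj
      push_cast at h3
      rw [htk, ← hKη, ← mul_add] at h3
      exact le_of_mul_le_mul_left (h3.trans h2) hK0
    rw [if_neg (by omega), if_neg (by omega), bb_of_mem (by linarith) (by linarith),
      bb_of_mem (by linarith) (by linarith), ← hu]
    have e : K * ((u - η) ^ 2 - (u - η) - (u ^ 2 - u)) = -2 * u + η + 1 := by
      linear_combination (-2 * u + η + 1) * hKη
    rw [e]
    constructor <;> linarith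

lemma abs_card_cell_sub_le {s : Finset ι} {x : ι → ℝ} {K : ℕ} {E : ℝ} (hK : 0 < K)
    (hx : ∀ i ∈ s, 0 ≤ x i ∧ x i < 1) (hE0 : 0 ≤ E)
    (hE : ∀ k < K, |K * ∑ i ∈ s, (bb (x i - (k / K + 1 / K)) - bb (x i - k / K))| ≤ E)
    {j : ℕ} (hj : j ≤ K) :
    |((s.filter fun i => ⌊K * x i⌋₊ < j).card : ℝ) - s.card * (j / K)| ≤ E + s.card / K := by
  have hK0 : (0 : ℝ) < K := by exact_mod_cast hK
  set N : ℕ → ℝ := fun j => ((s.filter fun i => ⌊K * x i⌋₊ < j).card : ℝ) with hN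
  set J : ℝ := (s.card : ℝ) with hJ
  have hJ0 : 0 ≤ J := Nat.cast_nonneg _
  have hJK : 0 ≤ J / K := by positivity
  have hNe : ∀ j, ∑ i ∈ s, (if ⌊K * x i⌋₊ < j then (1 : ℝ) else 0) = N j := fun j => by
    rw [sum_boole]
  have hsum : ∀ k j : ℕ, ∑ i ∈ s, ((1 - 2 * x i + 2 * ((k : ℝ) / K) + 1 / K)
      - 2 * (if ⌊K * x i⌋₊ < j then (1 : ℝ) else 0))
      = J - 2 * ∑ i ∈ s, x i + 2 * J * (k / K) + J / K - 2 * N j := fun k j => by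
    rw [sum_sub_distrib, sum_add_distrib, sum_add_distrib, sum_sub_distrib,
      ← mul_sum, ← mul_sum, ← mul_sum, hNe]
    simp only [sum_const, nsmul_eq_mul, mul_one]
    rw [← hJ]
    ring
  have hlow : ∀ k < K, J - 2 * ∑ i ∈ s, x i + 2 * J * (k / K) + J / K - 2 * N (k + 1) ≤ E :=
    fun k hk => by
      have h1 := sum_le_sum fun i hi => (bb_difference_bounds hk (hx i hi).1 (hx i hi).2).1
      rw [hsum, ← mul_sum] at h1
      exact h1.trans (abs_le.1 (hE k hk)).2
  have hupp : ∀ k < K, -E ≤ J - 2 * ∑ i ∈ s, x i + 2 * J * (k / K) + J / K - 2 * N k :=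
    fun k hk => by
      have h1 := sum_le_sum fun i hi => (bb_difference_bounds hk (hx i hi).1 (hx i hi).2).2
      rw [hsum, ← mul_sum] at h1
      exact (abs_le.1 (hE k hk)).1.trans h1
  have hN0 : N 0 = 0 := by simp [hN]
  have hNK : N K = J := by
    simp only [hN, hJ]
    congr 2
    refine filter_true_of_mem fun i hi => ?_
    rw [Nat.floor_lt (mul_nonneg hK0.le (hx i hi).1)]
    exact mul_lt_of_lt_one_right hK0 (hx i hi).2
  have hS1 : 2 * ∑ i ∈ s, x i - J ≤ E + J / K := by
    have := hupp 0 hK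
    rw [hN0, Nat.cast_zero, zero_div] at this
    linarith
  have hS2 : -(E + J / K) ≤ 2 * ∑ i ∈ s, x i - J := by
    have := hlow (K - 1) (by omega)
    rw [Nat.sub_add_cancel hK, hNK, Nat.cast_sub hK, Nat.cast_one, sub_div,
      div_self hK0.ne'] at this
    have e1 : 2 * J * (1 - 1 / K) = 2 * J - 2 * (J / K) := by ring
    rw [e1] at this
    linarith
  change |N j - J * (j / K)| ≤ E + J / K
  rw [abs_le]
  constructor
  · rcases Nat.eq_zero_or_pos j with rfl | hj0
    · rw [hN0, Nat.cast_zero, zero_div]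
      linarith
    · have := hlow (j - 1) (by omega)
      rw [Nat.sub_add_cancel hj0, Nat.cast_sub hj0, Nat.cast_one, sub_div] at this
      have e1 : 2 * J * (j / K - 1 / K) = 2 * (J * (j / K)) - 2 * (J / K) := by ring
      rw [e1] at this
      linarith
  · rcases Nat.lt_or_ge j K with hj1 | hj1
    · have := hupp j hj1
      have e1 : 2 * J * (j / K) = 2 * (J * (j / K)) := by ring
      rw [e1] at this
      linarith
    · obtain rfl : j = K := le_antisymm hj hj1
      rw [hNK, div_self hK0.ne']
      linarith

end Discrepancy

section Koksma

variable {ι : Type*}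

lemma abs_sum_mul_sub_le {G e : ℕ → ℝ} {K : ℕ} {D : ℝ} (hG : ∀ j < K, G j ≤ G (j + 1))
    (he : ∀ j ≤ K, |e j| ≤ D) (h0 : e 0 = 0) (hK : e K = 0) :
    |∑ j ∈ range K, G (j + 1) * (e (j + 1) - e j)| ≤ D * (G K - G 0) ∧
      |∑ j ∈ range K, G j * (e (j + 1) - e j)| ≤ D * (G K - G 0) := by
  have hV : ∑ j ∈ range K, D * (G (j + 1) - G j) = D * (G K - G 0) := by
    rw [← mul_sum, sum_range_sub]
  have hT := sum_range_sub (fun j => G j * e j) K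
  simp only [h0, hK, mul_zero, sub_zero] at hT
  constructor
  · have h : ∑ j ∈ range K, G (j + 1) * (e (j + 1) - e j)
        = -∑ j ∈ range K, e j * (G (j + 1) - G j) := by
      rw [eq_neg_iff_add_eq_zero, ← sum_add_distrib, ← hT]
      exact sum_congr rfl fun j _ => by ring
    rw [h, abs_neg, ← hV]
    refine (abs_sum_le_sum_abs _ _).trans (sum_le_sum fun j hj => ?_)
    have := mem_range.1 hj
    rw [abs_mul, abs_of_nonneg (sub_nonneg.2 (hG j this))]
    exact mul_le_mul_of_nonneg_right (he j this.le) (sub_nonneg.2 (hG j this))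
  · have h : ∑ j ∈ range K, G j * (e (j + 1) - e j)
        = -∑ j ∈ range K, e (j + 1) * (G (j + 1) - G j) := by
      rw [eq_neg_iff_add_eq_zero, ← sum_add_distrib, ← hT]
      exact sum_congr rfl fun j _ => by ring
    rw [h, abs_neg, ← hV]
    refine (abs_sum_le_sum_abs _ _).trans (sum_le_sum fun j hj => ?_)
    have := mem_range.1 hj
    rw [abs_mul, abs_of_nonneg (sub_nonneg.2 (hG j this))]
    exact mul_le_mul_of_nonneg_right (he _ this) (sub_nonneg.2 (hG j this))

lemma integral_bounds_of_monotoneOn {g : ℝ → ℝ} (hg : MonotoneOn g (Set.Icc 0 1)) {K : ℕ}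
    (hK : 0 < K) :
    (∑ j ∈ range K, g (j / K)) / K ≤ ∫ t in (0 : ℝ)..1, g t ∧
      ∫ t in (0 : ℝ)..1, g t ≤ (∑ j ∈ range K, g ((j + 1 : ℕ) / K)) / K := by
  have hK0 : (0 : ℝ) < K := by exact_mod_cast hK
  have hmem : ∀ j ≤ K, (j : ℝ) / K ∈ Set.Icc (0 : ℝ) 1 := fun j hj =>
    ⟨by positivity, by rw [div_le_one hK0]; exact_mod_cast hj⟩
  have hle : ∀ j : ℕ, (j : ℝ) / K ≤ (j + 1 : ℕ) / K := fun j => by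
    push_cast; gcongr; linarith
  have hsub : ∀ j < K, Set.Icc ((j : ℝ) / K) ((j + 1 : ℕ) / K) ⊆ Set.Icc 0 1 := fun j hj =>
    Set.Icc_subset_Icc (hmem j hj.le).1 (hmem (j + 1) hj).2
  have hmono : ∀ j < K, MonotoneOn g (Set.Icc ((j : ℝ) / K) ((j + 1 : ℕ) / K)) :=
    fun j hj => hg.mono (hsub j hj)
  have hgi : ∀ j < K, IntervalIntegrable g MeasureTheory.volume ((j : ℝ) / K)
      ((j + 1 : ℕ) / K) := fun j hj =>
    MonotoneOn.intervalIntegrable (by rw [Set.uIcc_of_le (hle j)]; exact hmono j hj)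
  have hsum := intervalIntegral.sum_integral_adjacent_intervals
    (a := fun j : ℕ => (j : ℝ) / K) (n := K) hgi
  rw [Nat.cast_zero, zero_div, div_self hK0.ne'] at hsum
  have hlen : ∀ j : ℕ, ((j + 1 : ℕ) : ℝ) / K - j / K = 1 / K := fun j => by
    push_cast; ring
  rw [← hsum, sum_div, sum_div]
  constructor
  · refine sum_le_sum fun j hj => ?_
    have hj := mem_range.1 hj
    have h := intervalIntegral.integral_mono_on (hle j) intervalIntegrable_const (hgi j hj)
      (f := fun _ => g (j / K)) fun t ht => hmono j hj (Set.left_mem_Icc.2 (hle j)) ht ht.1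
    rw [intervalIntegral.integral_const, hlen, smul_eq_mul] at h
    refine le_trans (le_of_eq ?_) h
    ring
  · refine sum_le_sum fun j hj => ?_
    have hj := mem_range.1 hj
    have h := intervalIntegral.integral_mono_on (hle j) (hgi j hj) intervalIntegrable_const
      (g := fun _ => g ((j + 1 : ℕ) / K))
      fun t ht => hmono j hj ht (Set.right_mem_Icc.2 (hle j)) ht.2
    rw [intervalIntegral.integral_const, hlen, smul_eq_mul] at h
    refine h.trans (le_of_eq ?_)
    ring

lemma abs_sum_sub_integral_le_of_monotoneOn {g : ℝ → ℝ} (hg : MonotoneOn g (Set.Icc 0 1))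
    {s : Finset ι} {x : ι → ℝ} {K : ℕ} {D : ℝ} (hK : 0 < K)
    (hx : ∀ i ∈ s, 0 ≤ x i ∧ x i < 1)
    (hD : ∀ j ≤ K, |((s.filter fun i => ⌊K * x i⌋₊ < j).card : ℝ) - s.card * (j / K)| ≤ D) :
    |∑ i ∈ s, g (x i) - s.card * ∫ t in (0 : ℝ)..1, g t|
      ≤ (D + s.card / K) * (g 1 - g 0) := by
  have hK0 : (0 : ℝ) < K := by exact_mod_cast hK
  set J : ℝ := (s.card : ℝ) with hJ
  have hJ0 : 0 ≤ J := Nat.cast_nonneg _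
  have hJK : 0 ≤ J / K := by positivity
  set N : ℕ → ℝ := fun j => ((s.filter fun i => ⌊K * x i⌋₊ < j).card : ℝ) with hN
  have hN0 : N 0 = 0 := by simp [hN]
  have hcell : ∀ i ∈ s, ⌊K * x i⌋₊ < K := fun i hi => by
    rw [Nat.floor_lt (mul_nonneg hK0.le (hx i hi).1)]
    exact mul_lt_of_lt_one_right hK0 (hx i hi).2
  have hNK : N K = J := by
    simp only [hN, hJ]
    congr 2
    exact filter_true_of_mem hcell
  have hNs : ∀ j, ((s.filter fun i => ⌊K * x i⌋₊ = j).card : ℝ) = N (j + 1) - N j := fun j => by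
    classical
    rw [eq_sub_iff_add_eq', hN]
    dsimp only
    rw [← Nat.cast_add, ← card_union_of_disjoint, ← filter_or]
    · congr 2
      refine filter_congr fun i _ => ?_
      omega
    · exact disjoint_filter.2 fun i _ h => by omega
  have hmem : ∀ j ≤ K, (j : ℝ) / K ∈ Set.Icc (0 : ℝ) 1 := fun j hj =>
    ⟨by positivity, by rw [div_le_one hK0]; exact_mod_cast hj⟩
  have hle : ∀ j : ℕ, (j : ℝ) / K ≤ (j + 1 : ℕ) / K := fun j => by
    push_cast; gcongr; linarith
  set G : ℕ → ℝ := fun j => g (j / K) with hG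
  have hGm : ∀ j < K, G j ≤ G (j + 1) := fun j hj =>
    hg (hmem j hj.le) (hmem (j + 1) hj) (hle j)
  have hG0 : G 0 = g 0 := by simp [hG]
  have hGK : G K = g 1 := by simp only [hG]; rw [div_self hK0.ne']
  obtain ⟨hA, hB⟩ := abs_sum_mul_sub_le (e := fun j => N j - J * (j / K)) hGm hD
    (by simp [hN0]) (by simp only [hNK]; rw [div_self hK0.ne']; ring)
  have hstep : ∀ j : ℕ, N (j + 1) - J * ((j + 1 : ℕ) / K) - (N j - J * (j / K))
      = N (j + 1) - N j - J / K := fun j => by push_cast; ring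
  simp only [hstep, mul_sub _ _ (J / (K : ℝ)), sum_sub_distrib, ← sum_mul] at hA hB
  obtain ⟨hI1, hI2⟩ := integral_bounds_of_monotoneOn hg hK
  change (∑ j ∈ range K, G j) / K ≤ _ at hI1
  change _ ≤ (∑ j ∈ range K, G (j + 1)) / K at hI2
  have hGG : ∑ j ∈ range K, G (j + 1) - ∑ j ∈ range K, G j = g 1 - g 0 := by
    rw [← sum_sub_distrib, sum_range_sub, hG0, hGK]
  rw [hG0, hGK] at hA hB
  have hfib := sum_fiberwise_of_maps_to (s := s) (t := range K) (g := fun i => ⌊K * x i⌋₊)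
    (fun i hi => mem_range.2 (hcell i hi)) (fun i => g (x i))
  have hU : ∑ i ∈ s, g (x i) ≤ ∑ j ∈ range K, G (j + 1) * (N (j + 1) - N j) := by
    rw [← hfib]
    refine sum_le_sum fun j hj => ?_
    rw [← hNs, mul_comm, ← nsmul_eq_mul]
    refine sum_le_card_nsmul _ _ _ fun i hi => ?_
    obtain ⟨his, hij⟩ := mem_filter.1 hi
    refine hg ⟨(hx i his).1, (hx i his).2.le⟩ (hmem (j + 1) (mem_range.1 hj)) ?_
    rw [le_div_iff₀ hK0, ← hij, mul_comm]
    push_cast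
    exact (Nat.lt_floor_add_one _).le
  have hL : ∑ j ∈ range K, G j * (N (j + 1) - N j) ≤ ∑ i ∈ s, g (x i) := by
    rw [← hfib]
    refine sum_le_sum fun j hj => ?_
    rw [← hNs, mul_comm, ← nsmul_eq_mul]
    refine card_nsmul_le_sum _ _ _ fun i hi => ?_
    obtain ⟨his, hij⟩ := mem_filter.1 hi
    refine hg (hmem j (mem_range.1 hj).le) ⟨(hx i his).1, (hx i his).2.le⟩ ?_
    rw [div_le_iff₀ hK0, ← hij, mul_comm]
    exact Nat.floor_le (mul_nonneg (hx i his).1 hK0.le)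
  have hI1' := mul_le_mul_of_nonneg_left hI1 hJ0
  have hI2' := mul_le_mul_of_nonneg_left hI2 hJ0
  have e1 : ∀ a : ℝ, J * (a / K) = a * (J / K) := fun a => by ring
  rw [e1] at hI1' hI2'
  have hGG' := congrArg (· * (J / (K : ℝ))) hGG
  simp only [sub_mul] at hGG'
  have hA' := (abs_le.1 hA).2
  have hB' := (abs_le.1 hB).1
  rw [abs_le, add_mul, mul_sub (J / (K : ℝ))]
  constructor <;> linarith

lemma exists_abs_sum_sub_integral_le {g : ℝ → ℝ} (hg : BoundedVariationOn g (Set.Icc 0 1)) :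
    ∃ V : ℝ, 0 ≤ V ∧ ∀ {ι : Type} (s : Finset ι) (x : ι → ℝ) (K : ℕ) (D : ℝ), 0 < K →
      (∀ i ∈ s, 0 ≤ x i ∧ x i < 1) →
      (∀ j ≤ K, |((s.filter fun i => ⌊K * x i⌋₊ < j).card : ℝ) - s.card * (j / K)| ≤ D) →
      |∑ i ∈ s, g (x i) - s.card * ∫ t in (0 : ℝ)..1, g t| ≤ V * (D + s.card / K) := by
  obtain ⟨p, q, hp, hq, rfl⟩ :=
    hg.locallyBoundedVariationOn.exists_monotoneOn_sub_monotoneOn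
  have h0 : (0 : ℝ) ∈ Set.Icc (0 : ℝ) 1 := by simp
  have h1 : (1 : ℝ) ∈ Set.Icc (0 : ℝ) 1 := by simp
  have hp1 := hp h0 h1 zero_le_one
  have hq1 := hq h0 h1 zero_le_one
  refine ⟨(p 1 - p 0) + (q 1 - q 0), by linarith, fun {ι} s x K D hK hx hD => ?_⟩
  have hpi : IntervalIntegrable p MeasureTheory.volume 0 1 :=
    MonotoneOn.intervalIntegrable (by rw [Set.uIcc_of_le zero_le_one]; exact hp)
  have hqi : IntervalIntegrable q MeasureTheory.volume 0 1 :=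
    MonotoneOn.intervalIntegrable (by rw [Set.uIcc_of_le zero_le_one]; exact hq)
  have hA := abs_sum_sub_integral_le_of_monotoneOn hp hK hx hD
  have hB := abs_sum_sub_integral_le_of_monotoneOn hq hK hx hD
  simp only [Pi.sub_apply]
  rw [intervalIntegral.integral_sub hpi hqi, sum_sub_distrib]
  refine le_trans (le_of_eq ?_) ((abs_sub _ _).trans ((add_le_add hA hB).trans (le_of_eq ?_)))
  · congr 1; ring
  · ring

end Koksma

section Assembly

lemma rho_prime {p : ℕ} (hp : p.Prime) (h2 : 2 < p) : rho p = if p % 4 = 1 then 2 else 0 := by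
  have hpf : Fact p.Prime := ⟨hp⟩
  have hodd : p % 2 = 1 := hp.eq_two_or_odd.resolve_left h2.ne'
  have hsq := ZMod.exists_sq_eq_neg_one_iff (p := p)
  have hroot : ∀ ν : ℕ, p ∣ ν ^ 2 + 1 ↔ (-1 : ZMod p) = ν * ν := fun ν => by
    rw [← ZMod.natCast_eq_zero_iff, neg_eq_iff_add_eq_zero]
    push_cast
    rw [add_comm, pow_two]
  by_cases h : p % 4 = 1
  · rw [if_pos h]
    refine le_antisymm (card_roots_prime_le hp) ?_
    obtain ⟨y, hy⟩ := hsq.2 (by omega)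
    have h1 : p ∣ y.val ^ 2 + 1 := by rw [hroot, ZMod.natCast_zmod_val, hy]
    have hlt : y.val < p := y.val_lt
    have hne : y.val ≠ 0 := fun h0 => by
      rw [h0] at h1
      exact hp.one_lt.ne' (Nat.dvd_one.1 (by simpa using h1))
    have h3 : p ∣ (p - y.val) ^ 2 + 1 := by
      rw [hroot, Nat.cast_sub hlt.le, ZMod.natCast_self, ZMod.natCast_zmod_val, hy]
      ring
    have hsub : ({y.val, p - y.val} : Finset ℕ) ⊆ roots p := by
      intro z hz
      rw [mem_insert, mem_singleton] at hz
      rw [roots, mem_filter, mem_range]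
      rcases hz with rfl | rfl
      · exact ⟨hlt, h1⟩
      · exact ⟨by omega, h3⟩
    have := card_le_card hsub
    rwa [card_pair (by omega)] at this
  · rw [if_neg h, rho, card_eq_zero, roots, filter_eq_empty_iff]
    intro ν _ hν
    have := hsq.1 ⟨ν, (hroot ν).1 hν⟩
    omega

/-- Primes in `(a, b]`. -/
def primesBetween (a b : ℕ) : Finset ℕ := (Icc (a + 1) b).filter Nat.Prime

lemma wsum_sub_wsum {h a b : ℕ} (hab : a ≤ b) :
    wsum h b - wsum h a = ∑ p ∈ primesBetween a b, asum h p := by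
  rw [sub_eq_iff_eq_add', wsum, wsum, primesBetween, ← sum_union]
  · refine sum_congr ?_ fun _ _ => rfl
    ext p
    simp only [mem_union, mem_filter, mem_Icc]
    constructor
    · rintro ⟨h1, h2⟩
      rcases le_or_gt p a with h3 | h3
      · exact Or.inl ⟨⟨h1.1, h3⟩, h2⟩
      · exact Or.inr ⟨⟨h3, h1.2⟩, h2⟩
    · rintro (⟨h1, h2⟩ | ⟨h1, h2⟩)
      · exact ⟨⟨h1.1, h1.2.trans hab⟩, h2⟩
      · exact ⟨⟨h2.two_le, h1.2⟩, h2⟩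
  · refine disjoint_left.2 fun p h1 h2 => ?_
    have := (mem_Icc.1 (mem_filter.1 h1).1).2
    have := (mem_Icc.1 (mem_filter.1 h2).1).1
    omega

lemma one_add_log_pow_four_le {M : ℕ} (hM : 1 ≤ M) :
    1 + Real.log ((M ^ 4 : ℕ) : ℝ) ≤ 81 * (M : ℝ) ^ (1 / 20 : ℝ) := by
  have hM1 : (1 : ℝ) ≤ M := by exact_mod_cast hM
  have h1 := Real.log_le_rpow_div (zero_le_one.trans hM1) (show (0 : ℝ) < 1 / 20 by norm_num)
  have h2 := Real.one_le_rpow hM1 (show (0 : ℝ) ≤ 1 / 20 by norm_num)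
  rw [Nat.cast_pow, Real.log_pow]
  push_cast
  linarith

lemma exists_abs_sum_primesBetween_sub_le {g : ℝ → ℝ}
    (hg : BoundedVariationOn g (Set.Icc 0 1)) :
    ∃ C : ℝ, 0 ≤ C ∧ ∀ X a b : ℕ, 2 ≤ X → a ≤ b → b ≤ X →
      |∑ p ∈ primesBetween a b, ∑ ν ∈ roots p, g ((ν : ℝ) / p)
          - (∑ p ∈ primesBetween a b, (rho p : ℝ)) * ∫ t in (0 : ℝ)..1, g t|
        ≤ C * (X / (Nat.log 2 X : ℝ) ^ (19 / 10 : ℝ)) := by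
  obtain ⟨V, hV0, hV⟩ := exists_abs_sum_sub_integral_le hg
  obtain ⟨C, hC0, hC⟩ := exists_norm_wsum_le
  refine ⟨V * (1134 * C + 6), by positivity, fun X a b hX hab hb => ?_⟩
  obtain ⟨M, hM⟩ : ∃ M, M = Nat.log 2 X := ⟨_, rfl⟩
  have hM1 : 1 ≤ M := by rw [hM]; exact Nat.log_pos one_lt_two hX
  have hMr : (1 : ℝ) ≤ M := by exact_mod_cast hM1
  have hM0 : (0 : ℝ) < M := by linarith
  rw [← hM]
  obtain ⟨Q, hQ⟩ : ∃ Q : ℝ, Q = X / (M : ℝ) ^ (19 / 10 : ℝ) := ⟨_, rfl⟩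
  rw [← hQ]
  obtain ⟨B, hB⟩ : ∃ B : ℝ, B = 2 * (C * X / (M : ℝ) ^ (39 / 20 : ℝ)) := ⟨_, rfl⟩
  have hB0 : 0 ≤ B := by rw [hB]; positivity
  set s : Finset (Σ _ : ℕ, ℕ) := (primesBetween a b).sigma roots with hs
  set x : (Σ _ : ℕ, ℕ) → ℝ := fun i => (i.2 : ℝ) / i.1 with hx
  have hJ : (s.card : ℝ) = ∑ p ∈ primesBetween a b, (rho p : ℝ) := by
    rw [hs, card_sigma]; push_cast; rfl
  have hJX : (s.card : ℝ) ≤ X := by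
    rw [hJ]
    have h1 : ∑ p ∈ primesBetween a b, rho p ≤ X := by
      refine le_trans (sum_le_sum_of_subset fun p hp => ?_) (sum_rho_le X)
      obtain ⟨h1, h2⟩ := mem_filter.1 hp
      exact mem_Icc.2 ⟨h2.two_le, (mem_Icc.1 h1).2.trans hb⟩
    exact_mod_cast h1
  have hxm : ∀ i ∈ s, 0 ≤ x i ∧ x i < 1 := fun i hi => by
    have h1 := mem_range.1 (mem_filter.1 (mem_sigma.1 hi).2).1
    have h2 : (0 : ℝ) < i.1 := by exact_mod_cast (Nat.zero_le _).trans_lt h1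
    refine ⟨by positivity, ?_⟩
    rw [div_lt_one h2]
    exact_mod_cast h1
  have hw : ∀ m : ℕ, 0 < m → m ≤ M ^ 4 → ‖∑ i ∈ s, ee (m * x i)‖ ≤ B := fun m h0 h1 => by
    have e : ∑ i ∈ s, ee (m * x i) = wsum m b - wsum m a := by
      rw [wsum_sub_wsum hab, hs, sum_sigma]
      refine sum_congr rfl fun p _ => sum_congr rfl fun ν _ => ?_
      rw [mul_div_assoc]
    rw [hM] at h1
    have hb' := hC X b m hX hb h0 h1
    have ha' := hC X a m hX (hab.trans hb) h0 h1
    rw [e, hB, hM]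
    refine (norm_sub_le _ _).trans ?_
    linarith
  have hM2 : (M : ℝ) ^ (19 / 10 : ℝ) ≤ (M : ℝ) ^ 2 := by
    rw [← Real.rpow_natCast]
    exact Real.rpow_le_rpow_of_exponent_le hMr (by norm_num)
  have hXQ : (X : ℝ) / (M : ℝ) ^ 2 ≤ Q := by
    rw [hQ]
    exact div_le_div_of_nonneg_left (Nat.cast_nonneg _) (by positivity) hM2
  have hBQ : 7 * B * (1 + Real.log ((M ^ 4 : ℕ) : ℝ)) ≤ 1134 * C * Q := by
    refine (mul_le_mul_of_nonneg_left (one_add_log_pow_four_le hM1)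
      (by positivity)).trans (le_of_eq ?_)
    have e : (M : ℝ) ^ (39 / 20 : ℝ) = (M : ℝ) ^ (19 / 10 : ℝ) * (M : ℝ) ^ (1 / 20 : ℝ) := by
      rw [← Real.rpow_add hM0]; norm_num
    rw [hB, hQ, e]
    field_simp
    ring
  have hK : 0 < M ^ 2 := by positivity
  have hKr : ((M ^ 2 : ℕ) : ℝ) = (M : ℝ) ^ 2 := by push_cast; rfl
  have hJK : (s.card : ℝ) / ((M ^ 2 : ℕ) : ℝ) ≤ Q := by
    refine le_trans ?_ hXQ
    rw [hKr]
    gcongr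
  have hE : ∀ k < M ^ 2, |((M ^ 2 : ℕ) : ℝ) * ∑ i ∈ s,
      (bb (x i - (k / ((M ^ 2 : ℕ) : ℝ) + 1 / ((M ^ 2 : ℕ) : ℝ)))
        - bb (x i - k / ((M ^ 2 : ℕ) : ℝ)))| ≤ (1134 * C + 4) * Q := fun k _ => by
    have h1 := abs_sum_bb_sub_le (η := 1 / ((M ^ 2 : ℕ) : ℝ)) (k / ((M ^ 2 : ℕ) : ℝ))
      (by positivity) hB0 hw
    rw [abs_mul, abs_of_nonneg (Nat.cast_nonneg _)]
    refine (mul_le_mul_of_nonneg_left h1 (Nat.cast_nonneg _)).trans ?_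
    have e : ((M ^ 2 : ℕ) : ℝ) * (7 * (1 / ((M ^ 2 : ℕ) : ℝ)) * B
        * (1 + Real.log ((M ^ 4 : ℕ) : ℝ)) + 4 * s.card / (((M ^ 4 : ℕ) : ℝ) + 1))
        = 7 * B * (1 + Real.log ((M ^ 4 : ℕ) : ℝ))
          + 4 * (s.card * ((M : ℝ) ^ 2 / ((M : ℝ) ^ 4 + 1))) := by
      push_cast
      field_simp
    have h2 : (s.card : ℝ) * ((M : ℝ) ^ 2 / ((M : ℝ) ^ 4 + 1)) ≤ X * (1 / (M : ℝ) ^ 2) := by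
      refine mul_le_mul hJX ?_ (by positivity) (Nat.cast_nonneg _)
      rw [div_le_div_iff₀ (by positivity) (by positivity)]
      have : (M : ℝ) ^ 2 * (M : ℝ) ^ 2 = (M : ℝ) ^ 4 := by ring
      linarith
    rw [mul_one_div] at h2
    rw [e]
    linarith
  have hQ0 : 0 ≤ Q := by rw [hQ]; positivity
  have hfin := hV s x (M ^ 2) ((1134 * C + 4) * Q + s.card / ((M ^ 2 : ℕ) : ℝ)) hK hxm
    fun j hj => abs_card_cell_sub_le hK hxm (by positivity) hE hj
  rw [hJ, hs, sum_sigma] at hfin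
  refine hfin.trans ?_
  rw [← hJ, mul_assoc]
  refine mul_le_mul_of_nonneg_left ?_ hV0
  linarith

lemma sq_le_four_mul_two_pow (M : ℕ) : M ^ 2 + 2 * M + 3 ≤ 4 * 2 ^ M := by
  induction M with
  | zero => norm_num
  | succ M ih =>
    rw [pow_succ 2 M]
    have : (M + 1) ^ 2 = M ^ 2 + 2 * M + 1 := by ring
    have := Nat.zero_le (M ^ 2)
    omega

lemma one_le_four_mul_div_rpow {X : ℕ} (hX : 2 ≤ X) :
    (1 : ℝ) ≤ 4 * (X / (Nat.log 2 X : ℝ) ^ (19 / 10 : ℝ)) := by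
  have hM1 : (1 : ℝ) ≤ Nat.log 2 X := by exact_mod_cast Nat.log_pos one_lt_two hX
  have h1 : (Nat.log 2 X : ℝ) ^ (19 / 10 : ℝ) ≤ (Nat.log 2 X : ℝ) ^ 2 := by
    rw [← Real.rpow_natCast]
    exact Real.rpow_le_rpow_of_exponent_le hM1 (by norm_num)
  have h2 : (Nat.log 2 X) ^ 2 ≤ 4 * X := by
    have := sq_le_four_mul_two_pow (Nat.log 2 X)
    have := Nat.pow_log_le_self 2 (show X ≠ 0 by omega)
    omega
  have h3 : (Nat.log 2 X : ℝ) ^ 2 ≤ 4 * X := by exact_mod_cast h2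
  rw [mul_div_assoc', one_le_div (by positivity)]
  exact h1.trans h3

lemma div_log_rpow_le {δ N : ℝ} (hδ : δ < 8 / 9) (hN : 2 ≤ N) :
    (⌈N⌉₊ : ℝ) / (Nat.log 2 ⌈N⌉₊ : ℝ) ^ (19 / 10 : ℝ)
      ≤ 8 * Real.log 2 ^ (δ - 9 / 10) * N / Real.log N ^ (1 + δ) := by
  obtain ⟨X, hX⟩ : ∃ X, X = ⌈N⌉₊ := ⟨_, rfl⟩
  rw [← hX]
  have hNX : N ≤ X := by rw [hX]; exact Nat.le_ceil N
  have hX2 : 2 ≤ X := by exact_mod_cast hN.trans hNX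
  have hXN : (X : ℝ) ≤ 2 * N := by
    have := Nat.ceil_lt_add_one (show 0 ≤ N by linarith)
    rw [← hX] at this
    linarith
  obtain ⟨M, hM⟩ : ∃ M, M = Nat.log 2 X := ⟨_, rfl⟩
  rw [← hM]
  have hM1 : (1 : ℝ) ≤ M := by rw [hM]; exact_mod_cast Nat.log_pos one_lt_two hX2
  have hL0 : 0 < Real.log 2 := Real.log_pos one_lt_two
  have hL2 : Real.log 2 ≤ Real.log N := Real.log_le_log two_pos hN
  have hL : 0 < Real.log N := hL0.trans_le hL2
  have hLM : Real.log N ≤ 2 * M := by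
    have h1 : X < 2 ^ (M + 1) := by rw [hM]; exact Nat.lt_pow_succ_log_self one_lt_two X
    have h2 : N ≤ 2 ^ (M + 1) := hNX.trans (by exact_mod_cast h1.le)
    have h3 := Real.log_le_log (by linarith) h2
    rw [Real.log_pow] at h3
    have h4 := Real.log_two_lt_d9
    have h5 : ((M + 1 : ℕ) : ℝ) * Real.log 2 ≤ (M + 1 : ℕ) * 1 :=
      mul_le_mul_of_nonneg_left (by linarith) (Nat.cast_nonneg _)
    push_cast at h3 h5
    linarith
  have hpow : Real.log N ^ (19 / 10 : ℝ) ≤ 4 * (M : ℝ) ^ (19 / 10 : ℝ) := by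
    refine (Real.rpow_le_rpow hL.le hLM (by norm_num)).trans ?_
    rw [Real.mul_rpow two_pos.le (by positivity)]
    refine mul_le_mul_of_nonneg_right ?_ (by positivity)
    calc (2 : ℝ) ^ (19 / 10 : ℝ) ≤ (2 : ℝ) ^ (2 : ℝ) :=
          Real.rpow_le_rpow_of_exponent_le one_le_two (by norm_num)
      _ = 4 := by norm_num
  have hsplit : Real.log N ^ (1 + δ)
      ≤ Real.log 2 ^ (δ - 9 / 10) * (4 * (M : ℝ) ^ (19 / 10 : ℝ)) := by
    rw [show 1 + δ = (δ - 9 / 10) + 19 / 10 by ring, Real.rpow_add hL]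
    exact mul_le_mul (Real.rpow_le_rpow_of_nonpos hL0 hL2 (by linarith)) hpow
      (by positivity) (by positivity)
  rw [div_le_div_iff₀ (by positivity) (by positivity)]
  calc (X : ℝ) * Real.log N ^ (1 + δ)
      ≤ (2 * N) * (Real.log 2 ^ (δ - 9 / 10) * (4 * (M : ℝ) ^ (19 / 10 : ℝ))) :=
        mul_le_mul hXN hsplit (by positivity) (by linarith)
    _ = _ := by ring

lemma mem_primesBetween_floor_ceil {n N : ℝ} (hn : 0 ≤ n) {p : ℕ} :
    p ∈ primesBetween ⌊n⌋₊ (⌈N⌉₊ - 1) ↔ p.Prime ∧ n < (p : ℝ) ∧ (p : ℝ) < N := by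
  rw [primesBetween, mem_filter, mem_Icc, Nat.add_one_le_iff, Nat.floor_lt hn]
  constructor
  · rintro ⟨⟨h1, h2⟩, h3⟩
    exact ⟨h3, h1, Nat.lt_ceil.1 (by have := h3.pos; omega)⟩
  · rintro ⟨h3, h1, h2⟩
    exact ⟨⟨h1, Nat.le_sub_one_of_lt (Nat.lt_ceil.2 h2)⟩, h3⟩

lemma sum_rho_primesBetween {a b : ℕ} (ha : 2 ≤ a) :
    ∑ p ∈ primesBetween a b, (rho p : ℝ)
      = 2 * (((primesBetween a b).filter fun p => p % 4 = 1).card : ℝ) := by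
  rw [mul_comm, ← nsmul_eq_mul, ← sum_const, sum_filter]
  refine sum_congr rfl fun p hp => ?_
  obtain ⟨h1, h2⟩ := mem_filter.1 hp
  rw [rho_prime h2 (by have := (mem_Icc.1 h1).1; omega)]
  split_ifs <;> simp

end Assembly

end QuadRoots

open scoped Classical

/-- For every `δ < 8/9` and every function `g : [0,1] → ℝ` of bounded variation there exists
`C > 0` such that for all reals `2 ≤ n < N`,
`|Σ_{n < p < N} Σ_{0 ≤ ν < p, ν² ≡ −1 (p)} g(ν/p) − 2·π₁([n,N])·∫₀¹ g| ≤ C·N/(log N)^{1+δ}`. -/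
theorem integration_lemma (δ : ℝ) (hδ : δ < 8 / 9)
    (g : ℝ → ℝ) (hg : BoundedVariationOn g (Set.Icc 0 1)) :
    ∃ C > 0, ∀ n N : ℝ, 2 ≤ n → n < N →
      |(∑ p ∈ (Finset.range ⌈N⌉₊).filter (fun p : ℕ => p.Prime ∧ n < (p : ℝ) ∧ (p : ℝ) < N),
          ∑ ν ∈ (Finset.range p).filter (fun ν => p ∣ ν ^ 2 + 1), g ((ν : ℝ) / p))
        - 2 * (((Finset.range (⌈N⌉₊ + 1)).filter
            (fun p : ℕ => p.Prime ∧ p % 4 = 1 ∧ n < (p : ℝ) ∧ (p : ℝ) ≤ N)).card : ℝ)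
          * ∫ t in (0 : ℝ)..1, g t|
      ≤ C * N / (Real.log N) ^ (1 + δ) := by
  obtain ⟨C, hC0, hC⟩ := QuadRoots.exists_abs_sum_primesBetween_sub_le hg
  obtain ⟨I, hI⟩ : ∃ I : ℝ, I = ∫ t in (0 : ℝ)..1, g t := ⟨_, rfl⟩
  rw [← hI] at hC ⊢
  have hL0 : 0 < Real.log 2 := Real.log_pos one_lt_two
  refine ⟨(C + 8 * |I| + 1) * (8 * Real.log 2 ^ (δ - 9 / 10)), by positivity,
    fun n N hn hnN => ?_⟩
  have hN2 : 2 ≤ N := hn.trans hnN.le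
  have hX2 : 2 ≤ ⌈N⌉₊ := by exact_mod_cast hN2.trans (Nat.le_ceil N)
  have hn2 : 2 ≤ ⌊n⌋₊ := Nat.le_floor (by exact_mod_cast hn)
  have hlt : ⌊n⌋₊ < ⌈N⌉₊ := Nat.lt_ceil.2 ((Nat.floor_le (by linarith)).trans_lt hnN)
  obtain ⟨P, hP⟩ : ∃ P, P = QuadRoots.primesBetween ⌊n⌋₊ (⌈N⌉₊ - 1) := ⟨_, rfl⟩
  have hmem : ∀ p, p ∈ P ↔ p.Prime ∧ n < (p : ℝ) ∧ (p : ℝ) < N := fun p => by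
    rw [hP, QuadRoots.mem_primesBetween_floor_ceil (by linarith)]
  have h1 := hC ⌈N⌉₊ ⌊n⌋₊ (⌈N⌉₊ - 1) hX2 (by omega) (by omega)
  rw [QuadRoots.sum_rho_primesBetween hn2, ← hP] at h1
  have e1 : ∑ p ∈ (Finset.range ⌈N⌉₊).filter
        (fun p : ℕ => p.Prime ∧ n < (p : ℝ) ∧ (p : ℝ) < N),
      ∑ ν ∈ (Finset.range p).filter (fun ν => p ∣ ν ^ 2 + 1), g ((ν : ℝ) / p)
      = ∑ p ∈ P, ∑ ν ∈ QuadRoots.roots p, g ((ν : ℝ) / p) := by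
    refine Finset.sum_congr ?_ fun p _ => Finset.sum_congr ?_ fun _ _ => rfl
    · ext p
      rw [Finset.mem_filter, Finset.mem_range, hmem, Nat.lt_ceil]
      tauto
    · ext ν
      rw [QuadRoots.roots, Finset.mem_filter]
  obtain ⟨A, hA⟩ : ∃ A, A = (Finset.range (⌈N⌉₊ + 1)).filter
    (fun p : ℕ => p.Prime ∧ p % 4 = 1 ∧ n < (p : ℝ) ∧ (p : ℝ) ≤ N) := ⟨_, rfl⟩
  rw [e1, ← hA]
  have hsub1 : P.filter (fun p => p % 4 = 1) ⊆ A := fun p hp => by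
    obtain ⟨hp1, hp2⟩ := Finset.mem_filter.1 hp
    obtain ⟨h3, h4, h5⟩ := (hmem p).1 hp1
    rw [hA, Finset.mem_filter, Finset.mem_range]
    exact ⟨(Nat.lt_ceil.2 h5).trans (Nat.lt_succ_self _), h3, hp2, h4, h5.le⟩
  have hsub2 : A ⊆ insert ⌈N⌉₊ (P.filter fun p => p % 4 = 1) := fun p hp => by
    rw [hA, Finset.mem_filter] at hp
    obtain ⟨_, h3, h4, h5, h6⟩ := hp
    rw [Finset.mem_insert, Finset.mem_filter, hmem]
    rcases h6.lt_or_eq with h7 | h7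
    · exact Or.inr ⟨⟨h3, h5, h7⟩, h4⟩
    · left
      rw [← h7, Nat.ceil_natCast]
  have hc1 := Finset.card_le_card hsub1
  have hc2 := (Finset.card_le_card hsub2).trans (Finset.card_insert_le _ _)
  have hc1' : ((P.filter fun p => p % 4 = 1).card : ℝ) ≤ A.card := by exact_mod_cast hc1
  have hc2' : (A.card : ℝ) ≤ (P.filter fun p => p % 4 = 1).card + 1 := by exact_mod_cast hc2
  have h2 : |(2 * ((P.filter fun p => p % 4 = 1).card : ℝ) - 2 * (A.card : ℝ)) * I|
      ≤ 2 * |I| := by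
    rw [abs_mul]
    refine mul_le_mul_of_nonneg_right ?_ (abs_nonneg _)
    rw [abs_le]
    constructor <;> linarith
  have h3 := QuadRoots.one_le_four_mul_div_rpow hX2
  have h4 := QuadRoots.div_log_rpow_le hδ hN2
  obtain ⟨Q, hQ⟩ : ∃ Q : ℝ, Q = (⌈N⌉₊ : ℝ) / (Nat.log 2 ⌈N⌉₊ : ℝ) ^ (19 / 10 : ℝ) := ⟨_, rfl⟩
  rw [← hQ] at h1 h3 h4
  have h5 : 2 * |I| ≤ 8 * |I| * Q := by
    have := mul_le_mul_of_nonneg_left h3 (by positivity : 0 ≤ 2 * |I|)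
    linarith
  calc _ ≤ C * Q + 2 * |I| := by
        refine le_trans (le_of_eq ?_) ((abs_add_le _ _).trans (add_le_add h1 h2))
        congr 1
        ring
    _ ≤ (C + 8 * |I| + 1) * Q := by linarith
    _ ≤ (C + 8 * |I| + 1) * (8 * Real.log 2 ^ (δ - 9 / 10) * N / Real.log N ^ (1 + δ)) :=
        mul_le_mul_of_nonneg_left h4 (by positivity)
    _ = _ := by ring
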